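/- Let N = p₁p₂ ∈ {6, 10} with p₁, p₂ distinct primes, and let c_n^{(N*)} denote the n-th Fourier coefficient of the hauptmodul j_N*(τ) of the Fricke group Γ₀*(N). Then for every integer n ≥ -1, one has 2n·c_n^{(N*)} = Σ_{r∈ℤ} { t₂^{(N*)}(4n - r²) - t₂^{(N*)}(4p₁n - r²) - t₂^{(N*)}(4p₂n - r²) + t₂^{(N*)}(4p₁p₂n - r²) }, where the sum over r is finite. -/

import Mathlib

open Complex Matrix

noncomputable section

/-- `SL(2, ℝ)`. -/
abbrev SL2R := Matrix.SpecialLinearGroup (Fin 2) ℝ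

/-- `q = e^{2πiz}` (also used as `ζ = e^{2πiz}`). -/
def qc (z : ℂ) : ℂ := Complex.exp (2 * Real.pi * Complex.I * z)

/-- The Dedekind eta function `η(z) = q^{1/24} ∏_{n ≥ 1} (1 - q^n)` (intended for `Im z > 0`). -/
def dedekindEta (z : ℂ) : ℂ :=
  Complex.exp (Real.pi * Complex.I * z / 12) *
    ∏' n : ℕ, (1 - Complex.exp (2 * Real.pi * Complex.I * ((n : ℂ) + 1) * z))

/-- The hauptmodul `j_N` of `Γ₀(N)` for `N ∈ {2, 3, 5, 7, 13, 6, 10}`. -/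
def jn (N : ℕ) (z : ℂ) : ℂ :=
  if N = 6 then (dedekindEta (2 * z) * dedekindEta (3 * z) ^ 3 / (dedekindEta z * dedekindEta (6 * z) ^ 3)) ^ 3 - 3
  else if N = 10 then dedekindEta (2 * z) * dedekindEta (5 * z) ^ 5 / (dedekindEta z * dedekindEta (10 * z) ^ 5) - 1
  else (dedekindEta z / dedekindEta ((N : ℂ) * z)) ^ (24 / (N - 1)) + 24 / ((N : ℂ) - 1)

/-- The hauptmodul `j_N^*` of the Fricke group `Γ₀^*(N)` for `N ∈ {2, 3, 5, 7, 13, 6, 10}`. -/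
def jnStar (N : ℕ) (z : ℂ) : ℂ :=
  if N = 6 then
    (dedekindEta z * dedekindEta (3 * z) / (dedekindEta (2 * z) * dedekindEta (6 * z))) ^ 6 + 6 +
      2 ^ 6 * (dedekindEta (2 * z) * dedekindEta (6 * z) / (dedekindEta z * dedekindEta (3 * z))) ^ 6
  else if N = 10 then
    (dedekindEta z * dedekindEta (5 * z) / (dedekindEta (2 * z) * dedekindEta (10 * z))) ^ 4 + 4 +
      2 ^ 4 * (dedekindEta (2 * z) * dedekindEta (10 * z) / (dedekindEta z * dedekindEta (5 * z))) ^ 4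
  else
    (dedekindEta z / dedekindEta ((N : ℂ) * z)) ^ (24 / (N - 1)) + 24 / ((N : ℂ) - 1) +
      (N : ℂ) ^ (12 / (N - 1)) * (dedekindEta ((N : ℂ) * z) / dedekindEta z) ^ (24 / (N - 1))

/-- `f` has the `q`-expansion `f(τ) = Σ_{n ≥ n₀} (a n) q^n` on the upper half-plane. -/
def HasQExp (f : ℂ → ℂ) (a : ℤ → ℂ) (n₀ : ℤ) : Prop :=
  (∀ n < n₀, a n = 0) ∧
    ∀ τ : ℂ, 0 < τ.im →
      HasSum (fun m : ℕ => a (n₀ + m) * qc τ ^ (n₀ + (m : ℤ))) (f τ)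

/-- `Γ₀(N)` viewed as a subgroup of `SL(2, ℝ)`. -/
def Gamma0SL2R (N : ℕ) : Subgroup SL2R :=
  (CongruenceSubgroup.Gamma0 N).map
    (Matrix.SpecialLinearGroup.map (Int.castRingHom ℝ))

/-- The set of Atkin–Lehner matrices `W_e` of level `N`:
`W_e = e^{-1/2} [[xe, y], [zN, we]]`, `x, y, z, w ∈ ℤ` (determinant `1` being automatic). -/
def atkinLehnerSet (N e : ℕ) : Set SL2R :=
  { g | ∃ x y z w : ℤ,
      g.1 = (Real.sqrt e)⁻¹ • !![(x : ℝ) * e, (y : ℝ); (z : ℝ) * N, (w : ℝ) * e] }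

/-- The Fricke group `Γ₀^*(N)`, generated by `Γ₀(N)` and all Atkin–Lehner involutions `W_e`
for `e ∣ N` with `gcd(e, N/e) = 1`. -/
def FrickeGroup (N : ℕ) : Subgroup SL2R :=
  Subgroup.closure
    ((Gamma0SL2R N : Set SL2R) ∪
      ⋃ e ∈ {e : ℕ | e ∣ N ∧ Nat.Coprime e (N / e)}, atkinLehnerSet N e)

/-- The Gram matrix of the integral binary quadratic form `[a, b, c]`. -/
def formMat (a b c : ℤ) : Matrix (Fin 2) (Fin 2) ℝ :=
  !![(a : ℝ), (b : ℝ) / 2; (b : ℝ) / 2, (c : ℝ)]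

/-- `𝒬_{d,N}`: positive definite integral binary quadratic forms `[a, b, c]` of
discriminant `-d` with `N ∣ a`. -/
def QdN (d : ℤ) (N : ℕ) : Set (Matrix (Fin 2) (Fin 2) ℝ) :=
  { M | ∃ a b c : ℤ, M = formMat a b c ∧ 0 < a ∧ b ^ 2 - 4 * a * c = -d ∧ (N : ℤ) ∣ a }

/-- `𝒬_{d,N,h}`: members of `𝒬_{d,N}` with `b ≡ h (mod 2N)`. -/
def QdNh (d : ℤ) (N : ℕ) (h : ℤ) : Set (Matrix (Fin 2) (Fin 2) ℝ) :=
  { M | ∃ a b c : ℤ, M = formMat a b c ∧ 0 < a ∧ b ^ 2 - 4 * a * c = -d ∧ (N : ℤ) ∣ a ∧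
      (b : ZMod (2 * N)) = (h : ZMod (2 * N)) }

/-- Orbit relation of the (right) action `Q ↦ Q ∘ g`, i.e. `M ↦ gᵀ M g`, of `Γ ≤ SL(2, ℝ)`
on a set `S` of Gram matrices of quadratic forms. -/
def formRel (Γ : Subgroup SL2R) (S : Set (Matrix (Fin 2) (Fin 2) ℝ)) (Q Q' : S) : Prop :=
  ∃ g ∈ Γ, Q'.1 = (g.1)ᵀ * Q.1 * g.1

/-- The CM point `α_Q` of a positive definite form (as a point of `ℂ`; it lies in the upper
half-plane): `α_Q = (-b + i √d) / (2a) = (-(b/2) + i √(det M)) / a`. -/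
def cmPointC (M : Matrix (Fin 2) (Fin 2) ℝ) : ℂ :=
  ((-(M 0 1) : ℝ) + Complex.I * Real.sqrt M.det) / ((M 0 0 : ℝ) : ℂ)

/-- The order of the stabilizer of the form `M` in `Γ/{±1}` (the stabilizer in `Γ` contains
`±1` and has twice the cardinality). -/
def stabOrder (Γ : Subgroup SL2R) (M : Matrix (Fin 2) (Fin 2) ℝ) : ℕ :=
  Nat.card { g : SL2R // g ∈ Γ ∧ (g.1)ᵀ * M * g.1 = M } / 2

/-- The modular trace `Σ_{Q ∈ S/Γ} f(α_Q) / |Γ̄_Q|`. -/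
def classTrace (Γ : Subgroup SL2R) (f : ℂ → ℂ)
    (S : Set (Matrix (Fin 2) (Fin 2) ℝ)) : ℂ :=
  ∑ᶠ O : Quot (formRel Γ S),
    f (cmPointC (Quot.out O).1) / (stabOrder Γ (Quot.out O).1 : ℂ)

/-- `t₂^{(N*)}(d)`, where `P` is the polynomial with `φ₂(j_N^*) = P(j_N^*)`;
includes the paper's conventions at nonpositive indices. -/
def t2Star (N : ℕ) (P : Polynomial ℂ) (d : ℤ) : ℂ :=
  if 0 < d then
    classTrace (FrickeGroup N) (fun z => Polynomial.eval (jnStar N z) P) (QdN d N)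
  else if d = 0 then (if N = 2 then 5 else if N = 6 ∨ N = 10 then 5 / 2 else 3)
  else if d = -1 then -1
  else if d = -4 then -2
  else 0

/-- `σ₁^{(N)}(x) = Σ_{d ∣ x, N ∤ d} d` for `x ∈ ℤ_{>0}`, `(N-1)/24` at `x = 0`, and `0`
off `ℤ_{≥0}`. -/
def sigmaN (N : ℕ) (x : ℚ) : ℂ :=
  if x = 0 then ((N : ℂ) - 1) / 24
  else if 0 < x ∧ x.den = 1 then
    ∑ d ∈ (Nat.divisors x.num.toNat).filter (fun d => ¬ N ∣ d), (d : ℂ)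
  else 0

/-- `σ₁(x) = Σ_{d ∣ x} d` for `x ∈ ℤ_{>0}` and `0` otherwise. -/
def sigmaQ (x : ℚ) : ℂ :=
  if 0 < x ∧ x.den = 1 then ∑ d ∈ Nat.divisors x.num.toNat, (d : ℂ) else 0

/-- A weakly holomorphic Jacobi form of weight `k` and index `m`. -/
structure WeakJacobiForm (k : ℤ) (m : ℕ) where
  toFun : ℂ → ℂ → ℂ
  holo : DifferentiableOn ℂ (fun p : ℂ × ℂ => toFun p.1 p.2)
      ({τ : ℂ | 0 < τ.im} ×ˢ (Set.univ : Set ℂ))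
  slash_inv : ∀ a b c d : ℤ, a * d - b * c = 1 → ∀ τ z : ℂ, 0 < τ.im →
    ((c : ℂ) * τ + d) ^ (-k) *
        Complex.exp (-(2 * Real.pi * Complex.I * m * c * z ^ 2) / ((c : ℂ) * τ + d)) *
        toFun (((a : ℂ) * τ + b) / ((c : ℂ) * τ + d)) (z / ((c : ℂ) * τ + d)) =
      toFun τ z
  elliptic : ∀ lm mu : ℤ, ∀ τ z : ℂ, 0 < τ.im →
    Complex.exp (2 * Real.pi * Complex.I * m * ((lm : ℂ) ^ 2 * τ + 2 * lm * z)) *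
        toFun τ (z + lm * τ + mu) = toFun τ z
  coeff : ℤ → ℤ → ℂ
  coeff_neg_finite : {n : ℤ | n < 0 ∧ ∃ r : ℤ, coeff n r ≠ 0}.Finite
  expansion : ∀ τ z : ℂ, 0 < τ.im →
    HasSum (fun p : ℤ × ℤ => coeff p.1 p.2 * qc τ ^ p.1 * qc z ^ p.2) (toFun τ z)

/-- Meromorphy of weight `k` at all cusps: at each cusp `γ∞`, the function `F|_k γ` has a
Fourier expansion in fractional powers of `q` with only finitely many negative terms. -/
def MeromAtCusps (k : ℤ) (F : ℂ → ℂ) : Prop :=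
  ∀ a b c d : ℤ, a * d - b * c = 1 →
    ∃ (M : ℕ) (cs : ℤ → ℂ) (n₀ : ℤ), 0 < M ∧
      ∀ τ : ℂ, 0 < τ.im →
        HasSum
          (fun j : ℕ => cs (n₀ + j) *
            Complex.exp (2 * Real.pi * Complex.I * τ / M) ^ (n₀ + (j : ℤ)))
          (((c : ℂ) * τ + d) ^ (-k) * F (((a : ℂ) * τ + b) / ((c : ℂ) * τ + d)))

/-- The Möbius action of an element of `SL(2, ℝ)` on `ℂ`. -/
def moebius (g : SL2R) (z : ℂ) : ℂ :=
  ((g.1 0 0 : ℝ) * z + ((g.1 0 1 : ℝ) : ℂ)) / ((g.1 1 0 : ℝ) * z + ((g.1 1 1 : ℝ) : ℂ))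

/-- A weakly holomorphic modular function on `Γ`: holomorphic on the upper half-plane,
`Γ`-invariant, with poles only at the cusps. -/
def IsWeaklyHolModularFn (Γ : Subgroup SL2R) (f : ℂ → ℂ) : Prop :=
  DifferentiableOn ℂ f {z : ℂ | 0 < z.im} ∧
    (∀ g ∈ Γ, ∀ z : ℂ, 0 < z.im → f (moebius g z) = f z) ∧
    MeromAtCusps 0 f

/-- The set `L_{h, d/4N}` of vectors
`X = [[b + h/2N, c/N], [-a, -(b + h/2N)]]`, `a, b, c ∈ ℤ`, of norm `q(X) = d/4N`. -/
def LhSet (N : ℕ) (h d : ℤ) : Set (Matrix (Fin 2) (Fin 2) ℝ) :=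
  { X | ∃ a b c : ℤ,
      X = !![(b : ℝ) + (h : ℝ) / (2 * N), (c : ℝ) / N;
             -(a : ℝ), -((b : ℝ) + (h : ℝ) / (2 * N))] ∧
      (2 * b * N + h) ^ 2 - 4 * a * c * N = -d }

/-- The map `X ↦ N ⬝ [[0,-1],[1,0]] ⬝ X` from vectors to Gram matrices of quadratic forms. -/
def vecToForm (N : ℕ) (X : Matrix (Fin 2) (Fin 2) ℝ) : Matrix (Fin 2) (Fin 2) ℝ :=
  (N : ℝ) • (!![(0 : ℝ), -1; 1, 0] * X)

/-- Orbit relation of `Γ` acting by conjugation `g.X = g X g⁻¹` on a set `S` of vectors. -/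
def vecRel (Γ : Subgroup SL2R) (S : Set (Matrix (Fin 2) (Fin 2) ℝ)) (X X' : S) : Prop :=
  ∃ g ∈ Γ, X'.1 = g.1 * X.1 * (g⁻¹).1

/-- The Heegner point `D_X ∈ ℍ` of a vector `X` of positive norm. -/
def heegnerC (X : Matrix (Fin 2) (Fin 2) ℝ) : ℂ :=
  ((X 0 0 / X 1 0 : ℝ) : ℂ) + Complex.I * Real.sqrt (X.det / (X 1 0) ^ 2)

/-- The order of the stabilizer of the vector `X` in `Γ/{±1}`. -/
def vecStabOrder (Γ : Subgroup SL2R) (X : Matrix (Fin 2) (Fin 2) ℝ) : ℕ :=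
  Nat.card { g : SL2R // g ∈ Γ ∧ g.1 * X * (g⁻¹).1 = X } / 2

/-- The modular trace `t_f(h, m) = Σ_{X ∈ Γ\L_{h,m}} f(D_X) / |Γ̄_X|`. -/
def vecTrace (Γ : Subgroup SL2R) (f : ℂ → ℂ) (S : Set (Matrix (Fin 2) (Fin 2) ℝ)) : ℂ :=
  ∑ᶠ O : Quot (vecRel Γ S), f (heegnerC (Quot.out O).1) / (vecStabOrder Γ (Quot.out O).1 : ℂ)

/-- The weight-2 Eisenstein series `E₂(z) = 1 - 24 Σ_{n ≥ 1} σ₁(n) qⁿ`. -/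
def E2 (z : ℂ) : ℂ :=
  1 - 24 * ∑' n : ℕ, (∑ d ∈ Nat.divisors (n + 1), (d : ℂ)) * qc z ^ (n + 1)

/-- `E₂^{(N)}(z) = N E₂(Nz) - E₂(z)`. -/
def E2N (N : ℕ) (z : ℂ) : ℂ := (N : ℂ) * E2 ((N : ℂ) * z) - E2 z

end

namespace FrickeTrace

open UpperHalfPlane

/-! ### Arithmetic groups -/

/-- Normalised integral matrices of level `M` and determinant `n` up to scaling: the real matrices
`(e n)^{-1/2} [[x e, y], [z M, w e]]` of determinant one with `e ∣ M`. -/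
def heckeSet (M n : ℕ) : Set SL2R :=
  {g | ∃ (e : ℕ) (x y z w : ℤ), e ∣ M ∧
    g.1 0 0 * √((e : ℝ) * n) = x * e ∧ g.1 0 1 * √((e : ℝ) * n) = y ∧
    g.1 1 0 * √((e : ℝ) * n) = z * M ∧ g.1 1 1 * √((e : ℝ) * n) = w * e}

theorem det_eq (g : SL2R) : g.1 0 0 * g.1 1 1 - g.1 0 1 * g.1 1 0 = 1 := by
  have := g.2
  rwa [Matrix.det_fin_two] at this

theorem ext_entries {g h : SL2R} (h00 : g.1 0 0 = h.1 0 0) (h01 : g.1 0 1 = h.1 0 1)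
    (h10 : g.1 1 0 = h.1 1 0) (h11 : g.1 1 1 = h.1 1 1) : g = h := by
  apply Subtype.ext
  ext i j
  fin_cases i <;> fin_cases j <;> assumption

theorem mul_entry (g h : SL2R) (i j : Fin 2) :
    (g * h).1 i j = g.1 i 0 * h.1 0 j + g.1 i 1 * h.1 1 j := by
  simp [Matrix.mul_apply, Fin.sum_univ_two]

theorem inv_entries (g : SL2R) : (g⁻¹).1 0 0 = g.1 1 1 ∧ (g⁻¹).1 0 1 = - g.1 0 1 ∧
    (g⁻¹).1 1 0 = - g.1 1 0 ∧ (g⁻¹).1 1 1 = g.1 0 0 := by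
  have : (g⁻¹).1 = Matrix.adjugate g.1 := rfl
  rw [this, Matrix.adjugate_fin_two]
  simp

theorem neg_entry (g : SL2R) (i j : Fin 2) : (-g).1 i j = - g.1 i j := by simp

theorem one_entries : (1 : SL2R).1 0 0 = 1 ∧ (1 : SL2R).1 0 1 = 0 ∧
    (1 : SL2R).1 1 0 = 0 ∧ (1 : SL2R).1 1 1 = 1 := by
  simp

/-- The integral determinant relation. -/
theorem int_det {M n e : ℕ} {x y z w : ℤ} {g : SL2R}
    (h00 : g.1 0 0 * √((e : ℝ) * n) = x * e) (h01 : g.1 0 1 * √((e : ℝ) * n) = y)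
    (h10 : g.1 1 0 * √((e : ℝ) * n) = z * M) (h11 : g.1 1 1 * √((e : ℝ) * n) = w * e) :
    (x * e) * (w * e) - y * (z * M) = e * n := by
  have h := det_eq g
  have hs : √((e : ℝ) * n) * √((e : ℝ) * n) = e * n := Real.mul_self_sqrt (by positivity)
  have : ((x : ℝ) * e) * (w * e) - y * (z * M) = e * n := by
    rw [← h00, ← h01, ← h10, ← h11]
    linear_combination (√((e : ℝ) * n) * √((e : ℝ) * n)) * h + hs
  exact_mod_cast this

theorem int_det' {M n e : ℕ} {x y z w : ℤ} {g : SL2R} (he : e ∣ M) (hM : 0 < M)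
    (h00 : g.1 0 0 * √((e : ℝ) * n) = x * e) (h01 : g.1 0 1 * √((e : ℝ) * n) = y)
    (h10 : g.1 1 0 * √((e : ℝ) * n) = z * M) (h11 : g.1 1 1 * √((e : ℝ) * n) = w * e) :
    x * w * e - y * z * (M / e : ℕ) = n := by
  have h := int_det h00 h01 h10 h11
  obtain ⟨f, rfl⟩ := he
  have he0 : 0 < e := Nat.pos_of_mul_pos_right hM
  rw [Nat.mul_div_cancel_left _ he0]
  have he1 : (e : ℤ) ≠ 0 := by positivity
  apply mul_left_cancel₀ he1
  rw [← h]; push_cast; ring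

theorem heckeSet_mul {M n m : ℕ} (hM : 0 < M) {g h : SL2R}
    (hg : g ∈ heckeSet M n) (hh : h ∈ heckeSet M m) : g * h ∈ heckeSet M (n * m) := by
  obtain ⟨e, x, y, z, w, he, h00, h01, h10, h11⟩ := hg
  obtain ⟨e', x', y', z', w', he', h00', h01', h10', h11'⟩ := hh
  have he0 : 0 < e := Nat.pos_of_dvd_of_pos he hM
  have he0' : 0 < e' := Nat.pos_of_dvd_of_pos he' hM
  obtain ⟨k, a, b, hk, hab, rfl, rfl⟩ := Nat.exists_coprime' (m := e) (n := e')
    (Nat.gcd_pos_of_pos_left _ he0)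
  have habM : a * b * k ∣ M := by
    have := Nat.lcm_dvd he he'
    rwa [Nat.lcm_mul_right, Nat.Coprime.lcm_eq_mul hab] at this
  obtain ⟨f, rfl⟩ := habM
  have hs : √(((a * k : ℕ) : ℝ) * n) * √(((b * k : ℕ) : ℝ) * m) =
      k * √(((a * b : ℕ) : ℝ) * ((n * m : ℕ) : ℝ)) := by
    rw [← Real.sqrt_mul (by positivity)]
    rw [show (((a * k : ℕ) : ℝ) * n) * (((b * k : ℕ) : ℝ) * m) =
      (k : ℝ) ^ 2 * (((a * b : ℕ) : ℝ) * ((n * m : ℕ) : ℝ)) by push_cast; ring]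
    rw [Real.sqrt_mul (by positivity), Real.sqrt_sq (by positivity)]
  have hk0 : (k : ℝ) ≠ 0 := by
    have : 0 < k := Nat.pos_of_mul_pos_left he0
    positivity
  set s := √(((a * k : ℕ) : ℝ) * n)
  set s' := √(((b * k : ℕ) : ℝ) * m)
  set S := √(((a * b : ℕ) : ℝ) * ((n * m : ℕ) : ℝ))
  push_cast at h00 h01 h10 h11 h00' h01' h10' h11'
  refine ⟨a * b, x * x' * k + y * z' * f, x * a * y' + y * w' * b,
    z * x' * b + w * a * z', z * y' * f + w * w' * k, ⟨k * f, by ring⟩, ?_, ?_, ?_, ?_⟩ <;>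
  · apply mul_left_cancel₀ hk0
    have key : ∀ u : ℝ, (k : ℝ) * (u * S) = u * (s * s') := fun u => by rw [hs]; ring
    rw [mul_entry, key]
    push_cast
    first
    | linear_combination h.1 0 0 * s' * h00 + x * (a * k) * h00' + h.1 1 0 * s' * h01 + y * h10'
    | linear_combination h.1 0 1 * s' * h00 + x * (a * k) * h01' + h.1 1 1 * s' * h01 + y * h11'
    | linear_combination h.1 0 0 * s' * h10 + z * (a * b * k * f) * h00' + h.1 1 0 * s' * h11 + w * (a * k) * h10'
    | linear_combination h.1 0 1 * s' * h10 + z * (a * b * k * f) * h01' + h.1 1 1 * s' * h11 + w * (a * k) * h11'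

theorem heckeSet_inv {M n : ℕ} {g : SL2R} (hg : g ∈ heckeSet M n) : g⁻¹ ∈ heckeSet M n := by
  obtain ⟨e, x, y, z, w, he, h00, h01, h10, h11⟩ := hg
  obtain ⟨i00, i01, i10, i11⟩ := inv_entries g
  refine ⟨e, w, -y, -z, x, he, ?_, ?_, ?_, ?_⟩
  · rw [i00, h11]
  · rw [i01]; push_cast; linarith
  · rw [i10]; push_cast; linarith
  · rw [i11, h00]

theorem heckeSet_neg {M n : ℕ} {g : SL2R} (hg : g ∈ heckeSet M n) : -g ∈ heckeSet M n := by
  obtain ⟨e, x, y, z, w, he, h00, h01, h10, h11⟩ := hg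
  refine ⟨e, -x, -y, -z, -w, he, ?_, ?_, ?_, ?_⟩ <;> rw [neg_entry] <;> push_cast <;> linarith

theorem one_mem_heckeSet (M : ℕ) : (1 : SL2R) ∈ heckeSet M 1 :=
  ⟨1, 1, 0, 0, 1, one_dvd _, by simp, by simp, by simp, by simp⟩

/-- The group `Γ₀*(M)`. -/
def Gam (M : ℕ) [NeZero M] : Subgroup SL2R where
  carrier := heckeSet M 1
  mul_mem' := fun ha hb => by simpa using heckeSet_mul (Nat.pos_of_neZero M) ha hb
  one_mem' := one_mem_heckeSet M
  inv_mem' := heckeSet_inv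

theorem mem_Gam {M : ℕ} [NeZero M] {g : SL2R} : g ∈ Gam M ↔ g ∈ heckeSet M 1 := Iff.rfl

theorem neg_mem_Gam {M : ℕ} [NeZero M] {g : SL2R} (h : g ∈ Gam M) : -g ∈ Gam M := heckeSet_neg h

theorem heckeSet_mul_left {M n : ℕ} [NeZero M] {g h : SL2R} (hg : g ∈ Gam M)
    (hh : h ∈ heckeSet M n) : g * h ∈ heckeSet M n := by
  simpa using heckeSet_mul (Nat.pos_of_neZero M) hg hh

theorem heckeSet_mul_right {M n : ℕ} [NeZero M] {g h : SL2R} (hg : g ∈ heckeSet M n)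
    (hh : h ∈ Gam M) : g * h ∈ heckeSet M n := by
  simpa using heckeSet_mul (Nat.pos_of_neZero M) hg hh

/-- The upper triangular matrix `(ad)^{-1/2} [[a, b], [0, d]]`. -/
noncomputable def upper (a b d : ℝ) : SL2R :=
  if h : 0 < a * d then
    ⟨!![a / √(a * d), b / √(a * d); 0, d / √(a * d)], by
      rw [Matrix.det_fin_two]
      have h1 : √(a * d) * √(a * d) = a * d := Real.mul_self_sqrt h.le
      have h2 : √(a * d) ≠ 0 := (Real.sqrt_pos.2 h).ne'
      simp only [Matrix.of_apply, Matrix.cons_val', Matrix.cons_val_zero, Matrix.cons_val_one,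
        Matrix.cons_val_fin_one]
      field_simp
      rw [sq, h1]; ring⟩
  else 1

theorem upper_entries {a b d : ℝ} (h : 0 < a * d) : (upper a b d).1 0 0 = a / √(a * d) ∧
    (upper a b d).1 0 1 = b / √(a * d) ∧ (upper a b d).1 1 0 = 0 ∧
    (upper a b d).1 1 1 = d / √(a * d) := by
  simp [upper, h]

theorem coe_smul_eq (g : SL2R) (τ : ℍ) :
    ((g • τ : ℍ) : ℂ) = (g.1 0 0 * τ + g.1 0 1) / (g.1 1 0 * τ + g.1 1 1) := by
  rw [coe_specialLinearGroup_apply]; simp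

/-- The automorphy factor. -/
noncomputable def jf (g : SL2R) (τ : ℂ) : ℂ := g.1 1 0 * τ + g.1 1 1

theorem jf_ne_zero (g : SL2R) (τ : ℍ) : jf g τ ≠ 0 := by
  intro h
  have h1 := congrArg Complex.im h
  have h2 := congrArg Complex.re h
  simp [jf] at h1 h2
  have hdet := det_eq g
  rcases h1 with h1 | h1
  · rw [h1] at h2 hdet
    simp at h2
    rw [h2] at hdet; simp at hdet
  · exact τ.im_pos.ne' h1

theorem im_smul_eq (g : SL2R) (τ : ℍ) : (g • τ).im = τ.im / Complex.normSq (jf g τ) := by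
  have := ModularGroup.im_smul_eq_div_normSq
  have h : (g • τ).im = ((g • τ : ℍ) : ℂ).im := rfl
  rw [h, coe_smul_eq]
  have hj : jf g τ = g.1 1 0 * τ + g.1 1 1 := rfl
  rw [← hj, Complex.div_im]
  have hn : Complex.normSq (jf g τ) ≠ 0 := by simpa using jf_ne_zero g τ
  field_simp
  rw [hj]
  simp
  linear_combination τ.im * det_eq g

theorem upper_smul {a b d : ℝ} (h : 0 < a * d) (τ : ℍ) :
    ((upper a b d • τ : ℍ) : ℂ) = (a * τ + b) / d := by
  obtain ⟨h1, h2, h3, h4⟩ := upper_entries (b := b) h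
  rw [coe_smul_eq, h1, h2, h3, h4]
  have hs : (√(a * d) : ℂ) ≠ 0 := by
    exact_mod_cast (Real.sqrt_pos.2 h).ne'
  have hd : (d : ℂ) ≠ 0 := by
    intro h0
    have : d = 0 := by exact_mod_cast h0
    simp [this] at h
  push_cast
  rw [zero_mul, zero_add, div_mul_eq_mul_div, ← add_div, div_div_div_cancel_right₀ hs]

theorem upper_smul_im {a b d : ℝ} (h : 0 < a * d) (τ : ℍ) :
    (upper a b d • τ : ℍ).im = a / d * τ.im := by
  have h1 : (upper a b d • τ : ℍ).im = ((upper a b d • τ : ℍ) : ℂ).im := rfl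
  rw [h1, upper_smul h]
  simp [Complex.div_im]
  have hd : d ≠ 0 := by rintro rfl; simp at h
  field_simp

theorem smul_eq_smul_jf {g h : SL2R} {τ : ℍ} (h1 : g • τ = h • τ) (h2 : jf g τ = jf h τ) :
    g = h := by
  have h3 := congrArg (fun z : ℍ => (z : ℂ)) h1
  simp only [coe_smul_eq] at h3
  have hj := jf_ne_zero g τ
  have hj' := jf_ne_zero h τ
  simp only [jf] at hj hj' h2
  rw [h2, div_left_inj' hj'] at h3
  have hτ := τ.im_pos.ne'
  have e1 := congrArg Complex.im h3
  have e2 := congrArg Complex.re h3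
  have e3 := congrArg Complex.im h2
  have e4 := congrArg Complex.re h2
  simp at e1 e2 e3 e4
  have f1 := e1.resolve_right hτ
  have f3 := e3.resolve_right hτ
  rw [f1] at e2; rw [f3] at e4
  exact ext_entries f1 (by linarith) f3 (by linarith)

/-- The pairs `(a, d)` of diagonal entries of upper triangular representatives of
`Γ₀*(M) \ heckeSet M n`. -/
def diagPairs (M n : ℕ) : Finset (ℕ × ℕ) :=
  (Finset.Icc 1 (M * n) ×ˢ Finset.Icc 1 (M * n)).filter
    (fun p => ∃ e ∈ M.divisors, e ∣ p.1 ∧ e ∣ p.2 ∧ p.1 * p.2 = e * n)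

theorem mem_diagPairs {M n : ℕ} (hM : 0 < M) {p : ℕ × ℕ} : p ∈ diagPairs M n ↔
    0 < p.1 ∧ 0 < p.2 ∧ ∃ e, e ∣ M ∧ e ∣ p.1 ∧ e ∣ p.2 ∧ p.1 * p.2 = e * n := by
  simp only [diagPairs, Finset.mem_filter, Finset.mem_product, Finset.mem_Icc, Nat.mem_divisors]
  constructor
  · rintro ⟨⟨⟨h1, -⟩, h2, -⟩, e, ⟨h3, -⟩, h4⟩
    exact ⟨h1, h2, e, h3, h4⟩
  · rintro ⟨h1, h2, e, h3, h4, h5, h6⟩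
    have h7 : e * n ≤ M * n := Nat.mul_le_mul_right _ (Nat.le_of_dvd hM h3)
    refine ⟨⟨⟨h1, ?_⟩, h2, ?_⟩, e, ⟨h3, hM.ne'⟩, h4, h5, h6⟩
    · nlinarith
    · nlinarith

/-- Indices of upper triangular representatives of `Γ₀*(M) \ heckeSet M n`. -/
def repIdx (M n : ℕ) : Finset (Σ _ : ℕ × ℕ, ℕ) := (diagPairs M n).sigma (fun p => Finset.range p.2)

/-- The representative attached to an index. -/
noncomputable def repMat (i : Σ _ : ℕ × ℕ, ℕ) : SL2R := upper i.1.1 i.2 i.1.2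

/-- Completing a bottom row. -/
theorem exists_row {M : ℕ} [NeZero M] {e : ℕ} (he : e ∣ M) {z w : ℤ}
    (h : IsCoprime (w * e) (z * (M / e : ℕ))) :
    ∃ g ∈ Gam M, g.1 1 0 * √e = z * M ∧ g.1 1 1 * √e = w * e := by
  obtain ⟨a, b, hab⟩ := h
  have he0 : 0 < e := Nat.pos_of_dvd_of_pos he (Nat.pos_of_neZero M)
  obtain ⟨f, hf⟩ := he
  rw [hf, Nat.mul_div_cancel_left _ he0] at hab
  have hs0 : √(e : ℝ) ≠ 0 := (Real.sqrt_pos.2 (by positivity)).ne'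
  have hss : √(e : ℝ) * √(e : ℝ) = e := Real.mul_self_sqrt (by positivity)
  have habR : (a : ℝ) * (w * e) + b * (z * f) = 1 := by exact_mod_cast hab
  refine ⟨⟨!![a * e / √e, - b / √e; z * M / √e, w * e / √e], ?_⟩,
    ⟨e, a, -b, z, w, ⟨f, hf⟩, ?_, ?_, ?_, ?_⟩, ?_, ?_⟩
  · rw [Matrix.det_fin_two]
    simp only [Matrix.of_apply, Matrix.cons_val', Matrix.cons_val_zero, Matrix.cons_val_one,
        Matrix.cons_val_fin_one]
    rw [div_mul_div_comm, div_mul_div_comm, hss, hf]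
    field_simp
    push_cast
    linear_combination (e : ℝ) * habR
  all_goals
    simp
    try field_simp

/-- Every element of `heckeSet M n` can be made upper triangular by the group. -/
theorem exists_upper {M n : ℕ} [NeZero M] (hM : Squarefree M) (hn : 0 < n) {g : SL2R}
    (hg : g ∈ heckeSet M n) : ∃ w ∈ Gam M, (w * g).1 1 0 = 0 := by
  obtain ⟨e, x, y, z, w, he, h00, h01, h10, h11⟩ := hg
  have hM0 := Nat.pos_of_neZero M
  have he0 : 0 < e := Nat.pos_of_dvd_of_pos he hM0
  have hdet := int_det' he hM0 h00 h01 h10 h11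
  have hs0 : √((e : ℝ) * n) ≠ 0 := (Real.sqrt_pos.2 (by positivity)).ne'
  have hpos : 0 < Int.gcd z (x * e) := by
    rw [Int.gcd_pos_iff]
    by_contra hcon
    push Not at hcon
    obtain ⟨h1, h2⟩ := hcon
    have : (x * w * e : ℤ) = 0 := by rw [mul_right_comm, h2, zero_mul]
    rw [this, h1] at hdet
    simp at hdet
    omega
  obtain ⟨k, u, v, hk, huv, hz, hxe⟩ := Int.exists_gcd_one' hpos
  set e1 := Nat.gcd v.natAbs M with he1
  have he1v : (e1 : ℤ) ∣ v := Int.natCast_dvd.2 (Nat.gcd_dvd_left _ _)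
  obtain ⟨w1, hw1⟩ := he1v
  have hcop : IsCoprime (w1 * e1) (-u * (M / e1 : ℕ)) := by
    rw [mul_comm, ← hw1]
    have c1 : IsCoprime v u := by
      rw [Int.isCoprime_iff_gcd_eq_one, Int.gcd_comm]; exact huv
    refine IsCoprime.mul_right c1.neg_right ?_
    rw [Int.isCoprime_iff_gcd_eq_one]
    have he1M : e1 ∣ M := Nat.gcd_dvd_right _ _
    obtain ⟨f, hf⟩ := he1M
    have he10 : 0 < e1 := Nat.pos_of_dvd_of_pos ⟨f, hf⟩ hM0
    rw [hf, Nat.mul_div_cancel_left _ he10]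
    by_contra hne
    obtain ⟨p, hp, hpd⟩ := Nat.exists_prime_and_dvd hne
    have hpv : p ∣ v.natAbs := hpd.trans (Nat.gcd_dvd_left _ _)
    have hpf : p ∣ f := by
      have := hpd.trans (Nat.gcd_dvd_right _ _)
      simpa using this
    have hpe : p ∣ e1 := Nat.dvd_gcd hpv (hf ▸ Dvd.dvd.mul_left hpf _)
    have : p * p ∣ M := by rw [hf]; exact mul_dvd_mul hpe hpf
    exact hp.one_lt.ne' (Nat.isUnit_iff.1 (hM p this))
  obtain ⟨w0, hw0, hr0, hr1⟩ := exists_row (Nat.gcd_dvd_right _ _) hcop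
  refine ⟨w0, hw0, ?_⟩
  have hs1 : √(e1 : ℝ) ≠ 0 := by
    have : 0 < e1 := Nat.gcd_pos_of_pos_right _ hM0
    exact (Real.sqrt_pos.2 (by positivity)).ne'
  have key : (w0 * g).1 1 0 * (√(e1 : ℝ) * √((e : ℝ) * n)) = 0 := by
    rw [mul_entry]
    have hzR : (z : ℝ) = u * k := by exact_mod_cast hz
    have hxR : (x : ℝ) * e = v * k := by exact_mod_cast hxe
    have hvR : (v : ℝ) = e1 * w1 := by exact_mod_cast hw1
    have : (w0.1 1 0 * g.1 0 0 + w0.1 1 1 * g.1 1 0) * (√(e1 : ℝ) * √((e : ℝ) * n)) =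
      (w0.1 1 0 * √(e1 : ℝ)) * (g.1 0 0 * √((e : ℝ) * n)) +
      (w0.1 1 1 * √(e1 : ℝ)) * (g.1 1 0 * √((e : ℝ) * n)) := by ring
    rw [this, hr0, hr1, h00, h10, hzR, hxR, hvR]
    push_cast
    ring
  exact (mul_eq_zero.1 key).resolve_right (mul_ne_zero hs1 hs0)

theorem upper_translate {a b d : ℝ} (h : 0 < a * d) (k : ℝ) :
    upper 1 k 1 * upper a b d = upper a (b + k * d) d := by
  have h1 : (0 : ℝ) < 1 * 1 := by norm_num
  obtain ⟨a1, a2, a3, a4⟩ := upper_entries (b := k) h1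
  obtain ⟨b1, b2, b3, b4⟩ := upper_entries (b := b) h
  obtain ⟨c1, c2, c3, c4⟩ := upper_entries (b := b + k * d) h
  have hs : √(a * d) ≠ 0 := (Real.sqrt_pos.2 h).ne'
  apply ext_entries <;> simp only [mul_entry, a1, a2, a3, a4, b1, b2, b3, b4, c1, c2, c3, c4] <;>
    simp
  field_simp

theorem translate_mem_Gam (M : ℕ) [NeZero M] (k : ℤ) : upper 1 k 1 ∈ Gam M := by
  obtain ⟨a1, a2, a3, a4⟩ := upper_entries (b := (k : ℝ)) (show (0 : ℝ) < 1 * 1 by norm_num)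
  exact ⟨1, 1, k, 0, 1, one_dvd _, by rw [a1]; simp, by rw [a2]; simp, by rw [a3]; simp,
    by rw [a4]; simp⟩

theorem repMat_mem {M n : ℕ} [NeZero M] {i} (hi : i ∈ repIdx M n) :
    repMat i ∈ heckeSet M n := by
  obtain ⟨⟨a, d⟩, b⟩ := i
  simp only [repIdx, Finset.mem_sigma, mem_diagPairs (Nat.pos_of_neZero M), Finset.mem_range] at hi
  obtain ⟨⟨ha, hd, e, he, ⟨x, hx⟩, ⟨w, hw⟩, had⟩, hb⟩ := hi
  have hpos : (0 : ℝ) < (a : ℝ) * d := by positivity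
  obtain ⟨a1, a2, a3, a4⟩ := upper_entries (b := (b : ℝ)) hpos
  have hs : √((a : ℝ) * d) ≠ 0 := (Real.sqrt_pos.2 hpos).ne'
  have hadR : (e : ℝ) * n = a * d := by exact_mod_cast had.symm
  refine ⟨e, x, b, 0, w, he, ?_, ?_, ?_, ?_⟩ <;> rw [hadR] <;> unfold repMat
  · rw [a1]; field_simp; exact_mod_cast by rw [hx, mul_comm]
  · rw [a2]; field_simp; simp
  · rw [a3]; simp
  · rw [a4]; field_simp; exact_mod_cast by rw [hw, mul_comm]

/-- Every element of `heckeSet M n` is a group element times a representative. -/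
theorem exists_rep {M n : ℕ} [NeZero M] (hM : Squarefree M) (hn : 0 < n) {g : SL2R}
    (hg : g ∈ heckeSet M n) : ∃ w ∈ Gam M, ∃ i ∈ repIdx M n, g = w * repMat i := by
  have hM0 := Nat.pos_of_neZero M
  obtain ⟨w, hw, hw0⟩ := exists_upper hM hn hg
  obtain ⟨h, hh, hsign, v, hv, hgv⟩ : ∃ h ∈ heckeSet M n, (h.1 1 0 = 0 ∧ 0 < h.1 1 1) ∧
      ∃ v ∈ Gam M, g = v * h := by
    have hwg := heckeSet_mul_left hw hg
    have hd := det_eq (w * g)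
    rw [hw0, mul_zero, sub_zero] at hd
    rcases lt_trichotomy ((w * g).1 1 1) 0 with h | h | h
    · refine ⟨-(w * g), heckeSet_neg hwg, ⟨by rw [neg_entry, hw0, neg_zero],
        by rw [neg_entry]; linarith⟩, -w⁻¹, neg_mem_Gam (inv_mem hw), ?_⟩
      rw [neg_mul_neg, inv_mul_cancel_left]
    · rw [h] at hd; simp at hd
    · exact ⟨w * g, hwg, ⟨hw0, h⟩, w⁻¹, inv_mem hw, by rw [inv_mul_cancel_left]⟩
  obtain ⟨h10, h11⟩ := hsign
  obtain ⟨e, x, y, z, w', he, k00, k01, k10, k11⟩ := hh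
  have hdet := int_det k00 k01 k10 k11
  have he0 : 0 < e := Nat.pos_of_dvd_of_pos he hM0
  have hs : 0 < √((e : ℝ) * n) := Real.sqrt_pos.2 (by positivity)
  have hz : z = 0 := by
    rw [h10, zero_mul] at k10
    have : (z : ℝ) * M = 0 := k10.symm
    rcases mul_eq_zero.1 this with h | h
    · exact_mod_cast h
    · exact absurd (by exact_mod_cast h) hM0.ne'
  rw [hz, zero_mul, mul_zero, sub_zero] at hdet
  have hw'pos : 0 < w' * e := by
    have : (0 : ℝ) < (w' * e : ℤ) := by
      push_cast; rw [← k11]; positivity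
    exact_mod_cast this
  have hxpos : 0 < x * e := by
    have h1 : (0 : ℤ) < e * n := by positivity
    rw [← hdet] at h1
    exact pos_of_mul_pos_left h1 hw'pos.le
  obtain ⟨a, ha⟩ := Int.eq_ofNat_of_zero_le hxpos.le
  obtain ⟨d, hd⟩ := Int.eq_ofNat_of_zero_le hw'pos.le
  have ha0 : 0 < a := by omega
  have hd0 : 0 < d := by omega
  have had : a * d = e * n := by
    have := hdet
    rw [ha, hd] at this
    exact_mod_cast this
  have hadR : (e : ℝ) * n = a * d := by exact_mod_cast had.symm
  have hpos : (0 : ℝ) < (a : ℝ) * d := by positivity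
  have hhu : h = upper a y d := by
    obtain ⟨a1, a2, a3, a4⟩ := upper_entries (b := (y : ℝ)) hpos
    rw [hadR] at k00 k01 k11 hs
    have haR : (x : ℝ) * e = a := by exact_mod_cast ha
    have hdR : (w' : ℝ) * e = d := by exact_mod_cast hd
    apply ext_entries
    · rw [a1, eq_div_iff hs.ne', k00, haR]
    · rw [a2, eq_div_iff hs.ne', k01]
    · rw [a3, h10]
    · rw [a4, eq_div_iff hs.ne', k11, hdR]
  have hdz : (0 : ℤ) < d := by exact_mod_cast hd0
  obtain ⟨b, hb⟩ := Int.eq_ofNat_of_zero_le (Int.emod_nonneg y hdz.ne')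
  refine ⟨v * upper 1 (y / d : ℤ) 1, mul_mem hv (translate_mem_Gam M _), ⟨(a, d), b⟩, ?_, ?_⟩
  · simp only [repIdx, Finset.mem_sigma, mem_diagPairs hM0, Finset.mem_range]
    refine ⟨⟨ha0, hd0, e, he, ?_, ?_, had⟩, ?_⟩
    · exact Int.natCast_dvd_natCast.1 ⟨x, by rw [mul_comm]; exact ha.symm⟩
    · exact Int.natCast_dvd_natCast.1 ⟨w', by rw [mul_comm]; exact hd.symm⟩
    · have := Int.emod_lt_of_pos y hdz
      rw [hb] at this
      exact_mod_cast this
  · rw [hgv, mul_assoc]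
    congr 1
    rw [repMat, upper_translate hpos, hhu]
    congr 1
    have h1 := Int.emod_add_mul_ediv y d
    rw [hb] at h1
    have h2 : ((b : ℤ) : ℝ) + d * (y / d : ℤ) = y := by exact_mod_cast h1
    push_cast at h2 ⊢
    linarith

theorem squarefree_eq_of_mul_sq {a b k l : ℕ} (ha : Squarefree a) (hb : Squarefree b)
    (hk : 0 < k) (hl : 0 < l) (h : a * k ^ 2 = b * l ^ 2) : a = b := by
  have main : ∀ {a b k l : ℕ}, Squarefree a → Squarefree b → 0 < k → 0 < l →
      a * k ^ 2 = b * l ^ 2 → a ∣ b := by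
    intro a b k l ha hb hk hl h
    have ha0 : a ≠ 0 := ha.ne_zero
    have hb0 : b ≠ 0 := hb.ne_zero
    rw [← Nat.factorization_le_iff_dvd ha0 hb0]
    intro p
    have h1 := congrArg (fun t => t.factorization p) h
    rw [Nat.factorization_mul ha0 (by positivity), Nat.factorization_mul hb0 (by positivity)] at h1
    simp only [Nat.factorization_pow, Finsupp.add_apply, Finsupp.smul_apply, smul_eq_mul] at h1
    have h2 := (Nat.squarefree_iff_factorization_le_one ha0).1 ha p
    omega
  exact Nat.dvd_antisymm (main ha hb hk hl h) (main hb ha hl hk h.symm)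

/-- Upper triangular elements of the group are translations up to sign. -/
theorem Gam_upper {M : ℕ} [NeZero M] {g : SL2R} (hg : g ∈ Gam M) (h0 : g.1 1 0 = 0)
    (h1 : 0 < g.1 1 1) : ∃ k : ℤ, g = upper 1 k 1 := by
  obtain ⟨e, x, y, z, w, he, h00, h01, h10, h11⟩ := hg
  have hM0 := Nat.pos_of_neZero M
  have he0 : 0 < e := Nat.pos_of_dvd_of_pos he hM0
  have hdet := int_det' he hM0 h00 h01 h10 h11
  have hz : z = 0 := by
    rw [h0, zero_mul] at h10
    have : (z : ℝ) * M = 0 := h10.symm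
    rcases mul_eq_zero.1 this with h | h
    · exact_mod_cast h
    · exact absurd (by exact_mod_cast h) hM0.ne'
  rw [hz] at hdet
  simp at hdet
  have he1 : e = 1 := by
    have : (e : ℤ) ∣ 1 := ⟨x * w, by rw [← hdet]; ring⟩
    exact Nat.eq_one_of_dvd_one (by exact_mod_cast this)
  subst he1
  simp at h00 h01 h11 hdet
  have hw : 0 < w := by rw [h11] at h1; exact_mod_cast h1
  have hw1 : w = 1 := by
    have : w ∣ 1 := ⟨x, by rw [← hdet]; ring⟩
    exact Int.eq_one_of_dvd_one hw.le this
  subst hw1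
  simp at hdet
  subst hdet
  obtain ⟨a1, a2, a3, a4⟩ := upper_entries (b := (y : ℝ)) (show (0 : ℝ) < 1 * 1 by norm_num)
  refine ⟨y, ext_entries ?_ ?_ ?_ ?_⟩
  · rw [a1, h00]; simp
  · rw [a2, h01]; simp
  · rw [a3, h0]
  · rw [a4, h11]; simp

/-- Uniqueness of representatives. -/
theorem rep_unique {M n : ℕ} [NeZero M] (hM : Squarefree M) (hn : 0 < n) {i j}
    (hi : i ∈ repIdx M n) (hj : j ∈ repIdx M n) {w : SL2R} (hw : w ∈ Gam M)
    (h : w * repMat i = repMat j) : i = j := by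
  obtain ⟨⟨a, d⟩, b⟩ := i
  obtain ⟨⟨a', d'⟩, b'⟩ := j
  simp only [repIdx, Finset.mem_sigma, mem_diagPairs (Nat.pos_of_neZero M), Finset.mem_range]
    at hi hj
  obtain ⟨⟨ha, hd, e, he, -, -, had⟩, hb⟩ := hi
  obtain ⟨⟨ha', hd', e', he', -, -, had'⟩, hb'⟩ := hj
  have hpos : (0 : ℝ) < (a : ℝ) * d := by positivity
  have hpos' : (0 : ℝ) < (a' : ℝ) * d' := by positivity
  obtain ⟨u1, u2, u3, u4⟩ := upper_entries (b := (b : ℝ)) hpos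
  obtain ⟨v1, v2, v3, v4⟩ := upper_entries (b := (b' : ℝ)) hpos'
  have hs : 0 < √((a : ℝ) * d) := Real.sqrt_pos.2 hpos
  have hs' : 0 < √((a' : ℝ) * d') := Real.sqrt_pos.2 hpos'
  simp only [repMat] at h
  have e10 := mul_entry w (upper a b d) 1 0
  have e11 := mul_entry w (upper a b d) 1 1
  rw [h, u1, u3, v3] at e10
  rw [h, u2, u4, v4] at e11
  have haR : (0 : ℝ) < a := by exact_mod_cast ha
  have hdR : (0 : ℝ) < d := by exact_mod_cast hd
  have hdR' : (0 : ℝ) < d' := by exact_mod_cast hd'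
  have hw10 : w.1 1 0 = 0 := by
    have h1 : w.1 1 0 * ((a : ℝ) / √((a : ℝ) * d)) = 0 := by linarith
    rcases mul_eq_zero.1 h1 with h2 | h2
    · exact h2
    · exact absurd h2 (by positivity)
  rw [hw10, zero_mul, zero_add] at e11
  have hw11 : 0 < w.1 1 1 := by
    have h1 : (0 : ℝ) < w.1 1 1 * (d / √((a : ℝ) * d)) := by rw [← e11]; positivity
    exact pos_of_mul_pos_left h1 (by positivity)
  obtain ⟨k, rfl⟩ := Gam_upper hw hw10 hw11
  rw [upper_translate hpos] at h
  obtain ⟨t1, t2, t3, t4⟩ := upper_entries (b := (b : ℝ) + k * d) hpos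
  have f00 := congrArg (fun g : SL2R => g.1 0 0) h
  have f01 := congrArg (fun g : SL2R => g.1 0 1) h
  have f11 := congrArg (fun g : SL2R => g.1 1 1) h
  simp only [t1, t2, t4, v1, v2, v4] at f00 f01 f11
  have hratio : (a : ℝ) * d' = a' * d := by
    have h1 : ((a : ℝ) / √((a : ℝ) * d)) * ((d' : ℝ) / √((a' : ℝ) * d')) =
      ((a' : ℝ) / √((a' : ℝ) * d')) * ((d : ℝ) / √((a : ℝ) * d)) := by rw [f00, f11]
    field_simp at h1
    linarith
  have hratioN : a * d' = a' * d := by exact_mod_cast hratio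
  have hee : e = e' := by
    refine squarefree_eq_of_mul_sq (k := n * a') (l := n * a) (hM.squarefree_of_dvd he)
      (hM.squarefree_of_dvd he') (by positivity) (by positivity) ?_
    calc e * (n * a') ^ 2 = (e * n) * n * a' ^ 2 := by ring
      _ = a * a' * (a' * d) * n := by rw [← had]; ring
      _ = a * a' * (a * d') * n := by rw [hratioN]
      _ = (a' * d') * a ^ 2 * n := by ring
      _ = e' * (n * a) ^ 2 := by rw [had']; ring
  subst hee
  have hss : (a : ℝ) * d = a' * d' := by exact_mod_cast had.trans had'.symm
  rw [hss, div_left_inj' hs'.ne'] at f00 f01 f11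
  have r1 : a = a' := by exact_mod_cast f00
  have r2 : d = d' := by exact_mod_cast f11
  subst r1 r2
  have r3 : (b : ℤ) + k * d = b' := by exact_mod_cast f01
  have r4 : b = b' := by
    have h1 : ((b : ℤ) + k * d) % d = (b' : ℤ) % d := by rw [r3]
    rw [Int.add_mul_emod_self_right, Int.emod_eq_of_lt (by positivity) (by exact_mod_cast hb),
      Int.emod_eq_of_lt (by positivity) (by exact_mod_cast hb')] at h1
    exact_mod_cast h1
  subst r4
  rfl

/-- Products over representatives are invariant under the group. -/
theorem prod_rep_invariant {M n : ℕ} [NeZero M] (hM : Squarefree M) (hn : 0 < n)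
    {R : Type*} [CommMonoid R] (F : SL2R → R) (hF : ∀ g ∈ Gam M, ∀ x, F (g * x) = F x)
    {w : SL2R} (hw : w ∈ Gam M) :
    ∏ i ∈ repIdx M n, F (repMat i * w) = ∏ i ∈ repIdx M n, F (repMat i) := by
  have hex : ∀ i, ∃ j, ∃ v, i ∈ repIdx M n →
      v ∈ Gam M ∧ j ∈ repIdx M n ∧ repMat i * w = v * repMat j := by
    intro i
    by_cases hi : i ∈ repIdx M n
    · obtain ⟨v, hv, j, hj, h⟩ := exists_rep hM hn (heckeSet_mul_right (repMat_mem hi) hw)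
      exact ⟨j, v, fun _ => ⟨hv, hj, h⟩⟩
    · exact ⟨i, 1, fun h => absurd h hi⟩
  choose π v hπ using hex
  have hmap : ∀ i ∈ repIdx M n, π i ∈ repIdx M n := fun i hi => (hπ i hi).2.1
  have hinj : Set.InjOn π (repIdx M n : Set _) := by
    intro i hi j hj hij
    obtain ⟨h1, -, h3⟩ := hπ i hi
    obtain ⟨h1', -, h3'⟩ := hπ j hj
    refine rep_unique hM hn hi hj (mul_mem h1' (inv_mem h1)) ?_
    have : repMat i = v i * repMat (π i) * w⁻¹ := by rw [← h3, mul_inv_cancel_right]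
    rw [this, hij, ← mul_assoc, ← mul_assoc, inv_mul_cancel_right, ← h3', mul_inv_cancel_right]
  have hbij := Finset.surjOn_of_injOn_of_card_le π hmap hinj le_rfl
  refine Finset.prod_bij (fun i _ => π i) hmap (fun i hi j hj h => hinj hi hj h)
    (fun j hj => by obtain ⟨i, hi, h⟩ := hbij hj; exact ⟨i, hi, h⟩) ?_
  intro i hi
  obtain ⟨h1, -, h3⟩ := hπ i hi
  rw [h3, hF _ h1]

/-- Every orbit meets a fixed horoball neighbourhood of the cusp. -/
theorem exists_im_ge {M : ℕ} [NeZero M] (hM : Squarefree M) (τ : ℍ) :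
    ∃ w ∈ Gam M, 1 / (2 * (M : ℝ) ^ 3) ≤ (w • τ).im := by
  have hM0 := Nat.pos_of_neZero M
  obtain ⟨γ, hγ⟩ := ModularGroup.exists_smul_mem_fd τ
  have him : 1 / 2 ≤ (γ • τ).im := by
    have := ModularGroup.three_le_four_mul_im_sq_of_mem_fd hγ
    have h2 := (γ • τ).im_pos
    nlinarith
  set g : SL2R := Matrix.SpecialLinearGroup.map (Int.castRingHom ℝ) γ with hg
  have hgτ : g • τ = γ • τ := rfl
  have hmem : g ∈ heckeSet M (M ^ 2) := by
    have hs : √(((1 : ℕ) : ℝ) * ((M ^ 2 : ℕ) : ℝ)) = M := by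
      push_cast; rw [one_mul]; exact Real.sqrt_sq (by positivity)
    refine ⟨1, γ.1 0 0 * M, γ.1 0 1 * M, γ.1 1 0, γ.1 1 1 * M, one_dvd _, ?_, ?_, ?_, ?_⟩ <;>
      rw [hs] <;> simp [hg]
  obtain ⟨w, hw, i, hi, hgi⟩ := exists_rep hM (by positivity) (heckeSet_inv hmem)
  refine ⟨w⁻¹, inv_mem hw, ?_⟩
  have h1 : w⁻¹ • τ = repMat i • (γ • τ) := by
    rw [← hgτ, smul_smul, show repMat i = w⁻¹ * g⁻¹ by rw [hgi]; simp]
    simp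
  obtain ⟨⟨a, d⟩, b⟩ := i
  simp only [repIdx, Finset.mem_sigma, Finset.mem_range, diagPairs, Finset.mem_filter,
    Finset.mem_product, Finset.mem_Icc] at hi
  obtain ⟨⟨⟨⟨ha, -⟩, hd, hd'⟩, -⟩, -⟩ := hi
  have hpos : (0 : ℝ) < (a : ℝ) * d := by positivity
  rw [h1, repMat, upper_smul_im hpos]
  have hdR : (d : ℝ) ≤ (M : ℝ) ^ 3 := by
    have : d ≤ M ^ 3 := by rw [pow_succ']; exact hd'
    exact_mod_cast this
  have haR : (1 : ℝ) ≤ a := by exact_mod_cast ha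
  have hd0 : (0 : ℝ) < d := by exact_mod_cast hd
  have h3 : 1 / (M : ℝ) ^ 3 ≤ a / d := div_le_div₀ (by linarith) haR hd0 hdR
  calc 1 / (2 * (M : ℝ) ^ 3) = 1 / (M : ℝ) ^ 3 * (1 / 2) := by ring
    _ ≤ _ := mul_le_mul h3 him (by norm_num) (by positivity)

/-- The square of the lower left entry of a group element is a natural number. -/
theorem exists_nat_sq {M : ℕ} [NeZero M] {g : SL2R} (hg : g ∈ Gam M) :
    ∃ k : ℕ, (g.1 1 0) ^ 2 = k := by
  obtain ⟨e, x, y, z, w, he, h00, h01, h10, h11⟩ := hg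
  have he0 : 0 < e := Nat.pos_of_dvd_of_pos he (Nat.pos_of_neZero M)
  obtain ⟨f, hf⟩ := he
  refine ⟨z.natAbs ^ 2 * M * f, ?_⟩
  have hs : √((e : ℝ) * (1 : ℕ)) ^ 2 = e := by
    rw [Real.sq_sqrt (by positivity)]; simp
  have h1 : (g.1 1 0) ^ 2 * e = (z * M) ^ 2 := by rw [← h10, mul_pow, hs]
  have h2 : ((z.natAbs : ℕ) : ℝ) ^ 2 = (z : ℝ) ^ 2 := by
    rw [Nat.cast_natAbs, Int.cast_abs, sq_abs]
  have heR : (e : ℝ) ≠ 0 := by positivity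
  apply mul_right_cancel₀ heR
  rw [h1]
  push_cast
  rw [h2, hf]
  push_cast
  ring

/-- A subgroup containing the translations and in which lower left entries can be reduced
contains the whole group. -/
theorem Gam_le_of_reduce {M : ℕ} [NeZero M] (H : Subgroup SL2R) (hneg : -1 ∈ H)
    (hT : ∀ k : ℤ, upper 1 k 1 ∈ H)
    (hred : ∀ g ∈ Gam M, g.1 1 0 ≠ 0 → 2 * |g.1 1 1| ≤ |g.1 1 0| →
      ∃ h ∈ H, h ∈ Gam M ∧ ((g * h).1 1 0) ^ 2 < (g.1 1 0) ^ 2) : Gam M ≤ H := by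
  have main : ∀ k : ℕ, ∀ g ∈ Gam M, (g.1 1 0) ^ 2 = k → g ∈ H := by
    intro k
    induction k using Nat.strong_induction_on with
    | _ k ih =>
      intro g hg hk
      by_cases h0 : g.1 1 0 = 0
      · have hd := det_eq g
        rw [h0, mul_zero, sub_zero] at hd
        rcases lt_trichotomy (g.1 1 1) 0 with h | h | h
        · obtain ⟨j, hj⟩ := Gam_upper (neg_mem_Gam hg) (by rw [neg_entry, h0, neg_zero])
            (by rw [neg_entry]; linarith)
          have : g = -1 * upper 1 j 1 := by rw [← hj]; simp
          rw [this]
          exact mul_mem hneg (hT j)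
        · rw [h] at hd; simp at hd
        · obtain ⟨j, hj⟩ := Gam_upper hg h0 h
          rw [hj]
          exact hT j
      · set j : ℤ := - round (g.1 1 1 / g.1 1 0) with hj
        obtain ⟨a1, a2, a3, a4⟩ := upper_entries (b := (j : ℝ)) (show (0 : ℝ) < 1 * 1 by norm_num)
        have e0 : (g * upper 1 j 1).1 1 0 = g.1 1 0 := by
          rw [mul_entry, a1, a3]; simp
        have e1 : (g * upper 1 j 1).1 1 1 = g.1 1 0 * j + g.1 1 1 := by
          rw [mul_entry, a2, a4]; simp
        have hG := mul_mem hg (translate_mem_Gam M j)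
        have hsmall : 2 * |(g * upper 1 j 1).1 1 1| ≤ |(g * upper 1 j 1).1 1 0| := by
          rw [e0, e1]
          have h1 := abs_sub_round (g.1 1 1 / g.1 1 0)
          have h2 : g.1 1 0 * j + g.1 1 1 =
              g.1 1 0 * (g.1 1 1 / g.1 1 0 - round (g.1 1 1 / g.1 1 0)) := by
            rw [hj]; push_cast; field_simp; ring
          rw [h2, abs_mul]
          have h3 := abs_nonneg (g.1 1 0)
          nlinarith
        obtain ⟨h, hh, hhG, hlt⟩ := hred _ hG (by rw [e0]; exact h0) hsmall
        obtain ⟨k', hk'⟩ := exists_nat_sq (mul_mem hG hhG)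
        have hlt' : k' < k := by
          rw [hk', e0, hk] at hlt
          exact_mod_cast hlt
        have := ih k' hlt' _ (mul_mem hG hhG) hk'
        have h2 := mul_mem (mul_mem this (inv_mem hh)) (inv_mem (hT j))
        simpa using h2
  intro g hg
  obtain ⟨k, hk⟩ := exists_nat_sq hg
  exact main k g hg hk

/-- The Fricke involution. -/
noncomputable def frickeW (M : ℕ) [NeZero M] : SL2R :=
  ⟨!![0, -(√M)⁻¹; √M, 0], by
    have : √(M : ℝ) ≠ 0 := (Real.sqrt_pos.2 (by exact_mod_cast Nat.pos_of_neZero M)).ne'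
    rw [Matrix.det_fin_two_of]; field_simp; simp⟩

theorem frickeW_mem (M : ℕ) [NeZero M] : frickeW M ∈ Gam M := by
  have h0 : (0 : ℝ) < M := by exact_mod_cast Nat.pos_of_neZero M
  have hs : √(M : ℝ) ≠ 0 := (Real.sqrt_pos.2 h0).ne'
  have hss : √(M : ℝ) * √(M : ℝ) = M := Real.mul_self_sqrt h0.le
  refine ⟨M, 0, -1, 1, 0, dvd_rfl, ?_, ?_, ?_, ?_⟩ <;> simp [frickeW, hs, hss]

/-- A further Atkin–Lehner element `k^{-1/2} [[k, b], [2k, k]]`, where `k = 2 b + 1`. -/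
noncomputable def halfV (b : ℕ) : SL2R :=
  ⟨!![√(2 * b + 1 : ℝ), b / √(2 * b + 1 : ℝ); 2 * √(2 * b + 1 : ℝ), √(2 * b + 1 : ℝ)], by
    have h0 : (0 : ℝ) < 2 * b + 1 := by positivity
    have hs : √(2 * b + 1 : ℝ) ≠ 0 := (Real.sqrt_pos.2 h0).ne'
    have hss : √(2 * b + 1 : ℝ) * √(2 * b + 1 : ℝ) = 2 * b + 1 := Real.mul_self_sqrt h0.le
    rw [Matrix.det_fin_two_of, hss]; field_simp; ring⟩

theorem halfV_mem {M b : ℕ} [NeZero M] (h1 : (2 * b + 1) ∣ M) (h2 : M ∣ 2 * (2 * b + 1)) :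
    halfV b ∈ Gam M := by
  have h0 : (0 : ℝ) < 2 * b + 1 := by positivity
  have hs : √(2 * b + 1 : ℝ) ≠ 0 := (Real.sqrt_pos.2 h0).ne'
  have hss : √(2 * b + 1 : ℝ) * √(2 * b + 1 : ℝ) = 2 * b + 1 := Real.mul_self_sqrt h0.le
  obtain ⟨z, hz⟩ := h2
  have hzR : 2 * (2 * (b : ℝ) + 1) = M * z := by exact_mod_cast hz
  refine ⟨2 * b + 1, 1, b, z, 1, h1, ?_, ?_, ?_, ?_⟩ <;> simp [halfV, hs, hss]
  rw [mul_assoc, hss, hzR, mul_comm]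

/-- Generation by the translation and the Fricke involution for small level. -/
theorem Gam_le_of_lt_four {M : ℕ} [NeZero M] (hM : M < 4) (H : Subgroup SL2R) (hneg : -1 ∈ H)
    (hT : ∀ k : ℤ, upper 1 k 1 ∈ H) (hW : frickeW M ∈ H) : Gam M ≤ H := by
  refine Gam_le_of_reduce H hneg hT fun g _ h0 hsm => ⟨frickeW M, hW, frickeW_mem M, ?_⟩
  have e0 : (g * frickeW M).1 1 0 = g.1 1 1 * √M := by rw [mul_entry]; simp [frickeW]
  rw [e0, mul_pow, Real.sq_sqrt (by positivity)]
  have h3 : (M : ℝ) ≤ 3 := by exact_mod_cast Nat.lt_succ_iff.1 hM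
  have h4 : (2 * |g.1 1 1|) ^ 2 ≤ |g.1 1 0| ^ 2 := pow_le_pow_left₀ (by positivity) hsm 2
  rw [mul_pow, sq_abs, sq_abs] at h4
  have h5 : 0 < (g.1 1 0) ^ 2 := by positivity
  nlinarith [sq_nonneg (g.1 1 1)]

/-- Generation by the translation, the Fricke involution and `halfV`. -/
theorem Gam_le_of_halfV {M b : ℕ} [NeZero M] (h1 : (2 * b + 1) ∣ M) (h2 : M ∣ 2 * (2 * b + 1))
    {ρ : ℝ} (hρ0 : 0 < ρ) (hρ : ρ ^ 2 * M ≤ 1) (hb : (2 * b + 1) * (1 - 2 * ρ) ^ 2 < 1)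
    (H : Subgroup SL2R) (hneg : -1 ∈ H)
    (hT : ∀ k : ℤ, upper 1 k 1 ∈ H) (hW : frickeW M ∈ H) (hV : halfV b ∈ H) : Gam M ≤ H := by
  refine Gam_le_of_reduce H hneg hT fun g _ h0 hsm => ?_
  have h5 : 0 < |g.1 1 0| := by positivity
  by_cases hlt : (g.1 1 1) ^ 2 * M < (g.1 1 0) ^ 2
  · refine ⟨frickeW M, hW, frickeW_mem M, ?_⟩
    have e0 : (g * frickeW M).1 1 0 = g.1 1 1 * √M := by rw [mul_entry]; simp [frickeW]
    rwa [e0, mul_pow, Real.sq_sqrt (by positivity)]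
  · push Not at hlt
    have hM0 : (0 : ℝ) < M := by exact_mod_cast Nat.pos_of_neZero M
    have h6 : ρ * |g.1 1 0| ≤ |g.1 1 1| := by
      refine (pow_le_pow_iff_left₀ (by positivity) (abs_nonneg _) two_ne_zero).1 ?_
      rw [mul_pow, sq_abs, sq_abs]
      have : ρ ^ 2 * g.1 1 0 ^ 2 * M ≤ g.1 1 1 ^ 2 * M := by nlinarith [sq_nonneg (g.1 1 0)]
      exact le_of_mul_le_mul_right this hM0
    have h7 : (2 * b + 1) * (|g.1 1 0| - 2 * |g.1 1 1|) ^ 2 < (g.1 1 0) ^ 2 := by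
      have h8 : (|g.1 1 0| - 2 * |g.1 1 1|) ^ 2 ≤ ((1 - 2 * ρ) * |g.1 1 0|) ^ 2 :=
        pow_le_pow_left₀ (by linarith) (by nlinarith) 2
      rw [mul_pow, sq_abs] at h8
      have h9 : 0 < (g.1 1 0) ^ 2 := by positivity
      have hb0 : (0 : ℝ) ≤ 2 * b + 1 := by positivity
      calc _ ≤ (2 * b + 1) * ((1 - 2 * ρ) ^ 2 * g.1 1 0 ^ 2) := by gcongr
        _ = ((2 * b + 1) * (1 - 2 * ρ) ^ 2) * g.1 1 0 ^ 2 := by ring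
        _ < 1 * g.1 1 0 ^ 2 := by gcongr
        _ = _ := one_mul _
    have hk : (0 : ℝ) ≤ 2 * b + 1 := by positivity
    have eV : ((g * halfV b).1 1 0) ^ 2 = (2 * b + 1) * (g.1 1 0 + 2 * g.1 1 1) ^ 2 := by
      rw [mul_entry]
      have : g.1 1 0 * (halfV b).1 0 0 + g.1 1 1 * (halfV b).1 1 0 =
        (g.1 1 0 + 2 * g.1 1 1) * √(2 * b + 1 : ℝ) := by simp [halfV]; ring
      rw [this, mul_pow, Real.sq_sqrt hk, mul_comm]
    have eV' : ((g * (halfV b)⁻¹).1 1 0) ^ 2 = (2 * b + 1) * (g.1 1 0 - 2 * g.1 1 1) ^ 2 := by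
      obtain ⟨i0, i1, i2, i3⟩ := inv_entries (halfV b)
      rw [mul_entry, i0, i2]
      have : g.1 1 0 * (halfV b).1 1 1 + g.1 1 1 * -(halfV b).1 1 0 =
        (g.1 1 0 - 2 * g.1 1 1) * √(2 * b + 1 : ℝ) := by simp [halfV]; ring
      rw [this, mul_pow, Real.sq_sqrt hk, mul_comm]
    have hVm := halfV_mem h1 h2
    rcases abs_cases (g.1 1 0) with ⟨c1, c2⟩ | ⟨c1, c2⟩ <;>
    rcases abs_cases (g.1 1 1) with ⟨d1, d2⟩ | ⟨d1, d2⟩ <;> rw [c1, d1] at h7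
    · exact ⟨(halfV b)⁻¹, inv_mem hV, inv_mem hVm, by rw [eV']; exact h7⟩
    · exact ⟨halfV b, hV, hVm, by rw [eV]; convert h7 using 2; ring⟩
    · exact ⟨halfV b, hV, hVm, by rw [eV]; convert h7 using 2; ring⟩
    · exact ⟨(halfV b)⁻¹, inv_mem hV, inv_mem hVm, by rw [eV']; convert h7 using 2; ring⟩

/-- The Fricke group consists of all Atkin–Lehner matrices. -/
theorem frickeGroup_eq {N : ℕ} [NeZero N] (hN : Squarefree N) : FrickeGroup N = Gam N := by
  apply le_antisymm
  · rw [FrickeGroup, Subgroup.closure_le]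
    rintro g (hg | hg)
    · obtain ⟨γ, hγ, rfl⟩ := hg
      have h0 : ((γ.1 1 0 : ℤ) : ZMod N) = 0 := CongruenceSubgroup.Gamma0_mem.1 hγ
      obtain ⟨z, hz⟩ := (ZMod.intCast_zmod_eq_zero_iff_dvd _ _).1 h0
      refine ⟨1, γ.1 0 0, γ.1 0 1, z, γ.1 1 1, one_dvd _, ?_, ?_, ?_, ?_⟩ <;> simp
      rw [hz]; push_cast; ring
    · simp only [Set.mem_iUnion, Set.mem_ofPred_eq] at hg
      obtain ⟨e, ⟨he, -⟩, x, y, z, w, hg⟩ := hg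
      have he0 : 0 < e := Nat.pos_of_dvd_of_pos he (Nat.pos_of_neZero N)
      have hs : √(e : ℝ) ≠ 0 := (Real.sqrt_pos.2 (by exact_mod_cast he0)).ne'
      refine ⟨e, x, y, z, w, he, ?_, ?_, ?_, ?_⟩ <;> rw [hg] <;> simp <;> field_simp
  · intro g hg
    obtain ⟨e, x, y, z, w, he, h00, h01, h10, h11⟩ := hg
    have he0 : 0 < e := Nat.pos_of_dvd_of_pos he (Nat.pos_of_neZero N)
    have hs : √(e : ℝ) ≠ 0 := (Real.sqrt_pos.2 (by exact_mod_cast he0)).ne'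
    apply Subgroup.subset_closure
    right
    simp only [Set.mem_iUnion, Set.mem_ofPred_eq]
    refine ⟨e, ⟨he, Nat.coprime_of_squarefree_mul (by rwa [Nat.mul_div_cancel' he])⟩,
      x, y, z, w, ?_⟩
    simp only [Nat.cast_one, mul_one] at h00 h01 h10 h11
    ext i j
    fin_cases i <;> fin_cases j <;> simp [← h00, ← h01, ← h10, ← h11] <;> field_simp

theorem finite_abs_le (C : ℝ) : {k : ℤ | |(k : ℝ)| ≤ C}.Finite := by
  refine (Set.finite_Icc (-⌊C⌋) ⌊C⌋).subset fun k hk => ?_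
  rw [Set.mem_ofPred_eq, abs_le] at hk
  exact ⟨by rw [neg_le]; exact Int.le_floor.2 (by push_cast; linarith), Int.le_floor.2 hk.2⟩

/-- Finitely many elements of `heckeSet M n` have bounded entries. -/
theorem heckeSet_finite {M n : ℕ} [NeZero M] (hn : 0 < n) (C : ℝ) :
    {g ∈ heckeSet M n | ∀ i j, |g.1 i j| ≤ C}.Finite := by
  have hfin : Set.Finite {k : ℤ | |(k : ℝ)| ≤ C * √((M : ℝ) * n)} := finite_abs_le _
  have hM0 := Nat.pos_of_neZero M
  set S := {k : ℤ | |(k : ℝ)| ≤ C * √((M : ℝ) * n)} with hS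
  let φ : ℕ × ℤ × ℤ × ℤ × ℤ → SL2R := fun p =>
    if h : Matrix.det !![(p.2.1 : ℝ) / √((p.1 : ℝ) * n), (p.2.2.1 : ℝ) / √((p.1 : ℝ) * n);
      (p.2.2.2.1 : ℝ) / √((p.1 : ℝ) * n), (p.2.2.2.2 : ℝ) / √((p.1 : ℝ) * n)] = 1 then ⟨_, h⟩ else 1
  have hfin2 : (((M.divisors : Set ℕ) ×ˢ S ×ˢ S ×ˢ S ×ˢ S).image φ).Finite :=
    ((M.divisors.finite_toSet).prod (hfin.prod (hfin.prod (hfin.prod hfin)))).image φ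
  refine hfin2.subset ?_
  rintro g ⟨⟨e, x, y, z, w, he, h00, h01, h10, h11⟩, hC⟩
  have he0 : 0 < e := Nat.pos_of_dvd_of_pos he hM0
  have hs : √((e : ℝ) * n) ≠ 0 := (Real.sqrt_pos.2 (by positivity)).ne'
  have hle : √((e : ℝ) * n) ≤ √((M : ℝ) * n) := by
    apply Real.sqrt_le_sqrt
    have : (e : ℝ) ≤ M := by exact_mod_cast Nat.le_of_dvd hM0 he
    gcongr
  have hC0 : 0 ≤ C := (abs_nonneg _).trans (hC 0 0)
  have key : ∀ {i j} {k : ℤ}, g.1 i j * √((e : ℝ) * n) = k → k ∈ S := by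
    intro i j k h
    rw [hS, Set.mem_ofPred_eq, ← h, abs_mul, abs_of_nonneg (Real.sqrt_nonneg _)]
    exact mul_le_mul (hC i j) hle (Real.sqrt_nonneg _) hC0
  have h00' : g.1 0 0 * √((e : ℝ) * n) = (x * e : ℤ) := by push_cast; exact h00
  have h10' : g.1 1 0 * √((e : ℝ) * n) = (z * M : ℤ) := by push_cast; exact h10
  have h11' : g.1 1 1 * √((e : ℝ) * n) = (w * e : ℤ) := by push_cast; exact h11
  refine ⟨(e, x * e, y, z * M, w * e), ⟨?_, key h00', key h01, key h10', key h11'⟩, ?_⟩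
  · simp [he, hM0.ne']
  · have hm : !![((x * e : ℤ) : ℝ) / √((e : ℝ) * n), (y : ℝ) / √((e : ℝ) * n);
      ((z * M : ℤ) : ℝ) / √((e : ℝ) * n), ((w * e : ℤ) : ℝ) / √((e : ℝ) * n)] = g.1 := by
      rw [← h00', ← h01, ← h10', ← h11']
      simp only [mul_div_cancel_right₀ _ hs]
      exact (Matrix.eta_fin_two g.1).symm
    have hd : Matrix.det !![((x * e : ℤ) : ℝ) / √((e : ℝ) * n), (y : ℝ) / √((e : ℝ) * n);
      ((z * M : ℤ) : ℝ) / √((e : ℝ) * n), ((w * e : ℤ) : ℝ) / √((e : ℝ) * n)] = 1 := by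
      rw [hm]; exact g.2
    exact (dif_pos hd).trans (Subtype.ext hm)

/-- Entries of a matrix moving a point of a region to another are bounded. -/
theorem entries_bounded {R δ : ℝ} (hδ : 0 < δ) : ∃ C : ℝ, ∀ (g : SL2R) (τ : ℍ),
    δ ≤ τ.im → ‖(τ : ℂ)‖ ≤ R → δ ≤ (g • τ).im → ‖((g • τ : ℍ) : ℂ)‖ ≤ R →
    ∀ i j, |g.1 i j| ≤ C := by
  set J := √(R / δ) with hJ
  have aux : ∀ (u v B : ℝ) (τ : ℍ), 0 ≤ R → δ ≤ τ.im → ‖(τ : ℂ)‖ ≤ R → ‖(u * τ + v : ℂ)‖ ≤ B →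
      |u| ≤ B / δ ∧ |v| ≤ B + B / δ * R := by
    intro u v B τ hR h1 h2 h3
    have hu : |u| ≤ B / δ := by
      rw [le_div_iff₀ hδ]
      have h4 := (Complex.abs_im_le_norm (u * τ + v : ℂ)).trans h3
      have h5 : (u * τ + v : ℂ).im = u * τ.im := by simp
      rw [h5, abs_mul, abs_of_pos τ.im_pos] at h4
      nlinarith [abs_nonneg u]
    refine ⟨hu, ?_⟩
    have h6 : (v : ℂ) = (u * τ + v) - u * τ := by ring
    have h7 : |v| = ‖(v : ℂ)‖ := by simp
    rw [h7, h6]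
    refine (norm_sub_le _ _).trans (add_le_add h3 ?_)
    rw [norm_mul]
    have h8 : ‖(u : ℂ)‖ = |u| := by simp
    rw [h8]
    exact mul_le_mul hu h2 (norm_nonneg _) ((abs_nonneg _).trans hu)
  refine ⟨max (max (J / δ) (J + J / δ * R)) (max (R * J / δ) (R * J + R * J / δ * R)), ?_⟩
  intro g τ h1 h2 h3 h4
  have hR : 0 ≤ R := (norm_nonneg _).trans h2
  have hj : ‖jf g τ‖ ≤ J := by
    rw [hJ]
    apply Real.le_sqrt_of_sq_le
    rw [← Complex.normSq_eq_norm_sq, le_div_iff₀ hδ]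
    have h5 := im_smul_eq g τ
    have h6 : 0 < Complex.normSq (jf g τ) := Complex.normSq_pos.2 (jf_ne_zero g τ)
    rw [h5, le_div_iff₀ h6] at h3
    have h7 : τ.im ≤ R := (le_abs_self _).trans ((Complex.abs_im_le_norm (τ : ℂ)).trans h2)
    linarith
  have hnum : ‖((g.1 0 0 : ℂ) * τ + g.1 0 1)‖ ≤ R * J := by
    have h5 := coe_smul_eq g τ
    have h6 : ((g.1 0 0 : ℂ) * τ + g.1 0 1) = ((g • τ : ℍ) : ℂ) * jf g τ := by
      rw [h5]; exact (div_mul_cancel₀ _ (jf_ne_zero g τ)).symm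
    rw [h6, norm_mul]
    exact mul_le_mul h4 hj (norm_nonneg _) hR
  obtain ⟨a1, a2⟩ := aux _ _ _ τ hR h1 h2 hnum
  obtain ⟨b1, b2⟩ := aux _ _ _ τ hR h1 h2 (show ‖((g.1 1 0 : ℂ) * τ + g.1 1 1)‖ ≤ J from hj)
  intro i j
  fin_cases i <;> fin_cases j <;> simp only [le_max_iff] <;> tauto

end FrickeTrace

namespace FrickeTrace

open UpperHalfPlane hiding I

/-! ### The Dedekind eta function -/

theorem qc_add (z w : ℂ) : qc (z + w) = qc z * qc w := by
  simp [qc, mul_add, Complex.exp_add]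

theorem qc_int (k : ℤ) : qc k = 1 := by
  rw [qc, ← Complex.exp_int_mul_two_pi_mul_I k]; congr 1; ring

theorem qc_natCast_mul (k : ℕ) (z : ℂ) : qc (k * z) = qc z ^ k := by
  rw [qc, qc, ← Complex.exp_nat_mul]; congr 1; ring

theorem qc_ne_zero (z : ℂ) : qc z ≠ 0 := Complex.exp_ne_zero _

theorem norm_qc (z : ℂ) : ‖qc z‖ = Real.exp (-2 * Real.pi * z.im) := by
  rw [qc, Complex.norm_exp]; simp

theorem norm_qc_lt_one {z : ℂ} (hz : 0 < z.im) : ‖qc z‖ < 1 := by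
  rw [norm_qc, Real.exp_lt_one_iff]
  have := Real.pi_pos
  nlinarith [mul_pos this hz]

/-- The Euler product `∏ (1 - x^n)`. -/
noncomputable def eulerP (x : ℂ) : ℂ := ∏' n : ℕ, (1 - x ^ (n + 1))

theorem eulerP_diff : DifferentiableOn ℂ eulerP (Metric.ball 0 1) :=
  ModularForm.differentiableOn_tprod_one_sub_pow

theorem eulerP_zero : eulerP 0 = 1 := by simp [eulerP]

theorem dedekindEta_eq (z : ℂ) :
    dedekindEta z = Complex.exp (Real.pi * I * z / 12) * eulerP (qc z) := by
  rw [dedekindEta, eulerP]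
  congr 1
  refine tprod_congr fun n => ?_
  rw [qc, ← Complex.exp_nat_mul]
  congr 2; push_cast; ring

theorem dedekindEta_eq_eta (z : ℂ) : dedekindEta z = ModularForm.eta z := by
  rw [dedekindEta, ModularForm.eta]
  congr 1
  · rw [Function.Periodic.qParam]; congr 1; push_cast; ring
  · simp [ModularForm.eta_q_eq_cexp]

theorem eta_ne_zero {z : ℂ} (hz : 0 < z.im) : dedekindEta z ≠ 0 := by
  rw [dedekindEta_eq_eta]; exact ModularForm.eta_ne_zero hz

theorem eta_diff {z : ℂ} (hz : 0 < z.im) : DifferentiableAt ℂ dedekindEta z := by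
  rw [funext dedekindEta_eq_eta]
  exact ModularForm.differentiableAt_eta_of_mem_upperHalfPlaneSet hz

theorem exists_qc_eq {x : ℂ} (hx : x ≠ 0) (h1 : ‖x‖ < 1) : ∃ z : ℂ, 0 < z.im ∧ qc z = x := by
  refine ⟨Complex.log x / (2 * Real.pi * I), ?_, ?_⟩
  · have h2 : Real.log ‖x‖ < 0 := Real.log_neg (norm_pos_iff.2 hx) h1
    have h3 := Real.pi_pos
    have : (Complex.log x / (2 * Real.pi * I)) = ((-(Complex.log x * I)) / ((2 * Real.pi : ℝ) : ℂ)) := by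
      push_cast; field_simp; rw [I_sq]; ring
    rw [this, Complex.div_ofReal_im]
    simp only [Complex.neg_im, Complex.mul_im, Complex.I_re, Complex.I_im, Complex.log_re]
    have : 0 < -Real.log ‖x‖ := by linarith
    simp only [mul_one, mul_zero]
    apply div_pos _ (by positivity)
    linarith
  · rw [qc, mul_div_cancel₀ _ (by simp), Complex.exp_log hx]

theorem eulerP_ne_zero {x : ℂ} (h1 : ‖x‖ < 1) : eulerP x ≠ 0 := by
  rcases eq_or_ne x 0 with rfl | hx
  · simp [eulerP_zero]
  obtain ⟨z, hz, rfl⟩ := exists_qc_eq hx h1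
  have := eta_ne_zero hz
  rw [dedekindEta_eq] at this
  exact right_ne_zero_of_mul this

/-- The square of the eta function. -/
noncomputable def etaSq (z : ℂ) : ℂ := dedekindEta z ^ 2

/-- The twelfth root of unity `e^{πi/6}`. -/
noncomputable def zet : ℂ := Complex.exp (Real.pi * I / 6)

theorem zet_ne_zero : zet ≠ 0 := Complex.exp_ne_zero _

theorem zet_pow_three : zet ^ 3 = I := by
  rw [zet, ← Complex.exp_nat_mul]
  refine Eq.trans ?_ Complex.exp_pi_div_two_mul_I
  congr 1; push_cast; ring

theorem etaSq_ne_zero {z : ℂ} (hz : 0 < z.im) : etaSq z ≠ 0 := pow_ne_zero _ (eta_ne_zero hz)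

theorem etaSq_eq (z : ℂ) : etaSq z = Complex.exp (Real.pi * I * z / 6) * eulerP (qc z) ^ 2 := by
  rw [etaSq, dedekindEta_eq, mul_pow, ← Complex.exp_nat_mul]
  congr 2; push_cast; ring

theorem etaSq_add_int (z : ℂ) (k : ℤ) : etaSq (z + k) = zet ^ k * etaSq z := by
  rw [etaSq_eq, etaSq_eq, qc_add, qc_int, mul_one, zet, ← Complex.exp_int_mul, ← mul_assoc,
    ← Complex.exp_add]
  congr 2; ring

theorem etaSq_neg_inv {z : ℂ} (hz : 0 < z.im) : etaSq (-1 / z) = -I * z * etaSq z := by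
  have h := ModularForm.eta_comp_eq_csqrt_I_inv (x := z) hz
  have hsq : ∀ w : ℂ, w ≠ 0 → Complex.sqrt w ^ 2 = w := by
    intro w hw
    simp [sqrt]
  have hz0 : z ≠ 0 := by rintro rfl; simp at hz
  simp only [Function.comp, Pi.smul_apply, Pi.mul_apply, smul_eq_mul] at h
  rw [etaSq, dedekindEta_eq_eta, h, mul_pow, mul_pow, inv_pow, hsq _ I_ne_zero, hsq _ hz0, etaSq,
    dedekindEta_eq_eta, inv_I]
  ring

/-- Transformation behaviour of `etaSq` under `[[a, b], [c, d]]`. -/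
def EtaRule (a b c d k : ℤ) : Prop := ∀ z : ℂ, 0 < z.im →
  (c : ℂ) * z + d ≠ 0 ∧ 0 < (((a : ℂ) * z + b) / (c * z + d)).im ∧
    etaSq ((a * z + b) / (c * z + d)) = zet ^ k * (c * z + d) * etaSq z

theorem etaRule_neg_one : EtaRule (-1) 0 0 (-1) 6 := by
  intro z hz
  refine ⟨by simp, by simpa using hz, ?_⟩
  have : zet ^ (6 : ℤ) = -1 := by
    rw [show (6 : ℤ) = ((3 * 2 : ℕ) : ℤ) by norm_num, zpow_natCast, pow_mul, zet_pow_three, I_sq]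
  rw [this]; simp

theorem etaRule_one : EtaRule 1 0 0 1 0 := by
  intro z hz
  exact ⟨by simp, by simpa using hz, by simp⟩

theorem EtaRule.translate {a b c d k : ℤ} (h : EtaRule a b c d k) (m : ℤ) :
    EtaRule (a + m * c) (b + m * d) c d (k + m) := by
  intro z hz
  obtain ⟨h0, h1, h2⟩ := h z hz
  have : (((a + m * c : ℤ) : ℂ) * z + (b + m * d : ℤ)) / (c * z + d) =
      (a * z + b) / (c * z + d) + m := by
    rw [div_add' _ _ _ h0]; push_cast; ring
  refine ⟨h0, ?_, ?_⟩
  · rw [this]; simpa using h1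
  · rw [this, etaSq_add_int, h2, zpow_add₀ zet_ne_zero]; ring

theorem EtaRule.invert {a b c d k : ℤ} (h : EtaRule a b c d k) :
    EtaRule (-c) (-d) a b (k - 3) := by
  intro z hz
  obtain ⟨h0, h1, h2⟩ := h z hz
  have h3 : (a : ℂ) * z + b ≠ 0 := by
    intro h; rw [h] at h1; simp at h1
  have : (((-c : ℤ) : ℂ) * z + (-d : ℤ)) / (a * z + b) = -1 / ((a * z + b) / (c * z + d)) := by
    field_simp; push_cast; ring
  have hz3 : zet ^ (k - 3) = zet ^ k * (-I) := by
    rw [zpow_sub₀ zet_ne_zero, show (3 : ℤ) = ((3 : ℕ) : ℤ) by norm_num, zpow_natCast,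
      zet_pow_three, div_eq_mul_inv, inv_I]
  refine ⟨h3, ?_, ?_⟩
  · rw [this]
    have := (UpperHalfPlane.mk ((a * z + b) / (c * z + d)) h1).im_inv_neg_coe_pos
    convert this using 2
    rw [neg_div, one_div]; simp [inv_neg]
  · rw [this, etaSq_neg_inv h1, h2, hz3]
    generalize (c : ℂ) * z + d = w at h0
    field_simp

theorem EtaRule.cast {a b c d k a' b' c' d' k' : ℤ} (h : EtaRule a b c d k) (ha : a = a')
    (hb : b = b') (hc : c = c') (hd : d = d') (hk : k = k') : EtaRule a' b' c' d' k' := by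
  subst ha hb hc hd hk; exact h

theorem etaRule_1123 : EtaRule 1 1 2 3 (-1) :=
  ((((etaRule_neg_one.translate 1).invert).translate (-2)).invert).cast rfl rfl rfl rfl rfl

theorem etaRule_3121 : EtaRule 3 1 2 1 (-1) :=
  (((((etaRule_one.translate 1).invert).translate 2).invert).translate 2).cast rfl rfl rfl rfl rfl

theorem etaRule_1213 : EtaRule 1 2 1 3 (1) :=
  (((etaRule_one.translate 3).invert).translate 1).cast rfl rfl rfl rfl rfl

theorem etaRule_3211 : EtaRule 3 2 1 1 (1) :=
  (((etaRule_one.translate 1).invert).translate 3).cast rfl rfl rfl rfl rfl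

theorem etaRule_1225 : EtaRule 1 2 2 5 (0) :=
  ((((etaRule_neg_one.translate 2).invert).translate (-2)).invert).cast rfl rfl rfl rfl rfl

theorem etaRule_5221 : EtaRule 5 2 2 1 (0) :=
  (((((etaRule_neg_one.translate 0).invert).translate (-2)).invert).translate 2).cast rfl rfl rfl rfl rfl

theorem etaRule_1415 : EtaRule 1 4 1 5 (3) :=
  (((etaRule_one.translate 5).invert).translate 1).cast rfl rfl rfl rfl rfl

theorem etaRule_5411 : EtaRule 5 4 1 1 (3) :=
  (((etaRule_one.translate 1).invert).translate 5).cast rfl rfl rfl rfl rfl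

/-! ### Hauptmoduln -/

/-- `h` is a hauptmodul-like function for `Γ₀*(M)`: holomorphic, invariant, and
`h = q⁻¹ + O(1)` at the cusp. -/
structure IsHaupt (M : ℕ) [NeZero M] (h : ℂ → ℂ) : Prop where
  hol : DifferentiableOn ℂ h {z | 0 < z.im}
  inv : ∀ g ∈ Gam M, ∀ τ : ℍ, h (g • τ : ℍ) = h τ
  cusp : ∃ G : ℂ → ℂ, DifferentiableOn ℂ G (Metric.ball 0 1) ∧ G 0 = 1 ∧
    ∀ z : ℂ, 0 < z.im → h z * qc z = G (qc z)

/-- The group of symmetries of a function on the upper half-plane. -/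
def invSub (h : ℂ → ℂ) : Subgroup SL2R where
  carrier := {g | ∀ τ : ℍ, h (g • τ : ℍ) = h τ}
  mul_mem' := fun {a b} ha hb τ => by rw [mul_smul, ha, hb]
  one_mem' := fun τ => by rw [one_smul]
  inv_mem' := fun {a} ha τ => by
    have := ha (a⁻¹ • τ)
    rw [smul_inv_smul] at this
    exact this.symm

theorem neg_one_mem_invSub (h : ℂ → ℂ) : -1 ∈ invSub h := by
  intro τ
  rw [coe_smul_eq]
  congr 1
  simp [neg_entry]

theorem upper_mem_invSub {h : ℂ → ℂ} (hp : ∀ z : ℂ, 0 < z.im → ∀ k : ℤ, h (z + k) = h z) (k : ℤ) :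
    upper 1 k 1 ∈ invSub h := by
  intro τ
  rw [upper_smul (by norm_num)]
  simpa using hp τ τ.im_pos k

theorem frickeW_smul (M : ℕ) [NeZero M] (τ : ℍ) :
    ((frickeW M • τ : ℍ) : ℂ) = -1 / (M * τ) := by
  have h0 : (0 : ℝ) < M := by exact_mod_cast Nat.pos_of_neZero M
  have hs : (√(M : ℝ) : ℂ) ≠ 0 := by exact_mod_cast (Real.sqrt_pos.2 h0).ne'
  have hss : (√(M : ℝ) : ℂ) * √(M : ℝ) = M := by exact_mod_cast Real.mul_self_sqrt h0.le
  have hτ : (τ : ℂ) ≠ 0 := τ.ne_zero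
  rw [coe_smul_eq, ← hss]
  simp [frickeW]
  field_simp

theorem halfV_smul (b : ℕ) (τ : ℍ) :
    ((halfV b • τ : ℍ) : ℂ) = ((2 * b + 1) * τ + b) / ((2 * b + 1) * (2 * τ + 1)) := by
  have h0 : (0 : ℝ) < 2 * b + 1 := by positivity
  have hs : (√(2 * b + 1 : ℝ) : ℂ) ≠ 0 := by exact_mod_cast (Real.sqrt_pos.2 h0).ne'
  have hss : (√(2 * b + 1 : ℝ) : ℂ) * √(2 * b + 1 : ℝ) = 2 * b + 1 := by
    exact_mod_cast Real.mul_self_sqrt h0.le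
  have h2 : (2 : ℂ) * τ + 1 ≠ 0 := by
    intro h
    have := congrArg Complex.im h
    simp at this
    exact τ.im_ne_zero this
  rw [coe_smul_eq, ← hss]
  simp [halfV]
  field_simp

theorem natMul_im_pos {z : ℂ} (hz : 0 < z.im) (k : ℕ) (hk : 0 < k) : 0 < ((k : ℂ) * z).im := by
  simp; positivity

theorem qc_diff : Differentiable ℂ qc := by
  unfold qc; fun_prop

/-- Functions `u + c + C / u`, where `u = q⁻¹ A(q)`. -/
theorem isHaupt_of_unit {M : ℕ} [NeZero M] {u A h : ℂ → ℂ} {c C : ℂ}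
    (hA : DifferentiableOn ℂ A (Metric.ball 0 1)) (hA0 : A 0 = 1)
    (hne : ∀ x ∈ Metric.ball (0 : ℂ) 1, A x ≠ 0)
    (hu : ∀ z : ℂ, 0 < z.im → u z * qc z = A (qc z))
    (hh : ∀ z : ℂ, h z = u z + c + C / u z)
    (hG : (-1 ∈ invSub h) → (∀ k : ℤ, upper 1 k 1 ∈ invSub h) → Gam M ≤ invSub h) :
    IsHaupt M h := by
  have hmem : ∀ z : ℂ, 0 < z.im → qc z ∈ Metric.ball (0 : ℂ) 1 := fun z hz => by
    simpa using norm_qc_lt_one hz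
  have hu' : ∀ z : ℂ, 0 < z.im → u z = A (qc z) / qc z := fun z hz => by
    rw [← hu z hz, mul_div_cancel_right₀ _ (qc_ne_zero z)]
  have hG' : ∀ z : ℂ, 0 < z.im → h z * qc z = A (qc z) + c * qc z + C * qc z ^ 2 / A (qc z) := by
    intro z hz
    rw [hh, hu' z hz]
    have h1 := qc_ne_zero z
    have h2 := hne _ (hmem z hz)
    field_simp
  refine ⟨?_, ?_, fun x => A x + c * x + C * x ^ 2 / A x, ?_, by simp [hA0], hG'⟩
  · have hd : DifferentiableOn ℂ (fun z => A (qc z) / qc z) {z | 0 < z.im} :=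
      (hA.comp qc_diff.differentiableOn fun z hz => hmem z hz).div qc_diff.differentiableOn
        fun z _ => qc_ne_zero z
    refine ((hd.add_const c).add ((differentiableOn_const C).div hd ?_)).congr ?_
    · intro z hz
      exact div_ne_zero (hne _ (hmem z hz)) (qc_ne_zero z)
    · intro z hz
      simp only [Pi.add_apply, Pi.div_apply]
      rw [hh, hu' z hz]
  · intro g hg
    refine hG (neg_one_mem_invSub h) (upper_mem_invSub fun z hz k => ?_) hg
    have hz' : 0 < (z + k).im := by simpa using hz
    rw [hh, hh, hu' _ hz', hu' _ hz, qc_add, qc_int, mul_one]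
  · refine (hA.add (by fun_prop)).add (DifferentiableOn.div (by fun_prop) hA hne)

theorem eulerP_pow_diff (k : ℕ) (hk : k ≠ 0) :
    DifferentiableOn ℂ (fun x => eulerP (x ^ k)) (Metric.ball 0 1) := by
  refine eulerP_diff.comp (by fun_prop) fun x hx => ?_
  simp only [Metric.mem_ball, dist_zero_right, norm_pow] at hx ⊢
  exact pow_lt_one₀ (norm_nonneg _) hx hk

theorem eulerP_pow_ne_zero (k : ℕ) (hk : k ≠ 0) {x : ℂ} (hx : x ∈ Metric.ball (0 : ℂ) 1) :
    eulerP (x ^ k) ≠ 0 := by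
  simp only [Metric.mem_ball, dist_zero_right] at hx
  exact eulerP_ne_zero (by rw [norm_pow]; exact pow_lt_one₀ (norm_nonneg _) hx hk)

theorem etaSq_natMul (k : ℕ) (z : ℂ) :
    etaSq (k * z) = Complex.exp (Real.pi * I * z / 6) ^ k * eulerP (qc z ^ k) ^ 2 := by
  rw [etaSq_eq, qc_natCast_mul, ← Complex.exp_nat_mul]; congr 2; ring

theorem exp_pow_twelve (z : ℂ) : Complex.exp (Real.pi * I * z / 6) ^ 12 = qc z := by
  rw [← Complex.exp_nat_mul, qc]; congr 1; push_cast; ring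

theorem etaSq_neg_inv_mul {M δ ε : ℕ} (hM : M = δ * ε) (hM0 : 0 < M) {z : ℂ} (hz : 0 < z.im) :
    etaSq (δ * (-1 / (M * z))) = -I * ε * z * etaSq (ε * z) := by
  subst hM
  have hδ : (δ : ℂ) ≠ 0 := by rintro h; simp [Nat.cast_eq_zero.1 h] at hM0
  have hε : 0 < ε := Nat.pos_of_mul_pos_left hM0
  have : (δ : ℂ) * (-1 / ((δ * ε : ℕ) * z)) = -1 / (ε * z) := by push_cast; field_simp
  rw [this, etaSq_neg_inv (natMul_im_pos hz ε hε)]; ring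

/-- The quotient for prime level. -/
theorem isHaupt_prime {M k : ℕ} [NeZero M] (hk : k * (M - 1) = 12)
    (hM : M < 4 ∨ M = 5) :
    IsHaupt M (fun z => (etaSq z / etaSq (M * z)) ^ k + 0 +
      (M : ℂ) ^ k / (etaSq z / etaSq (M * z)) ^ k) := by
  have hM0 : M ≠ 0 := NeZero.ne M
  have hMp := Nat.pos_of_neZero M
  have hM1 : (M : ℂ) ≠ 0 := by exact_mod_cast hM0
  have hkM : k + 12 = k * M := by
    obtain ⟨m, rfl⟩ := Nat.exists_eq_succ_of_ne_zero hM0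
    simp at hk
    rw [Nat.succ_eq_add_one, mul_add]; omega
  have hk0 : (-I) ≠ (0 : ℂ) := by simp
  refine isHaupt_of_unit (u := fun z => (etaSq z / etaSq (M * z)) ^ k)
    (A := fun x => (eulerP x / eulerP (x ^ M)) ^ (2 * k)) ?_ ?_ ?_ ?_ (fun z => rfl) ?_
  · exact (eulerP_diff.div (eulerP_pow_diff M hM0) fun x hx => eulerP_pow_ne_zero M hM0 hx).pow _
  · simp [hM0, eulerP_zero]
  · intro x hx
    refine pow_ne_zero _ (div_ne_zero ?_ (eulerP_pow_ne_zero M hM0 hx))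
    simpa using eulerP_pow_ne_zero 1 one_ne_zero hx
  · intro z hz
    have h1 := etaSq_natMul 1 z
    simp only [Nat.cast_one, one_mul, pow_one] at h1
    have hq : qc z ∈ Metric.ball (0 : ℂ) 1 := by simpa using norm_qc_lt_one hz
    have hP := eulerP_pow_ne_zero M hM0 hq
    have h2 := Complex.exp_ne_zero (Real.pi * I * z / 6)
    have h3 := exp_pow_twelve z
    have hq0 := qc_ne_zero z
    rw [h1, etaSq_natMul]
    generalize Complex.exp (Real.pi * I * z / 6) = e at *
    have h4 : e * eulerP (qc z) ^ 2 / (e ^ M * eulerP (qc z ^ M) ^ 2) =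
        e / e ^ M * (eulerP (qc z) / eulerP (qc z ^ M)) ^ 2 := by field_simp
    rw [h4, mul_pow, ← pow_mul, div_pow, ← pow_mul, mul_comm M k, ← hkM, pow_add, h3]
    field_simp
  · intro hneg hT
    have hW : frickeW M ∈ invSub (fun z => (etaSq z / etaSq (M * z)) ^ k + 0 +
      (M : ℂ) ^ k / (etaSq z / etaSq (M * z)) ^ k) := by
      intro τ
      have h1 := etaSq_ne_zero τ.im_pos
      have h2 := etaSq_ne_zero (natMul_im_pos τ.im_pos M hMp)
      have e1 := etaSq_neg_inv_mul (δ := 1) (ε := M) (by simp) hMp τ.im_pos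
      have e2 := etaSq_neg_inv_mul (δ := M) (ε := 1) (by simp) hMp τ.im_pos
      have hτ : (τ : ℂ) ≠ 0 := τ.ne_zero
      simp only [Nat.cast_one, one_mul] at e1 e2
      simp only [frickeW_smul]
      rw [e1, e2, add_zero, add_zero, add_comm]
      have e3 : -I * M * τ * etaSq (M * τ) / (-I * 1 * τ * etaSq τ) =
        M * (etaSq τ / etaSq (M * τ))⁻¹ := by field_simp
      have hne : etaSq τ / etaSq (M * τ) ≠ 0 := div_ne_zero h1 h2
      rw [e3]
      generalize etaSq τ / etaSq (M * τ) = v at *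
      rw [mul_pow, inv_pow]
      field_simp
    rcases hM with hM | rfl
    · exact Gam_le_of_lt_four hM _ hneg hT hW
    · have : k = 3 := by omega
      subst this
      refine Gam_le_of_halfV (b := 2) (ρ := 0.4) (by norm_num) (by norm_num) (by norm_num)
        (by norm_num) (by norm_num) _ hneg hT hW fun τ => ?_
      have h1 := etaSq_ne_zero τ.im_pos
      have h2 := etaSq_ne_zero (natMul_im_pos τ.im_pos 5 (by norm_num))
      obtain ⟨a0, -, a1⟩ := etaRule_1225 _ (natMul_im_pos τ.im_pos 5 (by norm_num))
      obtain ⟨b0, -, b1⟩ := etaRule_5221 _ τ.im_pos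
      simp only [halfV_smul]
      push_cast at *
      have c0 : (2 : ℂ) * τ + 1 ≠ 0 := b0
      have e1 : ((2 * 2 + 1) * (τ : ℂ) + 2) / ((2 * 2 + 1) * (2 * τ + 1)) =
          (1 * (5 * τ) + 2) / (2 * (5 * τ) + 5) := by congr 1 <;> ring
      have e2 : 5 * ((1 * (5 * (τ : ℂ)) + 2) / (2 * (5 * τ) + 5)) =
          (5 * τ + 2) / (2 * τ + 1) := by
        rw [show 2 * (5 * (τ : ℂ)) + 5 = 5 * (2 * τ + 1) by ring]; field_simp
      rw [e1, e2, a1, b1, zpow_zero, one_mul, one_mul,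
        show 2 * (5 * (τ : ℂ)) + 5 = 5 * (2 * τ + 1) by ring]
      field_simp
      ring

/-- The quotient for the composite levels `2p`. -/
noncomputable def compU (p : ℕ) (z : ℂ) : ℂ :=
  etaSq z * etaSq (p * z) / (etaSq (2 * z) * etaSq ((2 * p : ℕ) * z))

theorem isHaupt_comp {p k b : ℕ} [NeZero (2 * p)] (hk : k * (p + 1) = 12) (hb : p = 2 * b + 1)
    {ρ : ℝ} (hρ0 : 0 < ρ) (hρ : ρ ^ 2 * (2 * p : ℕ) ≤ 1) (hb2 : (2 * b + 1) * (1 - 2 * ρ) ^ 2 < 1)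
    (hV : ∀ τ : ℍ, compU p (halfV b • τ : ℍ) ^ k = compU p τ ^ k) (c : ℂ) :
    IsHaupt (2 * p) (fun z => compU p z ^ k + c + (4 : ℂ) ^ k / compU p z ^ k) := by
  have hp0 : p ≠ 0 := by omega
  have h2p : 2 * p ≠ 0 := by omega
  have hpC : (p : ℂ) ≠ 0 := by exact_mod_cast hp0
  have hkp : k * 2 + k * (2 * p) = k * 1 + k * p + 12 := by rw [← hk]; ring
  refine isHaupt_of_unit (u := fun z => compU p z ^ k)
    (A := fun x => (eulerP x * eulerP (x ^ p) / (eulerP (x ^ 2) * eulerP (x ^ (2 * p)))) ^ (2 * k))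
    ?_ ?_ ?_ ?_ (fun z => rfl) ?_
  · exact ((eulerP_diff.mul (eulerP_pow_diff p hp0)).div ((eulerP_pow_diff 2 two_ne_zero).mul
      (eulerP_pow_diff _ h2p)) fun x hx => mul_ne_zero (eulerP_pow_ne_zero 2 two_ne_zero hx)
        (eulerP_pow_ne_zero _ h2p hx)).pow _
  · simp [hp0, eulerP_zero]
  · intro x hx
    refine pow_ne_zero _ (div_ne_zero (mul_ne_zero ?_ (eulerP_pow_ne_zero p hp0 hx))
      (mul_ne_zero (eulerP_pow_ne_zero 2 two_ne_zero hx) (eulerP_pow_ne_zero _ h2p hx)))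
    simpa using eulerP_pow_ne_zero 1 one_ne_zero hx
  · intro z hz
    have h1 := etaSq_natMul 1 z
    have h1' := etaSq_natMul 2 z
    simp only [Nat.cast_one, one_mul, pow_one] at h1
    have hq : qc z ∈ Metric.ball (0 : ℂ) 1 := by simpa using norm_qc_lt_one hz
    have hP := eulerP_pow_ne_zero _ h2p hq
    have hP2 := eulerP_pow_ne_zero 2 two_ne_zero hq
    have h2 := Complex.exp_ne_zero (Real.pi * I * z / 6)
    have h3 := exp_pow_twelve z
    have hq0 := qc_ne_zero z
    rw [compU, h1, etaSq_natMul, etaSq_natMul, show (2 : ℂ) * z = (2 : ℕ) * z by simp, h1']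
    generalize Complex.exp (Real.pi * I * z / 6) = e at *
    generalize eulerP (qc z ^ (2 * p)) = P4 at *
    generalize eulerP (qc z ^ 2) = P3 at *
    generalize eulerP (qc z ^ p) = P2 at *
    generalize eulerP (qc z) = P1 at *
    have h4 : e * P1 ^ 2 * (e ^ p * P2 ^ 2) / (e ^ 2 * P3 ^ 2 * (e ^ (2 * p) * P4 ^ 2)) =
        (e ^ 1 * e ^ p) / (e ^ 2 * e ^ (2 * p)) * (P1 * P2 / (P3 * P4)) ^ 2 := by field_simp
    rw [h4, mul_pow, ← pow_mul, div_pow, ← pow_add, ← pow_add, ← pow_mul, ← pow_mul,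
      show (2 + 2 * p) * k = (1 + p) * k + 12 by linarith, pow_add, h3]
    field_simp
  · intro hneg hT
    have hW : frickeW (2 * p) ∈ invSub (fun z => compU p z ^ k + c + (4 : ℂ) ^ k / compU p z ^ k) := by
      intro τ
      have hτ : (τ : ℂ) ≠ 0 := τ.ne_zero
      have hMp := Nat.pos_of_neZero (2 * p)
      have h1 := etaSq_ne_zero τ.im_pos
      have h2 := etaSq_ne_zero (natMul_im_pos τ.im_pos 2 two_pos)
      have h3 := etaSq_ne_zero (natMul_im_pos τ.im_pos p (by omega))
      have h4 := etaSq_ne_zero (natMul_im_pos τ.im_pos (2 * p) hMp)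
      have e1 := etaSq_neg_inv_mul (δ := 1) (ε := 2 * p) (by simp) hMp τ.im_pos
      have e2 := etaSq_neg_inv_mul (M := 2 * p) (δ := 2) (ε := p) (by simp) hMp τ.im_pos
      have e3 := etaSq_neg_inv_mul (M := 2 * p) (δ := p) (ε := 2) (by ring) hMp τ.im_pos
      have e4 := etaSq_neg_inv_mul (δ := 2 * p) (ε := 1) (by simp) hMp τ.im_pos
      have key : compU p (frickeW (2 * p) • τ : ℍ) = 4 * (compU p τ)⁻¹ := by
        rw [frickeW_smul, compU, compU]
        simp only [Nat.cast_one, one_mul, Nat.cast_ofNat] at e1 e2 e3 e4 h1 h2 h3 h4 ⊢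
        rw [e1, e2, e3, e4]
        push_cast
        field_simp
        ring
      have hne : compU p τ ≠ 0 := by
        simp only [Nat.cast_ofNat] at h2
        exact div_ne_zero (mul_ne_zero h1 h3) (mul_ne_zero h2 h4)
      beta_reduce
      rw [key]
      generalize compU p τ = v at *
      rw [mul_pow, inv_pow]
      field_simp
      ring
    subst hb
    refine Gam_le_of_halfV (b := b) (ρ := ρ) ⟨2, by ring⟩ dvd_rfl hρ0 hρ hb2 _ hneg hT hW
      fun τ => ?_
    beta_reduce
    rw [hV]

theorem compU_halfV_three (τ : ℍ) : compU 3 (halfV 1 • τ : ℍ) ^ 3 = compU 3 τ ^ 3 := by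
  have h2 := etaSq_ne_zero (natMul_im_pos τ.im_pos 2 (by norm_num))
  have h6 := etaSq_ne_zero (natMul_im_pos τ.im_pos 6 (by norm_num))
  obtain ⟨a0, -, a1⟩ := etaRule_1123 _ (natMul_im_pos τ.im_pos 3 (by norm_num))
  obtain ⟨b0, -, b1⟩ := etaRule_3121 _ τ.im_pos
  obtain ⟨c0, -, c1⟩ := etaRule_1213 _ (natMul_im_pos τ.im_pos 6 (by norm_num))
  obtain ⟨d0, -, d1⟩ := etaRule_3211 _ (natMul_im_pos τ.im_pos 2 (by norm_num))
  have hz := zet_ne_zero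
  have h12 : zet ^ 12 = 1 := by
    rw [show 12 = 3 * 4 by norm_num, pow_mul, zet_pow_three, I_pow_four]
  rw [halfV_smul, compU, compU]
  push_cast at *
  simp only [mul_one, one_mul] at *
  norm_num only at *
  have e0 : (3 * (τ : ℂ) + 1) / (3 * (2 * τ + 1)) = (3 * τ + 1) / (2 * (3 * τ) + 3) := by
    congr 1; ring
  have e1 : 3 * ((3 * (τ : ℂ) + 1) / (3 * (2 * τ + 1))) = (3 * τ + 1) / (2 * τ + 1) := by field_simp
  have e2 : 2 * ((3 * (τ : ℂ) + 1) / (3 * (2 * τ + 1))) = (6 * τ + 2) / (6 * τ + 3) := by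
    rw [show 6 * (τ : ℂ) + 3 = 3 * (2 * τ + 1) by ring]; field_simp; ring
  have e3 : 6 * ((3 * (τ : ℂ) + 1) / (3 * (2 * τ + 1))) = (3 * (2 * τ) + 2) / (2 * τ + 1) := by
    field_simp; ring
  rw [e1, e2, e3, e0, a1, b1, c1, d1]
  rw [show 2 * (3 * (τ : ℂ)) + 3 = 3 * (2 * τ + 1) by ring,
    show 6 * (τ : ℂ) + 3 = 3 * (2 * τ + 1) by ring]
  simp only [_root_.zpow_neg_one, _root_.zpow_one]
  field_simp
  rw [h12]; simp

theorem compU_halfV_five (τ : ℍ) : compU 5 (halfV 2 • τ : ℍ) ^ 2 = compU 5 τ ^ 2 := by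
  have h2 := etaSq_ne_zero (natMul_im_pos τ.im_pos 2 (by norm_num))
  have h6 := etaSq_ne_zero (natMul_im_pos τ.im_pos 10 (by norm_num))
  obtain ⟨a0, -, a1⟩ := etaRule_1225 _ (natMul_im_pos τ.im_pos 5 (by norm_num))
  obtain ⟨b0, -, b1⟩ := etaRule_5221 _ τ.im_pos
  obtain ⟨c0, -, c1⟩ := etaRule_1415 _ (natMul_im_pos τ.im_pos 10 (by norm_num))
  obtain ⟨d0, -, d1⟩ := etaRule_5411 _ (natMul_im_pos τ.im_pos 2 (by norm_num))
  have hz := zet_ne_zero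
  have h12 : zet ^ 12 = 1 := by
    rw [show 12 = 3 * 4 by norm_num, pow_mul, zet_pow_three, I_pow_four]
  rw [halfV_smul, compU, compU]
  push_cast at *
  simp only [mul_one, one_mul] at *
  norm_num only at *
  have e0 : (5 * (τ : ℂ) + 2) / (5 * (2 * τ + 1)) = (5 * τ + 2) / (2 * (5 * τ) + 5) := by
    congr 1; ring
  have e1 : 5 * ((5 * (τ : ℂ) + 2) / (5 * (2 * τ + 1))) = (5 * τ + 2) / (2 * τ + 1) := by field_simp
  have e2 : 2 * ((5 * (τ : ℂ) + 2) / (5 * (2 * τ + 1))) = (10 * τ + 4) / (10 * τ + 5) := by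
    rw [show 10 * (τ : ℂ) + 5 = 5 * (2 * τ + 1) by ring]; field_simp; ring
  have e3 : 10 * ((5 * (τ : ℂ) + 2) / (5 * (2 * τ + 1))) = (5 * (2 * τ) + 4) / (2 * τ + 1) := by
    field_simp; ring
  rw [e1, e2, e3, e0, a1, b1, c1, d1]
  rw [show 2 * (5 * (τ : ℂ)) + 5 = 5 * (2 * τ + 1) by ring,
    show 10 * (τ : ℂ) + 5 = 5 * (2 * τ + 1) by ring]
  have h3 : zet ^ (3 : ℤ) = zet ^ 3 := by norm_cast
  rw [h3, zpow_zero, one_mul, one_mul]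
  field_simp
  rw [h12]; simp

theorem isHaupt_jnStar_six : IsHaupt 6 (jnStar 6) := by
  have h := isHaupt_comp (p := 3) (k := 3) (b := 1) (ρ := 0.4) (by norm_num) (by norm_num)
    (by norm_num) (by norm_num) (by norm_num) compU_halfV_three 6
  convert h using 1
  funext z
  simp only [jnStar, compU, etaSq, if_true]
  push_cast
  norm_num
  congr 2
  · ring
  · rw [div_eq_mul_inv, ← inv_pow, inv_div]; ring

theorem isHaupt_jnStar_ten : IsHaupt 10 (jnStar 10) := by
  have h := isHaupt_comp (p := 5) (k := 2) (b := 2) (ρ := 0.3) (by norm_num) (by norm_num)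
    (by norm_num) (by norm_num) (by norm_num) compU_halfV_five 4
  convert h using 1
  funext z
  simp only [jnStar, compU, etaSq]
  push_cast
  norm_num
  congr 2
  · ring
  · rw [div_eq_mul_inv, ← inv_pow, inv_div]; ring

theorem jf_mul (g h : SL2R) (τ : ℍ) : jf (g * h) τ = jf g (h • τ : ℍ) * jf h τ := by
  have := jf_ne_zero h τ
  rw [coe_smul_eq]
  simp only [jf, mul_entry] at *
  push_cast
  field_simp
  ring

theorem jf_one (z : ℂ) : jf 1 z = 1 := by simp [jf]

/-- The discriminant function. -/
noncomputable def deltaF (z : ℂ) : ℂ := etaSq z ^ 12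

theorem deltaF_eq (z : ℂ) : deltaF z = qc z * eulerP (qc z) ^ 24 := by
  rw [deltaF, etaSq_eq, mul_pow, exp_pow_twelve, ← pow_mul]

theorem deltaF_ne_zero {z : ℂ} (hz : 0 < z.im) : deltaF z ≠ 0 := pow_ne_zero _ (etaSq_ne_zero hz)

theorem deltaF_diff : DifferentiableOn ℂ deltaF {z | 0 < z.im} := fun _ hz =>
  (((eta_diff hz).pow 2).pow 12).differentiableWithinAt

/-- The group under which a function transforms with weight `k`. -/
def weightSub (k : ℕ) (h : ℂ → ℂ) : Subgroup SL2R where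
  carrier := {g | ∀ τ : ℍ, h (g • τ : ℍ) = jf g τ ^ k * h τ}
  mul_mem' := fun {a b} ha hb τ => by rw [mul_smul, ha, hb, jf_mul, mul_pow]; ring
  one_mem' := fun τ => by rw [one_smul, jf_one, one_pow, one_mul]
  inv_mem' := fun {a} ha τ => by
    have := ha (a⁻¹ • τ)
    rw [smul_inv_smul] at this
    have h2 : jf a (a⁻¹ • τ : ℍ) * jf a⁻¹ τ = 1 := by rw [← jf_mul, mul_inv_cancel, jf_one]
    have h3 : jf a (a⁻¹ • τ : ℍ) = (jf a⁻¹ τ)⁻¹ := eq_inv_of_mul_eq_one_left h2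
    have h4 := jf_ne_zero a⁻¹ τ
    rw [this, h3, ← mul_assoc, ← mul_pow, mul_inv_cancel₀ h4, one_pow, one_mul]

theorem Gam_one_le_weightSub {k : ℕ} (hk : Even k) {h : ℂ → ℂ}
    (hT : ∀ τ : ℍ, ∀ m : ℤ, h (τ + m) = h τ) (hS : ∀ τ : ℍ, h (-1 / τ) = (τ : ℂ) ^ k * h τ) :
    Gam 1 ≤ weightSub k h := by
  refine Gam_le_of_lt_four (by norm_num) _ ?_ ?_ ?_
  · intro τ
    have h1 : ((-1 : SL2R) • τ : ℍ) = (τ : ℂ) := by rw [coe_smul_eq]; simp [neg_entry]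
    have h2 : jf (-1) τ = -1 := by simp [jf, neg_entry]
    rw [h1, h2, hk.neg_one_pow, one_mul]
  · intro m τ
    obtain ⟨-, -, h3, h4⟩ := upper_entries (b := m) (show (0 : ℝ) < 1 * 1 by norm_num)
    have h2 : jf (upper 1 m 1) τ = 1 := by simp [jf, h3, h4]
    rw [upper_smul (by norm_num), h2, one_pow, one_mul, ← hT τ m]
    simp
  · intro τ
    have h2 : jf (frickeW 1) τ = τ := by simp [jf, frickeW]
    rw [frickeW_smul, h2, ← hS]
    simp

theorem deltaF_smul {g : SL2R} (hg : g ∈ Gam 1) (τ : ℍ) :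
    deltaF (g • τ : ℍ) = jf g τ ^ 12 * deltaF τ := by
  refine Gam_one_le_weightSub (k := 12) (by decide) ?_ ?_ hg τ
  · intro τ m
    rw [deltaF_eq, deltaF_eq, qc_add, qc_int, mul_one]
  · intro τ
    rw [deltaF, etaSq_neg_inv τ.im_pos, mul_pow, mul_pow, deltaF]
    have : (-I : ℂ) ^ 12 = 1 := by
      rw [show 12 = 4 * 3 by norm_num, pow_mul, Even.neg_pow (by decide), I_pow_four, one_pow]
    rw [this, one_mul]

open EisensteinSeries ModularForm MatrixGroups in
theorem exists_isHaupt_one : ∃ h, IsHaupt 1 h := by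
  let F : ℂ → ℂ := fun z => E₄ (ofComplex z)
  obtain ⟨G, hG, hG0, hGF⟩ : ∃ G : ℂ → ℂ, DifferentiableOn ℂ G (Metric.ball 0 1) ∧ G 0 = 1 ∧
      ∀ z : ℂ, 0 < z.im → F z = G (qc z) := by
    refine ⟨cuspFunction 1 E₄, fun x hx => ?_, ?_, fun z hz => ?_⟩
    · exact (ModularFormClass.differentiableAt_cuspFunction E₄ one_pos one_mem_strictPeriods_SL
        (by simpa using hx)).differentiableWithinAt
    · have h := E_qExpansion_coeff_zero (show 3 ≤ 4 by norm_num) (by decide)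
      rw [qExpansion_coeff] at h
      simpa using h
    · have h := SlashInvariantFormClass.eq_cuspFunction E₄ ⟨z, hz⟩ one_mem_strictPeriods_SL
        one_ne_zero
      have h2 : F z = E₄ ⟨z, hz⟩ := by
        change E₄ (ofComplex z) = _
        rw [ofComplex_apply_of_im_pos hz]
      rw [h2, ← h]
      congr 1
      simp [Function.Periodic.qParam, qc]
  have hd : DifferentiableOn ℂ F {z | 0 < z.im} :=
    (hG.comp qc_diff.differentiableOn fun z hz => by simpa using norm_qc_lt_one hz).congr hGF
  have hF : ∀ g ∈ Gam 1, ∀ τ : ℍ, F (g • τ : ℍ) = jf g τ ^ 4 * F τ := by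
    refine fun g hg => Gam_one_le_weightSub (k := 4) (by decide) ?_ ?_ hg
    · intro τ m
      rw [hGF _ (by simpa using τ.im_pos), hGF _ τ.im_pos, qc_add, qc_int, mul_one]
    · intro τ
      have h := SlashInvariantForm.slash_action_eqn' (Γ := 𝒮ℒ) E₄
        (γ := (ModularGroup.S : Matrix.GeneralLinearGroup (Fin 2) ℝ)) ⟨ModularGroup.S, rfl⟩ τ
      have h3 : F (-1 / τ) = E₄ (ModularGroup.S • τ) := by
        change E₄ (ofComplex _) = _
        have : (-1 / τ : ℂ) = (ModularGroup.S • τ : ℍ) := by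
          rw [modular_S_smul]
          simp [neg_div, inv_neg]
        rw [this, ofComplex_apply]
      have h4 : F τ = E₄ τ := by
        change E₄ (ofComplex _) = _
        rw [ofComplex_apply]
      rw [h3, h4]
      refine h.trans ?_
      have h5 : ((ModularGroup.S : Matrix.GeneralLinearGroup (Fin 2) ℝ) 1 0 : ℝ) = 1 := by
        simp [ModularGroup.coe_S]
      have h6 : ((ModularGroup.S : Matrix.GeneralLinearGroup (Fin 2) ℝ) 1 1 : ℝ) = 0 := by
        simp [ModularGroup.coe_S]
      rw [h5, h6]
      simp
  refine ⟨fun z => F z ^ 3 / deltaF z, ⟨?_, ?_, fun x => G x ^ 3 / eulerP x ^ 24, ?_, ?_, ?_⟩⟩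
  · exact (hd.pow 3).div deltaF_diff fun z hz => deltaF_ne_zero hz
  · intro g hg τ
    have := jf_ne_zero g τ
    rw [hF g hg, deltaF_smul hg]
    field_simp
  · refine (hG.pow 3).div (eulerP_diff.pow 24) fun x hx => pow_ne_zero _ (eulerP_ne_zero ?_)
    simpa using hx
  · simp [hG0, eulerP_zero]
  · intro z hz
    have := qc_ne_zero z
    have h2 := eulerP_ne_zero (norm_qc_lt_one hz)
    rw [hGF z hz, deltaF_eq]
    field_simp

/-! ### Functions holomorphic at the cusp -/

/-- `g` is a holomorphic function of `q` on the open unit disc. -/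
def CuspHol (g : ℂ → ℂ) : Prop :=
  ∃ H : ℂ → ℂ, DifferentiableOn ℂ H (Metric.ball 0 1) ∧ ∀ z : ℂ, 0 < z.im → g z = H (qc z)

theorem qc_mem_ball {z : ℂ} (hz : 0 < z.im) : qc z ∈ Metric.ball (0 : ℂ) 1 := by
  simpa using norm_qc_lt_one hz

/-- Maximum principle: an invariant function holomorphic at the cusp and vanishing there is zero. -/
theorem eqOn_zero_of_invariant {M : ℕ} [NeZero M] (hM : Squarefree M) {g H : ℂ → ℂ}
    (hinv : ∀ w ∈ Gam M, ∀ τ : ℍ, g (w • τ : ℍ) = g τ)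
    (hH : DifferentiableOn ℂ H (Metric.ball 0 1)) (hgH : ∀ z : ℂ, 0 < z.im → g z = H (qc z))
    (h0 : H 0 = 0) : ∀ z : ℂ, 0 < z.im → g z = 0 := by
  have hM0 : (0 : ℝ) < M := by exact_mod_cast Nat.pos_of_neZero M
  set c : ℝ := 1 / (2 * (M : ℝ) ^ 3) with hc
  have hc0 : 0 < c := by positivity
  set r : ℝ := Real.exp (-2 * Real.pi * c) with hr
  have hr1 : r < 1 := by
    rw [hr, Real.exp_lt_one_iff]; nlinarith [mul_pos Real.pi_pos hc0]
  have hsub : Metric.closedBall (0 : ℂ) r ⊆ Metric.ball 0 1 := Metric.closedBall_subset_ball hr1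
  obtain ⟨x0, hx0, hmax⟩ := (isCompact_closedBall (0 : ℂ) r).exists_isMaxOn
    ⟨0, by simp [hr, (Real.exp_pos _).le]⟩ (hH.continuousOn.mono hsub).norm
  have hmax' : IsMaxOn (norm ∘ H) (Metric.ball 0 1) x0 := by
    intro x hx
    rcases eq_or_ne x 0 with rfl | hx0'
    · simp [h0]
    obtain ⟨z, hz, rfl⟩ := exists_qc_eq hx0' (by simpa using hx)
    obtain ⟨w, hw, hwim⟩ := exists_im_ge hM (⟨z, hz⟩ : ℍ)
    have e1 : H (qc z) = H (qc (w • (⟨z, hz⟩ : ℍ) : ℍ)) := by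
      rw [← hgH _ hz, ← hgH _ (w • (⟨z, hz⟩ : ℍ)).im_pos]
      exact (hinv w hw ⟨z, hz⟩).symm
    have e2 : qc (w • (⟨z, hz⟩ : ℍ) : ℍ) ∈ Metric.closedBall (0 : ℂ) r := by
      rw [Metric.mem_closedBall, dist_zero_right, norm_qc, hr, Real.exp_le_exp]
      have : c ≤ ((w • (⟨z, hz⟩ : ℍ) : ℍ) : ℂ).im := hwim
      nlinarith [Real.pi_pos]
    have := hmax e2
    simpa [e1] using this
  have hconst := Complex.eqOn_of_isPreconnected_of_isMaxOn_norm
    (convex_ball (0 : ℂ) 1).isPreconnected Metric.isOpen_ball hH (hsub hx0) hmax'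
  have hx00 : H x0 = 0 := by
    have := hconst (show (0 : ℂ) ∈ Metric.ball (0 : ℂ) 1 by simp)
    simpa [h0] using this.symm
  intro z hz
  rw [hgH z hz, hconst (qc_mem_ball hz)]
  simpa using hx00

theorem exists_eq_mul_of_zero {H : ℂ → ℂ} (hH : DifferentiableOn ℂ H (Metric.ball 0 1))
    (h0 : H 0 = 0) : ∃ K : ℂ → ℂ, DifferentiableOn ℂ K (Metric.ball 0 1) ∧ ∀ x, H x = x * K x := by
  refine ⟨dslope H 0, ?_, fun x => ?_⟩
  · exact (Complex.differentiableOn_dslope (Metric.ball_mem_nhds 0 one_pos)).2 hH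
  · have := sub_smul_dslope H 0 x
    simp only [sub_zero, smul_eq_mul, h0] at this
    exact this.symm

/-- An invariant function meromorphic at the cusp is a polynomial in the hauptmodul. -/
theorem IsHaupt.exists_polynomial {M : ℕ} [NeZero M] (hM : Squarefree M) {f : ℂ → ℂ}
    (hf : IsHaupt M f) (D : ℕ) : ∀ g : ℂ → ℂ, (∀ w ∈ Gam M, ∀ τ : ℍ, g (w • τ : ℍ) = g τ) →
    CuspHol (fun z => g z * qc z ^ D) →
    ∃ P : Polynomial ℂ, ∀ z : ℂ, 0 < z.im → g z = P.eval (f z) := by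
  obtain ⟨G, hG, hG0, hfG⟩ := hf.cusp
  induction D with
  | zero =>
    rintro g hg ⟨H, hH, hgH⟩
    refine ⟨Polynomial.C (H 0), fun z hz => ?_⟩
    have := eqOn_zero_of_invariant hM (g := fun z => g z - H 0) (H := fun x => H x - H 0)
      (fun w hw τ => by rw [hg w hw]) (hH.sub_const _)
      (fun z hz => by rw [← hgH z hz]; simp) (by simp) z hz
    rw [Polynomial.eval_C]
    exact sub_eq_zero.1 this
  | succ D ih =>
    rintro g hg ⟨H, hH, hgH⟩
    obtain ⟨K, hK, hHK⟩ := exists_eq_mul_of_zero (H := fun x => H x - H 0 * G x ^ (D + 1))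
      (hH.sub ((hG.pow _).const_mul _)) (by simp [hG0])
    obtain ⟨P, hP⟩ := ih (fun z => g z - H 0 * f z ^ (D + 1))
      (fun w hw τ => by rw [hg w hw, hf.inv w hw]) ⟨K, hK, fun z hz => by
        have h1 := hHK (qc z)
        have h2 := hgH z hz
        have h3 := hfG z hz
        have h4 := qc_ne_zero z
        simp only [] at h1 h2
        rw [← h2, ← h3] at h1
        apply mul_left_cancel₀ h4
        rw [← h1]; ring⟩
    refine ⟨P + Polynomial.C (H 0) * Polynomial.X ^ (D + 1), fun z hz => ?_⟩
    rw [Polynomial.eval_add, ← hP z hz]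
    simp

theorem IsHaupt.surjective {M : ℕ} [NeZero M] (hM : Squarefree M) {f : ℂ → ℂ}
    (hf : IsHaupt M f) (x : ℂ) : ∃ τ : ℍ, f τ = x := by
  obtain ⟨G, hG, hG0, hfG⟩ := hf.cusp
  by_contra! hne
  have hne' : ∀ z : ℂ, 0 < z.im → f z - x ≠ 0 := fun z hz => sub_ne_zero.2 (hne ⟨z, hz⟩)
  have hGne : ∀ y ∈ Metric.ball (0 : ℂ) 1, G y - x * y ≠ 0 := by
    intro y hy
    rcases eq_or_ne y 0 with rfl | hy0
    · simp [hG0]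
    obtain ⟨z, hz, rfl⟩ := exists_qc_eq hy0 (by simpa using hy)
    rw [← hfG z hz, ← sub_mul]
    exact mul_ne_zero (hne' z hz) (qc_ne_zero z)
  have h := eqOn_zero_of_invariant hM (g := fun z => (f z - x)⁻¹)
    (H := fun y => y / (G y - x * y)) (fun w hw τ => by rw [hf.inv w hw])
    (differentiableOn_id.div (hG.sub (by fun_prop)) hGne) (fun z hz => by
      have h1 := hGne _ (qc_mem_ball hz)
      have h2 := hne' z hz
      have h3 := qc_ne_zero z
      rw [← hfG z hz, ← sub_mul]
      field_simp) (by simp) Complex.I (by simp)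
  exact inv_ne_zero (hne' Complex.I (by simp)) h

/-- Bound on the hauptmodul away from the real line. -/
theorem IsHaupt.growth {M : ℕ} [NeZero M] {f : ℂ → ℂ} (hf : IsHaupt M f) {δ : ℝ} (hδ : 0 < δ) :
    ∃ C : ℝ, 0 ≤ C ∧ ∀ z : ℂ, δ ≤ z.im → ‖f z‖ ≤ C * Real.exp (2 * Real.pi * z.im) := by
  obtain ⟨G, hG, hG0, hfG⟩ := hf.cusp
  set r : ℝ := Real.exp (-2 * Real.pi * δ) with hr
  have hr1 : r < 1 := by
    rw [hr, Real.exp_lt_one_iff]; nlinarith [mul_pos Real.pi_pos hδ]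
  obtain ⟨C, hC⟩ := (isCompact_closedBall (0 : ℂ) r).exists_bound_of_continuousOn
    (hG.continuousOn.mono (Metric.closedBall_subset_ball hr1))
  refine ⟨max C 0, le_max_right _ _, fun z hz => ?_⟩
  have hz0 : 0 < z.im := hδ.trans_le hz
  have h1 : qc z ∈ Metric.closedBall (0 : ℂ) r := by
    rw [Metric.mem_closedBall, dist_zero_right, norm_qc, hr, Real.exp_le_exp]
    nlinarith [Real.pi_pos]
  have h2 := hC _ h1
  rw [← hfG z hz0, norm_mul, norm_qc] at h2
  have h3 : Real.exp (-2 * Real.pi * z.im) * Real.exp (2 * Real.pi * z.im) = 1 := by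
    rw [← Real.exp_add]; simp
  have h4 := Real.exp_pos (2 * Real.pi * z.im)
  calc ‖f z‖ = ‖f z‖ * Real.exp (-2 * Real.pi * z.im) * Real.exp (2 * Real.pi * z.im) := by
        rw [mul_assoc, h3, mul_one]
    _ ≤ max C 0 * Real.exp (2 * Real.pi * z.im) := by
        gcongr; exact h2.trans (le_max_left _ _)

/-- A periodic holomorphic function of exponential growth is meromorphic at the cusp. -/
theorem cuspHol_of_growth {F : ℂ → ℂ} (hF : DifferentiableOn ℂ F {z | 0 < z.im})
    (hper : ∀ z : ℂ, 0 < z.im → F (z + 1) = F z) {D : ℕ} {C : ℝ}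
    (hgr : ∀ z : ℂ, 1 ≤ z.im → ‖F z‖ ≤ C * Real.exp (2 * Real.pi * D * z.im)) :
    CuspHol (fun z => F z * qc z ^ D) := by
  let f : ℍ → ℂ := fun τ => F τ * qc τ ^ D
  have hqper : ∀ z : ℂ, qc (z + 1) = qc z := fun z => by
    rw [qc_add]; simpa using congrArg (qc z * ·) (qc_int 1)
  have hof : ∀ z : ℂ, 0 < z.im → (f ∘ ofComplex) z = F z * qc z ^ D := fun z hz => by
    simp only [Function.comp, f]
    rw [ofComplex_apply_of_im_pos hz]
  have hfper : Function.Periodic (f ∘ ofComplex) (1 : ℝ) := by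
    intro z
    by_cases hz : 0 < z.im
    · rw [hof _ (by simpa using hz), hof _ hz]
      push_cast
      rw [hper z hz, hqper]
    · simp only [Function.comp]
      rw [ofComplex_apply_of_im_nonpos (by simpa using hz),
        ofComplex_apply_of_im_nonpos (by simpa using hz)]
  have hd : DifferentiableOn ℂ (fun z => F z * qc z ^ D) {z | 0 < z.im} :=
    hF.mul (qc_diff.pow D).differentiableOn
  have hfhol : MDifferentiable (modelWithCornersSelf ℂ ℂ) (modelWithCornersSelf ℂ ℂ) f := by
    rw [UpperHalfPlane.mdifferentiable_iff]
    exact hd.congr fun z hz => hof z hz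
  have hb : IsBoundedAtImInfty f := by
    rw [isBoundedAtImInfty_iff]
    refine ⟨C, 1, fun τ hτ => ?_⟩
    have h3 : Real.exp (2 * Real.pi * D * τ.im) * Real.exp (-2 * Real.pi * τ.im) ^ D = 1 := by
      rw [← Real.exp_nat_mul, ← Real.exp_add]; ring_nf; simp
    calc ‖f τ‖ = ‖F τ‖ * Real.exp (-2 * Real.pi * τ.im) ^ D := by
          simp only [f]; rw [norm_mul, norm_pow, norm_qc]; rfl
      _ ≤ C * Real.exp (2 * Real.pi * D * τ.im) * Real.exp (-2 * Real.pi * τ.im) ^ D := by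
          gcongr; exact hgr τ hτ
      _ = C := by rw [mul_assoc, h3, mul_one]
  refine ⟨cuspFunction 1 f, differentiableOn_cuspFunction_ball one_pos hfper hfhol hb, ?_⟩
  intro z hz
  have := eq_cuspFunction (h := 1) (f := f) ⟨z, hz⟩ one_ne_zero hfper
  rw [show Function.Periodic.qParam 1 ((⟨z, hz⟩ : ℍ) : ℂ) = qc z by
    simp [Function.Periodic.qParam, qc]] at this
  exact this.symm

end FrickeTrace

namespace FrickeTrace

open UpperHalfPlane hiding I
open Filter Topology

/-! ### Separation of orbits -/

/-- The elements of a Hecke set carrying points near `τ₀` to points near `τ₁` carry `τ₀` to `τ₁`. -/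
theorem eventually_smul_eq {M n : ℕ} [NeZero M] (hn : 0 < n) (τ₀ τ₁ : ℍ) :
    ∀ᶠ p : ℍ × ℍ in 𝓝 (τ₀, τ₁), ∀ g ∈ heckeSet M n, g • p.1 = p.2 → g • τ₀ = τ₁ := by
  set δ : ℝ := min τ₀.im τ₁.im / 2 with hδ
  set R : ℝ := max ‖(τ₀ : ℂ)‖ ‖(τ₁ : ℂ)‖ + 1 with hR
  have hm : 0 < min τ₀.im τ₁.im := lt_min τ₀.im_pos τ₁.im_pos
  have hδ0 : 0 < δ := by positivity
  obtain ⟨C, hC⟩ := entries_bounded (R := R) hδ0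
  have hfin := heckeSet_finite (M := M) hn C
  have c1 : Continuous fun p : ℍ × ℍ => p.1.im := UpperHalfPlane.continuous_im.comp continuous_fst
  have c2 : Continuous fun p : ℍ × ℍ => p.2.im := UpperHalfPlane.continuous_im.comp continuous_snd
  have c3 : Continuous fun p : ℍ × ℍ => ‖(p.1 : ℂ)‖ :=
    (UpperHalfPlane.continuous_coe.comp continuous_fst).norm
  have c4 : Continuous fun p : ℍ × ℍ => ‖(p.2 : ℂ)‖ :=
    (UpperHalfPlane.continuous_coe.comp continuous_snd).norm
  have e1 := (c1.tendsto (τ₀, τ₁)).eventually_const_lt (u := δ)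
    (by show δ < τ₀.im; linarith [min_le_left τ₀.im τ₁.im])
  have e2 := (c2.tendsto (τ₀, τ₁)).eventually_const_lt (u := δ)
    (by show δ < τ₁.im; linarith [min_le_right τ₀.im τ₁.im])
  have e3 := (c3.tendsto (τ₀, τ₁)).eventually_lt_const (u := R)
    (by show ‖(τ₀ : ℂ)‖ < R; linarith [le_max_left ‖(τ₀ : ℂ)‖ ‖(τ₁ : ℂ)‖])
  have e4 := (c4.tendsto (τ₀, τ₁)).eventually_lt_const (u := R)
    (by show ‖(τ₁ : ℂ)‖ < R; linarith [le_max_right ‖(τ₀ : ℂ)‖ ‖(τ₁ : ℂ)‖])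
  have e5 : ∀ᶠ p : ℍ × ℍ in 𝓝 (τ₀, τ₁), ∀ g ∈ {g ∈ heckeSet M n | ∀ i j, |g.1 i j| ≤ C},
      g • p.1 = p.2 → g • τ₀ = τ₁ := by
    rw [eventually_all_finite hfin]
    intro g _
    by_cases h : g • τ₀ = τ₁
    · exact Eventually.of_forall fun _ _ => h
    · have cg : Continuous fun p : ℍ × ℍ => g • p.1 := continuous_fst.const_smul g
      filter_upwards [(isOpen_ne_fun cg continuous_snd).mem_nhds (x := (τ₀, τ₁)) h] with p hp hp'
      exact absurd hp' hp
  filter_upwards [e1, e2, e3, e4, e5] with p h1 h2 h3 h4 h5 g hg hgp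
  refine h5 g ⟨hg, hC g p.1 h1.le h3.le ?_ ?_⟩ hgp
  · rw [hgp]; exact h2.le
  · rw [hgp]; exact h4.le

/-- Near the cusp a hauptmodul is injective modulo the group. -/
theorem IsHaupt.exists_equiv_of_large {M : ℕ} [NeZero M] (hM : Squarefree M) {f : ℂ → ℂ}
    (hf : IsHaupt M f) : ∃ R : ℝ, ∀ τ₀ τ₁ : ℍ, f τ₀ = f τ₁ → R < ‖f τ₀‖ →
    ∃ g ∈ Gam M, g • τ₀ = τ₁ := by
  obtain ⟨G, hG, hG0, hfG⟩ := hf.cusp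
  have hnb : Metric.ball (0 : ℂ) 1 ∈ 𝓝 (0 : ℂ) := Metric.ball_mem_nhds _ one_pos
  have hGa : AnalyticAt ℂ G 0 := hG.analyticAt hnb
  have hφ : AnalyticAt ℂ (fun x => x / G x) 0 := analyticAt_id.div hGa (by simp [hG0])
  have hd : HasStrictDerivAt (fun x => x / G x) 1 0 := by
    have h1 := (hasDerivAt_id (0 : ℂ)).div hGa.differentiableAt.hasDerivAt (by simp [hG0])
    have h2 := hφ.hasStrictDerivAt
    rwa [show deriv (fun x => x / G x) 0 = 1 by
      rw [show (fun x => x / G x) = (id / G : ℂ → ℂ) from rfl, h1.deriv]; simp [hG0]] at h2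
  obtain ⟨U, hU, hinj⟩ : ∃ U ∈ 𝓝 (0 : ℂ), Set.InjOn (fun x => x / G x) U := by
    have := hd.hasStrictFDerivAt_equiv one_ne_zero
    exact ⟨_, this.toOpenPartialHomeomorph.open_source.mem_nhds
      this.mem_toOpenPartialHomeomorph_source, this.toOpenPartialHomeomorph.injOn⟩
  obtain ⟨r, hr, hrU⟩ := Metric.mem_nhds_iff.1 (inter_mem hU hnb)
  set δ : ℝ := 1 / (2 * (M : ℝ) ^ 3)
  have hδ : 0 < δ := by have := Nat.pos_of_neZero M; positivity
  obtain ⟨C, hC0, hC⟩ := hf.growth hδ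
  have hlarge : ∀ z : ℂ, δ ≤ z.im → C / r < ‖f z‖ → qc z ∈ Metric.ball 0 r := by
    intro z hz h
    by_contra hnot
    rw [Metric.mem_ball, dist_zero_right, norm_qc, not_lt] at hnot
    have h1 := hC z hz
    have h2 : Real.exp (2 * Real.pi * z.im) ≤ 1 / r := by
      rw [le_div_iff₀ hr]
      calc _ ≤ Real.exp (2 * Real.pi * z.im) * Real.exp (-2 * Real.pi * z.im) := by gcongr
        _ = 1 := by rw [← Real.exp_add]; simp
    have : C * Real.exp (2 * Real.pi * z.im) ≤ C * (1 / r) := by gcongr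
    rw [mul_one_div] at this
    linarith
  refine ⟨C / r, fun τ₀ τ₁ h01 hR => ?_⟩
  obtain ⟨w₀, hw₀, h0⟩ := exists_im_ge hM τ₀
  obtain ⟨w₁, hw₁, h1⟩ := exists_im_ge hM τ₁
  have hf0 := hf.inv w₀ hw₀ τ₀
  have hf1 := hf.inv w₁ hw₁ τ₁
  have hq0 := hrU (hlarge _ h0 (by rwa [hf0]))
  have hq1 := hrU (hlarge _ h1 (by rwa [hf1, ← h01]))
  have hq : qc (w₀ • τ₀ : ℍ) = qc (w₁ • τ₁ : ℍ) := by
    apply hinj hq0.1 hq1.1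
    simp only []
    rw [← hfG _ (w₀ • τ₀).im_pos, ← hfG _ (w₁ • τ₁).im_pos, hf0, hf1, h01]
    have n0 := qc_ne_zero (w₀ • τ₀ : ℍ)
    have n1 := qc_ne_zero (w₁ • τ₁ : ℍ)
    rcases eq_or_ne (f τ₁) 0 with h | h
    · simp [h]
    · field_simp
  have : ∃ k : ℤ, ((w₁ • τ₁ : ℍ) : ℂ) = (w₀ • τ₀ : ℍ) + k := by
    obtain ⟨k, hk⟩ := Complex.exp_eq_exp_iff_exists_int.1 hq
    refine ⟨-k, ?_⟩
    have hpi : (2 * Real.pi * Complex.I : ℂ) ≠ 0 := Complex.two_pi_I_ne_zero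
    apply mul_left_cancel₀ hpi
    push_cast
    linear_combination -hk
  obtain ⟨k, hk⟩ := this
  refine ⟨w₁⁻¹ * (upper 1 k 1 * w₀), mul_mem (inv_mem hw₁) (mul_mem (translate_mem_Gam M k) hw₀), ?_⟩
  rw [mul_smul, inv_smul_eq_iff, mul_smul]
  apply UpperHalfPlane.ext
  rw [upper_smul (by norm_num), hk]
  simp

theorem IsHaupt.analyticAt {M : ℕ} [NeZero M] {f : ℂ → ℂ} (hf : IsHaupt M f) (τ : ℍ) :
    AnalyticAt ℂ f τ :=
  hf.hol.analyticAt ((isOpen_lt continuous_const Complex.continuous_im).mem_nhds τ.im_pos)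

theorem IsHaupt.not_const {M : ℕ} [NeZero M] (hM : Squarefree M) {f : ℂ → ℂ}
    (hf : IsHaupt M f) (τ : ℍ) : ¬ ∀ᶠ z in 𝓝 (τ : ℂ), f z = f τ := by
  intro h
  have hpre : IsPreconnected {z : ℂ | 0 < z.im} := (convex_halfSpace_im_gt 0).isPreconnected
  have han : AnalyticOnNhd ℂ f {z | 0 < z.im} := fun z hz => hf.analyticAt ⟨z, hz⟩
  have := han.eqOn_of_preconnected_of_eventuallyEq
    (analyticOnNhd_const (v := f τ)) hpre τ.im_pos h
  obtain ⟨τ', h'⟩ := hf.surjective hM (f τ + 1)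
  have h2 := this τ'.im_pos
  simp [h'] at h2

/-- A hauptmodul is an open map. -/
theorem IsHaupt.nhds_le {M : ℕ} [NeZero M] (hM : Squarefree M) {f : ℂ → ℂ}
    (hf : IsHaupt M f) (τ : ℍ) : 𝓝 (f τ) ≤ map (fun σ : ℍ => f σ) (𝓝 τ) := by
  have h := ((hf.analyticAt τ).eventually_constant_or_nhds_le_map_nhds).resolve_left
    (hf.not_const hM τ)
  have h2 : map (fun σ : ℍ => (σ : ℂ)) (𝓝 τ) = 𝓝 (τ : ℂ) :=
    UpperHalfPlane.isOpenEmbedding_coe.map_nhds_eq τ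
  rw [← h2, Filter.map_map] at h
  exact h

/-- Points with bounded value of the hauptmodul can be moved into a compact set. -/
theorem IsHaupt.exists_reduced {M : ℕ} [NeZero M] (hM : Squarefree M) {f : ℂ → ℂ}
    (hf : IsHaupt M f) (B : ℝ) : ∃ K : Set ℍ, IsCompact K ∧ ∀ τ : ℍ, ‖f τ‖ ≤ B →
    ∃ w ∈ Gam M, w • τ ∈ K := by
  obtain ⟨G, hG, hG0, hfG⟩ := hf.cusp
  have hGc : ContinuousAt G 0 :=
    (hG.differentiableAt (Metric.ball_mem_nhds _ one_pos)).continuousAt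
  obtain ⟨r, hr, hrG⟩ := Metric.continuousAt_iff.1 hGc (1 / 2) (by norm_num)
  set δ : ℝ := 1 / (2 * (M : ℝ) ^ 3)
  have hδ : 0 < δ := by have := Nat.pos_of_neZero M; positivity
  set ρ : ℝ := min r (1 / (2 * (|B| + 1))) with hρ
  have hρ0 : 0 < ρ := lt_min hr (by positivity)
  set Y : ℝ := -Real.log ρ / (2 * Real.pi) with hY
  have key : ∀ z : ℂ, 0 < z.im → ‖f z‖ ≤ B → z.im ≤ Y := by
    intro z hz hB
    have h1 : ρ ≤ ‖qc z‖ := by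
      by_contra! hlt
      have h2 := hrG (x := qc z) (by rw [dist_zero_right]; exact hlt.trans_le (min_le_left _ _))
      rw [hG0, ← hfG z hz, dist_comm, dist_eq_norm] at h2
      have h3 : (1 : ℝ) - ‖f z * qc z‖ ≤ ‖1 - f z * qc z‖ := by
        simpa using norm_sub_norm_le (1 : ℂ) (f z * qc z)
      have h4 : ‖f z * qc z‖ ≤ 1 / 2 := by
        rw [norm_mul]
        have : ‖qc z‖ ≤ 1 / (2 * (|B| + 1)) := hlt.le.trans (min_le_right _ _)
        calc ‖f z‖ * ‖qc z‖ ≤ (|B| + 1) * (1 / (2 * (|B| + 1))) := by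
              gcongr; linarith [le_abs_self B]
          _ = 1 / 2 := by field_simp
      linarith
    rw [norm_qc] at h1
    have h2 := Real.log_le_log hρ0 h1
    rw [Real.log_exp] at h2
    rw [hY, le_div_iff₀ (by positivity)]
    linarith
  refine ⟨{τ | (τ : ℂ) ∈ Set.Icc (-1 : ℝ) 1 ×ℂ Set.Icc δ Y}, ?_, fun τ hτ => ?_⟩
  · rw [UpperHalfPlane.isOpenEmbedding_coe.isInducing.isCompact_iff]
    convert (isCompact_Icc (a := (-1 : ℝ)) (b := 1)).reProdIm (isCompact_Icc (a := δ) (b := Y))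
    ext z
    constructor
    · rintro ⟨τ, hτ, rfl⟩; exact hτ
    · intro hz
      exact ⟨⟨z, hδ.trans_le hz.2.1⟩, hz, rfl⟩
  · obtain ⟨w, hw, h⟩ := exists_im_ge hM τ
    refine ⟨upper 1 ((-⌊(w • τ).re⌋ : ℤ) : ℝ) 1 * w, mul_mem (translate_mem_Gam M _) hw, ?_⟩
    have hre : (((upper 1 ((-⌊(w • τ).re⌋ : ℤ) : ℝ) 1 * w) • τ : ℍ) : ℂ) =
        ((w • τ : ℍ) : ℂ) - (⌊(w • τ).re⌋ : ℝ) := by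
      rw [mul_smul, upper_smul (by norm_num)]; push_cast; ring
    have hb : (w • τ).im ≤ Y := key _ (w • τ).im_pos (by rwa [hf.inv w hw])
    have h1 := Int.floor_le (w • τ).re
    have h2 := Int.lt_floor_add_one (w • τ).re
    rw [Set.mem_ofPred_eq, Complex.mem_reProdIm, hre, Complex.sub_re, Complex.sub_im,
      Complex.ofReal_re, Complex.ofReal_im, sub_zero]
    change (w • τ).re - _ ∈ _ ∧ (w • τ).im ∈ _
    exact ⟨⟨by linarith, by linarith⟩, h, hb⟩

theorem IsHaupt.countable_crit {M : ℕ} [NeZero M] (hM : Squarefree M) {f : ℂ → ℂ}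
    (hf : IsHaupt M f) : {z : ℂ | 0 < z.im ∧ deriv f z = 0}.Countable := by
  have hop : IsOpen {z : ℂ | 0 < z.im} := isOpen_lt continuous_const Complex.continuous_im
  have hpre : IsPreconnected {z : ℂ | 0 < z.im} := (convex_halfSpace_im_gt 0).isPreconnected
  have han : AnalyticOnNhd ℂ f {z | 0 < z.im} := fun z hz => hf.analyticAt ⟨z, hz⟩
  obtain ⟨x, hx, hx0⟩ : ∃ x : ℂ, 0 < x.im ∧ deriv f x ≠ 0 := by
    by_contra! hz
    apply hf.not_const hM UpperHalfPlane.I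
    filter_upwards [hop.mem_nhds UpperHalfPlane.I.im_pos] with z hz'
    exact hop.is_const_of_deriv_eq_zero hpre hf.hol hz hz' UpperHalfPlane.I.im_pos
  have h1 := han.deriv.preimage_zero_mem_codiscreteWithin hx0 hx ⟨⟨_, hx⟩, hpre⟩
  apply (HereditarilyLindelofSpace.isLindelof _).countable_of_isDiscrete
  refine (isDiscrete_of_codiscreteWithin (s := deriv f ⁻¹' {0}) (U := {z | 0 < z.im})
    (by simpa using h1)).mono ?_
  rintro z ⟨hz, hz'⟩
  simp [hz, hz']

theorem exists_injOn_nhds {f : ℂ → ℂ} {z : ℂ} (hf : AnalyticAt ℂ f z) (h : deriv f z ≠ 0) :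
    ∃ U ∈ 𝓝 z, Set.InjOn f U := by
  have := hf.hasStrictDerivAt.hasStrictFDerivAt_equiv h
  exact ⟨_, this.toOpenPartialHomeomorph.open_source.mem_nhds
    this.mem_toOpenPartialHomeomorph_source, this.toOpenPartialHomeomorph.injOn⟩

theorem IsHaupt.closure_inequiv {M : ℕ} [NeZero M] (hM : Squarefree M) {f : ℂ → ℂ}
    (hf : IsHaupt M f) {x : ℂ} (hx : x ∈ closure
      {x | ∃ τ₀ τ₁ : ℍ, f τ₀ = x ∧ f τ₁ = x ∧ ∀ g ∈ Gam M, g • τ₀ ≠ τ₁})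
    (hxC : ∀ z : ℂ, 0 < z.im → deriv f z = 0 → f z ≠ x) :
    ∃ τ₀ τ₁ : ℍ, f τ₀ = x ∧ f τ₁ = x ∧ ∀ g ∈ Gam M, g • τ₀ ≠ τ₁ := by
  obtain ⟨u, hu, hux⟩ := mem_closure_iff_seq_limit.1 hx
  obtain ⟨B, hB⟩ := (Metric.isBounded_range_of_tendsto u hux).exists_norm_le
  obtain ⟨K, hK, hKred⟩ := hf.exists_reduced hM B
  have hpair : ∀ k, ∃ p : ℍ × ℍ, p ∈ K ×ˢ K ∧ f p.1 = u k ∧ f p.2 = u k ∧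
      ∀ g ∈ Gam M, g • p.1 ≠ p.2 := by
    intro k
    obtain ⟨a, b, ha, hb, hab⟩ := hu k
    have hBk := hB (u k) ⟨k, rfl⟩
    obtain ⟨v, hv, hva⟩ := hKred a (by rwa [ha])
    obtain ⟨w, hw, hwb⟩ := hKred b (by rwa [hb])
    refine ⟨(v • a, w • b), ⟨hva, hwb⟩, by rw [hf.inv v hv, ha], by rw [hf.inv w hw, hb], ?_⟩
    intro g hg h
    refine hab (w⁻¹ * (g * v)) (mul_mem (inv_mem hw) (mul_mem hg hv)) ?_
    rw [mul_smul, inv_smul_eq_iff, mul_smul]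
    exact h
  choose p hpK hp0 hp1 hpne using hpair
  obtain ⟨⟨a, b⟩, -, φ, hφ, hlim⟩ := (hK.prod hK).tendsto_subseq hpK
  have ha : Tendsto (fun k => (p (φ k)).1) atTop (𝓝 a) := (continuous_fst.tendsto _).comp hlim
  have hb : Tendsto (fun k => (p (φ k)).2) atTop (𝓝 b) := (continuous_snd.tendsto _).comp hlim
  have hcf : ∀ τ : ℍ, ContinuousAt (fun σ : ℍ => f σ) τ := fun τ =>
    ContinuousAt.comp (hf.analyticAt τ).continuousAt UpperHalfPlane.continuous_coe.continuousAt
  have huφ := hux.comp hφ.tendsto_atTop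
  have hfa : f a = x := by
    refine tendsto_nhds_unique ((hcf a).tendsto.comp ha) (huφ.congr fun k => ?_)
    exact (hp0 _).symm
  have hfb : f b = x := by
    refine tendsto_nhds_unique ((hcf b).tendsto.comp hb) (huφ.congr fun k => ?_)
    exact (hp1 _).symm
  refine ⟨a, b, hfa, hfb, fun g hg hgab => ?_⟩
  obtain ⟨U, hU, hinj⟩ := exists_injOn_nhds (hf.analyticAt a) fun h0 => hxC a a.im_pos h0 hfa
  have hU' : ∀ᶠ σ : ℍ in 𝓝 a, (σ : ℂ) ∈ U :=
    UpperHalfPlane.continuous_coe.continuousAt.eventually_mem hU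
  have hb' : Tendsto (fun k => g⁻¹ • (p (φ k)).2) atTop (𝓝 a) := by
    have := hb.const_smul g⁻¹
    rwa [← hgab, inv_smul_smul] at this
  obtain ⟨k, hk1, hk2⟩ := ((ha.eventually hU').and (hb'.eventually hU')).exists
  refine hpne (φ k) g hg ?_
  have := hinj hk1 hk2 (by rw [hf.inv _ (inv_mem hg), hp0, hp1])
  rw [UpperHalfPlane.ext this, smul_inv_smul]

theorem IsHaupt.isOpen_inequiv {M : ℕ} [NeZero M] (hM : Squarefree M) {f : ℂ → ℂ}
    (hf : IsHaupt M f) :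
    IsOpen {x | ∃ τ₀ τ₁ : ℍ, f τ₀ = x ∧ f τ₁ = x ∧ ∀ g ∈ Gam M, g • τ₀ ≠ τ₁} := by
  rw [isOpen_iff_mem_nhds]
  rintro x ⟨τ₀, τ₁, rfl, h1, hne⟩
  have h2 : ∀ᶠ p : ℍ × ℍ in 𝓝 τ₀ ×ˢ 𝓝 τ₁, ∀ g ∈ Gam M, g • p.1 ≠ p.2 := by
    rw [← nhds_prod_eq]
    filter_upwards [eventually_smul_eq (M := M) one_pos τ₀ τ₁] with p hp g hg hgp
    exact hne g hg (hp g (mem_Gam.1 hg) hgp)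
  obtain ⟨U₀, hU₀, U₁, hU₁, hU⟩ := mem_prod_iff.1 h2
  have i0 := hf.nhds_le hM τ₀ (image_mem_map hU₀)
  have i1 := hf.nhds_le hM τ₁ (image_mem_map hU₁)
  rw [h1] at i1
  filter_upwards [i0, i1]
  rintro y ⟨σ₀, hσ₀, h0⟩ ⟨σ₁, hσ₁, h1⟩
  exact ⟨σ₀, σ₁, h0, h1, hU (Set.mk_mem_prod hσ₀ hσ₁)⟩

/-- A hauptmodul separates orbits. -/
theorem IsHaupt.injective {M : ℕ} [NeZero M] (hM : Squarefree M) {f : ℂ → ℂ}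
    (hf : IsHaupt M f) {τ₀ τ₁ : ℍ} (h : f τ₀ = f τ₁) : ∃ g ∈ Gam M, g • τ₀ = τ₁ := by
  set W : Set ℂ := {x | ∃ τ₀ τ₁ : ℍ, f τ₀ = x ∧ f τ₁ = x ∧ ∀ g ∈ Gam M, g • τ₀ ≠ τ₁} with hW
  set Z : Set ℂ := {z : ℂ | 0 < z.im ∧ deriv f z = 0} with hZ
  set C : Set ℂ := f '' Z with hC
  have hCc : C.Countable := (hf.countable_crit hM).image f
  have hWo : IsOpen W := hf.isOpen_inequiv hM
  have hWcl : ∀ x ∈ closure W, x ∉ C → x ∈ W := fun x hx hxC =>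
    hf.closure_inequiv hM hx fun z hz hz' hfz => hxC ⟨z, ⟨hz, hz'⟩, hfz⟩
  have hsub : W ⊆ C := by
    by_contra hnot
    rw [Set.not_subset] at hnot
    obtain ⟨x, hxW, hxC⟩ := hnot
    have hconn : IsConnected Cᶜ := hCc.isConnected_compl_of_one_lt_rank (by simp)
    have : Cᶜ ⊆ W := hconn.isPreconnected.subset_of_closure_inter_subset hWo ⟨x, hxC, hxW⟩
      fun y hy => hWcl y hy.1 hy.2
    obtain ⟨R, hR⟩ := hf.exists_equiv_of_large hM
    have hop : IsOpen {y : ℂ | R < ‖y‖} := isOpen_lt continuous_const continuous_norm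
    obtain ⟨y, hy, hyC⟩ : ∃ y : ℂ, R < ‖y‖ ∧ y ∉ C := by
      have hd : Dense Cᶜ := hCc.dense_compl ℝ
      obtain ⟨y, hy1, hy2⟩ := hd.inter_open_nonempty _ hop ⟨((|R| + 1 : ℝ) : ℂ), by
        simp only [Set.mem_ofPred_eq, Complex.norm_real, Real.norm_eq_abs]
        rw [abs_of_pos (by positivity)]
        linarith [le_abs_self R]⟩
      exact ⟨y, hy1, hy2⟩
    obtain ⟨σ₀, σ₁, rfl, h1, hne⟩ := this hyC
    obtain ⟨g, hg, hgs⟩ := hR σ₀ σ₁ h1.symm hy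
    exact hne g hg hgs
  by_contra! hne
  have hmem : f τ₀ ∈ W := ⟨τ₀, τ₁, rfl, h.symm, hne⟩
  have hd : Dense Cᶜ := hCc.dense_compl ℝ
  obtain ⟨y, hy1, hy2⟩ := hd.inter_open_nonempty _ hWo ⟨_, hmem⟩
  exact hy2 (hsub hy1)

/-! ### Ramification -/

theorem coe_smul_moebius (g : SL2R) (τ : ℍ) : ((g • τ : ℍ) : ℂ) = moebius g τ := coe_smul_eq g τ

theorem moebius_analyticAt (g : SL2R) (τ : ℍ) : AnalyticAt ℂ (moebius g) τ := by
  have h := jf_ne_zero g τ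
  unfold jf at h
  unfold moebius
  fun_prop (disch := exact h)

theorem hasDerivAt_moebius (g : SL2R) (τ : ℍ) :
    HasDerivAt (moebius g) (jf g τ ^ 2)⁻¹ τ := by
  have h := jf_ne_zero g τ
  have hd : (g.1 0 0 : ℂ) * g.1 1 1 - g.1 0 1 * g.1 1 0 = 1 := by exact_mod_cast det_eq g
  have h1 : HasDerivAt (fun z : ℂ => (g.1 0 0 : ℂ) * z + g.1 0 1) (g.1 0 0 : ℂ) τ := by
    simpa using ((hasDerivAt_id (τ : ℂ)).const_mul (g.1 0 0 : ℂ)).add_const (g.1 0 1 : ℂ)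
  have h2 : HasDerivAt (fun z : ℂ => (g.1 1 0 : ℂ) * z + g.1 1 1) (g.1 1 0 : ℂ) τ := by
    simpa using ((hasDerivAt_id (τ : ℂ)).const_mul (g.1 1 0 : ℂ)).add_const (g.1 1 1 : ℂ)
  have h3 := h1.fun_div h2 h
  unfold moebius
  refine h3.congr_deriv ?_
  unfold jf at h ⊢
  field_simp
  linear_combination hd

theorem eventually_im_pos (τ : ℍ) : ∀ᶠ z : ℂ in 𝓝 (τ : ℂ), 0 < z.im :=
  (isOpen_lt continuous_const Complex.continuous_im).mem_nhds τ.im_pos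

/-- Order of the difference of a function and its translate by a map fixing the point. -/
theorem analyticOrderAt_sub_comp {F κ : ℂ → ℂ} {z₀ u : ℂ} {o : ℕ} (hF : AnalyticAt ℂ F z₀)
    (hκ : AnalyticAt ℂ κ z₀) (hfix : κ z₀ = z₀) (hu : HasDerivAt κ u z₀)
    (ho : analyticOrderAt (fun z => F z - F z₀) z₀ = o) (huo : u ^ o ≠ 1) :
    analyticOrderAt (fun z => F z - F (κ z)) z₀ = o := by
  have hFκ : AnalyticAt ℂ (fun z => F (κ z)) z₀ :=
    AnalyticAt.fun_comp (by rwa [hfix]) hκ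
  obtain ⟨C, hC, hC0, hCe⟩ := ((hF.sub analyticAt_const).analyticOrderAt_eq_natCast).1 ho
  have hκc : Tendsto κ (𝓝 z₀) (𝓝 z₀) := by
    have := hκ.continuousAt.tendsto; rwa [hfix] at this
  have hv : AnalyticAt ℂ (dslope κ z₀) z₀ := by
    obtain ⟨s, hs, hs'⟩ := hκ.exists_mem_nhds_analyticOnNhd
    have hd : DifferentiableOn ℂ κ s := hs'.differentiableOn
    exact ((Complex.differentiableOn_dslope hs).2 hd).analyticAt hs
  refine ((hF.sub hFκ).analyticOrderAt_eq_natCast).2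
    ⟨fun z => C z - C (κ z) * dslope κ z₀ z ^ o, ?_, ?_, ?_⟩
  · exact hC.sub ((AnalyticAt.fun_comp (by rwa [hfix]) hκ).mul (hv.pow _))
  · simp only [hfix, dslope_same, hu.deriv]
    rw [show C z₀ - C z₀ * u ^ o = C z₀ * (1 - u ^ o) by ring]
    exact mul_ne_zero hC0 (sub_ne_zero.2 huo.symm)
  · filter_upwards [hCe, hκc.eventually hCe] with z h1 h2
    have h3 := sub_smul_dslope κ z₀ z
    rw [hfix, smul_eq_mul] at h3
    simp only [smul_eq_mul, Pi.sub_apply] at h1 h2 ⊢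
    rw [← h3, mul_pow] at h2
    linear_combination h1 - h2

/-- The ramification index at a point. -/
noncomputable def ram (f : ℂ → ℂ) (τ : ℍ) : ℕ := analyticOrderNatAt (fun z => f z - f τ) τ

theorem IsHaupt.order_eq_ram {M : ℕ} [NeZero M] (hM : Squarefree M) {f : ℂ → ℂ}
    (hf : IsHaupt M f) (τ : ℍ) : analyticOrderAt (fun z => f z - f τ) τ = ram f τ := by
  refine (Nat.cast_analyticOrderNatAt ?_).symm
  rw [Ne, analyticOrderAt_eq_top]
  intro h
  exact hf.not_const hM τ (h.mono fun z hz => sub_eq_zero.1 hz)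

theorem IsHaupt.ram_pos {M : ℕ} [NeZero M] (hM : Squarefree M) {f : ℂ → ℂ}
    (hf : IsHaupt M f) (τ : ℍ) : 0 < ram f τ := by
  rw [Nat.pos_iff_ne_zero]
  intro h0
  have h := hf.order_eq_ram hM τ
  rw [h0, Nat.cast_zero, analyticOrderAt_eq_zero] at h
  rcases h with h | h
  · exact h ((hf.analyticAt τ).sub analyticAt_const)
  · simp at h

theorem IsHaupt.jf_pow {M : ℕ} [NeZero M] (hM : Squarefree M) {f : ℂ → ℂ}
    (hf : IsHaupt M f) {τ : ℍ} {g : SL2R} (hg : g ∈ Gam M) (hfix : g • τ = τ) :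
    jf g τ ^ (2 * ram f τ) = 1 := by
  by_contra hne
  have h := analyticOrderAt_sub_comp (hf.analyticAt τ) (moebius_analyticAt g τ)
    (by rw [← coe_smul_moebius, hfix]) (hasDerivAt_moebius g τ) (hf.order_eq_ram hM τ)
    (by rwa [inv_pow, ← pow_mul, Ne, inv_eq_one])
  have h2 : analyticOrderAt (fun z => f z - f (moebius g z)) τ = ⊤ := by
    rw [analyticOrderAt_eq_top]
    filter_upwards [eventually_im_pos τ] with z hz
    have := hf.inv g hg ⟨z, hz⟩
    rw [coe_smul_moebius] at this
    rw [this]; simp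
  rw [h2] at h
  simp at h

theorem stab_finite {M : ℕ} [NeZero M] (τ : ℍ) : {g : SL2R | g ∈ Gam M ∧ g • τ = τ}.Finite := by
  obtain ⟨C, hC⟩ := entries_bounded (R := ‖(τ : ℂ)‖) τ.im_pos
  refine (heckeSet_finite (M := M) one_pos C).subset ?_
  rintro g ⟨hg, h⟩
  exact ⟨hg, hC g τ le_rfl le_rfl (by rw [h]) (by rw [h])⟩

/-- Local normal form of a nonconstant analytic function. -/
theorem exists_normal_form {F : ℂ → ℂ} {z₀ : ℂ} {o : ℕ} (hF : AnalyticAt ℂ F z₀) (ho : o ≠ 0)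
    (h : analyticOrderAt F z₀ = o) : ∃ (C : ℂ) (φ : ℂ → ℂ), C ≠ 0 ∧ AnalyticAt ℂ φ z₀ ∧
      φ z₀ = 0 ∧ HasDerivAt φ 1 z₀ ∧ ∀ᶠ z in 𝓝 z₀, F z = C * φ z ^ o := by
  obtain ⟨K, hK, hK0, hKe⟩ := (hF.analyticOrderAt_eq_natCast).1 h
  set ψ : ℂ → ℂ := fun z => (K z / K z₀) ^ (1 / (o : ℂ)) with hψ
  have hψa : AnalyticAt ℂ ψ z₀ := by
    refine AnalyticAt.cpow (hK.div analyticAt_const hK0) analyticAt_const ?_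
    simp [div_self hK0]
  have hψ0 : ψ z₀ = 1 := by simp [hψ, div_self hK0]
  refine ⟨K z₀, fun z => (z - z₀) * ψ z, hK0, (analyticAt_id.sub analyticAt_const).mul hψa,
    by simp, ?_, ?_⟩
  · have := ((hasDerivAt_id' z₀).sub_const z₀).fun_mul hψa.differentiableAt.hasDerivAt
    exact this.congr_deriv (by simp [hψ0])
  · filter_upwards [hKe] with z hz
    have hp : ψ z ^ o = K z / K z₀ := by
      rw [hψ]
      simp only [one_div]
      exact Complex.cpow_nat_inv_pow _ ho
    rw [hz, mul_pow, hp, smul_eq_mul]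
    field_simp

theorem IsHaupt.exists_stab {M : ℕ} [NeZero M] (hM : Squarefree M) {f : ℂ → ℂ}
    (hf : IsHaupt M f) {τ : ℍ} {ω : ℂ} (hω : ω ^ ram f τ = 1) :
    ∃ g ∈ Gam M, g • τ = τ ∧ (jf g τ ^ 2)⁻¹ = ω := by
  have hr0 := (hf.ram_pos hM τ).ne'
  have hω0 : ω ≠ 0 := by rintro rfl; simp [hr0] at hω
  obtain ⟨C, φ, hC, hφ, hφ0, hφ', hfφ⟩ := exists_normal_form
    ((hf.analyticAt τ).sub analyticAt_const) hr0 (hf.order_eq_ram hM τ)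
  have hop : 𝓝 (φ τ) ≤ map φ (𝓝 (τ : ℂ)) := by
    refine hφ.eventually_constant_or_nhds_le_map_nhds.resolve_left fun hc => ?_
    have h1 : HasDerivAt φ 0 τ := (hasDerivAt_const (τ : ℂ) (φ τ)).congr_of_eventuallyEq hc
    exact one_ne_zero (hφ'.unique h1)
  have hsep : ∀ᶠ p : ℍ × ℍ in 𝓝 τ ×ˢ 𝓝 τ, ∀ g ∈ heckeSet M 1, g • p.1 = p.2 → g • τ = τ := by
    rw [← nhds_prod_eq]; exact eventually_smul_eq one_pos τ τ
  obtain ⟨U₀, hU₀, U₁, hU₁, hU⟩ := mem_prod_iff.1 hsep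
  have hcoe := UpperHalfPlane.isOpenEmbedding_coe.map_nhds_eq τ
  have hV₀ : (fun σ : ℍ => (σ : ℂ)) '' U₀ ∈ 𝓝 (τ : ℂ) := by
    rw [← hcoe]; exact image_mem_map hU₀
  have hV₁ : (fun σ : ℍ => (σ : ℂ)) '' U₁ ∩ {z | f z - f τ = C * φ z ^ ram f τ} ∈ 𝓝 (τ : ℂ) := by
    refine inter_mem ?_ hfφ
    rw [← hcoe]; exact image_mem_map hU₁
  have himg : ∀ᶠ z in 𝓝 (τ : ℂ), ω * φ z ∈ φ '' ((fun σ : ℍ => (σ : ℂ)) '' U₁ ∩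
      {z | f z - f τ = C * φ z ^ ram f τ}) := by
    have hc : Tendsto (fun z => ω * φ z) (𝓝 (τ : ℂ)) (𝓝 (φ τ)) := by
      have := (hφ.continuousAt.tendsto).const_mul ω
      rwa [hφ0, mul_zero, ← hφ0] at this
    exact hc.eventually (hop (image_mem_map hV₁))
  have hex : ∀ᶠ z in 𝓝 (τ : ℂ), ∃ g ∈ {g : SL2R | g ∈ Gam M ∧ g • τ = τ},
      φ (moebius g z) = ω * φ z := by
    filter_upwards [hV₀, himg, hfφ]
    rintro z ⟨σ₀, hσ₀, rfl⟩ ⟨z₁, ⟨⟨σ₁, hσ₁, rfl⟩, h1⟩, h2⟩ h3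
    have : f σ₀ = f σ₁ := by
      simp only [Set.mem_ofPred_eq] at h1 h3
      rw [h2, mul_pow, hω, one_mul, ← h3] at h1
      simpa using h1.symm
    obtain ⟨g, hg, hgs⟩ := hf.injective hM this
    refine ⟨g, ⟨hg, hU (Set.mk_mem_prod hσ₀ hσ₁) g (mem_Gam.1 hg) hgs⟩, ?_⟩
    rw [← coe_smul_moebius, hgs, h2]
  obtain ⟨g, ⟨hg, hfix⟩, hgφ⟩ : ∃ g ∈ {g : SL2R | g ∈ Gam M ∧ g • τ = τ},
      ∃ᶠ z in 𝓝[≠] (τ : ℂ), φ (moebius g z) = ω * φ z := by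
    by_contra! hcon
    have h1 : ∀ᶠ z in 𝓝[≠] (τ : ℂ), ∀ g ∈ {g : SL2R | g ∈ Gam M ∧ g • τ = τ},
        ¬ φ (moebius g z) = ω * φ z := by
      rw [eventually_all_finite (stab_finite τ)]
      intro g hg
      exact hcon g hg
    obtain ⟨z, hz1, g, hg, hz2⟩ := (h1.and (hex.filter_mono nhdsWithin_le_nhds)).exists
    exact hz1 g hg hz2
  refine ⟨g, hg, hfix, ?_⟩
  have hmfix : moebius g τ = τ := by rw [← coe_smul_moebius, hfix]
  have hφ2 : HasDerivAt φ 1 (moebius g τ) := by rwa [hmfix]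
  have hφa2 : AnalyticAt ℂ φ (moebius g τ) := by rwa [hmfix]
  have hev := ((hφa2.fun_comp (moebius_analyticAt g τ)).frequently_eq_iff_eventually_eq
    (analyticAt_const.mul hφ)).1 hgφ
  have d1 := hφ2.comp (τ : ℂ) (hasDerivAt_moebius g τ)
  have d2 := (hφ'.const_mul ω).congr_of_eventuallyEq hev
  have := d1.unique d2
  simpa using this

theorem neg_smul_eq (g : SL2R) (τ : ℍ) : (-g) • τ = g • τ := by
  apply UpperHalfPlane.ext
  rw [coe_smul_eq, coe_smul_eq]
  simp only [neg_entry]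
  push_cast
  rw [← neg_div_neg_eq]
  ring_nf

theorem jf_neg (g : SL2R) (τ : ℂ) : jf (-g) τ = -jf g τ := by
  unfold jf
  rw [neg_entry, neg_entry]
  push_cast
  ring

theorem IsHaupt.mem_Gam_of_jf_pow {M : ℕ} [NeZero M] (hM : Squarefree M) {f : ℂ → ℂ}
    (hf : IsHaupt M f) {τ : ℍ} {κ : SL2R} (hfix : κ • τ = τ)
    (hκ : (jf κ τ ^ 2)⁻¹ ^ ram f τ = 1) : κ ∈ Gam M := by
  obtain ⟨g, hg, hgfix, hj⟩ := hf.exists_stab hM hκ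
  have h2 : jf g τ ^ 2 = jf κ τ ^ 2 := inv_injective hj
  rcases sq_eq_sq_iff_eq_or_eq_neg.1 h2 with h | h
  · rw [← smul_eq_smul_jf (hgfix.trans hfix.symm) h]; exact hg
  · have h3 : jf (-g) τ = jf κ τ := by
      rw [jf_neg, h, neg_neg]
    have h4 : (-g) • τ = κ • τ := by
      rw [hfix, neg_smul_eq, hgfix]
    rw [← smul_eq_smul_jf h4 h3]; exact neg_mem_Gam hg

/-- The order of the stabilizer of a point is twice the ramification index. -/
theorem IsHaupt.card_stab {M : ℕ} [NeZero M] (hM : Squarefree M) {f : ℂ → ℂ}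
    (hf : IsHaupt M f) (τ : ℍ) :
    Nat.card {g : SL2R // g ∈ Gam M ∧ g • τ = τ} = 2 * ram f τ := by
  have hr := hf.ram_pos hM τ
  have : NeZero (2 * ram f τ) := ⟨by omega⟩
  rw [← Complex.card_rootsOfUnity (2 * ram f τ)]
  refine Nat.card_congr (Equiv.ofBijective (fun g => rootsOfUnity.mkOfPowEq (jf g.1 τ)
    (hf.jf_pow hM g.2.1 g.2.2)) ⟨?_, ?_⟩)
  · intro g g' h
    have h2 : jf g.1 τ = jf g'.1 τ := by
      simpa using congrArg (fun u : rootsOfUnity (2 * ram f τ) ℂ => ((u : ℂˣ) : ℂ)) h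
    exact Subtype.ext (smul_eq_smul_jf (g.2.2.trans g'.2.2.symm) h2)
  · intro u
    have hu : ((u : ℂˣ) : ℂ) ^ (2 * ram f τ) = 1 := by
      simpa using congrArg Units.val ((_root_.mem_rootsOfUnity _ _).1 u.2)
    obtain ⟨κ, hmem, hκ, hj⟩ : ∃ κ ∈ Gam M, κ • τ = τ ∧ jf κ τ = ((u : ℂˣ) : ℂ) := by
      obtain ⟨g, hg, hgfix, hj⟩ := hf.exists_stab hM (τ := τ) (ω := (((u : ℂˣ) : ℂ) ^ 2)⁻¹)
        (by rw [inv_pow, ← pow_mul, hu, inv_one])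
      rcases sq_eq_sq_iff_eq_or_eq_neg.1 (inv_injective hj) with h | h
      · exact ⟨g, hg, hgfix, h⟩
      · exact ⟨-g, neg_mem_Gam hg, by rw [neg_smul_eq, hgfix], by rw [jf_neg, h, neg_neg]⟩
    refine ⟨⟨κ, hmem, hκ⟩, ?_⟩
    apply Subtype.ext
    apply Units.ext
    simpa using hj

theorem IsHaupt.order_sub_smul {M : ℕ} [NeZero M] (hM : Squarefree M) {f : ℂ → ℂ}
    (hf : IsHaupt M f) (g₁ g₂ : SL2R) (hne : g₂ * g₁⁻¹ ∉ Gam M) (τ : ℍ) :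
    ∃ k : ℕ, analyticOrderAt (fun z => f (moebius g₁ z) - f (moebius g₂ z)) τ = k ∧
      2 * k = Nat.card {w : SL2R // w ∈ Gam M ∧ w • g₁ • τ = g₂ • τ} := by
  have hmm : ∀ (g h : SL2R) (z : ℂ), 0 < z.im → moebius g (moebius h z) = moebius (g * h) z :=
    fun g h z hz => by
      have := coe_smul_moebius (g * h) ⟨z, hz⟩
      rw [mul_smul, coe_smul_moebius, coe_smul_moebius] at this
      exact this
  have han : ∀ g : SL2R, AnalyticAt ℂ (fun z => f (moebius g z)) τ := fun g =>
    AnalyticAt.fun_comp (by rw [← coe_smul_moebius]; exact hf.analyticAt _) (moebius_analyticAt g τ)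
  by_cases hex : ∃ w ∈ Gam M, w • g₁ • τ = g₂ • τ
  · obtain ⟨w, hw, hwτ⟩ := hex
    set σ : ℍ := g₁ • τ with hσ
    set κ : SL2R := w⁻¹ * (g₂ * g₁⁻¹) with hκ
    have hκσ : κ • σ = σ := by
      rw [hκ, mul_smul, mul_smul, hσ, inv_smul_smul, inv_smul_eq_iff, hwτ]
    have hord : analyticOrderAt (fun z => f z - f (moebius κ z)) σ = ram f σ := by
      refine analyticOrderAt_sub_comp (hf.analyticAt σ) (moebius_analyticAt κ σ)
        (by rw [← coe_smul_moebius, hκσ]) (hasDerivAt_moebius κ σ) (hf.order_eq_ram hM σ) ?_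
      intro h
      have := hf.mem_Gam_of_jf_pow hM hκσ h
      apply hne
      have h2 := mul_mem hw this
      rwa [hκ, mul_inv_cancel_left] at h2
    refine ⟨ram f σ, ?_, ?_⟩
    · rw [← hord]
      have hd : deriv (moebius g₁) τ ≠ 0 := by
        rw [(hasDerivAt_moebius g₁ τ).deriv]
        exact inv_ne_zero (pow_ne_zero _ (jf_ne_zero g₁ τ))
      have h1 := analyticOrderAt_comp_of_deriv_ne_zero (f := fun z => f z - f (moebius κ z))
        (moebius_analyticAt g₁ τ) hd
      rw [← coe_smul_moebius] at h1
      rw [← h1]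
      apply analyticOrderAt_congr
      filter_upwards [eventually_im_pos τ] with z hz
      simp only [Function.comp]
      rw [hmm _ _ _ hz, hκ, mul_assoc, mul_assoc, inv_mul_cancel, mul_one, ← hmm _ _ _ hz]
      congr 1
      have := hf.inv w⁻¹ (inv_mem hw) (g₂ • ⟨z, hz⟩)
      rw [coe_smul_moebius, coe_smul_moebius] at this
      exact this.symm
    · rw [← hf.card_stab hM σ]
      refine Nat.card_congr ⟨fun g => ⟨w * g.1, mul_mem hw g.2.1, ?_⟩,
        fun g => ⟨w⁻¹ * g.1, mul_mem (inv_mem hw) g.2.1, ?_⟩, fun g => ?_, fun g => ?_⟩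
      · rw [mul_smul, g.2.2, hwτ]
      · rw [mul_smul, g.2.2, ← hwτ, inv_smul_smul]
      · simp
      · simp
  · refine ⟨0, ?_, ?_⟩
    · rw [Nat.cast_zero, analyticOrderAt_eq_zero]
      right
      intro h0
      rw [sub_eq_zero, ← coe_smul_moebius, ← coe_smul_moebius] at h0
      exact hex (hf.injective hM h0)
    · have : IsEmpty {w : SL2R // w ∈ Gam M ∧ w • g₁ • τ = g₂ • τ} :=
        ⟨fun w => hex ⟨w.1, w.2⟩⟩
      simp

theorem IsHaupt.order_deriv {M : ℕ} [NeZero M] (hM : Squarefree M) {f : ℂ → ℂ}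
    (hf : IsHaupt M f) (τ : ℍ) : analyticOrderAt (deriv f) τ = (ram f τ - 1 : ℕ) := by
  have h1 := (hf.analyticAt τ).analyticOrderAt_deriv_add_one
  rw [hf.order_eq_ram hM τ] at h1
  have hr := hf.ram_pos hM τ
  obtain ⟨r, hr'⟩ : ∃ r, ram f τ = r + 1 := ⟨ram f τ - 1, by omega⟩
  rw [hr'] at h1 ⊢
  push_cast at h1
  simpa using h1

/-- The matrix of the dilation `τ ↦ s τ`. -/
noncomputable def dil (s : ℕ) : SL2R := upper s 0 1

theorem dil_entries {s : ℕ} (hs : 0 < s) : (dil s).1 0 0 = √s ∧ (dil s).1 0 1 = 0 ∧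
    (dil s).1 1 0 = 0 ∧ (dil s).1 1 1 = 1 / √s := by
  have h : (0 : ℝ) < s * 1 := by simpa using hs
  obtain ⟨h1, h2, h3, h4⟩ := upper_entries (b := 0) h
  refine ⟨by rw [dil, h1, mul_one, Real.div_sqrt], by rw [dil, h2]; simp, h3, by
    rw [dil, h4, mul_one]⟩

theorem dil_smul {s : ℕ} (hs : 0 < s) (τ : ℍ) : ((dil s • τ : ℍ) : ℂ) = s * τ := by
  rw [dil, upper_smul (by simpa using hs)]; simp

theorem jf_dil {s : ℕ} (hs : 0 < s) (τ : ℍ) : jf (dil s) τ = 1 / (√s : ℝ) := by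
  obtain ⟨-, -, h3, h4⟩ := dil_entries hs
  simp [jf, h3, h4]

theorem moebius_dil {s : ℕ} (hs : 0 < s) (z : ℂ) : moebius (dil s) z = s * z := by
  obtain ⟨h1, h2, h3, h4⟩ := dil_entries hs
  have h : ((√s : ℝ) : ℂ) * ((√s : ℝ) : ℂ) = s := by
    rw [← Complex.ofReal_mul, Real.mul_self_sqrt (by positivity)]; simp
  rw [moebius, h1, h2, h3, h4, ← h]
  simp
  ring

/-- Conjugating an Atkin–Lehner matrix of level `e M` by dilations. -/
theorem dil_conj {M E : ℕ} [NeZero M] {γ σ ε κ : ℕ} (hγ : 0 < γ) (hσ : 0 < σ) (hε : 0 < ε)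
    (hE : E ∣ M) {g : SL2R} {x y z w : ℤ}
    (h00 : g.1 0 0 * √((γ * ε * E : ℕ) : ℝ) = x * (γ * ε * E : ℕ))
    (h01 : g.1 0 1 * √((γ * ε * E : ℕ) : ℝ) = y)
    (h10 : g.1 1 0 * √((γ * ε * E : ℕ) : ℝ) = z * (γ * σ * ε * κ * M : ℕ))
    (h11 : g.1 1 1 * √((γ * ε * E : ℕ) : ℝ) = w * (γ * ε * E : ℕ)) :
    dil (γ * σ) * g * (dil (σ * ε))⁻¹ ∈ Gam M := by
  have hE0 : 0 < E := Nat.pos_of_dvd_of_pos hE (Nat.pos_of_neZero M)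
  obtain ⟨a1, a2, a3, a4⟩ := dil_entries (Nat.mul_pos hγ hσ)
  obtain ⟨b1, b2, b3, b4⟩ := dil_entries (Nat.mul_pos hσ hε)
  obtain ⟨i1, i2, i3, i4⟩ := inv_entries (dil (σ * ε))
  push_cast at h00 h01 h10 h11 a1 a4 b1 b4
  rw [Real.sqrt_mul (by positivity), Real.sqrt_mul (by positivity)] at h00 h01 h10 h11
  rw [Real.sqrt_mul (by positivity)] at a1 a4 b1 b4
  have q1 : √(γ : ℝ) ≠ 0 := by positivity
  have q2 : √(σ : ℝ) ≠ 0 := by positivity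
  have q3 : √(ε : ℝ) ≠ 0 := by positivity
  have q4 : √(E : ℝ) ≠ 0 := by positivity
  have s1 : √(γ : ℝ) ^ 2 = γ := Real.sq_sqrt (by positivity)
  have s2 : √(σ : ℝ) ^ 2 = σ := Real.sq_sqrt (by positivity)
  have s3 : √(ε : ℝ) ^ 2 = ε := Real.sq_sqrt (by positivity)
  have s4 : √(E : ℝ) ^ 2 = E := Real.sq_sqrt (by positivity)
  generalize √(γ : ℝ) = r₁ at *
  generalize √(σ : ℝ) = r₂ at *
  generalize √(ε : ℝ) = r₃ at *
  generalize hr₄ : √(E : ℝ) = r₄ at *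
  rw [← s1, ← s3, ← s4] at h00 h11
  rw [← s1, ← s2, ← s3] at h10
  have k00 : g.1 0 0 = x * r₁ * r₃ * r₄ := by
    field_simp at h00; linear_combination h00
  have k01 : g.1 0 1 = y / (r₁ * r₃ * r₄) := by
    field_simp; linear_combination h01
  have k10 : g.1 1 0 = z * (r₁ * r₂ ^ 2 * r₃ * κ * M) / r₄ := by
    field_simp; field_simp at h10; linear_combination h10
  have k11 : g.1 1 1 = w * r₁ * r₃ * r₄ := by
    field_simp at h11; linear_combination h11
  refine ⟨E, x * γ, y * σ, z * κ, w * ε, hE, ?_, ?_, ?_, ?_⟩ <;>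
    simp only [mul_entry, i1, i2, i3, i4, a1, a2, a3, a4, b1, b2, b3, b4, k00, k01, k10, k11] <;>
    push_cast <;> rw [mul_one, hr₄]
  · rw [← s1, ← s4]; field_simp; ring
  · rw [← s2]; field_simp; ring
  · field_simp; ring
  · rw [← s3, ← s4]; field_simp; ring

theorem exists_dil {M e : ℕ} [NeZero M] [NeZero (e * M)] (hN : Squarefree (e * M)) {g : SL2R}
    (hg : g ∈ Gam (e * M)) {s : ℕ} (hs : s ∣ e) : ∃ s', s' ∣ e ∧
      dil s * g * (dil s')⁻¹ ∈ Gam M ∧ dil (e / s) * g * (dil (e / s'))⁻¹ ∈ Gam M := by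
  obtain ⟨E, x, y, z, w, hE, h00, h01, h10, h11⟩ := hg
  rw [Nat.cast_one, mul_one] at h00 h01 h10 h11
  obtain ⟨he2, hM2, hcop⟩ : Squarefree e ∧ Squarefree M ∧ e.Coprime M :=
    ⟨hN.of_mul_left, hN.of_mul_right, Nat.coprime_of_squarefree_mul hN⟩
  have he0 : 0 < e := Nat.pos_of_ne_zero he2.ne_zero
  obtain ⟨E₁, E₂, hE₁, hE₂, rfl⟩ := Nat.dvd_mul.1 hE
  have hE₁2 : Squarefree E₁ := he2.squarefree_of_dvd hE₁
  obtain ⟨σ, hσ⟩ := Nat.gcd_dvd_left s E₁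
  obtain ⟨ε, hε⟩ := Nat.gcd_dvd_right s E₁
  set γ := Nat.gcd s E₁ with hγ
  have hs0 : 0 < s := Nat.pos_of_dvd_of_pos hs he0
  have hγ0 : 0 < γ := Nat.gcd_pos_of_pos_left _ hs0
  have hσ0 : 0 < σ := Nat.pos_of_ne_zero (by rintro rfl; omega)
  have hε0 : 0 < ε := Nat.pos_of_ne_zero (by rintro rfl; simp [hε] at hE₁2)
  have hcopr : s.Coprime ε := by
    have h1 : γ.Coprime ε := Nat.coprime_of_squarefree_mul (hε ▸ hE₁2)
    have h2 : Nat.gcd s ε ∣ γ := Nat.dvd_gcd (Nat.gcd_dvd_left _ _)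
      ((Nat.gcd_dvd_right s ε).trans (hε ▸ dvd_mul_left _ _))
    exact Nat.eq_one_of_dvd_coprimes h1 h2 (Nat.gcd_dvd_right _ _)
  obtain ⟨κ, hκ⟩ : s * ε ∣ e :=
    hcopr.mul_dvd_of_dvd_of_dvd hs ((hε ▸ dvd_mul_left _ _ : ε ∣ E₁).trans hE₁)
  have hκ0 : 0 < κ := Nat.pos_of_ne_zero (by rintro rfl; omega)
  have he' : e = γ * σ * ε * κ := by rw [← hσ]; exact hκ
  have d1 : e / s = ε * κ := Nat.div_eq_of_eq_mul_right hs0 (by rw [hκ]; ring)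
  have d2 : e / (σ * ε) = κ * γ :=
    Nat.div_eq_of_eq_mul_right (by positivity) (by rw [he']; ring)
  refine ⟨σ * ε, ⟨κ * γ, by rw [he']; ring⟩, ?_, ?_⟩
  · rw [hσ]
    rw [hε] at h00 h01 h10 h11
    rw [he'] at h10
    exact dil_conj hγ0 hσ0 hε0 hE₂ h00 h01 h10 h11
  · rw [d1, d2]
    have e1 : E₁ * E₂ = ε * γ * E₂ := by rw [hε]; ring
    rw [e1] at h00 h01 h10 h11
    rw [show e = ε * κ * γ * σ by rw [he']; ring] at h10
    exact dil_conj hε0 hκ0 hγ0 hE₂ h00 h01 h10 h11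

theorem dil_injective {M s t : ℕ} [NeZero M] (hs : 0 < s) (ht : 0 < t)
    (h : dil s * (dil t)⁻¹ ∈ Gam M) : s = t := by
  obtain ⟨a1, a2, a3, a4⟩ := dil_entries hs
  obtain ⟨b1, b2, b3, b4⟩ := dil_entries ht
  obtain ⟨i1, i2, i3, i4⟩ := inv_entries (dil t)
  have e11 : (dil s * (dil t)⁻¹).1 1 1 = 1 / √s * √t := by
    simp only [mul_entry, i1, i2, i3, i4, a1, a2, a3, a4, b1, b2, b3, b4]; ring
  have hst : 0 < √(s : ℝ) := by positivity
  obtain ⟨k, hk⟩ := Gam_upper h (by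
    simp only [mul_entry, i1, i2, i3, i4, a1, a2, a3, a4, b1, b2, b3, b4]; ring)
    (by rw [e11]; positivity)
  have := (upper_entries (a := 1) (d := 1) (b := k) (by norm_num)).2.2.2
  rw [← hk, e11] at this
  simp at this
  field_simp at this
  have h2 := (Real.sqrt_inj (by positivity) (by positivity)).1 this
  exact_mod_cast h2.symm

theorem prod_dil_invariant {M e : ℕ} [NeZero M] [NeZero (e * M)] (hN : Squarefree (e * M))
    {g : SL2R} (hg : g ∈ Gam (e * M)) {R : Type*} [CommMonoid R] (Φ Φ' : ℕ → R)
    (h : ∀ s s', s ∣ e → s' ∣ e → dil s * g * (dil s')⁻¹ ∈ Gam M →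
      dil (e / s) * g * (dil (e / s'))⁻¹ ∈ Gam M → Φ s = Φ' s') :
    ∏ s ∈ e.divisors, Φ s = ∏ s ∈ e.divisors, Φ' s := by
  have he0 : e ≠ 0 := hN.of_mul_left.ne_zero
  choose! f hf1 hf2 hf3 using fun s (hs : s ∣ e) => exists_dil hN hg hs
  have hmap : ∀ s ∈ e.divisors, f s ∈ e.divisors := fun s hs =>
    Nat.mem_divisors.2 ⟨hf1 s (Nat.dvd_of_mem_divisors hs), he0⟩
  have hinj : Set.InjOn f e.divisors := by
    intro s hs t ht hst
    have hs := Nat.dvd_of_mem_divisors hs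
    have ht := Nat.dvd_of_mem_divisors ht
    have h1 := (Gam M).mul_mem (hf2 s hs) ((Gam M).inv_mem (hf2 t ht))
    rw [hst] at h1
    refine dil_injective (M := M) (Nat.pos_of_dvd_of_pos hs (Nat.pos_of_ne_zero he0))
      (Nat.pos_of_dvd_of_pos ht (Nat.pos_of_ne_zero he0)) ?_
    convert h1 using 1
    group
  refine Finset.prod_nbij f hmap hinj (Finset.surjOn_of_injOn_of_card_le f hmap hinj le_rfl) ?_
  intro s hs
  have hs := Nat.dvd_of_mem_divisors hs
  exact h s (f s) hs (hf1 s hs) (hf2 s hs) (hf3 s hs)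

/-- The pair of correspondences `τ ↦ s τ` and `τ ↦ X (t τ)` coincides modulo `Γ₀*(M)`. -/
def Coincide (M s t : ℕ) [NeZero M] (X : SL2R) : Prop := X * dil t * (dil s)⁻¹ ∈ Gam M

theorem coincide_iff {M n s t : ℕ} [NeZero M] (hs : 0 < s) (ht : 0 < t)
    {i : Σ _ : ℕ × ℕ, ℕ} (hi : i ∈ repIdx M n) :
    Coincide M s t (repMat i) ↔ i.1.1 * t = s * i.1.2 ∧ i.2 = 0 := by
  obtain ⟨⟨a, d⟩, b⟩ := i
  simp only [repIdx, Finset.mem_sigma, mem_diagPairs (Nat.pos_of_neZero M), Finset.mem_range] at hi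
  obtain ⟨⟨ha, hd, -⟩, hb⟩ := hi
  have had : (0 : ℝ) < a * d := by positivity
  obtain ⟨a1, a2, a3, a4⟩ := dil_entries hs
  obtain ⟨b1, b2, b3, b4⟩ := dil_entries ht
  obtain ⟨c1, c2, c3, c4⟩ := upper_entries (b := b) had
  obtain ⟨i1, i2, i3, i4⟩ := inv_entries (dil s)
  have k00 : (repMat ⟨(a, d), b⟩ * dil t * (dil s)⁻¹).1 0 0 = a * √t / (√(a * d : ℝ) * √s) := by
    simp only [mul_entry, repMat, c1, c2, c3, c4, i1, i2, i3, i4, a1, a2, a3, a4, b1, b2, b3, b4]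
    ring
  have k01 : (repMat ⟨(a, d), b⟩ * dil t * (dil s)⁻¹).1 0 1 = b * √s / (√(a * d : ℝ) * √t) := by
    simp only [mul_entry, repMat, c1, c2, c3, c4, i1, i2, i3, i4, a1, a2, a3, a4, b1, b2, b3, b4]
    ring
  have k10 : (repMat ⟨(a, d), b⟩ * dil t * (dil s)⁻¹).1 1 0 = 0 := by
    simp only [mul_entry, repMat, c1, c2, c3, c4, i1, i2, i3, i4, a1, a2, a3, a4, b1, b2, b3, b4]
    ring
  have k11 : (repMat ⟨(a, d), b⟩ * dil t * (dil s)⁻¹).1 1 1 = d * √s / (√(a * d : ℝ) * √t) := by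
    simp only [mul_entry, repMat, c1, c2, c3, c4, i1, i2, i3, i4, a1, a2, a3, a4, b1, b2, b3, b4]
    ring
  have q0 : 0 < √(a * d : ℝ) := by positivity
  have q1 : 0 < √(s : ℝ) := by positivity
  have q2 : 0 < √(t : ℝ) := by positivity
  have s0 : √(a * d : ℝ) ^ 2 = a * d := Real.sq_sqrt had.le
  have s1 : √(s : ℝ) ^ 2 = s := Real.sq_sqrt (by positivity)
  have s2 : √(t : ℝ) ^ 2 = t := Real.sq_sqrt (by positivity)
  constructor
  · intro h
    obtain ⟨k, hk⟩ := Gam_upper h k10 (by rw [k11]; positivity)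
    obtain ⟨-, u2, -, u4⟩ := upper_entries (a := 1) (d := 1) (b := k) (by norm_num)
    rw [← hk] at u2 u4
    rw [k01] at u2
    rw [k11] at u4
    simp at u2 u4
    field_simp at u2 u4
    have e1 : (d : ℝ) * s = a * t := by
      have := congrArg (fun x => x ^ 2) u4
      simp only [mul_pow, s1, s2, Real.sq_sqrt (Nat.cast_nonneg a),
        Real.sq_sqrt (Nat.cast_nonneg d)] at this
      have hd' : (d : ℝ) ≠ 0 := by positivity
      apply mul_left_cancel₀ hd'
      linear_combination this
    have e2 : (b : ℝ) = d * k := by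
      apply mul_right_cancel₀ q1.ne'
      rw [u2]; linear_combination -(k : ℝ) * u4
    have e2' : (b : ℤ) = d * k := by exact_mod_cast e2
    refine ⟨by have : d * s = a * t := by exact_mod_cast e1
               linarith [mul_comm d s], ?_⟩
    have : (b : ℤ) = 0 := Int.eq_zero_of_dvd_of_nonneg_of_lt (by positivity)
      (by exact_mod_cast hb) ⟨k, e2'⟩
    exact_mod_cast this
  · rintro ⟨h1, h2⟩
    dsimp only at h1 h2
    subst h2
    have h1' : (a : ℝ) * t = s * d := by exact_mod_cast h1
    have e : √(a * d : ℝ) * √t = d * √s := by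
      rw [← Real.sqrt_mul had.le, show (a * d : ℝ) * t = d ^ 2 * s by linear_combination d * h1',
        Real.sqrt_mul (by positivity), Real.sqrt_sq (by positivity)]
    have e' : √(a * d : ℝ) * √s = a * √t := by
      rw [← Real.sqrt_mul had.le, show (a * d : ℝ) * s = a ^ 2 * t by linear_combination -a * h1',
        Real.sqrt_mul (by positivity), Real.sqrt_sq (by positivity)]
    have : repMat ⟨(a, d), 0⟩ * dil t * (dil s)⁻¹ = 1 := by
      obtain ⟨o1, o2, o3, o4⟩ := one_entries
      refine ext_entries ?_ ?_ ?_ ?_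
      · rw [k00, o1, e', div_self (by positivity)]
      · rw [k01, o2]; simp
      · rw [k10, o3]
      · rw [k11, o4, e, div_self (by positivity)]
    rw [Coincide, this]
    exact (Gam M).one_mem

/-- The exceptional case, in which one factor of the modular polynomial degenerates. -/
def Exc (M n e : ℕ) : Prop := ∃ p ∈ diagPairs M n, p.1 * e = p.2

theorem exists_coincide_iff {M n e s : ℕ} [NeZero M] (hN : Squarefree (e * M)) (hs : s ∣ e) :
    (∃ i ∈ repIdx M n, Coincide M s (e / s) (repMat i)) ↔ Exc M n e := by
  have he0 : 0 < e := Nat.pos_of_ne_zero hN.of_mul_left.ne_zero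
  have hM0 := Nat.pos_of_neZero M
  obtain ⟨t, rfl⟩ := hs
  have hs0 : 0 < s := Nat.pos_of_mul_pos_right he0
  have ht0 : 0 < t := Nat.pos_of_mul_pos_left he0
  have hst : s.Coprime t := Nat.coprime_of_squarefree_mul hN.of_mul_left
  have hcop : (s * t).Coprime M := Nat.coprime_of_squarefree_mul hN
  rw [Nat.mul_div_cancel_left _ hs0]
  constructor
  · rintro ⟨i, hi, h⟩
    rw [coincide_iff hs0 ht0 hi] at h
    obtain ⟨⟨a, d⟩, b⟩ := i
    obtain ⟨h1, -⟩ := h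
    dsimp only at h1
    simp only [repIdx, Finset.mem_sigma, mem_diagPairs hM0, Finset.mem_range] at hi
    obtain ⟨⟨ha, hd, e', he', hea, hed, had⟩, -⟩ := hi
    obtain ⟨k, rfl⟩ : s ∣ a := hst.dvd_of_dvd_mul_right ⟨d, h1⟩
    have hd' : d = t * k := by
      apply Nat.eq_of_mul_eq_mul_left hs0; rw [← h1]; ring
    subst hd'
    have hk : e' ∣ k := by
      have : e'.Coprime s := (Nat.Coprime.coprime_dvd_left he'
        ((hcop.coprime_mul_right).symm))
      exact this.dvd_of_dvd_mul_left hea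
    refine ⟨(k, s * t * k), (mem_diagPairs hM0).2 ⟨?_, ?_, e', he', hk, hk.mul_left _, ?_⟩, ?_⟩
    · exact Nat.pos_of_mul_pos_left ha
    · have := Nat.pos_of_mul_pos_left ha
      positivity
    · dsimp only; rw [← had]; ring
    · dsimp only; ring
  · rintro ⟨⟨a, d⟩, hp, h1⟩
    dsimp only at h1
    obtain ⟨ha, hd, e', he', hea, hed, had⟩ := (mem_diagPairs hM0).1 hp
    dsimp only at *
    have hi : (⟨(s * a, t * a), 0⟩ : Σ _ : ℕ × ℕ, ℕ) ∈ repIdx M n := by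
      simp only [repIdx, Finset.mem_sigma, mem_diagPairs hM0, Finset.mem_range]
      refine ⟨⟨by positivity, by positivity, e', he', hea.mul_left _, hea.mul_left _, ?_⟩,
        by positivity⟩
      rw [← had, ← h1]; ring
    exact ⟨_, hi, (coincide_iff hs0 ht0 hi).2 ⟨by dsimp only; ring, rfl⟩⟩

open Classical in
/-- A factor of the modular polynomial, with the degenerate factor removed. -/
noncomputable def polyFactor (M s t : ℕ) [NeZero M] (h : ℂ → ℂ) (X : SL2R) (z : ℂ) : ℂ :=
  if Coincide M s t X then 1 else h (moebius (dil s) z) - h (moebius (X * dil t) z)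

/-- The modular polynomial evaluated along `(s τ, t τ)`, without its degenerate factor. -/
noncomputable def polyProd (M n s t : ℕ) [NeZero M] (h : ℂ → ℂ) (z : ℂ) : ℂ :=
  ∏ i ∈ repIdx M n, polyFactor M s t h (repMat i) z

open Classical in
theorem prod_polyProd_smul {M n e : ℕ} [NeZero M] [NeZero (e * M)] (hN : Squarefree (e * M))
    (hn : 0 < n) {h : ℂ → ℂ} (hh : IsHaupt M h) {g : SL2R} (hg : g ∈ Gam (e * M)) (τ : ℍ) :
    ∏ s ∈ e.divisors, polyProd M n s (e / s) h (g • τ : ℍ) =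
      ∏ s ∈ e.divisors, polyProd M n s (e / s) h τ := by
  have hM : Squarefree M := hN.of_mul_right
  refine prod_dil_invariant hN hg (fun s => polyProd M n s (e / s) h (g • τ : ℍ))
    (fun s => polyProd M n s (e / s) h τ) ?_
  intro s s' hs hs' hw hv
  generalize e / s = t at *
  generalize e / s' = t' at *
  rw [polyProd, polyProd]
  refine Eq.trans (Finset.prod_congr rfl fun i hi => ?_)
    (prod_rep_invariant hM hn (fun X => polyFactor M s' t' h X τ) ?_ hv)
  · have h1 : Coincide M s t (repMat i) ↔
        Coincide M s' t' (repMat i * (dil t * g * (dil t')⁻¹)) := by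
      unfold Coincide
      rw [← (Gam M).mul_mem_cancel_right hw]
      have : repMat i * dil t * (dil s)⁻¹ * (dil s * g * (dil s')⁻¹) =
        repMat i * (dil t * g * (dil t')⁻¹) * dil t' * (dil s')⁻¹ := by group
      rw [this]
    simp only [polyFactor, ← coe_smul_moebius]
    have h2 : h ((dil s • g • τ : ℍ) : ℂ) = h ((dil s' • τ : ℍ) : ℂ) := by
      have : dil s • g • τ = (dil s * g * (dil s')⁻¹) • dil s' • τ := by
        simp only [smul_smul]
        congr 1; group
      rw [this, hh.inv _ hw]
    have h3 : (repMat i * dil t) • g • τ =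
        (repMat i * (dil t * g * (dil t')⁻¹) * dil t') • τ := by
      simp only [smul_smul]
      congr 1; group
    rw [h2, h3]
    exact if_congr h1 rfl rfl
  · intro w hw X
    have h1 : Coincide M s' t' (w * X) ↔ Coincide M s' t' X := by
      unfold Coincide
      rw [← (Gam M).mul_mem_cancel_left hw (y := X * dil t' * (dil s')⁻¹)]
      simp only [mul_assoc]
    simp only [polyFactor, ← coe_smul_moebius]
    rw [mul_assoc, mul_smul w, hh.inv w hw]
    exact if_congr h1 rfl rfl

theorem IsHaupt.differentiableAt {M : ℕ} [NeZero M] {h : ℂ → ℂ} (hh : IsHaupt M h) {z : ℂ}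
    (hz : 0 < z.im) : DifferentiableAt ℂ h z :=
  (hh.hol z hz).differentiableAt ((isOpen_lt continuous_const Complex.continuous_im).mem_nhds hz)

/-- The derivative of a hauptmodul has weight two. -/
theorem IsHaupt.deriv_smul {M : ℕ} [NeZero M] {h : ℂ → ℂ} (hh : IsHaupt M h) {w : SL2R}
    (hw : w ∈ Gam M) (τ : ℍ) : deriv h (w • τ : ℍ) = jf w τ ^ 2 * deriv h τ := by
  have h1 : (fun z => h (moebius w z)) =ᶠ[𝓝 (τ : ℂ)] h := by
    filter_upwards [eventually_im_pos τ] with z hz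
    have := hh.inv w hw ⟨z, hz⟩
    rwa [coe_smul_moebius] at this
  have h2 : HasDerivAt (fun z => h (moebius w z)) (deriv h (w • τ : ℍ) * (jf w τ ^ 2)⁻¹) τ := by
    refine HasDerivAt.comp (τ : ℂ) ?_ (hasDerivAt_moebius w τ)
    rw [← coe_smul_moebius]
    exact (hh.differentiableAt (w • τ).im_pos).hasDerivAt
  have h3 := h1.deriv_eq
  rw [h2.deriv] at h3
  have := jf_ne_zero w τ
  rw [← h3]
  field_simp

theorem jf_dil_conj {s s' : ℕ} (hs : 0 < s) (hs' : 0 < s') (g : SL2R) (τ : ℍ) :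
    s * jf (dil s * g * (dil s')⁻¹) (dil s' • τ : ℍ) ^ 2 = s' * jf g τ ^ 2 := by
  have h1 := jf_mul (dil s * g * (dil s')⁻¹) (dil s') τ
  rw [inv_mul_cancel_right, jf_mul, jf_dil hs, jf_dil hs'] at h1
  have e1 : ((√s : ℝ) : ℂ) ^ 2 = s := by
    rw [← Complex.ofReal_pow, Real.sq_sqrt (by positivity)]; simp
  have e2 : ((√s' : ℝ) : ℂ) ^ 2 = s' := by
    rw [← Complex.ofReal_pow, Real.sq_sqrt (by positivity)]; simp
  have n1 : ((√s : ℝ) : ℂ) ≠ 0 := by simpa using hs.ne'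
  have n2 : ((√s' : ℝ) : ℂ) ≠ 0 := by simpa using hs'.ne'
  rw [← e1, ← e2]
  field_simp at h1
  rw [← mul_pow, ← mul_pow]
  congr 1
  linear_combination -h1

/-- The product of the derivatives of a hauptmodul along dilations. -/
noncomputable def derivProd (e : ℕ) (h : ℂ → ℂ) (z : ℂ) : ℂ := ∏ s ∈ e.divisors, s * deriv h (s * z)

theorem derivProd_smul {M e : ℕ} [NeZero M] [NeZero (e * M)] (hN : Squarefree (e * M))
    {h : ℂ → ℂ} (hh : IsHaupt M h) {g : SL2R} (hg : g ∈ Gam (e * M)) (τ : ℍ) :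
    derivProd e h (g • τ : ℍ) = jf g τ ^ (2 * e.divisors.card) * derivProd e h τ := by
  have he0 : 0 < e := Nat.pos_of_ne_zero hN.of_mul_left.ne_zero
  rw [derivProd, derivProd, pow_mul, ← Finset.prod_const, ← Finset.prod_mul_distrib]
  refine prod_dil_invariant hN hg _ (fun s => jf g τ ^ 2 * (s * deriv h (s * τ))) ?_
  intro s s' hs hs' hw _
  have hs0 := Nat.pos_of_dvd_of_pos hs he0
  have hs0' := Nat.pos_of_dvd_of_pos hs' he0
  have h1 := hh.deriv_smul hw (dil s' • τ)
  have h2 : (dil s * g * (dil s')⁻¹) • dil s' • τ = dil s • g • τ := by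
    simp only [smul_smul]
    congr 1; group
  rw [h2, dil_smul hs0, dil_smul hs0'] at h1
  have h3 := jf_dil_conj hs0 hs0' g τ
  rw [dil_smul hs0'] at h3
  rw [h1]
  linear_combination deriv h (s' * τ) * h3

/-- The product of the discriminant functions along dilations. -/
noncomputable def deltaProd (N : ℕ) (z : ℂ) : ℂ := ∏ s ∈ N.divisors, (s : ℂ) ^ 6 * deltaF (s * z)

theorem deltaProd_smul {N : ℕ} [NeZero N] (hN : Squarefree N) {g : SL2R} (hg : g ∈ Gam N) (τ : ℍ) :
    deltaProd N (g • τ : ℍ) = jf g τ ^ (12 * N.divisors.card) * deltaProd N τ := by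
  have he0 : 0 < N := Nat.pos_of_neZero N
  have : NeZero (N * 1) := ⟨by rw [mul_one]; exact he0.ne'⟩
  have hg' : g ∈ Gam (N * 1) := by rw [mem_Gam] at *; rwa [mul_one]
  rw [deltaProd, deltaProd, pow_mul, ← Finset.prod_const, ← Finset.prod_mul_distrib]
  refine prod_dil_invariant (by rwa [mul_one]) hg' _
    (fun s => jf g τ ^ 12 * ((s : ℂ) ^ 6 * deltaF (s * τ))) ?_
  intro s s' hs hs' hw _
  have hs0 := Nat.pos_of_dvd_of_pos hs he0
  have hs0' := Nat.pos_of_dvd_of_pos hs' he0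
  have h1 := deltaF_smul hw (dil s' • τ)
  have h2 : (dil s * g * (dil s')⁻¹) • dil s' • τ = dil s • g • τ := by
    simp only [smul_smul]
    congr 1; group
  rw [h2, dil_smul hs0, dil_smul hs0'] at h1
  have h3 := congrArg (fun x => x ^ 6) (jf_dil_conj hs0 hs0' g τ)
  rw [dil_smul hs0'] at h3
  simp only [mul_pow, ← pow_mul] at h3
  rw [h1]
  linear_combination deltaF (s' * τ) * h3

theorem natCast_mul_im_pos {s : ℕ} (hs : 0 < s) {z : ℂ} (hz : 0 < z.im) : 0 < ((s : ℂ) * z).im := by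
  simpa using mul_pos (Nat.cast_pos.2 hs : (0 : ℝ) < s) hz

theorem deltaProd_ne_zero (N : ℕ) {z : ℂ} (hz : 0 < z.im) : deltaProd N z ≠ 0 := by
  refine Finset.prod_ne_zero_iff.2 fun s hs => ?_
  have hs0 := Nat.pos_of_mem_divisors hs
  exact mul_ne_zero (pow_ne_zero _ (by exact_mod_cast hs0.ne'))
    (deltaF_ne_zero (natCast_mul_im_pos hs0 hz))

theorem moebius_im_pos (g : SL2R) {z : ℂ} (hz : 0 < z.im) : 0 < (moebius g z).im := by
  have := (g • (⟨z, hz⟩ : ℍ)).im_pos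
  rwa [← coe_im, coe_smul_moebius] at this

open Classical in
/-- The modular function attached to the correspondences of degree `n` and the dilations by
divisors of `e`. -/
noncomputable def modFun (N M n e m : ℕ) [NeZero M] (h : ℂ → ℂ) (z : ℂ) : ℂ :=
  (∏ s ∈ e.divisors, polyProd M n s (e / s) h z) ^ m *
    (if Exc M n e then derivProd e h z ^ m / deltaProd N z else 1)

theorem modFun_smul {N M n e m : ℕ} [NeZero M] [NeZero N] (hN : Squarefree N) (hNe : N = e * M)
    (hm : m * (2 * e.divisors.card) = 12 * N.divisors.card)
    (hn : 0 < n) {h : ℂ → ℂ} (hh : IsHaupt M h) {g : SL2R} (hg : g ∈ Gam N) (τ : ℍ) :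
    modFun N M n e m h (g • τ : ℍ) = modFun N M n e m h τ := by
  subst hNe
  rw [modFun, modFun, prod_polyProd_smul hN hn hh hg τ, derivProd_smul hN hh hg,
    deltaProd_smul hN hg, mul_pow, ← pow_mul, mul_comm _ m, hm,
    mul_div_mul_left _ _ (pow_ne_zero _ (jf_ne_zero g τ))]

theorem modFun_diff {N M n e m : ℕ} [NeZero M] {h : ℂ → ℂ} (hh : IsHaupt M h) :
    DifferentiableOn ℂ (modFun N M n e m h) {z | 0 < z.im} := by
  have hU : IsOpen {z : ℂ | 0 < z.im} := isOpen_lt continuous_const Complex.continuous_im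
  have hmoeb : ∀ g, DifferentiableOn ℂ (fun z => h (moebius g z)) {z | 0 < z.im} := fun g z hz =>
    ((hh.differentiableAt (moebius_im_pos g hz)).fun_comp' z
      (moebius_analyticAt g ⟨z, hz⟩).differentiableAt).differentiableWithinAt
  have hderiv : ∀ s : ℕ, 0 < s → DifferentiableOn ℂ (fun z => deriv h (s * z)) {z | 0 < z.im} :=
    fun s hs => (hh.hol.deriv hU).comp (by fun_prop) fun z hz => natCast_mul_im_pos hs hz
  have hdelta : ∀ s : ℕ, 0 < s → DifferentiableOn ℂ (fun z => deltaF (s * z)) {z | 0 < z.im} :=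
    fun s hs => deltaF_diff.comp (by fun_prop) fun z hz => natCast_mul_im_pos hs hz
  unfold modFun
  refine DifferentiableOn.fun_mul (DifferentiableOn.fun_pow (DifferentiableOn.fun_finsetProd
    fun s hs => ?_) _) ?_
  · unfold polyProd
    refine DifferentiableOn.fun_finsetProd fun i hi => ?_
    unfold polyFactor
    split_ifs
    · exact differentiableOn_const _
    · exact (hmoeb _).fun_sub (hmoeb _)
  · split_ifs
    · refine DifferentiableOn.fun_div (DifferentiableOn.fun_pow ?_ _) ?_
        fun z hz => deltaProd_ne_zero N hz
      · exact DifferentiableOn.fun_finsetProd fun s hs =>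
          (differentiableOn_const _).mul (hderiv s (Nat.pos_of_mem_divisors hs))
      · exact DifferentiableOn.fun_finsetProd fun s hs =>
          (differentiableOn_const _).mul (hdelta s (Nat.pos_of_mem_divisors hs))
    · exact differentiableOn_const _

/-- Exponential growth at the cusp. -/
def ExpGrowth (F : ℂ → ℂ) : Prop :=
  ∃ (C : ℝ) (D : ℕ), ∀ z : ℂ, 1 ≤ z.im → ‖F z‖ ≤ C * Real.exp (2 * Real.pi * D * z.im)

theorem expGrowth_of_le {F : ℂ → ℂ} {C r : ℝ} (hC : 0 ≤ C)
    (h : ∀ z : ℂ, 1 ≤ z.im → ‖F z‖ ≤ C * Real.exp (r * z.im)) : ExpGrowth F := by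
  refine ⟨C, ⌈r⌉₊, fun z hz => (h z hz).trans ?_⟩
  gcongr
  have := Nat.le_ceil r
  have h2 : (0 : ℝ) ≤ ⌈r⌉₊ := by positivity
  nlinarith [Real.pi_gt_three]

theorem ExpGrowth.const (c : ℂ) : ExpGrowth (fun _ => c) := ⟨‖c‖, 0, fun z _ => by simp⟩

theorem ExpGrowth.mul {F G : ℂ → ℂ} (hF : ExpGrowth F) (hG : ExpGrowth G) :
    ExpGrowth (fun z => F z * G z) := by
  obtain ⟨C, D, h1⟩ := hF
  obtain ⟨C', D', h2⟩ := hG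
  refine ⟨C * C', D + D', fun z hz => ?_⟩
  have := mul_le_mul (h1 z hz) (h2 z hz) (norm_nonneg _) ((norm_nonneg _).trans (h1 z hz))
  rw [norm_mul]
  refine this.trans (le_of_eq ?_)
  push_cast
  rw [show 2 * Real.pi * (D + D' : ℝ) * z.im = 2 * Real.pi * D * z.im + 2 * Real.pi * D' * z.im by
    ring, Real.exp_add]
  ring

theorem ExpGrowth.prod {ι : Type*} (S : Finset ι) {F : ι → ℂ → ℂ} (h : ∀ i ∈ S, ExpGrowth (F i)) :
    ExpGrowth (fun z => ∏ i ∈ S, F i z) := by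
  classical
  induction S using Finset.induction_on with
  | empty => simpa using ExpGrowth.const 1
  | insert i S hi ih =>
    simp only [Finset.prod_insert hi]
    exact (h i (by simp)).mul (ih fun j hj => h j (by simp [hj]))

theorem ExpGrowth.pow {F : ℂ → ℂ} (h : ExpGrowth F) (m : ℕ) : ExpGrowth (fun z => F z ^ m) := by
  simpa using ExpGrowth.prod (Finset.range m) (fun _ _ => h)

theorem ExpGrowth.sub {F G : ℂ → ℂ} (hF : ExpGrowth F) (hG : ExpGrowth G) :
    ExpGrowth (fun z => F z - G z) := by
  obtain ⟨C, D, h1⟩ := hF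
  obtain ⟨C', D', h2⟩ := hG
  have hC : 0 ≤ C := nonneg_of_mul_nonneg_left
    ((norm_nonneg _).trans (h1 Complex.I (by simp))) (Real.exp_pos _)
  have hC' : 0 ≤ C' := nonneg_of_mul_nonneg_left
    ((norm_nonneg _).trans (h2 Complex.I (by simp))) (Real.exp_pos _)
  refine ⟨C + C', D + D', fun z hz => ?_⟩
  have hz0 : 0 ≤ z.im := by linarith
  refine (norm_sub_le _ _).trans ((add_le_add (h1 z hz) (h2 z hz)).trans ?_)
  rw [add_mul]
  gcongr <;> simp

theorem IsHaupt.expGrowth_moebius {M : ℕ} [NeZero M] {h : ℂ → ℂ} (hh : IsHaupt M h) {g : SL2R}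
    {r : ℝ} (hr : 0 < r) (hg : ∀ τ : ℍ, (g • τ).im = r * τ.im) :
    ExpGrowth (fun z => h (moebius g z)) := by
  obtain ⟨C, hC, hb⟩ := hh.growth hr
  refine expGrowth_of_le (r := 2 * Real.pi * r) hC fun z hz => ?_
  have him : (moebius g z).im = r * z.im := by
    have := hg ⟨z, by linarith⟩
    rwa [← coe_im, coe_smul_moebius] at this
  have := hb (moebius g z) (by rw [him]; nlinarith)
  rwa [him, ← mul_assoc] at this

theorem IsHaupt.expGrowth_deriv {M : ℕ} [NeZero M] {h : ℂ → ℂ} (hh : IsHaupt M h) {s : ℕ}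
    (hs : 0 < s) : ExpGrowth (fun z => deriv h (s * z)) := by
  obtain ⟨C, hC, hb⟩ := hh.growth (one_half_pos (α := ℝ))
  have hs1 : (1 : ℝ) ≤ s := by exact_mod_cast hs
  refine expGrowth_of_le (C := 2 * C * Real.exp Real.pi) (r := 2 * Real.pi * s) (by positivity)
    fun z hz => ?_
  have key : ∀ w ∈ Metric.closedBall ((s : ℂ) * z) (1 / 2), 1 / 2 ≤ w.im ∧ w.im ≤ s * z.im + 1 / 2 := by
    intro w hw
    have h1 := (Complex.abs_im_le_norm (w - s * z)).trans (by simpa [dist_eq_norm] using hw)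
    have h2 : (w - s * z).im = w.im - s * z.im := by simp
    rw [h2, abs_le] at h1
    constructor <;> nlinarith
  have := Complex.norm_deriv_le_of_forall_mem_sphere_norm_le (f := h) (c := (s : ℂ) * z)
    (R := 1 / 2) (C := C * Real.exp (2 * Real.pi * (s * z.im + 1 / 2))) one_half_pos
    (DifferentiableOn.diffContOnCl (by
      rw [closure_ball _ (by norm_num)]
      exact hh.hol.mono fun w hw => by
        have := (key w hw).1
        show 0 < w.im
        linarith))
    (fun w hw => by
      have h1 := key w (Metric.sphere_subset_closedBall hw)
      refine (hb w h1.1).trans ?_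
      gcongr
      exact h1.2)
  refine this.trans (le_of_eq ?_)
  rw [show 2 * Real.pi * (s * z.im + 1 / 2) = Real.pi + 2 * Real.pi * s * z.im by ring, Real.exp_add]
  ring

theorem expGrowth_deltaF_inv {s : ℕ} (hs : 0 < s) : ExpGrowth (fun z => (deltaF (s * z))⁻¹) := by
  have hs1 : (1 : ℝ) ≤ s := by exact_mod_cast hs
  set r : ℝ := Real.exp (-2 * Real.pi) with hr
  have hr1 : r < 1 := by rw [hr, Real.exp_lt_one_iff]; linarith [Real.pi_pos]
  have hcont : ContinuousOn (fun x => ((eulerP x) ^ 24)⁻¹) (Metric.closedBall (0 : ℂ) r) := by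
    have h1 : ContinuousOn eulerP (Metric.closedBall (0 : ℂ) r) :=
      eulerP_diff.continuousOn.mono (Metric.closedBall_subset_ball hr1)
    refine (h1.pow 24).inv₀ fun x hx => pow_ne_zero _ (eulerP_ne_zero ?_)
    have : ‖x‖ ≤ r := by simpa using hx
    linarith
  obtain ⟨C, hC⟩ := (isCompact_closedBall (0 : ℂ) r).exists_bound_of_continuousOn hcont
  have hC0 : 0 ≤ C := (norm_nonneg _).trans (hC 0 (by simp [hr, Real.exp_nonneg]))
  refine expGrowth_of_le (r := 2 * Real.pi * s) hC0 fun z hz => ?_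
  have him : ((s : ℂ) * z).im = s * z.im := by simp
  have h1 := hC (qc (s * z)) (by
    rw [mem_closedBall_zero_iff, norm_qc, him, hr]
    apply Real.exp_le_exp.2
    nlinarith [Real.pi_pos, mul_le_mul hs1 hz (by norm_num) (by linarith)])
  rw [deltaF_eq, mul_inv, norm_mul, norm_inv, norm_qc, him, ← Real.exp_neg, mul_comm]
  refine mul_le_mul h1 (le_of_eq ?_) (Real.exp_nonneg _) hC0
  congr 1; ring

theorem modFun_growth {N M n e m : ℕ} [NeZero M] {h : ℂ → ℂ} (hh : IsHaupt M h) :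
    ExpGrowth (modFun N M n e m h) := by
  have hM0 := Nat.pos_of_neZero M
  unfold modFun
  refine ExpGrowth.mul (ExpGrowth.pow (ExpGrowth.prod _ fun s hs => ?_) _) ?_
  · unfold polyProd
    have hs0 := Nat.pos_of_mem_divisors hs
    have ht0 : 0 < e / s := Nat.div_pos (Nat.divisor_le hs) hs0
    refine ExpGrowth.prod _ fun i hi => ?_
    unfold polyFactor
    split_ifs
    · exact ExpGrowth.const _
    · refine ExpGrowth.sub (hh.expGrowth_moebius (r := s) (by positivity) fun τ => ?_) ?_
      · rw [dil, upper_smul_im (by simpa using hs0)]; simp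
      · simp only [repIdx, Finset.mem_sigma, mem_diagPairs hM0, Finset.mem_range] at hi
        obtain ⟨⟨ha, hd, -⟩, -⟩ := hi
        have ha' : (0 : ℝ) < i.1.1 := by positivity
        have hd' : (0 : ℝ) < i.1.2 := by positivity
        refine hh.expGrowth_moebius (r := i.1.1 / i.1.2 * (e / s : ℕ)) (by positivity) fun τ => ?_
        rw [mul_smul, repMat, upper_smul_im (by positivity), dil,
          upper_smul_im (by simpa using ht0)]
        simp [mul_assoc]
  · split_ifs
    · simp only [div_eq_mul_inv, deltaProd, ← Finset.prod_inv_distrib]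
      refine ExpGrowth.mul (ExpGrowth.pow (ExpGrowth.prod _ fun s hs =>
        (ExpGrowth.const _).mul (hh.expGrowth_deriv (Nat.pos_of_mem_divisors hs))) _)
        (ExpGrowth.prod _ fun s hs => ?_)
      simp only [mul_inv]
      exact (ExpGrowth.const _).mul (expGrowth_deltaF_inv (Nat.pos_of_mem_divisors hs))
    · exact ExpGrowth.const _

theorem exists_modPoly {N M n e m : ℕ} [NeZero M] [NeZero N] (hN : Squarefree N) (hNe : N = e * M)
    (hm : m * (2 * e.divisors.card) = 12 * N.divisors.card) (hn : 0 < n) {f h : ℂ → ℂ}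
    (hf : IsHaupt N f) (hh : IsHaupt M h) :
    ∃ R : Polynomial ℂ, ∀ z : ℂ, 0 < z.im → modFun N M n e m h z = R.eval (f z) := by
  have hinv : ∀ w ∈ Gam N, ∀ τ : ℍ, modFun N M n e m h (w • τ : ℍ) = modFun N M n e m h τ :=
    fun w hw τ => modFun_smul hN hNe hm hn hh hw τ
  obtain ⟨C, D, hgr⟩ := modFun_growth (N := N) (n := n) (e := e) (m := m) hh
  refine hf.exists_polynomial hN D _ hinv (cuspHol_of_growth (modFun_diff hh) ?_ hgr)
  intro z hz
  have := hinv _ (translate_mem_Gam N 1) ⟨z, hz⟩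
  rw [upper_smul (by norm_num)] at this
  simpa using this

/-- `F` is analytic at `z` with a zero of order `k`. -/
def HasOrd (F : ℂ → ℂ) (z : ℂ) (k : ℕ) : Prop := AnalyticAt ℂ F z ∧ analyticOrderAt F z = k

theorem HasOrd.mul {F G : ℂ → ℂ} {z : ℂ} {k l : ℕ} (hF : HasOrd F z k) (hG : HasOrd G z l) :
    HasOrd (fun x => F x * G x) z (k + l) :=
  ⟨hF.1.mul hG.1, by
    have := analyticOrderAt_mul hF.1 hG.1
    rw [hF.2, hG.2] at this
    exact_mod_cast this⟩

theorem HasOrd.of_ne_zero {F : ℂ → ℂ} {z : ℂ} (hF : AnalyticAt ℂ F z) (h : F z ≠ 0) :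
    HasOrd F z 0 := ⟨hF, by simpa using (hF.analyticOrderAt_eq_zero.2 h)⟩

theorem HasOrd.prod {ι : Type*} (S : Finset ι) {F : ι → ℂ → ℂ} {z : ℂ} {k : ι → ℕ}
    (h : ∀ i ∈ S, HasOrd (F i) z (k i)) : HasOrd (fun x => ∏ i ∈ S, F i x) z (∑ i ∈ S, k i) := by
  classical
  induction S using Finset.induction_on with
  | empty => simpa using HasOrd.of_ne_zero (analyticAt_const (v := (1 : ℂ))) one_ne_zero
  | insert i S hi ih =>
    simp only [Finset.prod_insert hi, Finset.sum_insert hi]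
    exact (h i (by simp)).mul (ih fun j hj => h j (by simp [hj]))

theorem HasOrd.pow {F : ℂ → ℂ} {z : ℂ} {k : ℕ} (h : HasOrd F z k) (m : ℕ) :
    HasOrd (fun x => F x ^ m) z (m * k) := by
  simpa using HasOrd.prod (Finset.range m) (fun _ _ => h)

theorem HasOrd.unique {F : ℂ → ℂ} {z : ℂ} {k l : ℕ} (h : HasOrd F z k) (h' : HasOrd F z l) :
    k = l := by
  have := h.2.symm.trans h'.2
  exact_mod_cast this

theorem HasOrd.congr {F G : ℂ → ℂ} {z : ℂ} {k : ℕ} (h : HasOrd F z k) (hFG : F =ᶠ[𝓝 z] G) :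
    HasOrd G z k := ⟨h.1.congr hFG, by rw [← analyticOrderAt_congr hFG]; exact h.2⟩

/-- Elements of the Hecke set of degree `n` carrying `t τ` to `s τ`. -/
def heckeFix (M n s t : ℕ) (τ : ℍ) : Set SL2R := {Y | Y ∈ heckeSet M n ∧ Y • dil t • τ = dil s • τ}

theorem heckeTransport_finite {M n : ℕ} [NeZero M] (hn : 0 < n) (τ₁ τ₂ : ℍ) :
    {Y : SL2R | Y ∈ heckeSet M n ∧ Y • τ₁ = τ₂}.Finite := by
  obtain ⟨C, hC⟩ := entries_bounded (δ := min τ₁.im τ₂.im) (R := max ‖(τ₁ : ℂ)‖ ‖(τ₂ : ℂ)‖)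
    (lt_min τ₁.im_pos τ₂.im_pos)
  refine (heckeSet_finite (M := M) hn C).subset ?_
  rintro g ⟨hg, h⟩
  refine ⟨hg, hC g τ₁ ?_ ?_ ?_ ?_⟩ <;> simp [h]

theorem card_transport_symm {M : ℕ} [NeZero M] (τ₁ τ₂ : ℍ) :
    Nat.card {w : SL2R // w ∈ Gam M ∧ w • τ₁ = τ₂} =
      Nat.card {w : SL2R // w ∈ Gam M ∧ w • τ₂ = τ₁} := by
  refine Nat.card_congr ((Equiv.inv SL2R).subtypeEquiv fun w => ?_)
  simp only [Equiv.inv_apply, inv_mem_iff, inv_smul_eq_iff]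
  exact and_congr_right fun _ => eq_comm

theorem card_transport_smul {M : ℕ} [NeZero M] {v : SL2R} (hv : v ∈ Gam M) (τ : ℍ) :
    Nat.card {w : SL2R // w ∈ Gam M ∧ w • v • τ = τ} =
      Nat.card {w : SL2R // w ∈ Gam M ∧ w • τ = τ} := by
  refine Nat.card_congr ((Equiv.mulRight v).subtypeEquiv fun w => ?_)
  simp only [Equiv.coe_mulRight, (Gam M).mul_mem_cancel_right hv, mul_smul]

theorem card_heckeFix {M n : ℕ} [NeZero M] (hM : Squarefree M) (hn : 0 < n) (s t : ℕ) (τ : ℍ) :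
    Nat.card (heckeFix M n s t τ) = ∑ i ∈ repIdx M n,
      Nat.card {w : SL2R // w ∈ Gam M ∧ w • (repMat i * dil t) • τ = dil s • τ} := by
  have hfin : ∀ i : repIdx M n,
      Finite {w : SL2R // w ∈ Gam M ∧ w • (repMat i * dil t) • τ = dil s • τ} := fun i =>
    (heckeTransport_finite one_pos _ _).to_subtype
  rw [← Finset.sum_coe_sort, ← Nat.card_sigma]
  symm
  refine Nat.card_congr (Equiv.ofBijective (fun p => ⟨p.2.1 * repMat p.1,
    heckeSet_mul_left p.2.2.1 (repMat_mem p.1.2), ?_⟩) ⟨?_, ?_⟩)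
  · have := p.2.2.2
    simpa only [mul_smul] using this
  · rintro ⟨⟨i, hi⟩, w, hw, h⟩ ⟨⟨j, hj⟩, v, hv, h'⟩ heq
    have heq' : w * repMat i = v * repMat j := congrArg Subtype.val heq
    have hij : i = j := rep_unique hM hn hi hj ((Gam M).mul_mem ((Gam M).inv_mem hv) hw)
      (by rw [mul_assoc, heq']; group)
    subst hij
    have := mul_right_cancel heq'
    subst this
    rfl
  · rintro ⟨Y, hY, h⟩
    obtain ⟨w, hw, i, hi, rfl⟩ := exists_rep hM hn hY
    exact ⟨⟨⟨i, hi⟩, w, hw, by simpa only [mul_smul] using h⟩, rfl⟩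

theorem IsHaupt.hasOrd_sub {M : ℕ} [NeZero M] (hM : Squarefree M) {h : ℂ → ℂ} (hh : IsHaupt M h)
    (g₁ g₂ : SL2R) (hne : g₂ * g₁⁻¹ ∉ Gam M) (τ : ℍ) :
    ∃ k : ℕ, HasOrd (fun z => h (moebius g₁ z) - h (moebius g₂ z)) τ k ∧
      2 * k = Nat.card {w : SL2R // w ∈ Gam M ∧ w • g₂ • τ = g₁ • τ} := by
  obtain ⟨k, hk, hk2⟩ := hh.order_sub_smul hM g₁ g₂ hne τ
  have ha : ∀ g, AnalyticAt ℂ (fun z => h (moebius g z)) τ := fun g =>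
    AnalyticAt.fun_comp (by rw [← coe_smul_moebius]; exact hh.analyticAt _) (moebius_analyticAt g τ)
  exact ⟨k, ⟨(ha g₁).fun_sub (ha g₂), hk⟩, by rw [hk2, card_transport_symm]⟩

open Classical in
theorem hasOrd_polyProd {M n e s : ℕ} [NeZero M] (hN : Squarefree (e * M)) (hs : s ∣ e)
    (hn : 0 < n) {h : ℂ → ℂ} (hh : IsHaupt M h) (τ : ℍ) :
    ∃ k : ℕ, HasOrd (polyProd M n s (e / s) h) τ k ∧
      2 * k + (if Exc M n e then 2 * ram h (dil s • τ) else 0) =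
        Nat.card (heckeFix M n s (e / s) τ) := by
  have hM : Squarefree M := hN.of_mul_right
  generalize ht : e / s = t
  have hone : HasOrd (fun _ => (1 : ℂ)) (τ : ℂ) 0 := HasOrd.of_ne_zero analyticAt_const one_ne_zero
  have hfac : ∀ i, ∃ k : ℕ, i ∈ repIdx M n → HasOrd (polyFactor M s t h (repMat i)) τ k ∧
      2 * k + (if Coincide M s t (repMat i) then 2 * ram h (dil s • τ) else 0) =
        Nat.card {w : SL2R // w ∈ Gam M ∧ w • (repMat i * dil t) • τ = dil s • τ} := by
    intro i
    by_cases hc : Coincide M s t (repMat i)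
    · refine ⟨0, fun hi => ⟨hone.congr (Eventually.of_forall fun z => by simp [polyFactor, hc]), ?_⟩⟩
      rw [if_pos hc, ← hh.card_stab hM, ← card_transport_smul hc (dil s • τ)]
      simp only [mul_zero, zero_add, smul_smul, inv_mul_cancel_right, mul_assoc, inv_mul_cancel,
        mul_one]
    · obtain ⟨k, hk, hk2⟩ := hh.hasOrd_sub hM (dil s) (repMat i * dil t) hc τ
      exact ⟨k, fun hi => ⟨hk.congr (Eventually.of_forall fun z => by simp [polyFactor, hc]), by
        rw [if_neg hc, add_zero, hk2]⟩⟩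
  choose k hk using hfac
  refine ⟨∑ i ∈ repIdx M n, k i, HasOrd.prod _ fun i hi => (hk i hi).1, ?_⟩
  rw [card_heckeFix hM hn, ← Finset.sum_congr rfl fun i hi => (hk i hi).2, Finset.sum_add_distrib,
    ← Finset.mul_sum]
  congr 1
  subst ht
  by_cases hE : Exc M n e
  · obtain ⟨i, hi, hc⟩ := (exists_coincide_iff hN hs).2 hE
    rw [if_pos hE, Finset.sum_eq_single_of_mem i hi, if_pos hc]
    intro j hj hij
    rw [if_neg]
    intro hc'
    refine hij (rep_unique hM hn hj hi ((Gam M).mul_mem hc ((Gam M).inv_mem hc')) ?_)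
    group
  · rw [if_neg hE, Finset.sum_eq_zero]
    intro i hi
    rw [if_neg]
    exact fun hc => hE ((exists_coincide_iff hN hs).1 ⟨i, hi, hc⟩)

theorem IsHaupt.hasOrd_deriv {M : ℕ} [NeZero M] (hM : Squarefree M) {h : ℂ → ℂ} (hh : IsHaupt M h)
    {s : ℕ} (hs : 0 < s) (τ : ℍ) :
    HasOrd (fun z => s * deriv h (s * z)) τ (ram h (dil s • τ) - 1) := by
  have h1 := hh.order_deriv hM (dil s • τ)
  rw [dil_smul hs] at h1
  have hs' : (s : ℂ) ≠ 0 := by exact_mod_cast hs.ne'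
  have ha : AnalyticAt ℂ (deriv h) (s * τ) := by
    have := (hh.analyticAt (dil s • τ)).deriv
    rwa [dil_smul hs] at this
  have hl : HasDerivAt (fun z : ℂ => (s : ℂ) * z) s τ := by
    simpa using (hasDerivAt_id (τ : ℂ)).const_mul (s : ℂ)
  have hc : HasOrd (fun z => deriv h (s * z)) τ (ram h (dil s • τ) - 1) := by
    refine ⟨AnalyticAt.fun_comp ha (by fun_prop), ?_⟩
    have := analyticOrderAt_comp_of_deriv_ne_zero (f := deriv h) (g := fun z : ℂ => (s : ℂ) * z)
      (z₀ := (τ : ℂ)) (by fun_prop) (by rw [hl.deriv]; exact hs')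
    rw [← h1]
    exact this
  simpa using (HasOrd.of_ne_zero (analyticAt_const (v := (s : ℂ))) hs').mul hc

open Classical in
theorem hasOrd_modFun {N M n e m : ℕ} [NeZero M] (hN : Squarefree (e * M)) 
    (hn : 0 < n) {h : ℂ → ℂ} (hh : IsHaupt M h) (τ : ℍ) :
    ∃ k : ℕ, HasOrd (modFun N M n e m h) τ k ∧
      (2 * k : ℤ) = m * ∑ s ∈ e.divisors, ((Nat.card (heckeFix M n s (e / s) τ) : ℤ) -
        if Exc M n e then 2 else 0) := by
  have hM : Squarefree M := hN.of_mul_right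
  choose! k hk hk2 using fun s (hs : s ∣ e) => hasOrd_polyProd hN hs hn hh τ
  have hF : HasOrd (fun z => (∏ s ∈ e.divisors, polyProd M n s (e / s) h z) ^ m) τ
      (m * ∑ s ∈ e.divisors, k s) :=
    (HasOrd.prod _ fun s hs => hk s (Nat.dvd_of_mem_divisors hs)).pow m
  by_cases hE : Exc M n e
  · have hW : HasOrd (fun z => derivProd e h z ^ m) τ
        (m * ∑ s ∈ e.divisors, (ram h (dil s • τ) - 1)) :=
      (HasOrd.prod _ fun s hs => hh.hasOrd_deriv hM (Nat.pos_of_mem_divisors hs) τ).pow m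
    have hD : HasOrd (fun z => (deltaProd N z)⁻¹) τ 0 := by
      refine HasOrd.of_ne_zero ?_ (inv_ne_zero (deltaProd_ne_zero N τ.im_pos))
      refine AnalyticAt.fun_inv ?_ (deltaProd_ne_zero N τ.im_pos)
      have hU : IsOpen {z : ℂ | 0 < z.im} := isOpen_lt continuous_const Complex.continuous_im
      refine DifferentiableOn.analyticAt (s := {z : ℂ | 0 < z.im}) ?_ (hU.mem_nhds τ.im_pos)
      exact DifferentiableOn.fun_finsetProd fun s hs => (differentiableOn_const _).mul
        (deltaF_diff.comp (by fun_prop) fun z hz =>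
          natCast_mul_im_pos (Nat.pos_of_mem_divisors hs) hz)
    refine ⟨_, (hF.mul (hW.mul hD)).congr (Eventually.of_forall fun z => ?_), ?_⟩
    · simp only [modFun, if_pos hE, div_eq_mul_inv]
    · have : ∀ s ∈ e.divisors, (Nat.card (heckeFix M n s (e / s) τ) : ℤ) - (if Exc M n e then 2 else 0)
          = 2 * (k s + (ram h (dil s • τ) - 1 : ℕ)) := by
        intro s hs
        have h1 := hk2 s (Nat.dvd_of_mem_divisors hs)
        have h2 := hh.ram_pos hM (dil s • τ)
        rw [if_pos hE] at h1 ⊢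
        omega
      rw [Finset.sum_congr rfl this, ← Finset.mul_sum, Finset.sum_add_distrib]
      push_cast
      ring
  · refine ⟨_, hF.congr (Eventually.of_forall fun z => ?_), ?_⟩
    · simp only [modFun, if_neg hE, mul_one]
    · have : ∀ s ∈ e.divisors, (Nat.card (heckeFix M n s (e / s) τ) : ℤ) - (if Exc M n e then 2 else 0)
          = 2 * k s := by
        intro s hs
        have h1 := hk2 s (Nat.dvd_of_mem_divisors hs)
        rw [if_neg hE] at h1 ⊢
        omega
      rw [Finset.sum_congr rfl this, ← Finset.mul_sum]
      push_cast
      ring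

theorem IsHaupt.hasOrd_eval {N : ℕ} [NeZero N] (hN : Squarefree N) {f : ℂ → ℂ} (hf : IsHaupt N f)
    {R : Polynomial ℂ} (hR : R ≠ 0) (τ : ℍ) :
    HasOrd (fun z => R.eval (f z)) τ (R.rootMultiplicity (f τ) * ram f τ) := by
  obtain ⟨Q, hQ, hQ2⟩ := Polynomial.exists_eq_pow_rootMultiplicity_mul_and_not_dvd R hR (f τ)
  have h1 : HasOrd (fun z => f z - f τ) τ (ram f τ) :=
    ⟨(hf.analyticAt τ).fun_sub analyticAt_const, hf.order_eq_ram hN τ⟩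
  have h2 : HasOrd (fun z => Q.eval (f z)) τ 0 := by
    refine HasOrd.of_ne_zero ?_ ?_
    · simpa using (hf.analyticAt τ).aeval_polynomial Q
    · rwa [Polynomial.dvd_iff_isRoot] at hQ2
  refine ((h1.pow _).mul h2).congr (Eventually.of_forall fun z => ?_)
  conv_rhs => rw [hQ]
  simp

/-- `G x = A x ^ D (1 + u x + (l + u² / 2) x² + o(x²))` as `x → 0⁺`, with `A ≠ 0`. The invariant `l`
is additive under multiplication. -/
def HasJet (G : ℝ → ℂ) (l : ℂ) : Prop := ∃ (A : ℂ) (D : ℤ) (u : ℂ) (ρ : ℝ → ℂ), A ≠ 0 ∧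
  Tendsto ρ (𝓝[>] 0) (𝓝 (l + u ^ 2 / 2)) ∧
  ∀ᶠ x : ℝ in 𝓝[>] 0, G x = A * (x : ℂ) ^ D * (1 + u * x + ρ x * x ^ 2)

theorem eventually_pos_lt_one : ∀ᶠ x : ℝ in 𝓝[>] 0, 0 < x ∧ x < 1 :=
  Ioo_mem_nhdsGT one_pos

theorem tendsto_ofReal_zero : Tendsto (fun x : ℝ => (x : ℂ)) (𝓝[>] 0) (𝓝 0) :=
  (Complex.continuous_ofReal.tendsto' 0 0 Complex.ofReal_zero).mono_left nhdsWithin_le_nhds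

theorem HasJet.congr {G H : ℝ → ℂ} {l : ℂ} (h : HasJet G l) (hGH : G =ᶠ[𝓝[>] 0] H) :
    HasJet H l := by
  obtain ⟨A, D, u, ρ, hA, hρ, h⟩ := h
  exact ⟨A, D, u, ρ, hA, hρ, by filter_upwards [h, hGH] with x h1 h2; rw [← h2, h1]⟩

theorem HasJet.mul {G H : ℝ → ℂ} {l k : ℂ} (hG : HasJet G l) (hH : HasJet H k) :
    HasJet (fun x => G x * H x) (l + k) := by
  obtain ⟨A, D, u, ρ, hA, hρ, h⟩ := hG
  obtain ⟨B, D', v, σ, hB, hσ, h'⟩ := hH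
  refine ⟨A * B, D + D', u + v,
    fun x => ρ x + σ x + u * v + (u * σ x + v * ρ x) * x + ρ x * σ x * x ^ 2, mul_ne_zero hA hB,
    ?_, ?_⟩
  · have h0 := tendsto_ofReal_zero
    have := (((hρ.add hσ).add_const (u * v)).add
      (((hσ.const_mul u).add (hρ.const_mul v)).mul h0)).add ((hρ.mul hσ).mul (h0.pow 2))
    convert this using 2
    ring
  · filter_upwards [h, h', eventually_pos_lt_one] with x h1 h2 h3
    rw [h1, h2, zpow_add₀ (by exact_mod_cast h3.1.ne')]
    ring

theorem HasJet.inv {G : ℝ → ℂ} {l : ℂ} (hG : HasJet G l) : HasJet (fun x => (G x)⁻¹) (-l) := by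
  obtain ⟨A, D, u, ρ, hA, hρ, h⟩ := hG
  have h0 := tendsto_ofReal_zero
  have h1 : Tendsto (fun x : ℝ => 1 + u * x + ρ x * x ^ 2) (𝓝[>] 0) (𝓝 1) := by
    have := ((h0.const_mul u).const_add 1).add (hρ.mul (h0.pow 2))
    simpa using this
  refine ⟨A⁻¹, -D, -u, fun x => (u ^ 2 - ρ x + u * ρ x * x) / (1 + u * x + ρ x * x ^ 2),
    inv_ne_zero hA, ?_, ?_⟩
  · have := (((hρ.const_sub (u ^ 2)).add ((hρ.const_mul u).mul h0))).div h1 one_ne_zero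
    have h2 : -l + (-u) ^ 2 / 2 = (u ^ 2 - (l + u ^ 2 / 2) + u * (l + u ^ 2 / 2) * 0) / 1 := by ring
    rw [h2]
    exact this
  · filter_upwards [h, h1.eventually_ne one_ne_zero] with x h1 h2
    rw [h1, _root_.zpow_neg, mul_inv, mul_inv]
    congr 1
    symm
    apply eq_inv_of_mul_eq_one_left
    rw [div_mul_eq_mul_div, add_div' _ _ _ h2, div_mul_cancel₀ _ h2]
    ring

theorem hasJet_const {c : ℂ} (hc : c ≠ 0) : HasJet (fun _ => c) 0 :=
  ⟨c, 0, 0, fun _ => 0, hc, by simp, by simp⟩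

theorem hasJet_zpow (D : ℤ) : HasJet (fun x => (x : ℂ) ^ D) 0 :=
  ⟨1, D, 0, fun _ => 0, one_ne_zero, by simp, by simp⟩

theorem hasJet_one_add {ε : ℝ → ℂ} {l : ℂ} (h : Tendsto (fun x => ε x / (x : ℂ) ^ 2) (𝓝[>] 0) (𝓝 l)) :
    HasJet (fun x => 1 + ε x) l := by
  refine ⟨1, 0, 0, _, one_ne_zero, by simpa using h, ?_⟩
  filter_upwards [eventually_pos_lt_one] with x hx
  have hx : (x : ℂ) ≠ 0 := by exact_mod_cast hx.1.ne'
  field_simp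
  simp

theorem HasJet.prod {ι : Type*} (S : Finset ι) {G : ι → ℝ → ℂ} {l : ι → ℂ}
    (h : ∀ i ∈ S, HasJet (G i) (l i)) : HasJet (fun x => ∏ i ∈ S, G i x) (∑ i ∈ S, l i) := by
  classical
  induction S using Finset.induction_on with
  | empty => simpa using hasJet_const one_ne_zero
  | insert a S ha ih =>
    simp only [Finset.prod_insert ha, Finset.sum_insert ha]
    exact (h a (Finset.mem_insert_self _ _)).mul (ih fun i hi => h i (Finset.mem_insert_of_mem hi))

theorem HasJet.pow {G : ℝ → ℂ} {l : ℂ} (h : HasJet G l) (m : ℕ) :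
    HasJet (fun x => G x ^ m) (m * l) := by
  simpa using HasJet.prod (Finset.range m) (fun _ _ => h)

theorem hasJet_one_eq {l : ℂ} (h : HasJet (fun _ => 1) l) : l = 0 := by
  obtain ⟨A, D, u, ρ, hA, hρ, h⟩ := h
  have h0 := tendsto_ofReal_zero
  have h1 : Tendsto (fun x : ℝ => 1 + u * x + ρ x * x ^ 2) (𝓝[>] 0) (𝓝 1) := by
    have := ((h0.const_mul u).const_add 1).add (hρ.mul (h0.pow 2))
    simpa using this
  have hpow : ∀ k : ℕ, k ≠ 0 → Tendsto (fun x : ℝ => (x : ℂ) ^ k) (𝓝[>] 0) (𝓝 0) := fun k hk => by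
    simpa [hk] using h0.pow k
  have hA1 : Tendsto (fun x : ℝ => A * (1 + u * x + ρ x * x ^ 2)) (𝓝[>] 0) (𝓝 A) := by
    simpa using h1.const_mul A
  have hcases : D = 0 ∨ (∃ k : ℕ, k ≠ 0 ∧ D = k) ∨ ∃ k : ℕ, k ≠ 0 ∧ D = -k := by
    rcases lt_trichotomy D 0 with h | h | h
    · exact Or.inr (Or.inr ⟨D.natAbs, by omega, by omega⟩)
    · exact Or.inl h
    · exact Or.inr (Or.inl ⟨D.natAbs, by omega, by omega⟩)
  obtain rfl | ⟨k, hk, rfl⟩ | ⟨k, hk, rfl⟩ := hcases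
  · simp only [_root_.zpow_zero, mul_one] at h
    have hA2 : A = 1 := tendsto_nhds_unique hA1
      (tendsto_const_nhds.congr' (by filter_upwards [h] with x hx; exact hx))
    subst hA2
    have h3 : ∀ᶠ x : ℝ in 𝓝[>] 0, u + ρ x * x = 0 := by
      filter_upwards [h, eventually_pos_lt_one] with x h1 h2
      have hx : (x : ℂ) ≠ 0 := by exact_mod_cast h2.1.ne'
      apply mul_right_cancel₀ hx
      linear_combination -h1
    have hu : u = 0 := by
      have h4 : Tendsto (fun x : ℝ => u + ρ x * x) (𝓝[>] 0) (𝓝 u) := by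
        simpa using (hρ.mul h0).const_add u
      exact tendsto_nhds_unique h4
        (tendsto_const_nhds.congr' (by filter_upwards [h3] with x hx; exact hx.symm))
    subst hu
    have := tendsto_nhds_unique hρ (tendsto_const_nhds.congr' (f₁ := fun _ => (0 : ℂ)) (by
      filter_upwards [h3, eventually_pos_lt_one] with x h1 h2
      have hx : (x : ℂ) ≠ 0 := by exact_mod_cast h2.1.ne'
      simp only [zero_add, mul_eq_zero, hx, or_false] at h1
      exact h1.symm))
    simpa using this
  · exfalso
    have h5 := (hpow k hk).mul hA1
    rw [zero_mul] at h5
    refine one_ne_zero (tendsto_nhds_unique (tendsto_const_nhds.congr' ?_) h5)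
    filter_upwards [h] with x hx
    rw [_root_.zpow_natCast] at hx
    exact hx.trans (by ring)
  · exfalso
    refine hA (tendsto_nhds_unique (hA1.congr' ?_) (hpow k hk))
    filter_upwards [h, eventually_pos_lt_one] with x h1 h2
    have hx : (x : ℂ) ≠ 0 := by exact_mod_cast h2.1.ne'
    have hxk := pow_ne_zero k hx
    rw [_root_.zpow_neg, _root_.zpow_natCast] at h1
    calc _ = (x : ℂ) ^ k * (A * ((x : ℂ) ^ k)⁻¹ * (1 + u * x + ρ x * x ^ 2)) := by
            field_simp
      _ = _ := by rw [← h1, mul_one]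

theorem HasJet.eventually_ne_zero {G : ℝ → ℂ} {l : ℂ} (h : HasJet G l) :
    ∀ᶠ x : ℝ in 𝓝[>] 0, G x ≠ 0 := by
  obtain ⟨A, D, u, ρ, hA, hρ, h⟩ := h
  have h0 := tendsto_ofReal_zero
  have h1 : Tendsto (fun x : ℝ => 1 + u * x + ρ x * x ^ 2) (𝓝[>] 0) (𝓝 1) := by
    have := ((h0.const_mul u).const_add 1).add (hρ.mul (h0.pow 2))
    simpa using this
  filter_upwards [h, h1.eventually_ne one_ne_zero, eventually_pos_lt_one] with x h1 h2 h3
  have hx : (x : ℂ) ≠ 0 := by exact_mod_cast h3.1.ne'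
  rw [h1]
  exact mul_ne_zero (mul_ne_zero hA (zpow_ne_zero _ hx)) h2

theorem HasJet.unique {G : ℝ → ℂ} {l k : ℂ} (h : HasJet G l) (h' : HasJet G k) : l = k := by
  have := hasJet_one_eq ((h.mul h'.inv).congr (by
    filter_upwards [h.eventually_ne_zero] with x hx; exact mul_inv_cancel₀ hx))
  linear_combination this

/-- The second order invariant of `x ^ a - x ^ b`, up to a factor `-1/2`, in terms of `a - b`. -/
def gapWeight (k : ℤ) : ℤ := if |k| = 1 then 1 else if |k| = 2 then 2 else 0

theorem hasJet_one_sub_pow {k : ℕ} (hk : k ≠ 0) :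
    HasJet (fun x => 1 - (x : ℂ) ^ k) (-(gapWeight k : ℂ) / 2) := by
  have h0 := tendsto_ofReal_zero
  obtain rfl | rfl | hk3 : k = 1 ∨ k = 2 ∨ 3 ≤ k := by omega
  · refine ⟨1, 0, -1, fun _ => 0, one_ne_zero, ?_, ?_⟩
    · norm_num [gapWeight]
    · filter_upwards with x; simp; ring
  · refine ⟨1, 0, 0, fun _ => -1, one_ne_zero, ?_, ?_⟩
    · simp [gapWeight]
    · filter_upwards with x; simp; ring
  · obtain ⟨j, rfl⟩ := Nat.exists_eq_add_of_le hk3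
    refine ⟨1, 0, 0, fun x => -(x : ℂ) ^ (j + 1), one_ne_zero, ?_, ?_⟩
    · have h1 : gapWeight ((3 + j : ℕ) : ℤ) = 0 := by
        simp only [gapWeight, Nat.abs_cast]; split_ifs <;> omega
      rw [h1]
      simpa using (h0.pow (j + 1)).neg
    · filter_upwards with x; simp; ring

theorem gapWeight_neg (k : ℤ) : gapWeight (-k) = gapWeight k := by simp [gapWeight]

theorem hasJet_pow_sub_pow {a b : ℕ} (hab : a ≠ b) :
    HasJet (fun x => (x : ℂ) ^ a - (x : ℂ) ^ b) (-(gapWeight (a - b) : ℂ) / 2) := by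
  rcases lt_or_gt_of_ne hab with h | h
  · obtain ⟨k, rfl⟩ := Nat.exists_eq_add_of_lt h
    have := (hasJet_zpow a).mul (hasJet_one_sub_pow (k := k + 1) (by omega))
    rw [zero_add] at this
    have h2 : ((a : ℤ) - ((a + k + 1 : ℕ) : ℤ)) = -((k + 1 : ℕ) : ℤ) := by push_cast; ring
    rw [h2, gapWeight_neg]
    refine this.congr (Eventually.of_forall fun x => ?_)
    simp only [_root_.zpow_natCast]; ring
  · obtain ⟨k, rfl⟩ := Nat.exists_eq_add_of_lt h
    have := ((hasJet_zpow b).mul (hasJet_one_sub_pow (k := k + 1) (by omega))).mul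
      (hasJet_const (c := -1) (by norm_num))
    rw [zero_add, add_zero] at this
    have h2 : (((b + k + 1 : ℕ) : ℤ) - (b : ℤ)) = ((k + 1 : ℕ) : ℤ) := by push_cast; ring
    rw [h2]
    refine this.congr (Eventually.of_forall fun x => ?_)
    simp only [_root_.zpow_natCast]; ring

theorem tendsto_prod_one_sub {ι : Type*} (S : Finset ι) {ε : ι → ℝ → ℂ}
    (h : ∀ i ∈ S, Tendsto (fun x => ε i x / x) (𝓝[>] 0) (𝓝 0)) :
    Tendsto (fun x => (∏ i ∈ S, (1 - ε i x) - 1 + ∑ i ∈ S, ε i x) / (x : ℂ) ^ 2) (𝓝[>] 0) (𝓝 0) := by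
  classical
  induction S using Finset.induction_on with
  | empty => simp
  | insert a S ha ih =>
    have ih := ih fun i hi => h i (Finset.mem_insert_of_mem hi)
    have h1 := h a (Finset.mem_insert_self _ _)
    have h2 : Tendsto (fun x => ∑ i ∈ S, ε i x / x) (𝓝[>] 0) (𝓝 (∑ i ∈ S, 0)) :=
      tendsto_finsetSum _ fun i hi => h i (Finset.mem_insert_of_mem hi)
    rw [Finset.sum_const_zero] at h2
    have h3 : Tendsto (fun x => ε a x / x * x) (𝓝[>] 0) (𝓝 0) := by
      simpa using h1.mul tendsto_ofReal_zero
    have := (h1.mul h2).add (ih.mul (h3.const_sub 1))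
    simp only [mul_zero, sub_zero, zero_mul, add_zero] at this
    refine this.congr' ?_
    filter_upwards [eventually_pos_lt_one] with x hx
    have hx : (x : ℂ) ≠ 0 := by exact_mod_cast hx.1.ne'
    rw [Finset.prod_insert ha, Finset.sum_insert ha, ← Finset.sum_div]
    field_simp
    ring

theorem hasJet_prod_one_sub {ι : Type*} (S : Finset ι) {ε : ι → ℝ → ℂ} {l : ℂ}
    (h : ∀ i ∈ S, Tendsto (fun x => ε i x / x) (𝓝[>] 0) (𝓝 0))
    (h' : Tendsto (fun x => (∑ i ∈ S, ε i x) / (x : ℂ) ^ 2) (𝓝[>] 0) (𝓝 l)) :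
    HasJet (fun x => ∏ i ∈ S, (1 - ε i x)) (-l) := by
  refine (hasJet_one_add (ε := fun x => ∏ i ∈ S, (1 - ε i x) - 1) ?_).congr
    (Eventually.of_forall fun x => by ring)
  have := (tendsto_prod_one_sub S h).sub h'
  rw [zero_sub] at this
  refine this.congr fun x => ?_
  ring

/-- The tails of the Taylor expansion at the origin. -/
noncomputable def tail (G : ℂ → ℂ) : ℕ → ℂ → ℂ
  | 0 => G
  | j + 1 => dslope (tail G j) 0

theorem tail_diff {G : ℂ → ℂ} (hG : DifferentiableOn ℂ G (Metric.ball 0 1)) (j : ℕ) :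
    DifferentiableOn ℂ (tail G j) (Metric.ball 0 1) := by
  induction j with
  | zero => exact hG
  | succ j ih => exact (Complex.differentiableOn_dslope (Metric.ball_mem_nhds 0 one_pos)).2 ih

theorem tail_eq (G : ℂ → ℂ) (j : ℕ) (q : ℂ) : tail G j q = tail G j 0 + q * tail G (j + 1) q := by
  have := sub_smul_dslope (tail G j) 0 q
  rw [sub_zero, smul_eq_mul] at this
  rw [tail, this]; ring

theorem tail_eq_sum (G : ℂ → ℂ) (i D : ℕ) (q : ℂ) :
    tail G i q = ∑ j ∈ Finset.range D, tail G (i + j) 0 * q ^ j + q ^ D * tail G (i + D) q := by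
  induction D with
  | zero => simp
  | succ D ih =>
    rw [Finset.sum_range_succ, ih, tail_eq G (i + D) q, ← add_assoc i D 1]
    ring

theorem tail_tendsto {G : ℂ → ℂ} (hG : DifferentiableOn ℂ G (Metric.ball 0 1)) (j : ℕ) :
    Tendsto (tail G j) (𝓝 0) (𝓝 (tail G j 0)) :=
  ((tail_diff hG j).differentiableAt (Metric.ball_mem_nhds 0 one_pos)).continuousAt

theorem mul_dslope_tail {G : ℂ → ℂ} (hG : DifferentiableOn ℂ G (Metric.ball 0 1)) (j : ℕ) {p Q : ℂ}
    (hQ : Q ∈ Metric.ball (0 : ℂ) 1) :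
    p * Q * dslope (tail G j) Q p =
      Q * (tail G j p - tail G j 0) + p * Q ^ 2 * dslope (tail G (j + 1)) Q p := by
  by_cases h : p = Q
  · subst h
    rw [dslope_same, dslope_same]
    have h1 : DifferentiableAt ℂ (tail G (j + 1)) p :=
      (tail_diff hG (j + 1)).differentiableAt (Metric.isOpen_ball.mem_nhds hQ)
    have h2 : HasDerivAt (tail G j) (tail G (j + 1) p + p * deriv (tail G (j + 1)) p) p := by
      have := ((hasDerivAt_id p).fun_mul h1.hasDerivAt).const_add (tail G j 0)
      simp only [id, one_mul] at this
      exact this.congr_of_eventuallyEq (Eventually.of_forall fun q => tail_eq G j q)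
    rw [h2.deriv, tail_eq G j p]
    ring
  · have hs : p - Q ≠ 0 := sub_ne_zero.2 h
    rw [dslope_of_ne _ h, dslope_of_ne _ h, slope_def_field, slope_def_field, tail_eq G j p,
      tail_eq G j Q]
    field_simp
    ring

theorem exists_dslope_bound {F : ℂ → ℂ} (hF : DifferentiableOn ℂ F (Metric.ball 0 1)) :
    ∃ C r : ℝ, 0 < r ∧ ∀ p Q : ℂ, ‖p‖ < r → ‖Q‖ < r → ‖dslope F Q p‖ ≤ C := by
  have hA : AnalyticAt ℂ F 0 := hF.analyticAt (Metric.ball_mem_nhds 0 one_pos)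
  obtain ⟨K, t, ht, hK⟩ := (hA.contDiffAt (n := 1)).exists_lipschitzOnWith
  obtain ⟨r, hr, hrt⟩ := Metric.mem_nhds_iff.1 ht
  refine ⟨K, r, hr, fun p Q hp hQ => ?_⟩
  have hp : p ∈ Metric.ball (0 : ℂ) r := by simpa using hp
  have hQ : Q ∈ Metric.ball (0 : ℂ) r := by simpa using hQ
  by_cases h : p = Q
  · subst h
    rw [dslope_same]
    exact norm_deriv_le_of_lipschitzOn (Metric.isOpen_ball.mem_nhds hp) (hK.mono hrt)
  · rw [dslope_of_ne _ h, slope_def_field, norm_div]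
    have := (hK.mono hrt).norm_sub_le hp hQ
    rwa [div_le_iff₀ (norm_pos_iff.2 (sub_ne_zero.2 h))]

theorem IsPrimitiveRoot.sum_pow_pow {ζ : ℂ} {d : ℕ} (h : IsPrimitiveRoot ζ d) {j : ℕ} :
    ∑ b ∈ Finset.range d, (ζ ^ b) ^ j = if d ∣ j then (d : ℂ) else 0 := by
  have h1 : ∀ b, (ζ ^ b) ^ j = (ζ ^ j) ^ b := fun b => by rw [← pow_mul, ← pow_mul, mul_comm]
  simp only [h1]
  split_ifs with hd
  · rw [(h.pow_eq_one_iff_dvd j).2 hd]; simp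
  · have h2 : ζ ^ j - 1 ≠ 0 := sub_ne_zero.2 fun h3 => hd ((h.pow_eq_one_iff_dvd j).1 h3)
    have h3 := mul_geom_sum (ζ ^ j) d
    rw [← pow_mul, mul_comm j, pow_mul, h.pow_eq_one, one_pow, sub_self] at h3
    exact (mul_eq_zero.1 h3).resolve_left h2

theorem sum_tail_roots (G : ℂ → ℂ) {ζ : ℂ} {d : ℕ} (h : IsPrimitiveRoot ζ d) (hd : 0 < d) (v : ℂ) :
    ∑ b ∈ Finset.range d, (tail G 1 (ζ ^ b * v) - tail G 1 0) =
      v ^ d * (d * tail G (d + 1) 0 +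
        v * ∑ b ∈ Finset.range d, ζ ^ b * tail G (d + 2) (ζ ^ b * v)) := by
  have h1 : ∀ b, tail G 1 (ζ ^ b * v) - tail G 1 0 =
      ∑ j ∈ Finset.range d, (tail G (j + 2) 0 * v ^ (j + 1)) * (ζ ^ b) ^ (j + 1) +
        v ^ d * v * (ζ ^ b * tail G (d + 2) (ζ ^ b * v)) := by
    intro b
    rw [tail_eq_sum G 1 (d + 1), Finset.sum_range_succ', mul_pow _ v (d + 1), pow_succ (ζ ^ b) d,
      ← pow_mul ζ b d, mul_comm b d, pow_mul, h.pow_eq_one, one_pow]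
    simp only [pow_zero, mul_one, add_zero]
    have : ∀ j, tail G (1 + (j + 1)) 0 * (ζ ^ b * v) ^ (j + 1) =
        (tail G (j + 2) 0 * v ^ (j + 1)) * (ζ ^ b) ^ (j + 1) := fun j => by
      rw [show 1 + (j + 1) = j + 2 by ring]; ring
    simp only [this]
    rw [show 1 + (d + 1) = d + 2 by ring]
    ring
  simp only [h1, Finset.sum_add_distrib, ← Finset.mul_sum]
  rw [Finset.sum_comm]
  simp only [← Finset.mul_sum, IsPrimitiveRoot.sum_pow_pow h]
  rw [Finset.sum_eq_single (d - 1)]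
  · rw [Nat.sub_add_cancel hd, show d - 1 + 2 = d + 1 by omega]
    simp only [dvd_refl, if_true]
    ring
  · intro j hj hjd
    rw [if_neg, mul_zero]
    intro hdj
    have := Nat.le_of_dvd (by omega) hdj
    rw [Finset.mem_range] at hj
    omega
  · intro h; simp at h; omega

theorem prod_sub_roots {ζ : ℂ} {d : ℕ} (h : IsPrimitiveRoot ζ d) (hd : 0 < d) (Q v : ℂ) :
    ∏ b ∈ Finset.range d, (Q - ζ ^ b * v) = Q ^ d - v ^ d := by
  have : NeZero d := ⟨hd.ne'⟩
  rw [h.pow_sub_pow_eq_prod_sub_mul Q v hd]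
  refine Finset.prod_nbij (fun b => ζ ^ b) ?_ ?_ ?_ (fun _ _ => rfl)
  · intro b hb
    rw [Polynomial.mem_nthRootsFinset hd, ← pow_mul, mul_comm, pow_mul, h.pow_eq_one, one_pow]
  · intro a ha b hb hab
    simp only [Finset.coe_range, Set.mem_Iio] at ha hb
    exact h.pow_inj ha hb hab
  · intro x hx
    rw [Finset.mem_coe, Polynomial.mem_nthRootsFinset hd] at hx
    obtain ⟨i, hi, rfl⟩ := h.eq_pow_of_pow_eq_one hx
    exact ⟨i, by simpa using hi, rfl⟩

/-- The correction factors of one block of the modular polynomial. -/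
theorem hasJet_block {G : ℂ → ℂ} (hG : DifferentiableOn ℂ G (Metric.ball 0 1)) {ζ : ℂ} {d : ℕ}
    (h : IsPrimitiveRoot ζ d) (hd : 0 < d) {s A : ℕ} (hs : 0 < s) (hA : 0 < A) {v : ℝ → ℂ}
    (hv : Tendsto v (𝓝[>] 0) (𝓝 0)) (hvd : ∀ᶠ x : ℝ in 𝓝[>] 0, v x ^ d = (x : ℂ) ^ A) :
    HasJet (fun x => ∏ b ∈ Finset.range d,
      (1 - (ζ ^ b * v x) * (x : ℂ) ^ s * dslope (tail G 1) ((x : ℂ) ^ s) (ζ ^ b * v x)))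
      (-(if s = 1 ∧ A = 1 then d * tail G (d + 1) 0 else 0)) := by
  have h0 := tendsto_ofReal_zero
  obtain ⟨s, rfl⟩ : ∃ s', s = s' + 1 := ⟨s - 1, by omega⟩
  obtain ⟨A, rfl⟩ : ∃ s', A = s' + 1 := ⟨A - 1, by omega⟩
  have hpow : ∀ k : ℕ, Tendsto (fun x : ℝ => (x : ℂ) ^ k) (𝓝[>] 0) (𝓝 (if k = 0 then 1 else 0)) := by
    intro k
    by_cases hk : k = 0
    · simp [hk]
    · simpa [hk] using h0.pow k
  have hp : ∀ b, Tendsto (fun x => ζ ^ b * v x) (𝓝[>] 0) (𝓝 0) := fun b => by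
    simpa using hv.const_mul (ζ ^ b)
  have hQ : Tendsto (fun x : ℝ => (x : ℂ) ^ (s + 1)) (𝓝[>] 0) (𝓝 0) := by simpa using hpow (s + 1)
  obtain ⟨C, r, hr, hC⟩ := exists_dslope_bound (tail_diff hG 2)
  have hD : ∀ b, Tendsto (fun x => (ζ ^ b * v x) *
      dslope (tail G 2) ((x : ℂ) ^ (s + 1)) (ζ ^ b * v x)) (𝓝[>] 0) (𝓝 0) := by
    intro b
    refine (hp b).zero_mul_isBoundedUnder_le ⟨C, ?_⟩
    rw [eventually_map]
    have hball : Metric.ball (0 : ℂ) r ∈ 𝓝 (0 : ℂ) := Metric.ball_mem_nhds 0 hr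
    filter_upwards [(hp b).eventually hball, hQ.eventually hball] with x h1 h2
    exact hC _ _ (by simpa using h1) (by simpa using h2)
  have hball : ∀ᶠ x : ℝ in 𝓝[>] 0, (x : ℂ) ^ (s + 1) ∈ Metric.ball (0 : ℂ) 1 :=
    hQ.eventually (Metric.ball_mem_nhds 0 one_pos)
  have htail : ∀ b j, Tendsto (fun x => tail G j (ζ ^ b * v x)) (𝓝[>] 0) (𝓝 (tail G j 0)) :=
    fun b j => (tail_tendsto hG j).comp (hp b)
  refine hasJet_prod_one_sub _ (fun b _ => ?_) ?_
  · have h1 : Tendsto (fun x => tail G 1 (ζ ^ b * v x) - tail G 1 0) (𝓝[>] 0) (𝓝 0) := by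
      simpa using (htail b 1).sub_const (tail G 1 0)
    have := ((hpow s).mul h1).add (((hpow s).mul hQ).mul (hD b))
    simp only [mul_zero, add_zero] at this
    refine this.congr' ?_
    filter_upwards [hball, eventually_pos_lt_one] with x h2 hx
    have hx : (x : ℂ) ≠ 0 := by exact_mod_cast hx.1.ne'
    rw [mul_dslope_tail hG 1 h2]
    field_simp
    ring
  · have h1 := tendsto_finsetSum (Finset.range d) fun b _ => hD b
    have h2 := tendsto_finsetSum (Finset.range d) fun b (_ : b ∈ Finset.range d) =>
      (htail b (d + 2)).const_mul (ζ ^ b)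
    have h3 := ((hpow s).mul ((hpow A).mul ((hv.mul h2).const_add (d * tail G (d + 1) 0)))).add
      (((hpow s).mul (hpow s)).mul h1)
    simp only [Finset.sum_const_zero, mul_zero, zero_mul, add_zero] at h3
    have h4 : (if s + 1 = 1 ∧ A + 1 = 1 then (d : ℂ) * tail G (d + 1) 0 else 0) =
        (if s = 0 then (1 : ℂ) else 0) * ((if A = 0 then 1 else 0) * (d * tail G (d + 1) 0)) := by
      by_cases hs : s = 0 <;> by_cases hA : A = 0 <;> simp [hs, hA]
    rw [h4]
    refine h3.congr' ?_
    filter_upwards [hball, eventually_pos_lt_one, hvd] with x h2 hx h5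
    have hx : (x : ℂ) ≠ 0 := by exact_mod_cast hx.1.ne'
    simp only [mul_dslope_tail hG 1 h2, Finset.sum_add_distrib, ← Finset.mul_sum]
    rw [sum_tail_roots G h hd, h5]
    have h6 : ∑ b ∈ Finset.range d, ζ ^ b * v x * ((x : ℂ) ^ (s + 1)) ^ 2 *
        dslope (tail G (1 + 1)) ((x : ℂ) ^ (s + 1)) (ζ ^ b * v x) =
        ((x : ℂ) ^ (s + 1)) ^ 2 * ∑ b ∈ Finset.range d, ζ ^ b * v x *
        dslope (tail G 2) ((x : ℂ) ^ (s + 1)) (ζ ^ b * v x) := by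
      rw [Finset.mul_sum]
      exact Finset.sum_congr rfl fun b _ => by ring
    rw [h6]
    field_simp
    ring

/-- The point of the imaginary axis whose `q`-parameter is `x`. -/
noncomputable def axisPt (x : ℝ) : ℂ := I * ((-Real.log x / (2 * Real.pi) : ℝ) : ℂ)

theorem qc_axisPt_mul {x : ℝ} (hx : 0 < x) (r : ℝ) : qc (r * axisPt x) = ((x ^ r : ℝ) : ℂ) := by
  rw [qc, axisPt, Real.rpow_def_of_pos hx, Complex.ofReal_exp]
  congr 1
  have : (Real.pi : ℂ) ≠ 0 := by exact_mod_cast Real.pi_ne_zero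
  push_cast
  field_simp
  rw [I_sq]
  ring

theorem qc_natCast_axisPt {x : ℝ} (hx : 0 < x) (k : ℕ) : qc (k * axisPt x) = (x : ℂ) ^ k := by
  have := qc_axisPt_mul hx k
  rw [Real.rpow_natCast] at this
  simpa using this

theorem axisPt_im_pos {x : ℝ} (hx : 0 < x) (h1 : x < 1) : 0 < (axisPt x).im := by
  simp only [axisPt, I_mul_im, ofReal_re]
  exact div_pos (neg_pos.2 (Real.log_neg hx h1)) (by positivity)

theorem haupt_eq {h G : ℂ → ℂ} (hG0 : G 0 = 1)
    (hG : ∀ z : ℂ, 0 < z.im → h z * qc z = G (qc z)) {z : ℂ} (hz : 0 < z.im) :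
    h z = (qc z)⁻¹ + tail G 1 (qc z) := by
  have h1 := hG z hz
  have h2 := tail_eq G 0 (qc z)
  have hq := qc_ne_zero z
  rw [tail, hG0] at h2
  rw [h2] at h1
  field_simp
  linear_combination h1

theorem haupt_sub_eq {h G : ℂ → ℂ} (hG0 : G 0 = 1)
    (hG : ∀ z : ℂ, 0 < z.im → h z * qc z = G (qc z)) {z w : ℂ} (hz : 0 < z.im) (hw : 0 < w.im)
    (hne : qc w ≠ qc z) :
    h z - h w = (qc w - qc z) / (qc w * qc z) *
      (1 - qc w * qc z * dslope (tail G 1) (qc z) (qc w)) := by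
  have hq := qc_ne_zero z
  have hq2 := qc_ne_zero w
  have hs : qc w - qc z ≠ 0 := sub_ne_zero.2 hne
  rw [haupt_eq hG0 hG hz, haupt_eq hG0 hG hw, dslope_of_ne _ hne, slope_def_field]
  field_simp
  ring

theorem hasDerivAt_qc (z : ℂ) : HasDerivAt qc (2 * Real.pi * I * qc z) z := by
  have := ((hasDerivAt_id z).const_mul (2 * Real.pi * I : ℂ)).cexp
  simp only [id, mul_one] at this
  rw [mul_comm]
  exact this

theorem haupt_deriv_eq {h G : ℂ → ℂ} (hGd : DifferentiableOn ℂ G (Metric.ball 0 1)) (hG0 : G 0 = 1)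
    (hG : ∀ z : ℂ, 0 < z.im → h z * qc z = G (qc z)) {z : ℂ} (hz : 0 < z.im) :
    deriv h z = -(2 * Real.pi * I) / qc z *
      (1 - qc z * qc z * dslope (tail G 1) (qc z) (qc z)) := by
  have hq := qc_ne_zero z
  have hmem : qc z ∈ Metric.ball (0 : ℂ) 1 := by simpa using norm_qc_lt_one hz
  have h1 : HasDerivAt (tail G 1) (deriv (tail G 1) (qc z)) (qc z) :=
    ((tail_diff hGd 1).differentiableAt (Metric.isOpen_ball.mem_nhds hmem)).hasDerivAt
  have h2 := ((hasDerivAt_inv hq).add h1).comp z (hasDerivAt_qc z)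
  have h3 : h =ᶠ[𝓝 z] ((fun y => y⁻¹) + tail G 1) ∘ qc := by
    filter_upwards [(isOpen_lt continuous_const Complex.continuous_im).mem_nhds hz] with w hw
    exact haupt_eq hG0 hG hw
  rw [(h2.congr_of_eventuallyEq h3).deriv, dslope_same]
  field_simp
  ring

open Classical in
/-- A factor of the modular polynomial, the degenerate one being replaced by a derivative. -/
noncomputable def fullFactor (M s t : ℕ) [NeZero M] (h : ℂ → ℂ) (X : SL2R) (z : ℂ) : ℂ :=
  if Coincide M s t X then s * deriv h (s * z) else h (moebius (dil s) z) - h (moebius (X * dil t) z)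

theorem moebius_repMat_mul_dil {a d t : ℕ} (ha : 0 < a) (hd : 0 < d) (ht : 0 < t) (b : ℕ) {z : ℂ}
    (hz : 0 < z.im) :
    moebius (repMat ⟨(a, d), b⟩ * dil t) z = ((a * t : ℕ) / d : ℝ) * z + (b : ℂ) / d := by
  have h1 := coe_smul_moebius (repMat ⟨(a, d), b⟩ * dil t) ⟨z, hz⟩
  change _ = moebius _ z at h1
  rw [← h1, mul_smul, repMat, upper_smul (by positivity), dil_smul ht]
  push_cast
  change ((a : ℂ) * (t * z) + b) / d = _
  ring

theorem hasJet_fullFactor {M n s t : ℕ} [NeZero M] (hs : 0 < s) (ht : 0 < t) {h G : ℂ → ℂ}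
    (hGd : DifferentiableOn ℂ G (Metric.ball 0 1)) (hG0 : G 0 = 1)
    (hG : ∀ z : ℂ, 0 < z.im → h z * qc z = G (qc z)) {a d : ℕ} (had : (a, d) ∈ diagPairs M n) :
    HasJet (fun x => ∏ b ∈ Finset.range d, fullFactor M s t h (repMat ⟨(a, d), b⟩) (axisPt x))
      (-(gapWeight (a * t - s * d) : ℂ) / 2 -
        if s = 1 ∧ a * t = 1 then d * tail G (d + 1) 0 else 0) := by
  obtain ⟨ha, hd, -⟩ := (mem_diagPairs (Nat.pos_of_neZero M)).1 had
  dsimp only at ha hd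
  have hidx : ∀ b ∈ Finset.range d, (⟨(a, d), b⟩ : Σ _ : ℕ × ℕ, ℕ) ∈ repIdx M n := fun b hb =>
    Finset.mem_sigma.2 ⟨had, hb⟩
  set ζ : ℂ := qc (1 / d) with hζdef
  have hd' : (d : ℂ) ≠ 0 := by exact_mod_cast hd.ne'
  have hζ : IsPrimitiveRoot ζ d := by
    have := Complex.isPrimitiveRoot_exp d hd.ne'
    rwa [show (2 * Real.pi * I / d : ℂ) = 2 * Real.pi * I * (1 / d) by ring] at this
  have hζ0 : ζ ≠ 0 := qc_ne_zero _
  set r : ℝ := ((a * t : ℕ) : ℝ) / d with hr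
  have hr0 : 0 < r := by positivity
  set v : ℝ → ℂ := fun x => ((x ^ r : ℝ) : ℂ) with hvdef
  have hv : Tendsto v (𝓝[>] 0) (𝓝 0) := by
    have h1 : Tendsto (fun x : ℝ => x ^ r) (𝓝[>] 0) (𝓝 0) := by
      have := (Real.continuousAt_rpow_const 0 r (Or.inr hr0.le)).tendsto
      rw [Real.zero_rpow hr0.ne'] at this
      exact this.mono_left nhdsWithin_le_nhds
    exact (Complex.continuous_ofReal.tendsto' 0 0 Complex.ofReal_zero).comp h1
  have hvd : ∀ x : ℝ, 0 < x → v x ^ d = (x : ℂ) ^ (a * t) := by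
    intro x hx
    have h2 : (x ^ r) ^ d = x ^ (a * t) := by
      rw [← Real.rpow_natCast, ← Real.rpow_mul hx.le, hr, div_mul_cancel₀ _ (by positivity),
        Real.rpow_natCast]
    simp only [hvdef]
    exact_mod_cast h2
  have hv0 : ∀ x : ℝ, 0 < x → v x ≠ 0 := fun x hx => by
    simp only [hvdef]; exact_mod_cast (Real.rpow_pos_of_pos hx r).ne'
  have hqQ : ∀ x : ℝ, 0 < x → qc (moebius (dil s) (axisPt x)) = (x : ℂ) ^ s := fun x hx => by
    rw [moebius_dil hs, qc_natCast_axisPt hx]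
  have hqp : ∀ x : ℝ, 0 < x → x < 1 → ∀ b : ℕ,
      qc (moebius (repMat ⟨(a, d), b⟩ * dil t) (axisPt x)) = ζ ^ b * v x := fun x hx hx1 b => by
    rw [moebius_repMat_mul_dil ha hd ht b (axisPt_im_pos hx hx1), qc_add, qc_axisPt_mul hx,
      hζdef, ← qc_natCast_mul, mul_comm]
    congr 2
    ring
  set pref : ℕ → ℝ → ℂ := fun b x => if a * t = s * d ∧ b = 0 then -(2 * Real.pi * I * s) / (x : ℂ) ^ s
    else (ζ ^ b * v x - (x : ℂ) ^ s) / (ζ ^ b * v x * (x : ℂ) ^ s) with hpref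
  have hvQ : a * t = s * d → ∀ x : ℝ, 0 < x → v x = (x : ℂ) ^ s := by
    intro hE x hx
    simp only [hvdef]
    rw [hr, hE]
    push_cast
    rw [mul_div_cancel_right₀ _ (by positivity), Real.rpow_natCast]
    push_cast; rfl
  have hfac : ∀ x : ℝ, 0 < x → x < 1 → ∀ b ∈ Finset.range d,
      fullFactor M s t h (repMat ⟨(a, d), b⟩) (axisPt x) = pref b x *
        (1 - (ζ ^ b * v x) * (x : ℂ) ^ s * dslope (tail G 1) ((x : ℂ) ^ s) (ζ ^ b * v x)) := by
    intro x hx hx1 b hb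
    have hz := axisPt_im_pos hx hx1
    rw [fullFactor]
    by_cases hc : a * t = s * d ∧ b = 0
    · rw [if_pos ((coincide_iff hs ht (hidx b hb)).2 hc)]
      simp only [hpref, if_pos hc]
      have hz' : 0 < ((s : ℂ) * axisPt x).im := natCast_mul_im_pos hs hz
      rw [haupt_deriv_eq hGd hG0 hG hz', qc_natCast_axisPt hx, hc.2, pow_zero, one_mul,
        hvQ hc.1 x hx]
      ring
    · rw [if_neg fun h => hc ((coincide_iff hs ht (hidx b hb)).1 h)]
      simp only [hpref, if_neg hc]
      rw [haupt_sub_eq hG0 hG (moebius_im_pos _ hz) (moebius_im_pos _ hz), hqQ x hx, hqp x hx hx1]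
      rw [hqQ x hx, hqp x hx hx1]
      intro h1
      by_cases hE : a * t = s * d
      · rw [hvQ hE x hx] at h1
        have h2 : ζ ^ b = 1 :=
          mul_right_cancel₀ (pow_ne_zero s (by exact_mod_cast hx.ne' : (x : ℂ) ≠ 0))
            (h1.trans (one_mul _).symm)
        have h3 := Nat.eq_zero_of_dvd_of_lt ((hζ.pow_eq_one_iff_dvd b).1 h2) (Finset.mem_range.1 hb)
        exact hc ⟨hE, h3⟩
      · have h2 := congrArg (· ^ d) h1
        rw [mul_pow, hvd x hx, ← pow_mul ζ, mul_comm b, pow_mul, hζ.pow_eq_one, one_pow, one_mul,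
          ← pow_mul] at h2
        have h3 : x ^ (a * t) = x ^ (s * d) := by exact_mod_cast h2
        exact hE (pow_right_injective₀ hx hx1.ne h3)
  have hblock := hasJet_block hGd hζ hd hs (A := a * t) (by positivity) hv (by
    filter_upwards [eventually_pos_lt_one] with x hx using hvd x hx.1)
  have hprefJ : HasJet (fun x => ∏ b ∈ Finset.range d, pref b x)
      (-(gapWeight (a * t - s * d) : ℂ) / 2) := by
    by_cases hE : a * t = s * d
    · have h1 : ∀ b ∈ Finset.range d, HasJet (pref b) 0 := by
        intro b hb
        by_cases hb0 : b = 0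
        · have hc : -(2 * Real.pi * I * s) ≠ 0 := by
            simp [hs.ne', Real.pi_ne_zero]
          have := (hasJet_const hc).mul (hasJet_zpow (-s))
          rw [add_zero] at this
          refine this.congr (Eventually.of_forall fun x => ?_)
          simp [hpref, hE, hb0, div_eq_mul_inv]
        · have hc : (ζ ^ b - 1) / ζ ^ b ≠ 0 := by
            refine div_ne_zero (sub_ne_zero.2 fun h2 => hb0 ?_) (pow_ne_zero _ hζ0)
            exact Nat.eq_zero_of_dvd_of_lt ((hζ.pow_eq_one_iff_dvd b).1 h2) (Finset.mem_range.1 hb)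
          have := (hasJet_const hc).mul (hasJet_zpow (-s))
          rw [add_zero] at this
          refine this.congr ?_
          filter_upwards [eventually_pos_lt_one] with x hx
          have hx' : (x : ℂ) ≠ 0 := by exact_mod_cast hx.1.ne'
          simp only [hpref, hb0, and_false, if_false]
          rw [hvQ hE x hx.1, _root_.zpow_neg, _root_.zpow_natCast]
          have := pow_ne_zero s hx'
          have := pow_ne_zero b hζ0
          field_simp
      have := HasJet.prod _ h1
      have h2 : ((a : ℤ) * t - s * d) = 0 := by rw [sub_eq_zero]; exact_mod_cast hE
      rw [h2]
      simpa [gapWeight] using this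
    · have hc : (-1) ^ d / ∏ b ∈ Finset.range d, ζ ^ b ≠ 0 :=
        div_ne_zero (pow_ne_zero _ (by norm_num))
          (Finset.prod_ne_zero_iff.2 fun b _ => pow_ne_zero _ hζ0)
      have := ((hasJet_const hc).mul (hasJet_pow_sub_pow (a := s * d) (b := a * t) (Ne.symm hE))).mul
        (hasJet_zpow (-(a * t + s * d : ℕ)))
      have h2 : ((a : ℤ) * t - s * d) = -(((s * d : ℕ) : ℤ) - ((a * t : ℕ) : ℤ)) := by
        push_cast; ring
      rw [h2, gapWeight_neg]
      rw [zero_add, add_zero] at this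
      refine this.congr ?_
      filter_upwards [eventually_pos_lt_one] with x hx
      have hx' : (x : ℂ) ≠ 0 := by exact_mod_cast hx.1.ne'
      simp only [hpref, hE, false_and, if_false]
      rw [Finset.prod_div_distrib, Finset.prod_mul_distrib, Finset.prod_mul_distrib]
      have h3 : ∏ b ∈ Finset.range d, (ζ ^ b * v x - (x : ℂ) ^ s) =
          (-1) ^ d * ((x : ℂ) ^ (s * d) - (x : ℂ) ^ (a * t)) := by
        rw [pow_mul, ← hvd x hx.1, ← prod_sub_roots hζ hd]
        rw [← Finset.card_range d, ← Finset.prod_const, Finset.card_range, ← Finset.prod_mul_distrib]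
        exact Finset.prod_congr rfl fun b _ => by ring
      rw [h3, Finset.prod_const, Finset.prod_const, Finset.card_range, hvd x hx.1, ← pow_mul (x : ℂ) s,
        _root_.zpow_neg, _root_.zpow_natCast, pow_add]
      have := pow_ne_zero (a * t) hx'
      have := pow_ne_zero (s * d) hx'
      have h4 : ∏ b ∈ Finset.range d, ζ ^ b ≠ 0 := Finset.prod_ne_zero_iff.2 fun b _ => pow_ne_zero _ hζ0
      field_simp
  have := hprefJ.mul hblock
  rw [← sub_eq_add_neg] at this
  refine this.congr ?_
  filter_upwards [eventually_pos_lt_one] with x hx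
  rw [← Finset.prod_mul_distrib]
  exact (Finset.prod_congr rfl (hfac x hx.1 hx.2)).symm

theorem multipliable_one_sub_pow {q : ℂ} (hq : ‖q‖ < 1) (k : ℕ) :
    Multipliable fun n : ℕ => 1 - q ^ (n + k) := by
  have h1 : Summable fun n : ℕ => ‖-q ^ (n + k)‖ := by
    simp only [norm_neg, norm_pow]
    exact (summable_nat_add_iff k).2 (summable_geometric_of_lt_one (norm_nonneg _) hq)
  simpa [sub_eq_add_neg] using multipliable_one_add_of_summable h1

theorem eulerP_eq {q : ℂ} (hq : ‖q‖ < 1) :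
    eulerP q = (1 - q) * ((1 - q ^ 2) * ∏' n : ℕ, (1 - q ^ (n + 3))) := by
  have h := (multipliable_one_sub_pow hq 3).prod_mul_tprod_nat_mul' (f := fun n => 1 - q ^ (n + 1))
    (k := 2)
  rw [eulerP, ← h]
  simp [Finset.prod_range_succ, mul_assoc]

theorem norm_tprod_sub_one_le {q : ℂ} (hq : ‖q‖ ≤ 1 / 2) :
    ‖∏' n : ℕ, (1 - q ^ (n + 3)) - 1‖ ≤ 4 * ‖q‖ ^ 3 := by
  have hq1 : ‖q‖ < 1 := by linarith
  have hs := summable_geometric_of_lt_one (norm_nonneg _) hq1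
  have h0 : ∀ n : ℕ, ‖-q ^ (n + 3)‖ = ‖q‖ ^ 3 * ‖q‖ ^ n := fun n => by
    rw [norm_neg, norm_pow, pow_add, mul_comm]
  have h1 : Summable fun n : ℕ => ‖-q ^ (n + 3)‖ := by
    simp only [h0]; exact hs.mul_left _
  have hm : Multipliable fun n : ℕ => 1 + -q ^ (n + 3) := multipliable_one_add_of_summable h1
  have h2 : ‖∏' n : ℕ, (1 + -q ^ (n + 3)) - 1‖ ≤ Real.exp (∑' n : ℕ, ‖-q ^ (n + 3)‖) - 1 := by
    refine le_of_tendsto ((hm.hasProd.sub_const 1).norm) (Eventually.of_forall fun t => ?_)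
    refine (t.norm_prod_one_add_sub_one_le _).trans ?_
    gcongr
    exact h1.sum_le_tsum t fun _ _ => norm_nonneg _
  have h3 : ∑' n : ℕ, ‖-q ^ (n + 3)‖ ≤ 2 * ‖q‖ ^ 3 := by
    simp only [h0]
    rw [tsum_mul_left, tsum_geometric_of_lt_one (norm_nonneg _) hq1, mul_comm]
    gcongr
    rw [inv_le_comm₀ (by linarith) (by norm_num)]
    linarith
  have h4 : 2 * ‖q‖ ^ 3 ≤ 1 := by
    have : ‖q‖ ^ 3 ≤ (1 / 2) ^ 3 := by gcongr
    linarith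
  have h5 : Real.exp (∑' n : ℕ, ‖-q ^ (n + 3)‖) - 1 ≤ 2 * (2 * ‖q‖ ^ 3) := by
    have h6 : 0 ≤ 2 * ‖q‖ ^ 3 := by positivity
    have := Real.abs_exp_sub_one_le (x := 2 * ‖q‖ ^ 3) (by rwa [abs_of_nonneg h6])
    rw [abs_of_nonneg h6] at this
    have h7 := Real.exp_le_exp.2 h3
    linarith [le_abs_self (Real.exp (2 * ‖q‖ ^ 3) - 1)]
  have h8 : ∏' n : ℕ, (1 + -q ^ (n + 3)) = ∏' n : ℕ, (1 - q ^ (n + 3)) := by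
    simp only [sub_eq_add_neg]
  rw [h8] at h2
  linarith

theorem hasJet_eulerP {s : ℕ} (hs : 0 < s) :
    HasJet (fun x => eulerP ((x : ℂ) ^ s)) (-((gapWeight s + gapWeight (2 * s) : ℤ) : ℂ) / 2) := by
  have h0 := tendsto_ofReal_zero
  have hQ : Tendsto (fun x : ℝ => (x : ℂ) ^ s) (𝓝[>] 0) (𝓝 0) := by simpa [hs.ne'] using h0.pow s
  have hball : ∀ᶠ x : ℝ in 𝓝[>] 0, ‖(x : ℂ) ^ s‖ ≤ 1 / 2 := by
    filter_upwards [hQ.eventually (Metric.ball_mem_nhds 0 (by norm_num : (0 : ℝ) < 1 / 2))] with x hx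
    simp only [Metric.mem_ball, dist_zero_right] at hx
    exact hx.le
  have hR : HasJet (fun x : ℝ => 1 + (∏' n : ℕ, (1 - ((x : ℂ) ^ s) ^ (n + 3)) - 1)) 0 := by
    refine hasJet_one_add ?_
    have h1 : Tendsto (fun x : ℝ => 4 * x) (𝓝[>] 0) (𝓝 0) :=
      ((by fun_prop : Continuous fun x : ℝ => 4 * x).tendsto' 0 0 (by simp)).mono_left nhdsWithin_le_nhds
    refine squeeze_zero_norm' ?_ h1
    filter_upwards [hball, eventually_pos_lt_one] with x h1 h2
    have h3 := norm_tprod_sub_one_le h1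
    rw [norm_div, norm_pow, Complex.norm_real, Real.norm_of_nonneg h2.1.le, div_le_iff₀ (by
      have := h2.1; positivity)]
    refine h3.trans ?_
    rw [norm_pow, Complex.norm_real, Real.norm_of_nonneg h2.1.le]
    have h4 : (x ^ s) ^ 3 ≤ x ^ 3 := by
      have : x ^ s ≤ x := pow_le_of_le_one h2.1.le h2.2.le hs.ne'
      have := h2.1
      gcongr
    nlinarith
  have h3 := (hasJet_one_sub_pow (k := s) hs.ne').mul
    ((hasJet_one_sub_pow (k := s * 2) (by positivity)).mul hR)
  have h4 : -((gapWeight s + gapWeight (2 * s) : ℤ) : ℂ) / 2 =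
      -(gapWeight s : ℂ) / 2 + (-(gapWeight ((s * 2 : ℕ) : ℤ) : ℂ) / 2 + 0) := by
    rw [show ((s * 2 : ℕ) : ℤ) = 2 * s by push_cast; ring]
    push_cast; ring
  rw [h4]
  refine h3.congr ?_
  filter_upwards [hball] with x h1
  rw [eulerP_eq (by linarith)]
  ring

theorem hasJet_deltaProd {N : ℕ} (hN : N = 6 ∨ N = 10) :
    HasJet (fun x => deltaProd N (axisPt x)) (-60) := by
  have h1 : ∀ s ∈ N.divisors, HasJet (fun x => (s : ℂ) ^ 6 * deltaF (s * axisPt x))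
      (24 * (-((gapWeight s + gapWeight (2 * s) : ℤ) : ℂ) / 2)) := by
    intro s hs
    have hs0 : 0 < s := Nat.pos_of_mem_divisors hs
    have hc : (s : ℂ) ^ 6 ≠ 0 := pow_ne_zero _ (by exact_mod_cast hs0.ne')
    have h2 := (hasJet_const hc).mul ((hasJet_zpow s).mul ((hasJet_eulerP hs0).pow 24))
    rw [zero_add, zero_add] at h2
    refine h2.congr ?_
    filter_upwards [eventually_pos_lt_one] with x hx
    rw [deltaF_eq, qc_natCast_axisPt hx.1, _root_.zpow_natCast]
  have h2 := HasJet.prod _ h1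
  have h3 : ∑ s ∈ N.divisors, 24 * (-((gapWeight s + gapWeight (2 * s) : ℤ) : ℂ) / 2) = -60 := by
    have h4 : ∑ s ∈ N.divisors, (gapWeight s + gapWeight (2 * s)) = 5 := by
      rcases hN with rfl | rfl <;> decide
    have h5 : ∀ s : ℕ, 24 * (-((gapWeight s + gapWeight (2 * s) : ℤ) : ℂ) / 2) =
        -12 * ((gapWeight s + gapWeight (2 * s) : ℤ) : ℂ) := fun s => by ring
    simp only [h5]
    rw [← Finset.mul_sum, ← Int.cast_sum, h4]
    norm_num
  rw [← h3]
  exact h2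

open Classical in
theorem polyProd_mul_deriv {M n e s : ℕ} [NeZero M] (hN : Squarefree (e * M)) (hs : s ∣ e)
    (hn : 0 < n) (h : ℂ → ℂ) (z : ℂ) :
    polyProd M n s (e / s) h z * (if Exc M n e then s * deriv h (s * z) else 1) =
      ∏ i ∈ repIdx M n, fullFactor M s (e / s) h (repMat i) z := by
  have h1 : ∀ i, fullFactor M s (e / s) h (repMat i) z = polyFactor M s (e / s) h (repMat i) z *
      (if Coincide M s (e / s) (repMat i) then s * deriv h (s * z) else 1) := fun i => by
    rw [fullFactor, polyFactor]; split_ifs <;> ring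
  simp only [h1]
  rw [Finset.prod_mul_distrib, polyProd]
  congr 1
  by_cases hE : Exc M n e
  · obtain ⟨i, hi, hc⟩ := (exists_coincide_iff hN hs).2 hE
    rw [if_pos hE, Finset.prod_eq_single_of_mem i hi, if_pos hc]
    intro j hj hij
    rw [if_neg]
    intro hc'
    refine hij (rep_unique hN.of_mul_right hn hj hi
      ((Gam M).mul_mem hc ((Gam M).inv_mem hc')) ?_)
    group
  · rw [if_neg hE, Finset.prod_eq_one]
    intro i hi
    rw [if_neg]
    exact fun hc => hE ((exists_coincide_iff hN hs).1 ⟨i, hi, hc⟩)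

/-- The contribution of one pair to the second order invariant of the modular polynomial. -/
noncomputable def pairJet (G : ℂ → ℂ) (s t : ℕ) (p : ℕ × ℕ) : ℂ :=
  -(gapWeight (p.1 * t - s * p.2) : ℂ) / 2 - if s = 1 ∧ p.1 * t = 1 then p.2 * tail G (p.2 + 1) 0 else 0

open Classical in
theorem hasJet_modFun {N M n e m : ℕ} [NeZero M] (hN6 : N = 6 ∨ N = 10) (hN : Squarefree (e * M))
    (hn : 0 < n) {h G : ℂ → ℂ} (hGd : DifferentiableOn ℂ G (Metric.ball 0 1)) (hG0 : G 0 = 1)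
    (hG : ∀ z : ℂ, 0 < z.im → h z * qc z = G (qc z)) :
    HasJet (fun x => modFun N M n e m h (axisPt x))
      (m * ∑ s ∈ e.divisors, ∑ p ∈ diagPairs M n, pairJet G s (e / s) p +
        if Exc M n e then 60 else 0) := by
  have he0 : e ≠ 0 := hN.of_mul_left.ne_zero
  have h1 : HasJet (fun x => (∏ s ∈ e.divisors, ∏ p ∈ diagPairs M n, ∏ b ∈ Finset.range p.2,
      fullFactor M s (e / s) h (repMat ⟨p, b⟩) (axisPt x)) ^ m)
      (m * ∑ s ∈ e.divisors, ∑ p ∈ diagPairs M n, pairJet G s (e / s) p) := by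
    refine (HasJet.prod _ fun s hs => HasJet.prod _ fun p hp => ?_).pow m
    have hs0 : 0 < s := Nat.pos_of_mem_divisors hs
    exact hasJet_fullFactor hs0 (Nat.div_pos (Nat.divisor_le hs) hs0) hGd hG0 hG hp
  have h2 : HasJet (fun x => if Exc M n e then (deltaProd N (axisPt x))⁻¹ else 1)
      (if Exc M n e then 60 else 0) := by
    split_ifs
    · simpa using (hasJet_deltaProd hN6).inv
    · exact hasJet_const one_ne_zero
  refine (h1.mul h2).congr (Eventually.of_forall fun x => ?_)
  dsimp only
  have h3 : ∀ s ∈ e.divisors, ∏ p ∈ diagPairs M n, ∏ b ∈ Finset.range p.2,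
      fullFactor M s (e / s) h (repMat ⟨p, b⟩) (axisPt x) = polyProd M n s (e / s) h (axisPt x) *
        (if Exc M n e then s * deriv h (s * axisPt x) else 1) := by
    intro s hs
    rw [polyProd_mul_deriv hN (Nat.dvd_of_mem_divisors hs) hn, repIdx, Finset.prod_sigma]
  rw [Finset.prod_congr rfl h3, Finset.prod_mul_distrib, modFun]
  split_ifs
  · rw [derivProd, mul_pow]; ring
  · simp

theorem hasJet_haupt_sub {f F : ℂ → ℂ} (hFd : DifferentiableOn ℂ F (Metric.ball 0 1)) (hF0 : F 0 = 1)
    (hF : ∀ z : ℂ, 0 < z.im → f z * qc z = F (qc z)) (y : ℂ) :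
    HasJet (fun x => f (axisPt x) - y) (-((y - tail F 1 0) ^ 2 - 2 * tail F 2 0) / 2) := by
  refine ⟨1, -1, tail F 1 0 - y, fun x => tail F 2 x, one_ne_zero, ?_, ?_⟩
  · have := (tail_tendsto hFd 2).comp tendsto_ofReal_zero
    have h2 : -((y - tail F 1 0) ^ 2 - 2 * tail F 2 0) / 2 + (tail F 1 0 - y) ^ 2 / 2 = tail F 2 0 := by
      ring
    rw [h2]
    exact this
  · filter_upwards [eventually_pos_lt_one] with x hx
    have hx' : (x : ℂ) ≠ 0 := by exact_mod_cast hx.1.ne'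
    have hq : qc (axisPt x) = x := by simpa using qc_natCast_axisPt hx.1 1
    rw [haupt_eq hF0 hF (axisPt_im_pos hx.1 hx.2), hq, tail_eq F 1, _root_.zpow_neg_one]
    field_simp
    ring

theorem hasJet_poly {f F : ℂ → ℂ} (hFd : DifferentiableOn ℂ F (Metric.ball 0 1)) (hF0 : F 0 = 1)
    (hF : ∀ z : ℂ, 0 < z.im → f z * qc z = F (qc z)) {R : Polynomial ℂ} (hR : R ≠ 0) :
    HasJet (fun x => R.eval (f (axisPt x))) (∑ y ∈ R.roots.toFinset,
      R.rootMultiplicity y * (-((y - tail F 1 0) ^ 2 - 2 * tail F 2 0) / 2)) := by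
  have h1 := (HasJet.prod R.roots.toFinset fun y _ =>
    (hasJet_haupt_sub hFd hF0 hF y).pow (R.rootMultiplicity y)).mul
    (hasJet_const (Polynomial.leadingCoeff_ne_zero.2 hR))
  rw [add_zero] at h1
  refine h1.congr (Eventually.of_forall fun x => ?_)
  have h2 := (IsAlgClosed.splits R).eq_prod_roots
  conv_rhs => rw [h2]
  rw [Finset.prod_multiset_map_count]
  simp only [Polynomial.eval_mul, Polynomial.eval_C, Polynomial.eval_prod, Polynomial.eval_pow,
    Polynomial.eval_sub, Polynomial.eval_X, Polynomial.count_roots]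
  ring

theorem squarefree_six_ten {N : ℕ} (hN : N = 6 ∨ N = 10) : Squarefree N := by
  have h (p q : ℕ) (hp : p.Prime) (hq : q.Prime) (h : p ≠ q) : Squarefree (p * q) :=
    (Nat.squarefree_mul ((Nat.coprime_primes hp hq).2 h)).2 ⟨hp.prime.squarefree, hq.prime.squarefree⟩
  rcases hN with rfl | rfl
  · exact h 2 3 (by norm_num) (by norm_num) (by norm_num)
  · exact h 2 5 (by norm_num) (by norm_num) (by norm_num)

open Classical in
/-- The number of nondegenerate coincidences of the correspondences of degree `n` at `τ`. -/
noncomputable def coincWeight (M n e : ℕ) (τ : ℍ) : ℤ :=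
  ∑ s ∈ e.divisors, ((Nat.card (heckeFix M n s (e / s) τ) : ℤ) - if Exc M n e then 2 else 0)

open Classical in
theorem sum_coincWeight {N M n e : ℕ} [NeZero M] [NeZero N] (hN6 : N = 6 ∨ N = 10)
    (hNe : N = e * M) (hn : 0 < n) {f h F G : ℂ → ℂ} (hf : IsHaupt N f) (hh : IsHaupt M h)
    (hFd : DifferentiableOn ℂ F (Metric.ball 0 1)) (hF0 : F 0 = 1)
    (hF : ∀ z : ℂ, 0 < z.im → f z * qc z = F (qc z))
    (hGd : DifferentiableOn ℂ G (Metric.ball 0 1)) (hG0 : G 0 = 1)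
    (hG : ∀ z : ℂ, 0 < z.im → h z * qc z = G (qc z)) {pt : ℂ → ℍ} (hpt : ∀ x, f (pt x) = x) :
    (Function.support fun x => coincWeight M n e (pt x)).Finite ∧
    ∑ᶠ x : ℂ, ((x - tail F 1 0) ^ 2 - 2 * tail F 2 0) *
        ((coincWeight M n e (pt x) : ℂ) / (2 * ram f (pt x))) =
      ∑ s ∈ e.divisors, ((∑ p ∈ diagPairs M n, ((gapWeight (p.1 * (e / s : ℕ) - s * p.2) : ℂ) +
          if s = 1 ∧ p.1 * (e / s) = 1 then 2 * (p.2 * tail G (p.2 + 1) 0) else 0)) -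
        if Exc M n e then 5 else 0) := by
  have hN : Squarefree N := squarefree_six_ten hN6
  have hN' : Squarefree (e * M) := hNe ▸ hN
  obtain ⟨m, hm⟩ : ∃ m : ℕ, m * e.divisors.card = 24 := by
    have hd : e ∣ N := ⟨M, hNe⟩
    have he : e ∈ N.divisors := Nat.mem_divisors.2 ⟨hd, hN.ne_zero⟩
    have key : ∀ e ∈ N.divisors, e.divisors.card ∣ 24 := by
      rcases hN6 with rfl | rfl <;> decide
    obtain ⟨k, hk⟩ := key e he
    exact ⟨k, by rw [hk]; ring⟩
  have hc : N.divisors.card = 4 := by rcases hN6 with rfl | rfl <;> rfl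
  obtain ⟨R, hR⟩ := exists_modPoly hN hNe (by rw [hc]; linarith : m * (2 * e.divisors.card) = _)
    hn hf hh
  have hj := hasJet_modFun (m := m) hN6 hN' hn hGd hG0 hG
  have hjR := hj.congr (H := fun x => R.eval (f (axisPt x))) (by
    filter_upwards [eventually_pos_lt_one] with x hx
    exact hR _ (axisPt_im_pos hx.1 hx.2))
  have hR0 : R ≠ 0 := by
    rintro rfl
    obtain ⟨x, hx⟩ := hjR.eventually_ne_zero.exists
    simp at hx
  have hjet := hjR.unique (hasJet_poly hFd hF0 hF hR0)
  have hord : ∀ τ : ℍ, (2 * (R.rootMultiplicity (f τ) * ram f τ : ℕ) : ℤ) =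
      m * coincWeight M n e τ := by
    intro τ
    obtain ⟨k, hk, hk2⟩ := hasOrd_modFun (N := N) (m := m) hN' hn hh τ
    have h1 := hk.congr (G := fun z => R.eval (f z)) (by
      filter_upwards [(isOpen_lt continuous_const Complex.continuous_im).mem_nhds τ.im_pos] with z hz
      exact hR z hz)
    rw [← h1.unique (hf.hasOrd_eval hN hR0 τ), hk2, coincWeight]
  have hm0 : m ≠ 0 := by rintro rfl; simp at hm
  have hsub : (Function.support fun x => coincWeight M n e (pt x)) ⊆ R.roots.toFinset := by
    intro x hx
    simp only [Finset.mem_coe, Multiset.mem_toFinset, Polynomial.mem_roots hR0]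
    by_contra h
    have h1 := hord (pt x)
    rw [hpt, Polynomial.rootMultiplicity_eq_zero h] at h1
    simp [hm0] at h1
    exact hx h1
  refine ⟨(Finset.finite_toSet _).subset hsub, ?_⟩
  rw [finsum_eq_sum_of_support_subset (s := R.roots.toFinset)]
  swap
  · refine subset_trans ?_ hsub
    intro x hx hx2
    apply hx
    simp only at hx2
    simp [hx2]
  have hmC : (m : ℂ) ≠ 0 := by exact_mod_cast hm0
  have hmC2 : (m : ℂ) * e.divisors.card = 24 := by exact_mod_cast hm
  have hroot : ∀ x, (R.rootMultiplicity x : ℂ) =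
      m * ((coincWeight M n e (pt x) : ℂ) / (2 * ram f (pt x))) := by
    intro x
    have h1 := hord (pt x)
    rw [hpt] at h1
    have h2 : (2 * (R.rootMultiplicity x * ram f (pt x)) : ℂ) = m * coincWeight M n e (pt x) := by
      exact_mod_cast h1
    have h3 : (ram f (pt x) : ℂ) ≠ 0 := by exact_mod_cast (hf.ram_pos hN (pt x)).ne'
    rw [mul_div_assoc', eq_div_iff (by simpa using h3), ← h2]
    ring
  apply mul_left_cancel₀ hmC
  rw [Finset.sum_sub_distrib, Finset.sum_const, nsmul_eq_mul, mul_sub, ← mul_assoc, hmC2]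
  have h1 : (m : ℂ) * ∑ s ∈ e.divisors, ∑ p ∈ diagPairs M n,
      ((gapWeight (p.1 * (e / s : ℕ) - s * p.2) : ℂ) +
          if s = 1 ∧ p.1 * (e / s) = 1 then 2 * (p.2 * tail G (p.2 + 1) 0) else 0) =
      -2 * (m * ∑ s ∈ e.divisors, ∑ p ∈ diagPairs M n, pairJet G s (e / s) p) := by
    rw [mul_left_comm]
    congr 1
    rw [Finset.mul_sum]
    refine Finset.sum_congr rfl fun s _ => ?_
    rw [Finset.mul_sum]
    refine Finset.sum_congr rfl fun p _ => ?_
    rw [pairJet]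
    split_ifs <;> ring
  have h2 : (m : ℂ) * ∑ x ∈ R.roots.toFinset, ((x - tail F 1 0) ^ 2 - 2 * tail F 2 0) *
        ((coincWeight M n e (pt x) : ℂ) / (2 * ram f (pt x))) =
      -2 * ∑ y ∈ R.roots.toFinset,
      R.rootMultiplicity y * (-((y - tail F 1 0) ^ 2 - 2 * tail F 2 0) / 2) := by
    rw [Finset.mul_sum, Finset.mul_sum]
    refine Finset.sum_congr rfl fun x _ => ?_
    rw [hroot]; ring
  rw [h1, h2, ← hjet]
  split_ifs <;> ring

/-! ### Coincidences and integral matrices -/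

/-- Integral two by two matrices. -/
@[ext] structure IntQuad where
  (a b c d : ℤ)

/-- The determinant. -/
def IntQuad.det (A : IntQuad) : ℤ := A.a * A.d - A.b * A.c

/-- Integral matrices of determinant `L` with lower left entry divisible by `N` that fix `τ`. -/
def fixSet (N : ℕ) (L : ℤ) (τ : ℍ) : Set IntQuad :=
  {A | (N : ℤ) ∣ A.c ∧ A.det = L ∧ (A.c : ℂ) * (τ : ℂ) ^ 2 + (A.d - A.a) * τ - A.b = 0}

/-- The normalisation of an integral matrix of positive determinant. -/
noncomputable def normMat (A : IntQuad) : SL2R :=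
  if h : 0 < A.det then
    ⟨!![A.a / √A.det, A.b / √A.det; A.c / √A.det, A.d / √A.det], by
      have h0 : (0 : ℝ) < A.det := by exact_mod_cast h
      have h1 : √(A.det : ℝ) * √(A.det : ℝ) = A.det := Real.mul_self_sqrt h0.le
      have h3 : (A.det : ℝ) = A.a * A.d - A.b * A.c := by simp [IntQuad.det]
      rw [Matrix.det_fin_two_of, div_mul_div_comm, div_mul_div_comm, h1, ← sub_div, ← h3,
        div_self h0.ne']⟩
  else 1

theorem normMat_entries {A : IntQuad} (h : 0 < A.det) : (normMat A).1 0 0 = A.a / √A.det ∧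
    (normMat A).1 0 1 = A.b / √A.det ∧ (normMat A).1 1 0 = A.c / √A.det ∧
    (normMat A).1 1 1 = A.d / √A.det := by
  simp [normMat, h]

theorem normMat_smul_eq_iff {A : IntQuad} (h : 0 < A.det) (τ : ℍ) :
    normMat A • τ = τ ↔ (A.c : ℂ) * (τ : ℂ) ^ 2 + (A.d - A.a) * τ - A.b = 0 := by
  obtain ⟨h1, h2, h3, h4⟩ := normMat_entries h
  have hj := jf_ne_zero (normMat A) τ
  simp only [jf] at hj
  have h0 : ((√(A.det : ℝ) : ℝ) : ℂ) ≠ 0 := by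
    have : (0 : ℝ) < A.det := by exact_mod_cast h
    exact_mod_cast (Real.sqrt_pos.2 this).ne'
  rw [UpperHalfPlane.ext_iff, coe_smul_eq, div_eq_iff hj, h1, h2, h3, h4]
  push_cast
  field_simp
  constructor <;> intro h <;> linear_combination -h

theorem normMat_injective {A B : IntQuad} {E E' n : ℕ} (hn : 0 < n) (hE : Squarefree E)
    (hE' : Squarefree E') (hA : A.det = E * n) (hB : B.det = E' * n)
    (h : normMat A = normMat B) : A = B := by
  have hE0 : 0 < E := Nat.pos_of_ne_zero hE.ne_zero
  have hE0' : 0 < E' := Nat.pos_of_ne_zero hE'.ne_zero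
  have hA0 : 0 < A.det := by rw [hA]; positivity
  have hB0 : 0 < B.det := by rw [hB]; positivity
  obtain ⟨a1, a2, a3, a4⟩ := normMat_entries hA0
  obtain ⟨b1, b2, b3, b4⟩ := normMat_entries hB0
  rw [h] at a1 a2 a3 a4
  have hAR : (0 : ℝ) < A.det := by exact_mod_cast hA0
  have hBR : (0 : ℝ) < B.det := by exact_mod_cast hB0
  have hAs := Real.sqrt_pos.2 hAR
  have hBs := Real.sqrt_pos.2 hBR
  have key : ∀ x y : ℤ, (x : ℝ) / √A.det = y / √B.det → E' * x.natAbs ^ 2 = E * y.natAbs ^ 2 := by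
    intro x y hxy
    have h2 := congrArg (fun z : ℝ => z ^ 2) hxy
    simp only [div_pow, Real.sq_sqrt hAR.le, Real.sq_sqrt hBR.le] at h2
    rw [div_eq_div_iff hAR.ne' hBR.ne', hA, hB] at h2
    have h3 : x ^ 2 * (E' * n) = y ^ 2 * ((E : ℤ) * n) := by exact_mod_cast h2
    zify
    rw [sq_abs, sq_abs]
    have hn' : (n : ℤ) ≠ 0 := by positivity
    apply mul_left_cancel₀ hn'
    linear_combination h3
  have hEE : E' = E := by
    by_cases hx : A.a = 0
    · have hc : A.c ≠ 0 := by
        intro hc; rw [IntQuad.det, hx, hc] at hA0; simp at hA0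
      have h4 := key A.c B.c (a3.symm.trans b3)
      have h5 : B.c ≠ 0 := by
        intro h5; rw [h5] at h4; simp [hE0'.ne', hc] at h4
      exact squarefree_eq_of_mul_sq hE' hE (Int.natAbs_pos.2 hc) (Int.natAbs_pos.2 h5) h4
    · have h4 := key A.a B.a (a1.symm.trans b1)
      have h5 : B.a ≠ 0 := by
        intro h5; rw [h5] at h4; simp [hE0'.ne', hx] at h4
      exact squarefree_eq_of_mul_sq hE' hE (Int.natAbs_pos.2 hx) (Int.natAbs_pos.2 h5) h4
  subst hEE
  rw [hA, ← hB] at a1 a2 a3 a4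
  have fin : ∀ x y : ℤ, (x : ℝ) / √B.det = y / √B.det → x = y := by
    intro x y hxy
    rw [div_left_inj' hBs.ne'] at hxy
    exact_mod_cast hxy
  ext
  · exact fin _ _ (a1.symm.trans b1)
  · exact fin _ _ (a2.symm.trans b2)
  · exact fin _ _ (a3.symm.trans b3)
  · exact fin _ _ (a4.symm.trans b4)

/-- Integral matrices parametrising `heckeFix`. -/
def coincSet (M n s t : ℕ) (τ : ℍ) : Set IntQuad :=
  {A | ∃ e ∈ M.divisors, A ∈ fixSet (s * t * M) ((s * t * e : ℕ) * n) τ ∧ ((e * t : ℕ) : ℤ) ∣ A.a ∧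
    ((e * s : ℕ) : ℤ) ∣ A.d}

theorem heckeFix_eq_image {M n s t : ℕ} [NeZero M] (hs : 0 < s) (ht : 0 < t) (hn : 0 < n) (τ : ℍ) :
    heckeFix M n s t τ = (fun A => dil s * normMat A * (dil t)⁻¹) '' coincSet M n s t τ := by
  obtain ⟨a1, a2, a3, a4⟩ := dil_entries hs
  obtain ⟨b1, b2, b3, b4⟩ := dil_entries ht
  obtain ⟨i1, i2, i3, i4⟩ := inv_entries (dil t)
  have q1 : 0 < √(s : ℝ) := by positivity
  have q2 : 0 < √(t : ℝ) := by positivity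
  have s1 : √(s : ℝ) ^ 2 = s := Real.sq_sqrt (by positivity)
  have s2 : √(t : ℝ) ^ 2 = t := Real.sq_sqrt (by positivity)
  have hM := NeZero.ne M
  have hfix : ∀ X : SL2R, (dil s * X * (dil t)⁻¹) • dil t • τ = dil s • τ ↔ X • τ = τ := by
    intro X
    rw [mul_smul, inv_smul_smul, mul_smul, smul_left_cancel_iff]
  have hsq : ∀ e : ℕ, √(((((s * t * e : ℕ) : ℤ) * n : ℤ) : ℝ)) = √s * √t * √(e * n : ℝ) := by
    intro e
    push_cast
    rw [← Real.sqrt_mul (by positivity), ← Real.sqrt_mul (by positivity)]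
    ring_nf
  ext Y
  constructor
  · rintro ⟨⟨e, x, y, z, w, he, h00, h01, h10, h11⟩, hY⟩
    have he0 : 0 < e := Nat.pos_of_dvd_of_pos he (Nat.pos_of_ne_zero hM)
    have hdet := int_det h00 h01 h10 h11
    set A : IntQuad := ⟨x * e * t, y, z * M * (s * t), w * e * s⟩ with hA
    have hAd : A.det = (s * t * e : ℕ) * n := by
      rw [IntQuad.det, hA]; push_cast; linear_combination (s * t : ℤ) * hdet
    have hA0 : 0 < A.det := by rw [hAd]; positivity
    have q3 : 0 < √(e * n : ℝ) := by positivity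
    have hYA : dil s * normMat A * (dil t)⁻¹ = Y := by
      obtain ⟨c1, c2, c3, c4⟩ := normMat_entries hA0
      rw [hAd, hsq] at c1 c2 c3 c4
      refine ext_entries ?_ ?_ ?_ ?_ <;> apply mul_right_cancel₀ q3.ne' <;>
        simp only [h00, h01, h10, h11, mul_entry, c1, c2, c3, c4, i1, i2, i3, i4, a1, a2, a3, a4,
          b1, b2, b3, b4] <;> push_cast [hA] <;> field_simp <;> (try simp only [s1, s2]) <;>
        (try ring)
    refine ⟨A, ⟨e, Nat.mem_divisors.2 ⟨he, hM⟩, ⟨⟨z, ?_⟩, hAd, ?_⟩, ⟨x, ?_⟩, ⟨w, ?_⟩⟩, hYA⟩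
    · rw [hA]; push_cast; ring
    · rwa [← normMat_smul_eq_iff hA0, ← hfix, hYA]
    · rw [hA]; push_cast; ring
    · rw [hA]; push_cast; ring
  · rintro ⟨A, ⟨e, he, ⟨⟨z, hz⟩, hAd, hq⟩, ⟨x, hx⟩, ⟨w, hw⟩⟩, rfl⟩
    have he0 : 0 < e := Nat.pos_of_mem_divisors he
    have hA0 : 0 < A.det := by rw [hAd]; positivity
    have q3 : 0 < √(e * n : ℝ) := by positivity
    obtain ⟨c1, c2, c3, c4⟩ := normMat_entries hA0
    rw [hAd, hsq] at c1 c2 c3 c4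
    refine ⟨⟨e, x, A.b, z, w, Nat.dvd_of_mem_divisors he, ?_, ?_, ?_, ?_⟩, ?_⟩
    iterate 4
      simp only [mul_entry, c1, c2, c3, c4, i1, i2, i3, i4, a1, a2, a3, a4, b1, b2, b3, b4, hz, hx, hw]
      push_cast
      field_simp
      try simp only [s1, s2]
      try ring
    · exact (hfix _).2 ((normMat_smul_eq_iff hA0 τ).2 hq)

theorem coincSet_injOn {M n s t : ℕ} (hN : Squarefree (s * t * M)) (hn : 0 < n) (τ : ℍ) :
    Set.InjOn (fun A => dil s * normMat A * (dil t)⁻¹) (coincSet M n s t τ) := by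
  rintro A ⟨e, he, ⟨-, hA, -⟩, -⟩ B ⟨e', he', ⟨-, hB, -⟩, -⟩ h
  simp only [mul_left_inj, mul_right_inj] at h
  exact normMat_injective hn
    (hN.squarefree_of_dvd (Nat.mul_dvd_mul_left _ (Nat.dvd_of_mem_divisors he)))
    (hN.squarefree_of_dvd (Nat.mul_dvd_mul_left _ (Nat.dvd_of_mem_divisors he'))) hA hB h

theorem card_heckeFix_eq {M n s t : ℕ} [NeZero M] (hN : Squarefree (s * t * M)) (hn : 0 < n)
    (τ : ℍ) : Nat.card (heckeFix M n s t τ) = Nat.card (coincSet M n s t τ) := by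
  have hst : 0 < s * t := Nat.pos_of_ne_zero hN.of_mul_left.ne_zero
  rw [heckeFix_eq_image (Nat.pos_of_mul_pos_right hst) (Nat.pos_of_mul_pos_left hst) hn]
  exact Nat.card_image_of_injOn (coincSet_injOn hN hn τ)

theorem coincSet_finite {M n s t : ℕ} [NeZero M] (hN : Squarefree (s * t * M)) (hn : 0 < n)
    (τ : ℍ) : (coincSet M n s t τ).Finite := by
  have hst : 0 < s * t := Nat.pos_of_ne_zero hN.of_mul_left.ne_zero
  have h1 : (heckeFix M n s t τ).Finite := by
    refine (heckeTransport_finite (M := M) hn (dil t • τ) (dil s • τ)).subset ?_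
    exact fun Y hY => hY
  rw [heckeFix_eq_image (Nat.pos_of_mul_pos_right hst) (Nat.pos_of_mul_pos_left hst) hn] at h1
  exact h1.of_finite_image (coincSet_injOn hN hn τ)

/-- The Möbius function on the divisors of a product `N` of two primes. -/
def divSign (N e : ℕ) : ℂ := if e = 1 ∨ e = N then 1 else -1

theorem collapse_prime {p : ℕ} (hp : p.Prime) {a d : ℤ} (h : (p : ℤ) ∣ a * d) (v : ℂ) :
    (if (p : ℤ) ∣ a ∧ (p : ℤ) ∣ d then v else 0) -
      ((if (p : ℤ) ∣ a then v else 0) + (if (p : ℤ) ∣ d then v else 0)) = -v := by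
  rcases (Nat.prime_iff_prime_int.1 hp).dvd_or_dvd h with h1 | h1
  · by_cases h2 : (p : ℤ) ∣ d <;> simp [h1, h2]
  · by_cases h2 : (p : ℤ) ∣ a <;> simp [h1, h2]

theorem collapse_mul {p q r : ℕ} (hp : p.Prime) (hq : q.Prime) (hpq : p ≠ q) (hr : p * q = r)
    {a d : ℤ} (h : (r : ℤ) ∣ a * d) (v : ℂ) :
    (if (r : ℤ) ∣ a ∧ (r : ℤ) ∣ d then v else 0) -
      ((if (r : ℤ) ∣ a ∧ (q : ℤ) ∣ d then v else 0) + (if (q : ℤ) ∣ a ∧ (r : ℤ) ∣ d then v else 0)) -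
      ((if (r : ℤ) ∣ a ∧ (p : ℤ) ∣ d then v else 0) + (if (p : ℤ) ∣ a ∧ (r : ℤ) ∣ d then v else 0)) +
      ((if (r : ℤ) ∣ a then v else 0) + ((if (q : ℤ) ∣ a ∧ (p : ℤ) ∣ d then v else 0) +
        ((if (p : ℤ) ∣ a ∧ (q : ℤ) ∣ d then v else 0) + (if (r : ℤ) ∣ d then v else 0)))) = v := by
  have hc : IsCoprime (p : ℤ) q := Nat.isCoprime_iff_coprime.2 ((Nat.coprime_primes hp hq).2 hpq)
  have key : ∀ x : ℤ, (r : ℤ) ∣ x ↔ (p : ℤ) ∣ x ∧ (q : ℤ) ∣ x := by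
    intro x
    rw [← hr, Nat.cast_mul]
    exact ⟨fun h => ⟨dvd_of_mul_right_dvd h, dvd_of_mul_left_dvd h⟩, fun h => hc.mul_dvd h.1 h.2⟩
  have h1 := (Nat.prime_iff_prime_int.1 hp).dvd_or_dvd ((key _).1 h).1
  have h2 := (Nat.prime_iff_prime_int.1 hq).dvd_or_dvd ((key _).1 h).2
  simp only [key]
  by_cases a1 : (p : ℤ) ∣ a <;> by_cases a2 : (q : ℤ) ∣ a <;> by_cases a3 : (p : ℤ) ∣ d <;>
    by_cases a4 : (q : ℤ) ∣ d <;> simp [a1, a2, a3, a4] at h1 h2 ⊢ <;> ring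

theorem sum_divSign_collapse {N : ℕ} (hN : N = 6 ∨ N = 10) {ι : Type*} (B : ℕ → Finset ι)
    (α δ : ι → ℤ) (v : ι → ℂ) (h : ∀ E ∈ N.divisors, ∀ A ∈ B E, (E : ℤ) ∣ α A * δ A) :
    ∑ e ∈ N.divisors, divSign N e * ∑ s ∈ e.divisors, ∑ e' ∈ (N / e).divisors, ∑ A ∈ B (e * e'),
      (if ((e' * (e / s) : ℕ) : ℤ) ∣ α A ∧ ((e' * s : ℕ) : ℤ) ∣ δ A then v A else 0) =
    ∑ E ∈ N.divisors, divSign N E * ∑ A ∈ B E, v A := by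
  obtain ⟨p, q, hp, hq, hpq, hr⟩ : ∃ p q : ℕ, p.Prime ∧ q.Prime ∧ p < q ∧ p * q = N := by
    rcases hN with rfl | rfl
    · exact ⟨2, 3, by norm_num, by norm_num, by norm_num, by norm_num⟩
    · exact ⟨2, 5, by norm_num, by norm_num, by norm_num, by norm_num⟩
  have h1 := hp.one_lt
  have e1 : 1 ≠ p := h1.ne
  have e2 : 1 ≠ q := (h1.trans hpq).ne
  have e3 : p ≠ q := hpq.ne
  have e4 : q < N := by rw [← hr]; nlinarith
  have e5 : 1 ≠ N := (h1.trans (hpq.trans e4)).ne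
  have e6 : p ≠ N := (hpq.trans e4).ne
  have e7 : q ≠ N := e4.ne
  have hpp : p / p = 1 := Nat.div_self (by omega)
  have hqq : q / q = 1 := Nat.div_self (by omega)
  have hNN : N / N = 1 := Nat.div_self (by omega)
  have hNp : N / p = q := by rw [← hr, Nat.mul_div_cancel_left _ hp.pos]
  have hNq : N / q = p := by rw [← hr, Nat.mul_div_cancel _ hq.pos]
  have hdN : N.divisors = {1, p, q, N} := by
    rw [← hr, Nat.divisors_mul, hp.divisors, hq.divisors]
    ext x
    simp [Finset.mem_mul]
    tauto
  have i1 := Finset.sum_congr (s₁ := B p) rfl fun A hA =>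
    collapse_prime hp (h p (by simp [hdN]) A hA) (v A)
  have i2 := Finset.sum_congr (s₁ := B q) rfl fun A hA =>
    collapse_prime hq (h q (by simp [hdN]) A hA) (v A)
  have i3 := Finset.sum_congr (s₁ := B N) rfl fun A hA =>
    collapse_mul hp hq e3 hr (h N (by simp [hdN]) A hA) (v A)
  simp only [Finset.sum_add_distrib, Finset.sum_sub_distrib, Finset.sum_neg_distrib] at i1 i2 i3
  have sN : ∀ F : ℕ → ℂ, ∑ e ∈ N.divisors, F e = F 1 + (F p + (F q + F N)) := by
    intro F
    rw [hdN, Finset.sum_insert (by simp [*]), Finset.sum_insert (by simp [*]),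
      Finset.sum_insert (by simp [*]), Finset.sum_singleton]
  have sp : ∀ F : ℕ → ℂ, ∑ e ∈ p.divisors, F e = F 1 + F p := by
    intro F
    rw [hp.divisors, Finset.sum_pair e1]
  have sq : ∀ F : ℕ → ℂ, ∑ e ∈ q.divisors, F e = F 1 + F q := by
    intro F
    rw [hq.divisors, Finset.sum_pair e2]
  have d1 : divSign N 1 = 1 := by simp [divSign]
  have d2 : divSign N p = -1 := by simp [divSign, e6, e1.symm]
  have d3 : divSign N q = -1 := by simp [divSign, e7, e2.symm]
  have d4 : divSign N N = 1 := by simp [divSign]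
  simp only [sN, sp, sq, d1, d2, d3, d4, hNp, hNq, hNN, hpp, hqq, Nat.div_one, one_mul, mul_one,
    Nat.divisors_one, Finset.sum_singleton, hr, mul_comm q p, Nat.cast_one, isUnit_one,
    IsUnit.dvd, one_dvd, true_and, and_true, if_true]
  linear_combination i1 + i2 + i3

/-- The matrices of `fixSet` with positive lower left entry. -/
def posSet (N : ℕ) (L : ℤ) (τ : ℍ) : Set IntQuad := {A | A ∈ fixSet N L τ ∧ 0 < A.c}

theorem fixSet_eq_zero {N : ℕ} {L : ℤ} {τ : ℍ} {A : IntQuad} (h : A ∈ fixSet N L τ) (hc : A.c = 0) :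
    A.d = A.a ∧ A.b = 0 := by
  obtain ⟨-, -, h⟩ := h
  rw [hc] at h
  have h1 := congrArg Complex.im h
  simp at h1
  have h2 : A.d = A.a := by
    rcases h1 with h1 | h1
    · have : (A.d : ℝ) = A.a := by linarith
      exact_mod_cast this
    · exact absurd h1 τ.im_pos.ne'
  refine ⟨h2, ?_⟩
  rw [h2] at h
  simpa using h

theorem coprime_pair_unique {M n s t : ℕ} (hN : Squarefree (s * t * M)) {p p' : ℕ × ℕ}
    [NeZero M] (hn : 0 < n) (hp : p ∈ diagPairs M n) (hp' : p' ∈ diagPairs M n) (h : p.1 * t = s * p.2)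
    (h' : p'.1 * t = s * p'.2) : p = p' := by
  have hst := hN.of_mul_left
  have hst0 : 0 < s * t := Nat.pos_of_ne_zero hst.ne_zero
  have hs : 0 < s := Nat.pos_of_mul_pos_right hst0
  have ht : 0 < t := Nat.pos_of_mul_pos_left hst0
  have hi : ∀ p ∈ diagPairs M n, (⟨p, 0⟩ : Σ _ : ℕ × ℕ, ℕ) ∈ repIdx M n := fun p hp => by
    rw [repIdx, Finset.mem_sigma]
    exact ⟨hp, Finset.mem_range.2 ((mem_diagPairs (Nat.pos_of_neZero M)).1 hp).2.1⟩
  have h1 := (coincide_iff hs ht (hi p hp)).2 ⟨h, rfl⟩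
  have h2 := (coincide_iff hs ht (hi p' hp')).2 ⟨h', rfl⟩
  have h3 := rep_unique (hN.of_mul_right) hn (hi p hp) (hi p' hp')
    ((Gam M).mul_mem h2 ((Gam M).inv_mem h1)) (by group)
  exact congrArg Sigma.fst h3

theorem exc_iff {M n s t : ℕ} [NeZero M] (hN : Squarefree (s * t * M)) :
    Exc M n (s * t) ↔ ∃ p ∈ diagPairs M n, p.1 * t = s * p.2 := by
  have hst0 : 0 < s * t := Nat.pos_of_ne_zero hN.of_mul_left.ne_zero
  have hs : 0 < s := Nat.pos_of_mul_pos_right hst0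
  have ht : 0 < t := Nat.pos_of_mul_pos_left hst0
  rw [← exists_coincide_iff hN (Dvd.intro t rfl), Nat.mul_div_cancel_left _ hs]
  constructor
  · rintro ⟨i, hi, h⟩
    rw [coincide_iff hs ht hi] at h
    rw [repIdx, Finset.mem_sigma] at hi
    exact ⟨i.1, hi.1, h.1⟩
  · rintro ⟨p, hp, h⟩
    have hi : (⟨p, 0⟩ : Σ _ : ℕ × ℕ, ℕ) ∈ repIdx M n := by
      rw [repIdx, Finset.mem_sigma]
      exact ⟨hp, Finset.mem_range.2 ((mem_diagPairs (Nat.pos_of_neZero M)).1 hp).2.1⟩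
    exact ⟨_, hi, (coincide_iff hs ht hi).2 ⟨h, rfl⟩⟩

open Classical in
theorem ncard_coincSet_zero {M n s t : ℕ} [NeZero M] (hN : Squarefree (s * t * M)) (hn : 0 < n)
    (τ : ℍ) : {A | A ∈ coincSet M n s t τ ∧ A.c = 0}.ncard = if Exc M n (s * t) then 2 else 0 := by
  have hM0 := Nat.pos_of_neZero M
  have hst0 : 0 < s * t := Nat.pos_of_ne_zero hN.of_mul_left.ne_zero
  have hs : 0 < s := Nat.pos_of_mul_pos_right hst0
  have ht : 0 < t := Nat.pos_of_mul_pos_left hst0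
  have key : ∀ A ∈ coincSet M n s t τ, A.c = 0 →
      ∃ p ∈ diagPairs M n, p.1 * t = s * p.2 ∧ p.1 * t = A.a.natAbs ∧ A.d = A.a ∧ A.b = 0 := by
    rintro A ⟨e, he, hA, hx, hw⟩ hc
    obtain ⟨hd, hb⟩ := fixSet_eq_zero hA hc
    have hdet := hA.2.1
    rw [hd] at hw
    rw [IntQuad.det, hb, hd, zero_mul, sub_zero, ← Int.natAbs_mul_self] at hdet
    obtain ⟨x, hx⟩ := Int.natCast_dvd.1 hx
    obtain ⟨w, hw⟩ := Int.natCast_dvd.1 hw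
    have he0 := Nat.pos_of_mem_divisors he
    have hdet' : A.a.natAbs * A.a.natAbs = s * t * e * n := by exact_mod_cast hdet
    have hmul : e * x * (e * w) = e * n := by
      apply Nat.eq_of_mul_eq_mul_left hst0
      calc s * t * (e * x * (e * w)) = (e * t * x) * (e * s * w) := by ring
        _ = A.a.natAbs * A.a.natAbs := by rw [← hx, ← hw]
        _ = s * t * (e * n) := by rw [hdet']; ring
    have hpos : 0 < e * x * (e * w) := by rw [hmul]; positivity
    refine ⟨(e * x, e * w), (mem_diagPairs hM0).2 ⟨Nat.pos_of_mul_pos_right hpos,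
      Nat.pos_of_mul_pos_left hpos, e, Nat.dvd_of_mem_divisors he, Dvd.intro x rfl, Dvd.intro w rfl,
      hmul⟩, ?_, ?_, hd, hb⟩
    · dsimp only
      rw [show e * x * t = e * t * x by ring, ← hx, hw]; ring
    · dsimp only
      rw [hx]; ring
  by_cases hE : Exc M n (s * t)
  · rw [if_pos hE]
    obtain ⟨p, hp, hpst⟩ := (exc_iff hN).1 hE
    obtain ⟨hp1, hp2, e, he, he1, he2, hpp⟩ := (mem_diagPairs hM0).1 hp
    set K := p.1 * t with hK
    have hK0 : 0 < K := by positivity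
    have hne : (⟨K, 0, 0, K⟩ : IntQuad) ≠ ⟨-K, 0, 0, -K⟩ := by
      intro h
      have := congrArg IntQuad.a h
      simp only at this
      omega
    rw [← Set.ncard_pair hne]
    congr 1
    have hKK : (K : ℤ) * K = (s * t * e : ℕ) * n := by
      have : K * K = s * t * e * n := by
        calc K * K = (p.1 * t) * (s * p.2) := by rw [← hpst]
          _ = s * t * (p.1 * p.2) := by ring
          _ = s * t * e * n := by rw [hpp]; ring
      exact_mod_cast this
    have d1 : ((e * t : ℕ) : ℤ) ∣ K := by
      exact_mod_cast Nat.mul_dvd_mul_right he1 t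
    have d2 : ((e * s : ℕ) : ℤ) ∣ K := by
      rw [hpst, mul_comm s]
      exact_mod_cast Nat.mul_dvd_mul_right he2 s
    ext A
    constructor
    · rintro ⟨hA, hc⟩
      obtain ⟨p', hp', h1, h2, h3, h4⟩ := key A hA hc
      obtain rfl := coprime_pair_unique hN hn hp hp' hpst h1
      rw [← hK] at h2
      obtain ⟨a, b, c, d⟩ := A
      simp only at h2 h3 h4 hc
      subst h3 h4 hc
      rw [Set.mem_insert_iff, Set.mem_singleton_iff, IntQuad.mk.injEq, IntQuad.mk.injEq]
      omega
    · have he' : e ∈ M.divisors := Nat.mem_divisors.2 ⟨he, hM0.ne'⟩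
      rintro (rfl | rfl)
      · exact ⟨⟨e, he', ⟨dvd_zero _, by simpa [IntQuad.det] using hKK, by simp⟩, d1, d2⟩, rfl⟩
      · exact ⟨⟨e, he', ⟨dvd_zero _, by simpa [IntQuad.det] using hKK, by simp⟩, d1.neg_right,
          d2.neg_right⟩, rfl⟩
  · rw [if_neg hE]
    rw [show {A | A ∈ coincSet M n s t τ ∧ A.c = 0} = ∅ by
      ext A
      simp only [Set.mem_ofPred_eq, Set.mem_empty_iff_false, iff_false]
      rintro ⟨hA, hc⟩
      obtain ⟨p, hp, h, -⟩ := key A hA hc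
      exact hE ((exc_iff hN).2 ⟨p, hp, h⟩)]
    simp

theorem ncard_coincSet_neg {M n s t : ℕ} (τ : ℍ) :
    {A | A ∈ coincSet M n s t τ ∧ A.c < 0}.ncard = {A | A ∈ coincSet M n s t τ ∧ 0 < A.c}.ncard := by
  have hmem : ∀ A ∈ coincSet M n s t τ, (⟨-A.a, -A.b, -A.c, -A.d⟩ : IntQuad) ∈ coincSet M n s t τ := by
    rintro A ⟨e, he, ⟨h1, h2, h3⟩, h4, h5⟩
    refine ⟨e, he, ⟨h1.neg_right, ?_, ?_⟩, h4.neg_right, h5.neg_right⟩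
    · rw [← h2]; simp [IntQuad.det]
    · push_cast; linear_combination -h3
  refine Set.ncard_congr (fun A _ => ⟨-A.a, -A.b, -A.c, -A.d⟩) ?_ ?_ ?_
  · rintro A ⟨hA, hc⟩
    exact ⟨hmem A hA, by simpa using hc⟩
  · rintro A B - - h
    simp only [IntQuad.mk.injEq, neg_inj] at h
    ext
    exacts [h.1, h.2.1, h.2.2.1, h.2.2.2]
  · rintro B ⟨hB, hc⟩
    exact ⟨_, ⟨hmem B hB, by simpa using hc⟩, by simp⟩

theorem quad_root {a b c : ℝ} {τ : ℍ} (h : (a : ℂ) * (τ : ℂ) ^ 2 + b * τ + c = 0) :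
    b = -(2 * a * τ.re) ∧ c = a * (τ.re ^ 2 + τ.im ^ 2) := by
  have h1 := congrArg Complex.im h
  have h2 := congrArg Complex.re h
  simp [sq] at h1 h2
  have h3 : b = -(2 * a * τ.re) := by
    apply mul_right_cancel₀ τ.im_pos.ne'
    linear_combination h1
  refine ⟨h3, ?_⟩
  rw [h3] at h2
  linear_combination h2

theorem posSet_root {N : ℕ} {L : ℤ} {τ : ℍ} {A : IntQuad} (h : A ∈ posSet N L τ) :
    (A.d - A.a : ℝ) = -(2 * A.c * τ.re) ∧ (A.b : ℝ) = -(A.c * (τ.re ^ 2 + τ.im ^ 2)) ∧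
      (4 * L - (A.a + A.d) ^ 2 : ℝ) = (2 * A.c * τ.im) ^ 2 := by
  obtain ⟨⟨-, hdet, h⟩, -⟩ := h
  obtain ⟨h1, h2⟩ := quad_root (a := A.c) (b := A.d - A.a) (c := -A.b) (τ := τ)
    (by push_cast; linear_combination h)
  refine ⟨h1, by linear_combination -h2, ?_⟩
  have h3 : (L : ℝ) = A.a * A.d - A.b * A.c := by rw [← hdet, IntQuad.det]; push_cast; ring
  rw [h3]
  have h4 : (A.d : ℝ) = A.a - 2 * A.c * τ.re := by linear_combination h1
  have h5 : (A.b : ℝ) = -(A.c * (τ.re ^ 2 + τ.im ^ 2)) := by linear_combination -h2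
  rw [h4, h5]
  ring

theorem posSet_trace_injOn (N : ℕ) (L : ℤ) (τ : ℍ) :
    Set.InjOn (fun A : IntQuad => A.a + A.d) (posSet N L τ) := by
  intro A hA B hB h
  obtain ⟨a1, a2, a3⟩ := posSet_root hA
  obtain ⟨b1, b2, b3⟩ := posSet_root hB
  have h' : (A.a + A.d : ℝ) = B.a + B.d := by exact_mod_cast h
  have hAc : (0 : ℝ) < A.c := by exact_mod_cast hA.2
  have hBc : (0 : ℝ) < B.c := by exact_mod_cast hB.2
  have him := τ.im_pos
  rw [h', b3] at a3
  have h1 := (pow_left_inj₀ (by positivity) (by positivity) two_ne_zero).1 a3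
  have hc : (A.c : ℝ) = B.c := by
    apply mul_right_cancel₀ him.ne'
    linear_combination -h1 / 2
  rw [hc] at a1 a2
  ext
  · have : (A.a : ℝ) = B.a := by linear_combination (h' - a1 + b1) / 2
    exact_mod_cast this
  · have : (A.b : ℝ) = B.b := by rw [a2, b2]
    exact_mod_cast this
  · exact_mod_cast hc
  · have : (A.d : ℝ) = B.d := by linear_combination (h' + a1 - b1) / 2
    exact_mod_cast this

theorem posSet_trace_lt {N : ℕ} {L : ℤ} {τ : ℍ} {A : IntQuad} (h : A ∈ posSet N L τ) :
    0 < 4 * L - (A.a + A.d) ^ 2 := by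
  have h1 := (posSet_root h).2.2
  have hAc : (0 : ℝ) < A.c := by exact_mod_cast h.2
  have him := τ.im_pos
  have : (0 : ℝ) < 4 * L - (A.a + A.d) ^ 2 := by rw [h1]; positivity
  exact_mod_cast this

theorem posSet_finite (N : ℕ) (L : ℤ) (τ : ℍ) : (posSet N L τ).Finite := by
  refine Set.Finite.of_finite_image ((Set.finite_Icc (-(4 * |L|)) (4 * |L|)).subset ?_)
    (posSet_trace_injOn N L τ)
  rintro _ ⟨A, hA, rfl⟩
  have h1 := posSet_trace_lt hA
  have h2 := le_abs_self L
  have h3 : (A.a + A.d) ^ 2 ≤ 4 * |L| := by linarith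
  have h4 : |A.a + A.d| ≤ 4 * |L| := by
    rcases eq_or_ne (A.a + A.d) 0 with h | h
    · rw [h]; simp
    · have := Int.one_le_abs h
      rw [← sq_abs] at h3
      nlinarith
  exact abs_le.1 h4

/-- `posSet` as a finite set. -/
noncomputable def posFin (N : ℕ) (L : ℤ) (τ : ℍ) : Finset IntQuad := (posSet_finite N L τ).toFinset

theorem mem_posFin {N : ℕ} {L : ℤ} {τ : ℍ} {A : IntQuad} : A ∈ posFin N L τ ↔ A ∈ posSet N L τ := by
  simp [posFin]

theorem ncard_coincSet_pos {M n s t : ℕ} (hst0 : 0 < s * t) (hn : 0 < n)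
    (τ : ℍ) : {A | A ∈ coincSet M n s t τ ∧ 0 < A.c}.ncard = ∑ e ∈ M.divisors,
      ∑ A ∈ posFin (s * t * M) ((s * t * e : ℕ) * n) τ,
        if ((e * t : ℕ) : ℤ) ∣ A.a ∧ ((e * s : ℕ) : ℤ) ∣ A.d then 1 else 0 := by
  classical
  simp only [← Finset.card_filter]
  rw [← Finset.card_biUnion, ← Set.ncard_coe_finset]
  · congr 1
    ext A
    simp only [Set.mem_ofPred_eq, coincSet, Finset.coe_biUnion, Set.mem_iUnion, Finset.mem_coe,
      Finset.mem_filter, mem_posFin, posSet]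
    constructor
    · rintro ⟨⟨e, he, h1, h2⟩, h3⟩
      exact ⟨e, he, ⟨h1, h3⟩, h2⟩
    · rintro ⟨e, he, ⟨h1, h3⟩, h2⟩
      exact ⟨⟨e, he, h1, h2⟩, h3⟩
  · intro e he e' he' hne
    rw [Function.onFun, Finset.disjoint_left]
    intro A hA hA'
    rw [Finset.mem_filter, mem_posFin] at hA hA'
    have h := hA.1.1.2.1.symm.trans hA'.1.1.2.1
    have h' : s * t * e * n = s * t * e' * n := by exact_mod_cast h
    exact hne (Nat.eq_of_mul_eq_mul_left hst0 (Nat.eq_of_mul_eq_mul_right hn h'))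

theorem coincWeight_eq {N M n e : ℕ} [NeZero M] (hN : Squarefree N) (hNe : N = e * M)
    (hn : 0 < n) (τ : ℍ) :
    (coincWeight M n e τ : ℂ) = 2 * ∑ s ∈ e.divisors, ∑ e' ∈ M.divisors,
      ∑ A ∈ posFin N ((e * e' : ℕ) * n) τ,
        if ((e' * (e / s) : ℕ) : ℤ) ∣ A.a ∧ ((e' * s : ℕ) : ℤ) ∣ A.d then 1 else 0 := by
  rw [coincWeight, Finset.mul_sum, Int.cast_sum]
  refine Finset.sum_congr rfl fun s hs => ?_
  have hs0 := Nat.pos_of_mem_divisors hs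
  obtain ⟨t, rfl⟩ := Nat.dvd_of_mem_divisors hs
  rw [Nat.mul_div_cancel_left _ hs0]
  subst hNe
  have hst0 : 0 < s * t := Nat.pos_of_ne_zero hN.of_mul_left.ne_zero
  have hfin := coincSet_finite hN hn τ
  have h1 : (coincSet M n s t τ).ncard = {A | A ∈ coincSet M n s t τ ∧ 0 < A.c}.ncard +
      ({A | A ∈ coincSet M n s t τ ∧ A.c < 0}.ncard +
        {A | A ∈ coincSet M n s t τ ∧ A.c = 0}.ncard) := by
    have f1 : {A | A ∈ coincSet M n s t τ ∧ 0 < A.c}.Finite :=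
      hfin.subset fun A hA => hA.1
    have f2 : {A | A ∈ coincSet M n s t τ ∧ A.c < 0}.Finite :=
      hfin.subset fun A hA => hA.1
    have f3 : {A | A ∈ coincSet M n s t τ ∧ A.c = 0}.Finite :=
      hfin.subset fun A hA => hA.1
    rw [← Set.ncard_union_eq _ f2 f3, ← Set.ncard_union_eq _ f1 (f2.union f3)]
    · congr 1
      ext A
      simp only [Set.mem_union, Set.mem_ofPred_eq, ← and_or_left]
      constructor
      · intro h; exact ⟨h, lt_trichotomy 0 A.c |>.imp_right fun h => h.symm.imp_right Eq.symm⟩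
      · exact fun h => h.1
    · rw [Set.disjoint_left]
      rintro A ⟨-, h⟩ (⟨-, h'⟩ | ⟨-, h'⟩) <;> omega
    · rw [Set.disjoint_left]
      rintro A ⟨-, h⟩ ⟨-, h'⟩
      omega
  rw [ncard_coincSet_neg, ncard_coincSet_zero hN hn, ncard_coincSet_pos hst0 hn] at h1
  rw [card_heckeFix_eq hN hn, Nat.card_coe_set_eq, h1]
  push_cast
  ring

/-- The local weight of a factorisation at the cusp, including the degenerate one. -/
def cuspWeight (k : ℤ) : ℤ := if k = 0 then -5 else gapWeight k

theorem sum_diagPairs {M n s t : ℕ} (hM : 0 < M) (hs : 0 < s) (ht : 0 < t) (hn : 0 < n)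
    (g : ℕ → ℕ → ℂ) :
    ∑ p ∈ diagPairs M n, g (p.1 * t) (s * p.2) = ∑ e ∈ M.divisors,
      ∑ A ∈ (s * t * e * n).divisorsAntidiagonal,
        if ((e * t : ℕ) : ℤ) ∣ (A.1 : ℤ) ∧ ((e * s : ℕ) : ℤ) ∣ (A.2 : ℤ) then g A.1 A.2 else 0 := by
  simp only [← Finset.sum_filter]
  rw [Finset.sum_sigma']
  refine Finset.sum_nbij' (fun p => ⟨p.1 * p.2 / n, (p.1 * t, s * p.2)⟩)
    (fun B => (B.2.1 / t, B.2.2 / s)) ?_ ?_ ?_ ?_ ?_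
  · intro p hp
    obtain ⟨h1, h2, e, he, ha, hb, hab⟩ := (mem_diagPairs hM).1 hp
    rw [hab, Nat.mul_div_cancel _ hn]
    have he0 : e ≠ 0 := by rintro rfl; simp at he; omega
    simp only [Finset.mem_sigma, Nat.mem_divisors, Finset.mem_filter,
      Nat.mem_divisorsAntidiagonal, Int.natCast_dvd_natCast]
    refine ⟨⟨he, hM.ne'⟩, ⟨?_, by positivity⟩, Nat.mul_dvd_mul_right ha t, ?_⟩
    · calc p.1 * t * (s * p.2) = s * t * (p.1 * p.2) := by ring
        _ = _ := by rw [hab]; ring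
    · rw [mul_comm]; exact Nat.mul_dvd_mul_left s hb
  · rintro ⟨e, U, W⟩ hB
    simp only [Finset.mem_sigma, Nat.mem_divisors, Finset.mem_filter,
      Nat.mem_divisorsAntidiagonal, Int.natCast_dvd_natCast] at hB
    obtain ⟨⟨he, -⟩, ⟨hUW, h0⟩, ⟨u, rfl⟩, ⟨w, rfl⟩⟩ := hB
    have h1 : e * t * u / t = e * u := by
      rw [show e * t * u = e * u * t by ring, Nat.mul_div_cancel _ ht]
    have h2 : e * s * w / s = e * w := by
      rw [show e * s * w = e * w * s by ring, Nat.mul_div_cancel _ hs]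
    simp only [h1, h2]
    have h3 : e * t * u * (e * s * w) ≠ 0 := by rw [hUW]; exact h0
    have he0 : 0 < e := Nat.pos_of_ne_zero (by rintro rfl; simp at h3)
    have hu0 : 0 < u := Nat.pos_of_ne_zero (by rintro rfl; simp at h3)
    have hw0 : 0 < w := Nat.pos_of_ne_zero (by rintro rfl; simp at h3)
    refine (mem_diagPairs hM).2 ⟨by positivity, by positivity, e, he, ⟨u, rfl⟩, ⟨w, rfl⟩, ?_⟩
    apply Nat.eq_of_mul_eq_mul_left (by positivity : 0 < s * t)
    calc s * t * (e * u * (e * w)) = e * t * u * (e * s * w) := by ring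
      _ = _ := by rw [hUW]; ring
  · intro p _
    simp [Nat.mul_div_cancel _ ht, Nat.mul_div_cancel_left _ hs]
  · rintro ⟨e, U, W⟩ hB
    simp only [Finset.mem_sigma, Nat.mem_divisors, Finset.mem_filter,
      Nat.mem_divisorsAntidiagonal, Int.natCast_dvd_natCast] at hB
    obtain ⟨⟨he, -⟩, ⟨hUW, h0⟩, ⟨u, rfl⟩, ⟨w, rfl⟩⟩ := hB
    have h1 : e * t * u / t = e * u := by
      rw [show e * t * u = e * u * t by ring, Nat.mul_div_cancel _ ht]
    have h2 : e * s * w / s = e * w := by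
      rw [show e * s * w = e * w * s by ring, Nat.mul_div_cancel _ hs]
    simp only [h1, h2]
    have h3 : e * u * (e * w) = e * n := by
      apply Nat.eq_of_mul_eq_mul_left (by positivity : 0 < s * t)
      calc s * t * (e * u * (e * w)) = e * t * u * (e * s * w) := by ring
        _ = _ := by rw [hUW]; ring
    rw [h3, Nat.mul_div_cancel _ hn, show e * u * t = e * t * u by ring,
      show s * (e * w) = e * s * w by ring]
  · intro p _
    rfl

open Classical in
theorem sum_gapWeight_sub {M n s t : ℕ} [NeZero M] (hN : Squarefree (s * t * M)) (hn : 0 < n) :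
    (∑ p ∈ diagPairs M n, (gapWeight (p.1 * t - s * p.2) : ℂ)) -
        (if Exc M n (s * t) then 5 else 0) =
      ∑ p ∈ diagPairs M n, (cuspWeight ((p.1 * t : ℕ) - (s * p.2 : ℕ)) : ℂ) := by
  have h : ∀ p : ℕ × ℕ, (cuspWeight ((p.1 * t : ℕ) - (s * p.2 : ℕ)) : ℂ) =
      (gapWeight (p.1 * t - s * p.2) : ℂ) - if p.1 * t = s * p.2 then 5 else 0 := by
    intro p
    by_cases hp : p.1 * t = s * p.2
    · have : ((p.1 * t : ℤ) - s * p.2) = 0 := by rw [sub_eq_zero]; exact_mod_cast hp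
      rw [if_pos hp, this, hp]
      simp [cuspWeight, gapWeight]
    · have : ((p.1 * t : ℤ) - s * p.2) ≠ 0 := by rw [sub_ne_zero]; exact_mod_cast hp
      rw [if_neg hp, sub_zero, cuspWeight, if_neg (by push_cast; exact this)]
      push_cast; rfl
  simp only [h, Finset.sum_sub_distrib]
  congr 1
  split_ifs with hE
  · obtain ⟨p, hp, hpt⟩ := (exc_iff hN).1 hE
    rw [Finset.sum_eq_single_of_mem p hp, if_pos hpt]
    intro q hq hqp
    rw [if_neg]
    exact fun hqt => hqp (coprime_pair_unique hN hn hq hp hqt hpt)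
  · symm
    refine Finset.sum_eq_zero fun p hp => if_neg fun hpt => hE ((exc_iff hN).2 ⟨p, hp, hpt⟩)

open Classical in
theorem cusp_side_eq {N M n e : ℕ} [NeZero M] (hN : Squarefree N) (hNe : N = e * M) (hn : 0 < n)
    (G : ℂ → ℂ) :
    ∑ s ∈ e.divisors, ((∑ p ∈ diagPairs M n, ((gapWeight (p.1 * (e / s : ℕ) - s * p.2) : ℂ) +
          if s = 1 ∧ p.1 * (e / s) = 1 then 2 * (p.2 * tail G (p.2 + 1) 0) else 0)) -
        if Exc M n e then 5 else 0) =
      (∑ s ∈ e.divisors, ∑ e' ∈ M.divisors, ∑ A ∈ (e * e' * n).divisorsAntidiagonal,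
        if ((e' * (e / s) : ℕ) : ℤ) ∣ (A.1 : ℤ) ∧ ((e' * s : ℕ) : ℤ) ∣ (A.2 : ℤ) then
          (cuspWeight (A.1 - A.2) : ℂ) else 0) +
      if e = 1 then 2 * (n * tail G (n + 1) 0) else 0 := by
  have hM : 0 < M := Nat.pos_of_ne_zero (NeZero.ne M)
  have key : ∀ s ∈ e.divisors,
      ((∑ p ∈ diagPairs M n, ((gapWeight (p.1 * (e / s : ℕ) - s * p.2) : ℂ) +
          if s = 1 ∧ p.1 * (e / s) = 1 then 2 * (p.2 * tail G (p.2 + 1) 0) else 0)) -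
        if Exc M n e then 5 else 0) =
      (∑ e' ∈ M.divisors, ∑ A ∈ (e * e' * n).divisorsAntidiagonal,
        if ((e' * (e / s) : ℕ) : ℤ) ∣ (A.1 : ℤ) ∧ ((e' * s : ℕ) : ℤ) ∣ (A.2 : ℤ) then
          (cuspWeight (A.1 - A.2) : ℂ) else 0) +
      if s = 1 then (if e = 1 then 2 * (n * tail G (n + 1) 0) else 0) else 0 := by
    intro s hs
    have hs0 := Nat.pos_of_mem_divisors hs
    obtain ⟨t, rfl⟩ := Nat.dvd_of_mem_divisors hs
    subst hNe
    have ht0 : 0 < t := Nat.pos_of_ne_zero (by rintro rfl; simp at hs)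
    rw [Nat.mul_div_cancel_left _ hs0, Finset.sum_add_distrib, add_sub_right_comm,
      sum_gapWeight_sub hN hn,
      sum_diagPairs hM hs0 ht0 hn (fun U W => (cuspWeight ((U : ℤ) - (W : ℤ)) : ℂ))]
    congr 1
    by_cases h : s = 1 ∧ t = 1
    · obtain ⟨rfl, rfl⟩ := h
      simp only [if_true, mul_one, true_and]
      rw [Finset.sum_eq_single_of_mem (1, n)]
      · simp
      · exact (mem_diagPairs hM).2 ⟨one_pos, hn, 1, one_dvd _, one_dvd _, one_dvd _, rfl⟩
      · rintro ⟨a, b⟩ hp hne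
        rw [if_neg]
        rintro (rfl : a = 1)
        obtain ⟨-, -, e, -, h1, -, h2⟩ := (mem_diagPairs hM).1 hp
        rw [Nat.dvd_one.1 h1] at h2
        simp at h2
        exact hne (by rw [h2])
    · rw [Finset.sum_eq_zero]
      · by_cases h1 : s = 1
        · subst h1
          have : t ≠ 1 := fun h2 => h ⟨rfl, h2⟩
          simp [this]
        · simp [h1]
      · intro p _
        rw [if_neg]
        rintro ⟨h1, h2⟩
        exact h ⟨h1, Nat.eq_one_of_mul_eq_one_left h2⟩
  rw [Finset.sum_congr rfl key, Finset.sum_add_distrib]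
  congr 1
  rw [Finset.sum_ite_eq']
  rw [if_pos]
  exact Nat.one_mem_divisors.2 (by rintro rfl; rw [hNe] at hN; simp at hN)

theorem antidiagonal_filter_eq {L a b : ℕ} (hab : a * b = L) (hL : 0 < L) :
    L.divisorsAntidiagonal.filter (fun A => A.1 + A.2 = a + b) = {(a, b), (b, a)} := by
  ext ⟨U, W⟩
  simp only [Finset.mem_filter, Nat.mem_divisorsAntidiagonal, Finset.mem_insert,
    Finset.mem_singleton, Prod.mk.injEq]
  constructor
  · rintro ⟨⟨h1, -⟩, h2⟩
    have h3 : ((U : ℤ) - a) * (U - b) = 0 := by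
      have h1' : (U : ℤ) * W = a * b := by exact_mod_cast h1.trans hab.symm
      have h2' : (U : ℤ) + W = a + b := by exact_mod_cast h2
      linear_combination U * h2' - h1'
    rcases mul_eq_zero.1 h3 with h | h <;> omega
  · rintro (⟨rfl, rfl⟩ | ⟨rfl, rfl⟩)
    · exact ⟨⟨hab, hL.ne'⟩, rfl⟩
    · exact ⟨⟨by rw [mul_comm, hab], hL.ne'⟩, add_comm _ _⟩

theorem t2Star_nonpos_eq {N : ℕ} (hN : N = 6 ∨ N = 10) (P : Polynomial ℂ) {L k : ℕ} (hL : 0 < L)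
    (hk : 4 * L ≤ k ^ 2) :
    t2Star N P (4 * L - k ^ 2) =
      -(1 / 2) * ∑ A ∈ L.divisorsAntidiagonal.filter (fun A => A.1 + A.2 = k),
        (cuspWeight (A.1 - A.2) : ℂ) := by
  have hk' : ¬ (0 : ℤ) < 4 * L - k ^ 2 := by
    have : (4 * L : ℤ) ≤ k ^ 2 := by exact_mod_cast hk
    omega
  have hN2 : N ≠ 2 := by omega
  have hpar := Nat.even_or_odd' k
  rw [t2Star, if_neg hk']
  by_cases h0 : k ^ 2 = 4 * L
  · obtain ⟨m, rfl | rfl⟩ := hpar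
    · have hm : m * m = L := by nlinarith
      rw [show 2 * m = m + m by ring, antidiagonal_filter_eq hm hL, if_pos, if_neg hN2, if_pos hN]
      · simp [cuspWeight]; norm_num
      · subst hm; push_cast; ring
    · exfalso
      have : (2 * m + 1) ^ 2 = 4 * (m ^ 2 + m) + 1 := by ring
      omega
  by_cases h1 : k ^ 2 = 4 * L + 1
  · obtain ⟨m, rfl | rfl⟩ := hpar
    · exfalso
      have : (2 * m) ^ 2 = 4 * (m ^ 2) := by ring
      omega
    · have hm : m * (m + 1) = L := by nlinarith
      have hd : (4 * L - ((2 * m + 1 : ℕ) : ℤ) ^ 2) = -1 := by subst hm; push_cast; ring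
      rw [hd, if_neg (by norm_num), if_pos rfl, show 2 * m + 1 = m + (m + 1) by ring,
        antidiagonal_filter_eq hm hL, Finset.sum_pair (by simp)]
      simp [cuspWeight, gapWeight]; norm_num
  by_cases h4 : k ^ 2 = 4 * L + 4
  · obtain ⟨m, rfl | rfl⟩ := hpar
    · have hm1 : 1 ≤ m := by by_contra h; have : m = 0 := by omega
                             subst this; omega
      obtain ⟨l, rfl⟩ := Nat.exists_eq_add_of_le' hm1
      have hm : l * (l + 2) = L := by nlinarith
      have hd : (4 * L - ((2 * (l + 1) : ℕ) : ℤ) ^ 2) = -4 := by subst hm; push_cast; ring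
      rw [hd, if_neg (by norm_num), if_neg (by norm_num), if_pos rfl,
        show 2 * (l + 1) = l + (l + 2) by ring,
        antidiagonal_filter_eq hm hL, Finset.sum_pair (by simp)]
      simp [cuspWeight, gapWeight]; norm_num
    · exfalso
      have : (2 * m + 1) ^ 2 = 4 * (m ^ 2 + m) + 1 := by ring
      omega
  have e0 : ¬ (4 * L - (k : ℤ) ^ 2) = 0 := fun h => h0 (by zify; omega)
  have e1 : ¬ (4 * L - (k : ℤ) ^ 2) = -1 := fun h => h1 (by zify; omega)
  have e4 : ¬ (4 * L - (k : ℤ) ^ 2) = -4 := fun h => h4 (by zify; omega)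
  rw [if_neg e0, if_neg e1, if_neg e4, Finset.sum_eq_zero, mul_zero]
  rintro ⟨U, W⟩ hA
  simp only [Finset.mem_filter, Nat.mem_divisorsAntidiagonal] at hA
  obtain ⟨⟨h2, -⟩, h3⟩ := hA
  have hd : (4 * L - (k : ℤ) ^ 2) = -((U : ℤ) - W) ^ 2 := by
    rw [← h2, ← h3]; push_cast; ring
  rw [hd] at e0 e1 e4
  generalize hx : (U : ℤ) - W = x at *
  have hx0 : x ≠ 0 := by rintro rfl; simp at e0
  have hx1 : |x| ≠ 1 := fun h => e1 (by rw [← sq_abs, h]; norm_num)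
  have hx2 : |x| ≠ 2 := fun h => e4 (by rw [← sq_abs, h]; norm_num)
  simp [cuspWeight, gapWeight, hx0, hx1, hx2]

theorem sum_t2Star_nonpos {N : ℕ} (hN : N = 6 ∨ N = 10) (P : Polynomial ℂ) {L : ℕ} (hL : 0 < L)
    {B : ℤ} (hB : (2 * L : ℤ) ≤ B) :
    ∑ r ∈ (Finset.Icc (-B) B).filter (fun r : ℤ => ¬ 0 < 4 * (L : ℤ) - r ^ 2),
      t2Star N P (4 * L - r ^ 2) =
      -∑ A ∈ L.divisorsAntidiagonal, (cuspWeight (A.1 - A.2) : ℂ) := by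
  have key : ∀ r ∈ (Finset.Icc (-B) B).filter (fun r : ℤ => ¬ 0 < 4 * (L : ℤ) - r ^ 2),
      t2Star N P (4 * L - r ^ 2) = ∑ A ∈ L.divisorsAntidiagonal,
        if A.1 + A.2 = r.natAbs then -(1 / 2) * (cuspWeight (A.1 - A.2) : ℂ) else 0 := by
    intro r hr
    rw [Finset.mem_filter] at hr
    have hr2 : r ^ 2 = ((r.natAbs : ℕ) : ℤ) ^ 2 := by rw [Int.natCast_natAbs, sq_abs]
    have h5 : 4 * (L : ℤ) ≤ (r.natAbs : ℤ) ^ 2 := by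
      rw [← hr2]; linarith [not_lt.1 hr.2]
    rw [hr2, t2Star_nonpos_eq hN P hL (by exact_mod_cast h5),
      ← Finset.sum_filter, Finset.mul_sum]
  rw [Finset.sum_congr rfl key, Finset.sum_comm, ← Finset.sum_neg_distrib]
  refine Finset.sum_congr rfl fun A hA => ?_
  obtain ⟨hUW, -⟩ := Nat.mem_divisorsAntidiagonal.1 hA
  have hU : 0 < A.1 := Nat.pos_of_ne_zero fun h => by rw [h] at hUW; simp at hUW; omega
  have hW : 0 < A.2 := Nat.pos_of_ne_zero fun h => by rw [h] at hUW; simp at hUW; omega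
  rw [← Finset.sum_filter, Finset.sum_const]
  have : ((Finset.Icc (-B) B).filter (fun r : ℤ => ¬ 0 < 4 * (L : ℤ) - r ^ 2)).filter
      (fun r => A.1 + A.2 = r.natAbs) = {(A.1 + A.2 : ℤ), -(A.1 + A.2 : ℤ)} := by
    ext r
    have h1 : (A.1 : ℤ) + A.2 ≤ 2 * L := by
      rw [← hUW]; push_cast; nlinarith
    have h2 : 4 * (L : ℤ) - (A.1 + A.2) ^ 2 ≤ 0 := by
      rw [← hUW]; push_cast; nlinarith [sq_nonneg ((A.1 : ℤ) - A.2)]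
    simp only [Finset.mem_filter, Finset.mem_Icc, Finset.mem_insert, Finset.mem_singleton]
    constructor
    · rintro ⟨-, h⟩; omega
    · rintro (rfl | rfl)
      · exact ⟨⟨⟨by omega, by omega⟩, by omega⟩, by omega⟩
      · exact ⟨⟨⟨by omega, by omega⟩, by rw [neg_sq]; omega⟩, by omega⟩
  rw [this, Finset.card_pair (by omega)]
  simp

/-- `M` is the Gram matrix of a positive definite form with root `τ`. -/
def IsRootOf (M : Matrix (Fin 2) (Fin 2) ℝ) (τ : ℍ) : Prop :=
  0 < M 0 0 ∧ M 1 0 = M 0 1 ∧ (M 0 0 : ℂ) * (τ : ℂ) ^ 2 + (2 * M 0 1 : ℝ) * τ + M 1 1 = 0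

theorem IsRootOf.entries {M : Matrix (Fin 2) (Fin 2) ℝ} {τ : ℍ} (h : IsRootOf M τ) :
    M 0 1 = -(M 0 0 * τ.re) ∧ M 1 1 = M 0 0 * (τ.re ^ 2 + τ.im ^ 2) ∧
      M.det = (M 0 0 * τ.im) ^ 2 := by
  obtain ⟨h1, h2⟩ := quad_root h.2.2
  have h3 : M 0 1 = -(M 0 0 * τ.re) := by linear_combination h1 / 2
  refine ⟨h3, h2, ?_⟩
  rw [Matrix.det_fin_two, h.2.1, h2, h3]
  ring

theorem IsRootOf.unique {M M' : Matrix (Fin 2) (Fin 2) ℝ} {τ : ℍ} (h : IsRootOf M τ)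
    (h' : IsRootOf M' τ) (hd : M.det = M'.det) : M = M' := by
  obtain ⟨h1, h2, h3⟩ := h.entries
  obtain ⟨h1', h2', h3'⟩ := h'.entries
  have h0 : M 0 0 = M' 0 0 := by
    rw [h3, h3', sq_eq_sq₀ (mul_pos h.1 τ.im_pos).le (mul_pos h'.1 τ.im_pos).le] at hd
    exact mul_right_cancel₀ τ.im_pos.ne' hd
  ext i j
  fin_cases i <;> fin_cases j
  · exact h0
  · exact h1.trans (by rw [h0]; exact h1'.symm)
  · exact (h.2.1.trans h1).trans (by rw [h0]; exact (h'.2.1.trans h1').symm)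
  · exact h2.trans (by rw [h0]; exact h2'.symm)

theorem IsRootOf.cmPointC_eq {M : Matrix (Fin 2) (Fin 2) ℝ} {τ : ℍ} (h : IsRootOf M τ) :
    cmPointC M = τ := by
  obtain ⟨h1, h2, h3⟩ := h.entries
  have h0 : (M 0 0 : ℂ) ≠ 0 := by exact_mod_cast h.1.ne'
  rw [cmPointC, h3, Real.sqrt_sq (mul_pos h.1 τ.im_pos).le, h1, div_eq_iff h0]
  apply Complex.ext
  · simp
    ring
  · simp
    ring

theorem IsRootOf.transform {M : Matrix (Fin 2) (Fin 2) ℝ} {τ : ℍ} {g : SL2R}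
    (h : IsRootOf M (g • τ)) : IsRootOf (g.1ᵀ * M * g.1) τ := by
  obtain ⟨h1, h2, h3⟩ := h.entries
  have hroot := h.2.2
  have hs := h.2.1
  have e00 : (g.1ᵀ * M * g.1) 0 0 =
      M 0 0 * g.1 0 0 ^ 2 + 2 * M 0 1 * g.1 0 0 * g.1 1 0 + M 1 1 * g.1 1 0 ^ 2 := by
    simp [Matrix.mul_apply, Fin.sum_univ_two, hs]; ring
  have e01 : (g.1ᵀ * M * g.1) 0 1 = M 0 0 * g.1 0 0 * g.1 0 1 +
      M 0 1 * (g.1 0 0 * g.1 1 1 + g.1 0 1 * g.1 1 0) + M 1 1 * g.1 1 0 * g.1 1 1 := by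
    simp [Matrix.mul_apply, Fin.sum_univ_two, hs]; ring
  have e10 : (g.1ᵀ * M * g.1) 1 0 = M 0 0 * g.1 0 0 * g.1 0 1 +
      M 0 1 * (g.1 0 0 * g.1 1 1 + g.1 0 1 * g.1 1 0) + M 1 1 * g.1 1 0 * g.1 1 1 := by
    simp [Matrix.mul_apply, Fin.sum_univ_two, hs]; ring
  have e11 : (g.1ᵀ * M * g.1) 1 1 =
      M 0 0 * g.1 0 1 ^ 2 + 2 * M 0 1 * g.1 0 1 * g.1 1 1 + M 1 1 * g.1 1 1 ^ 2 := by
    simp [Matrix.mul_apply, Fin.sum_univ_two, hs]; ring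
  refine ⟨?_, by rw [e01, e10], ?_⟩
  · rw [e00, h1, h2]
    have hd := det_eq g
    have him := (g • τ).im_pos
    have : 0 < (g.1 0 0 - (g • τ).re * g.1 1 0) ^ 2 + (g • τ).im ^ 2 * g.1 1 0 ^ 2 := by
      rcases eq_or_ne (g.1 1 0) 0 with h0 | h0
      · have h00 : g.1 0 0 ≠ 0 := by rintro h00; rw [h00, h0] at hd; norm_num at hd
        rw [h0]
        have := sq_pos_of_ne_zero h00
        linarith [this]
      · have := sq_pos_of_ne_zero h0
        positivity
    nlinarith [mul_pos h.1 this]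
  · rw [e00, e01, e11]
    have hj := jf_ne_zero g τ
    simp only [jf] at hj
    have hw : ((g • τ : ℍ) : ℂ) * (g.1 1 0 * τ + g.1 1 1) = g.1 0 0 * τ + g.1 0 1 := by
      rw [coe_smul_eq, div_mul_cancel₀ _ hj]
    push_cast at hroot ⊢
    linear_combination (g.1 1 0 * τ + g.1 1 1 : ℂ) ^ 2 * hroot -
      (M 0 0 * (g.1 0 0 * τ + g.1 0 1 + (g • τ : ℍ) * (g.1 1 0 * τ + g.1 1 1)) +
        2 * M 0 1 * (g.1 1 0 * τ + g.1 1 1) : ℂ) * hw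

theorem det_transform (M : Matrix (Fin 2) (Fin 2) ℝ) (g : SL2R) :
    (g.1ᵀ * M * g.1).det = M.det := by
  rw [Matrix.det_mul, Matrix.det_mul, Matrix.det_transpose, g.2]
  ring

theorem isRootOf_formMat {a b c : ℤ} {τ : ℍ} (ha : 0 < a) :
    IsRootOf (formMat a b c) τ ↔ (a : ℂ) * (τ : ℂ) ^ 2 + b * τ + c = 0 := by
  simp only [IsRootOf, formMat]
  simp [ha, mul_div_cancel₀]

theorem det_formMat {a b c d : ℤ} (h : b ^ 2 - 4 * a * c = -d) :
    (formMat a b c).det = d / 4 := by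
  have h' : (b : ℝ) ^ 2 - 4 * a * c = -d := by exact_mod_cast h
  rw [formMat, Matrix.det_fin_two_of]
  linear_combination -h' / 4

theorem exists_root {M : Matrix (Fin 2) (Fin 2) ℝ} {d : ℤ} {N : ℕ} (hd : 0 < d)
    (h : M ∈ QdN d N) : ∃ τ : ℍ, IsRootOf M τ := by
  obtain ⟨a, b, c, rfl, ha, hdisc, -⟩ := h
  have ha' : (0 : ℝ) < a := by exact_mod_cast ha
  have hd' : (0 : ℝ) < d := by exact_mod_cast hd
  have hdisc' : (b : ℂ) ^ 2 - 4 * a * c = -d := by exact_mod_cast hdisc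
  refine ⟨⟨⟨-b / (2 * a), √d / (2 * a)⟩, by positivity⟩, ?_⟩
  rw [isRootOf_formMat ha]
  have hτ : (⟨-b / (2 * a), √d / (2 * a)⟩ : ℂ) = (-b + √d * I) / (2 * a) := by
    have h2 : ((-b + √d * I) / (2 * a) : ℂ) = ((-b / (2 * a) : ℝ) : ℂ) + ((√d / (2 * a) : ℝ) : ℂ) * I := by
      push_cast; ring
    rw [h2, Complex.mk_eq_add_mul_I]
  rw [UpperHalfPlane.coe_mk, hτ]
  have ha0 : (a : ℂ) ≠ 0 := by exact_mod_cast ha.ne'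
  have hs : ((√d : ℝ) : ℂ) ^ 2 = d := by
    rw [← Complex.ofReal_pow, Real.sq_sqrt hd'.le]; simp
  field_simp
  linear_combination -hdisc' + I ^ 2 * hs + d * Complex.I_sq

theorem mem_QdN_det {M : Matrix (Fin 2) (Fin 2) ℝ} {d : ℤ} {N : ℕ} (h : M ∈ QdN d N) :
    M.det = d / 4 := by
  obtain ⟨a, b, c, rfl, ha, hdisc, -⟩ := h
  exact det_formMat hdisc

theorem transform_mem_QdN {M : Matrix (Fin 2) (Fin 2) ℝ} {d : ℤ} {N : ℕ} [NeZero N] (hd : 0 < d)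
    (h : M ∈ QdN d N) {g : SL2R} (hg : g ∈ Gam N) : g.1ᵀ * M * g.1 ∈ QdN d N := by
  obtain ⟨τ, hτ⟩ := exists_root hd h
  have hpos : 0 < (g.1ᵀ * M * g.1) 0 0 :=
    (IsRootOf.transform (τ := g⁻¹ • τ) (g := g) (by rwa [smul_inv_smul])).1
  have hdet := (det_transform M g).trans (mem_QdN_det h)
  obtain ⟨a, b, c, rfl, ha, hdisc, k, hk⟩ := h
  obtain ⟨e, x, y, z, w, ⟨m, hm⟩, h00, h01, h10, h11⟩ := mem_Gam.1 hg
  have he0 : 0 < e := Nat.pos_of_ne_zero (by rintro rfl; simp at hm; exact NeZero.ne N hm)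
  have hs : √((e : ℝ) * (1 : ℕ)) ^ 2 = e := by rw [Real.sq_sqrt (by positivity)]; simp
  have hs0 : √((e : ℝ) * (1 : ℕ)) ≠ 0 := by
    intro h0; rw [h0] at hs; have : (0 : ℝ) < e := by exact_mod_cast he0
    norm_num at hs; linarith
  generalize √((e : ℝ) * (1 : ℕ)) = σ at *
  have he' : (e : ℝ) ≠ 0 := by exact_mod_cast he0.ne'
  have hm' : (N : ℝ) = e * m := by exact_mod_cast hm
  have ha' : (a : ℝ) = N * k := by exact_mod_cast hk
  have g00 := eq_div_of_mul_eq hs0 h00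
  have g01 := eq_div_of_mul_eq hs0 h01
  have g10 := eq_div_of_mul_eq hs0 h10
  have g11 := eq_div_of_mul_eq hs0 h11
  have key : g.1ᵀ * formMat a b c * g.1 = formMat
      (a * x ^ 2 * e + b * x * z * N + c * z ^ 2 * N * m)
      (2 * a * x * y + b * (x * w * e + y * z * m) + 2 * c * z * N * w)
      (y ^ 2 * m * k + b * y * w + c * w ^ 2 * e) := by
    ext i j
    fin_cases i <;> fin_cases j <;>
    · simp [formMat, Matrix.mul_apply, Fin.sum_univ_two, g00, g01, g10, g11]
      field_simp
      rw [hs, ha', hm']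
      ring
  rw [key] at hpos hdet ⊢
  refine ⟨_, _, _, rfl, ?_, ?_, ?_⟩
  · simp only [formMat, Matrix.of_apply, Matrix.cons_val_zero, Matrix.cons_val'] at hpos
    exact_mod_cast hpos
  · rw [formMat, Matrix.det_fin_two_of] at hdet
    have : ∀ A B C : ℤ, (A : ℝ) * C - B / 2 * (B / 2) = d / 4 → B ^ 2 - 4 * A * C = -d := by
      intro A B C h
      have : (B : ℝ) ^ 2 - 4 * A * C = -d := by linear_combination -4 * h
      exact_mod_cast this
    exact this _ _ _ hdet
  · rw [hk]
    exact ⟨k * x ^ 2 * e + b * x * z + c * z ^ 2 * m, by ring⟩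

/-- `τ` is the root of a form of discriminant `-d` and level `N`. -/
def HasForm (N : ℕ) (d : ℤ) (τ : ℍ) : Prop := ∃ M ∈ QdN d N, IsRootOf M τ

theorem IsHaupt.ram_smul {N : ℕ} [NeZero N] (hN : Squarefree N) {f : ℂ → ℂ} (hf : IsHaupt N f)
    {g : SL2R} (hg : g ∈ Gam N) (τ : ℍ) : ram f (g • τ) = ram f τ := by
  have h1 := hf.card_stab hN τ
  have h2 := hf.card_stab hN (g • τ)
  have : Nat.card {h : SL2R // h ∈ Gam N ∧ h • g • τ = g • τ} =
      Nat.card {h : SL2R // h ∈ Gam N ∧ h • τ = τ} := by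
    refine Nat.card_congr
      { toFun := fun h => ⟨g⁻¹ * h.1 * g, (Gam N).mul_mem ((Gam N).mul_mem ((Gam N).inv_mem hg) h.2.1) hg, ?_⟩
        invFun := fun h => ⟨g * h.1 * g⁻¹, (Gam N).mul_mem ((Gam N).mul_mem hg h.2.1) ((Gam N).inv_mem hg), ?_⟩
        left_inv := ?_
        right_inv := ?_ }
    · rw [mul_smul, mul_smul, h.2.2, inv_smul_smul]
    · rw [mul_smul, mul_smul, inv_smul_smul, h.2.2]
    · intro h; ext1; simp [mul_assoc]
    · intro h; ext1; simp [mul_assoc]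
  omega

theorem stabOrder_eq {N : ℕ} [NeZero N] (hN : Squarefree N) {f : ℂ → ℂ} (hf : IsHaupt N f)
    {M : Matrix (Fin 2) (Fin 2) ℝ} {τ : ℍ} (h : IsRootOf M τ) :
    stabOrder (FrickeGroup N) M = ram f τ := by
  have h1 := hf.card_stab hN τ
  have : Nat.card {g : SL2R // g ∈ FrickeGroup N ∧ g.1ᵀ * M * g.1 = M} =
      Nat.card {g : SL2R // g ∈ Gam N ∧ g • τ = τ} := by
    rw [frickeGroup_eq hN]
    refine Nat.card_congr (Equiv.subtypeEquivRight fun g => and_congr_right fun _ => ?_)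
    have h2 : IsRootOf (g.1ᵀ * M * g.1) (g⁻¹ • τ) := IsRootOf.transform (by rwa [smul_inv_smul])
    constructor
    · intro h3
      rw [h3] at h2
      have h4 := h2.cmPointC_eq.symm.trans h.cmPointC_eq
      have h5 : g⁻¹ • τ = τ := UpperHalfPlane.ext_iff.2 h4
      rw [inv_smul_eq_iff] at h5
      exact h5.symm
    · intro h3
      have h4 : g⁻¹ • τ = τ := by rw [inv_smul_eq_iff, h3]
      rw [h4] at h2
      exact h2.unique h (det_transform M g)
  rw [stabOrder, this, h1]
  omega

theorem t2Star_pos_eq {N : ℕ} [NeZero N] (hN : Squarefree N) (hf : IsHaupt N (jnStar N))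
    {pt : ℂ → ℍ} (hpt : ∀ x, jnStar N (pt x) = x) (P : Polynomial ℂ) {d : ℤ} (hd : 0 < d) :
    t2Star N P d = ∑ᶠ x ∈ {x : ℂ | HasForm N d (pt x)}, P.eval x / ram (jnStar N) (pt x) := by
  have hG := frickeGroup_eq hN
  have hinv : ∀ Q Q' : QdN d N, formRel (FrickeGroup N) (QdN d N) Q Q' →
      jnStar N (cmPointC Q.1) = jnStar N (cmPointC Q'.1) := by
    rintro Q Q' ⟨g, hg, h⟩
    rw [hG] at hg
    obtain ⟨τ, hτ⟩ := exists_root hd Q.2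
    have h2 : IsRootOf Q'.1 (g⁻¹ • τ) := by
      rw [h]; exact IsRootOf.transform (by rwa [smul_inv_smul])
    rw [hτ.cmPointC_eq, h2.cmPointC_eq, hf.inv _ ((Gam N).inv_mem hg)]
  set Φ : Quot (formRel (FrickeGroup N) (QdN d N)) → ℂ :=
    Quot.lift (fun Q => jnStar N (cmPointC Q.1)) hinv with hΦ
  have hΦout : ∀ O, Φ O = jnStar N (cmPointC O.out.1) := by
    intro O
    conv_lhs => rw [← Quot.out_eq O]
  have hΦinj : Function.Injective Φ := by
    intro O O' h
    rw [hΦout, hΦout] at h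
    obtain ⟨τ, hτ⟩ := exists_root hd O.out.2
    obtain ⟨τ', hτ'⟩ := exists_root hd O'.out.2
    rw [hτ.cmPointC_eq, hτ'.cmPointC_eq] at h
    obtain ⟨g, hg, rfl⟩ := hf.injective hN h
    rw [← Quot.out_eq O, ← Quot.out_eq O']
    refine (Quot.sound ⟨g, hG ▸ hg, ?_⟩).symm
    refine hτ.unique (IsRootOf.transform hτ') ?_
    rw [det_transform, mem_QdN_det O.out.2, mem_QdN_det O'.out.2]
  have hrange : Set.range Φ = {x : ℂ | HasForm N d (pt x)} := by
    ext x
    constructor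
    · rintro ⟨O, rfl⟩
      obtain ⟨τ, hτ⟩ := exists_root hd O.out.2
      have h1 : jnStar N (pt (Φ O)) = jnStar N τ := by
        rw [hpt, hΦout, hτ.cmPointC_eq]
      obtain ⟨g, hg, rfl⟩ := hf.injective hN h1
      exact ⟨_, transform_mem_QdN hd O.out.2 hg, hτ.transform⟩
    · rintro ⟨M, hM, hr⟩
      refine ⟨Quot.mk _ ⟨M, hM⟩, ?_⟩
      show jnStar N (cmPointC M) = x
      rw [hr.cmPointC_eq, hpt]
  rw [t2Star, if_pos hd, classTrace, ← hrange, finsum_mem_range hΦinj]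
  refine finsum_congr fun O => ?_
  obtain ⟨τ, hτ⟩ := exists_root hd O.out.2
  have h1 : jnStar N (pt (Φ O)) = jnStar N τ := by
    rw [hpt, hΦout, hτ.cmPointC_eq]
  obtain ⟨g, hg, rfl⟩ := hf.injective hN h1
  rw [stabOrder_eq hN hf hτ, hf.ram_smul hN hg, hΦout]

open Classical in
theorem card_posFin {N L : ℕ} (hL : 0 < L) {B : ℤ} (hB : (2 * L : ℤ) ≤ B) (τ : ℍ) :
    (posFin N L τ).card = (((Finset.Icc (-B) B).filter (fun r : ℤ => 0 < 4 * (L : ℤ) - r ^ 2)).filter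
      fun r => HasForm N (4 * L - r ^ 2) τ).card := by
  rw [← Finset.card_image_of_injOn (f := fun A : IntQuad => A.a + A.d) (s := posFin N L τ)]
  · congr 1
    ext r
    simp only [Finset.mem_image, mem_posFin, Finset.mem_filter, Finset.mem_Icc]
    constructor
    · rintro ⟨A, hA, rfl⟩
      have h1 := posSet_trace_lt hA
      have h2 : |A.a + A.d| ≤ B := by
        by_contra hlt
        rw [← sq_abs] at h1
        have hL' : (0 : ℤ) < L := by exact_mod_cast hL
        nlinarith
      refine ⟨⟨abs_le.1 h2, h1⟩, formMat A.c (A.d - A.a) (-A.b), ⟨_, _, _, rfl, hA.2, ?_, hA.1.1⟩, ?_⟩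
      · have := hA.1.2.1
        rw [IntQuad.det] at this
        linear_combination -4 * this
      · rw [isRootOf_formMat hA.2]
        have := hA.1.2.2
        push_cast
        linear_combination this
    · rintro ⟨⟨-, hr⟩, _, ⟨a, b, c, rfl, ha, hdisc, hNa⟩, hroot⟩
      rw [isRootOf_formMat ha] at hroot
      have hpar : Even (r - b) := by
        have h1 : Even ((r - b) * (r + b)) := ⟨2 * (L - a * c), by linear_combination -hdisc⟩
        rcases Int.even_mul.1 h1 with h | h
        · exact h
        · have : r - b = r + b - 2 * b := by ring
          rw [this]
          exact h.sub (even_two_mul b)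
      obtain ⟨m, hm⟩ := hpar
      refine ⟨⟨m, -c, a, m + b⟩, ⟨⟨hNa, ?_, ?_⟩, ha⟩, ?_⟩
      · rw [IntQuad.det]
        have hr' : r = m + m + b := by linear_combination hm
        subst hr'
        have : 4 * (m * (m + b) - -c * a) = 4 * (L : ℤ) := by linear_combination -hdisc
        linarith
      · push_cast
        linear_combination hroot
      · show m + (m + b) = r
        linear_combination -hm
  · intro A hA A' hA' h
    exact posSet_trace_injOn N L τ (mem_posFin.1 hA) (mem_posFin.1 hA') h

theorem exists_isHaupt_div {N e : ℕ} [NeZero (N / e)] (hN : N = 6 ∨ N = 10) (he : e ∈ N.divisors)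
    (he1 : e ≠ 1) : ∃ h, IsHaupt (N / e) h := by
  obtain ⟨k, rfl⟩ := Nat.dvd_of_mem_divisors he
  have he0 := Nat.pos_of_mem_divisors he
  generalize hM : e * k / e = M at *
  rw [Nat.mul_div_cancel_left _ he0] at hM
  subst hM
  have : k = 1 ∨ k = 2 ∨ k = 3 ∨ k = 5 := by
    have h1 : 2 ≤ e := by omega
    have h3 : 0 < k := Nat.pos_of_neZero k
    have h2 : k ≤ 5 := by rcases hN with h | h <;> nlinarith
    interval_cases k <;> omega
  rcases this with rfl | rfl | rfl | rfl
  · exact exists_isHaupt_one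
  · exact ⟨_, isHaupt_prime (k := 12) (by norm_num) (by norm_num)⟩
  · exact ⟨_, isHaupt_prime (k := 6) (by norm_num) (by norm_num)⟩
  · exact ⟨_, isHaupt_prime (k := 3) (by norm_num) (by norm_num)⟩

theorem finite_posFin_nonempty {N L : ℕ} [NeZero N] (hN6 : N = 6 ∨ N = 10) (hL : 0 < L)
    {f F : ℂ → ℂ} (hf : IsHaupt N f) (hFd : DifferentiableOn ℂ F (Metric.ball 0 1)) (hF0 : F 0 = 1)
    (hF : ∀ z : ℂ, 0 < z.im → f z * qc z = F (qc z)) {pt : ℂ → ℍ} (hpt : ∀ x, f (pt x) = x) :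
    {x : ℂ | (posFin N L (pt x)).Nonempty}.Finite := by
  have hN := squarefree_six_ten hN6
  refine (sum_coincWeight hN6 (one_mul N).symm hL hf hf hFd hF0 hF hFd hF0 hF hpt).1.subset ?_
  rintro x ⟨A, hA⟩ h0
  have h1 := coincWeight_eq hN (one_mul N).symm hL (pt x)
  rw [show coincWeight N L 1 (pt x) = 0 from h0] at h1
  simp only [Nat.divisors_one, Finset.sum_singleton, one_mul, Nat.div_self one_pos] at h1
  have h2 : ((∑ e' ∈ N.divisors, ∑ A ∈ posFin N ((e' : ℕ) * L) (pt x),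
      if ((e' * 1 : ℕ) : ℤ) ∣ A.a ∧ ((e' * 1 : ℕ) : ℤ) ∣ A.d then 1 else 0 : ℕ) : ℂ) = 0 := by
    push_cast
    simpa using h1.symm
  rw [Nat.cast_eq_zero, Finset.sum_eq_zero_iff] at h2
  have h3 := h2 1 (Nat.one_mem_divisors.2 (NeZero.ne N))
  rw [Finset.sum_eq_zero_iff] at h3
  have h4 := h3 A (by simpa using hA)
  simp at h4

theorem sum_t2Star_pos {N L : ℕ} [NeZero N] (hN6 : N = 6 ∨ N = 10) (hL : 0 < L)
    (hf : IsHaupt N (jnStar N)) {pt : ℂ → ℍ} (hpt : ∀ x, jnStar N (pt x) = x) (P : Polynomial ℂ)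
    (hfin : {x : ℂ | (posFin N L (pt x)).Nonempty}.Finite) {B : ℤ} (hB : (2 * L : ℤ) ≤ B) :
    ∑ r ∈ (Finset.Icc (-B) B).filter (fun r : ℤ => 0 < 4 * (L : ℤ) - r ^ 2),
      t2Star N P (4 * L - r ^ 2) =
      ∑ᶠ x : ℂ, P.eval x / ram (jnStar N) (pt x) * (posFin N L (pt x)).card := by
  classical
  have hN := squarefree_six_ten hN6
  have hsub : ∀ r ∈ (Finset.Icc (-B) B).filter (fun r : ℤ => 0 < 4 * (L : ℤ) - r ^ 2),
      {x : ℂ | HasForm N (4 * L - r ^ 2) (pt x)} ⊆ {x : ℂ | (posFin N L (pt x)).Nonempty} := by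
    intro r hr x hx
    have h1 := card_posFin (N := N) hL hB (pt x)
    refine Finset.card_pos.1 ?_
    rw [h1]
    exact Finset.card_pos.2 ⟨r, Finset.mem_filter.2 ⟨hr, hx⟩⟩
  have key : ∀ r ∈ (Finset.Icc (-B) B).filter (fun r : ℤ => 0 < 4 * (L : ℤ) - r ^ 2),
      t2Star N P (4 * L - r ^ 2) = ∑ᶠ x : ℂ, if HasForm N (4 * L - r ^ 2) (pt x) then
        P.eval x / ram (jnStar N) (pt x) else 0 := by
    intro r hr
    rw [t2Star_pos_eq hN hf hpt P (Finset.mem_filter.1 hr).2, finsum_mem_def]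
    refine finsum_congr fun x => ?_
    rw [Set.indicator_apply]
    rfl
  rw [Finset.sum_congr rfl key, ← finsum_sum_comm]
  · refine finsum_congr fun x => ?_
    rw [← Finset.sum_filter, Finset.sum_const, card_posFin hL hB, nsmul_eq_mul, mul_comm]
  · intro r hr
    refine hfin.subset fun x hx => hsub r hr ?_
    by_contra h
    exact hx (if_neg h)

theorem sum_divSign_t2Star {N n : ℕ} [NeZero N] (hN6 : N = 6 ∨ N = 10) (hn : 0 < n)
    (hf : IsHaupt N (jnStar N)) {F : ℂ → ℂ}
    (hFd : DifferentiableOn ℂ F (Metric.ball 0 1)) (hF0 : F 0 = 1)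
    (hF : ∀ z : ℂ, 0 < z.im → jnStar N z * qc z = F (qc z)) (P : Polynomial ℂ)
    (hP : ∀ x, P.eval x = (x - tail F 1 0) ^ 2 - 2 * tail F 2 0) {B : ℤ}
    (hB : (2 * (N * n) : ℤ) ≤ B) :
    ∑ E ∈ N.divisors, divSign N E * ∑ r ∈ Finset.Icc (-B) B, t2Star N P (4 * (E * n : ℕ) - r ^ 2) =
      2 * (n * tail F (n + 1) 0) := by
  classical
  have hN := squarefree_six_ten hN6
  choose pt hpt using fun x => hf.surjective hN x
  have hEpos : ∀ E ∈ N.divisors, 0 < E * n := fun E hE =>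
    Nat.mul_pos (Nat.pos_of_mem_divisors hE) hn
  have hEB : ∀ E ∈ N.divisors, (2 * (E * n : ℕ) : ℤ) ≤ B := by
    intro E hE
    have h1 : E * n ≤ N * n := Nat.mul_le_mul_right n (Nat.divisor_le hE)
    have h2 : ((E * n : ℕ) : ℤ) ≤ N * n := by exact_mod_cast h1
    linarith
  have hfin : ∀ E ∈ N.divisors, {x : ℂ | (posFin N (E * n : ℕ) (pt x)).Nonempty}.Finite := fun E hE =>
    finite_posFin_nonempty hN6 (hEpos E hE) hf hFd hF0 hF hpt
  have hsplit : ∀ E ∈ N.divisors,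
      ∑ r ∈ Finset.Icc (-B) B, t2Star N P (4 * (E * n : ℕ) - r ^ 2) =
      (∑ᶠ x : ℂ, P.eval x / ram (jnStar N) (pt x) * (posFin N (E * n : ℕ) (pt x)).card) -
        ∑ A ∈ (E * n).divisorsAntidiagonal, (cuspWeight (A.1 - A.2) : ℂ) := by
    intro E hE
    rw [← Finset.sum_filter_add_sum_filter_not _ (fun r : ℤ => 0 < 4 * ((E * n : ℕ) : ℤ) - r ^ 2),
      sum_t2Star_pos hN6 (hEpos E hE) hf hpt P (hfin E hE) (hEB E hE),
      sum_t2Star_nonpos hN6 P (hEpos E hE) (hEB E hE)]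
    ring
  have hlevel : ∀ e ∈ N.divisors,
      (Function.support fun x => coincWeight (N / e) n e (pt x)).Finite ∧
      ∑ᶠ x : ℂ, P.eval x *
        ((coincWeight (N / e) n e (pt x) : ℂ) / (2 * ram (jnStar N) (pt x))) =
      (∑ s ∈ e.divisors, ∑ e' ∈ (N / e).divisors, ∑ A ∈ (e * e' * n).divisorsAntidiagonal,
        if ((e' * (e / s) : ℕ) : ℤ) ∣ (A.1 : ℤ) ∧ ((e' * s : ℕ) : ℤ) ∣ (A.2 : ℤ) then
          (cuspWeight (A.1 - A.2) : ℂ) else 0) +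
      if e = 1 then 2 * (n * tail F (n + 1) 0) else 0 := by
    intro e he
    have hed : N = e * (N / e) := (Nat.mul_div_cancel' (Nat.dvd_of_mem_divisors he)).symm
    have : NeZero (N / e) := ⟨fun h => NeZero.ne N (by rw [hed, h, mul_zero])⟩
    simp only [hP]
    by_cases he1 : e = 1
    · subst he1
      have h1 := sum_coincWeight (M := N / 1) hN6 hed hn hf (by simpa using hf) hFd hF0 hF hFd hF0 hF hpt
      rw [cusp_side_eq hN hed hn F] at h1
      exact h1
    · obtain ⟨h, hh⟩ := exists_isHaupt_div hN6 he he1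
      obtain ⟨G, hGd, hG0, hG⟩ := hh.cusp
      have h1 := sum_coincWeight hN6 hed hn hf hh hFd hF0 hF hGd hG0 hG hpt
      rw [cusp_side_eq hN hed hn G, if_neg he1] at h1
      rw [if_neg he1]
      exact h1
  have hcollapse : ∀ x : ℂ, ∑ E ∈ N.divisors, divSign N E *
        (P.eval x / ram (jnStar N) (pt x) * (posFin N (E * n : ℕ) (pt x)).card) =
      ∑ e ∈ N.divisors, divSign N e * (P.eval x *
        ((coincWeight (N / e) n e (pt x) : ℂ) / (2 * ram (jnStar N) (pt x)))) := by
    intro x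
    have h1 := sum_divSign_collapse hN6 (fun E => posFin N ((E : ℕ) * n) (pt x)) (fun A => A.a)
      (fun A => A.d) (fun _ => 1) (by
        intro E hE A hA
        obtain ⟨⟨h1, h2, -⟩, -⟩ := mem_posFin.1 hA
        have h3 : (E : ℤ) ∣ A.c :=
          (Int.natCast_dvd_natCast.2 (Nat.dvd_of_mem_divisors hE)).trans h1
        rw [IntQuad.det] at h2
        have h4 : A.a * A.d = E * n + A.b * A.c := by linear_combination h2
        rw [h4]
        exact (dvd_mul_right _ _).add (h3.mul_left _))
    have h2 : ∀ e ∈ N.divisors, divSign N e * (P.eval x *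
        ((coincWeight (N / e) n e (pt x) : ℂ) / (2 * ram (jnStar N) (pt x)))) =
        P.eval x / ram (jnStar N) (pt x) * (divSign N e * ∑ s ∈ e.divisors,
          ∑ e' ∈ (N / e).divisors, ∑ A ∈ posFin N ((e * e' : ℕ) * n) (pt x),
          (if ((e' * (e / s) : ℕ) : ℤ) ∣ A.a ∧ ((e' * s : ℕ) : ℤ) ∣ A.d then 1 else 0)) := by
      intro e he
      have hed : N = e * (N / e) := (Nat.mul_div_cancel' (Nat.dvd_of_mem_divisors he)).symm
      have : NeZero (N / e) := ⟨fun h => NeZero.ne N (by rw [hed, h, mul_zero])⟩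
      rw [coincWeight_eq hN hed hn]
      have hr : (ram (jnStar N) (pt x) : ℂ) ≠ 0 := by exact_mod_cast (hf.ram_pos hN (pt x)).ne'
      field_simp
    rw [Finset.sum_congr rfl h2, ← Finset.mul_sum, h1, Finset.mul_sum]
    refine Finset.sum_congr rfl fun E _ => ?_
    rw [Finset.sum_const, nsmul_eq_mul, mul_one]
    push_cast
    ring
  have hpos : ∑ E ∈ N.divisors, divSign N E *
      (∑ᶠ x : ℂ, P.eval x / ram (jnStar N) (pt x) * (posFin N (E * n : ℕ) (pt x)).card) =
      ∑ e ∈ N.divisors, divSign N e * ∑ᶠ x : ℂ, P.eval x *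
        ((coincWeight (N / e) n e (pt x) : ℂ) / (2 * ram (jnStar N) (pt x))) := by
    have f1 : ∀ E ∈ N.divisors, (Function.support fun x =>
        P.eval x / ram (jnStar N) (pt x) * (posFin N (E * n : ℕ) (pt x)).card).Finite := by
      intro E hE
      refine (hfin E hE).subset fun x hx => ?_
      by_contra h
      rw [Set.mem_ofPred_eq, Finset.not_nonempty_iff_eq_empty] at h
      exact hx (by simp only [h, Finset.card_empty, Nat.cast_zero, mul_zero])
    have f2 : ∀ e ∈ N.divisors, (Function.support fun x => P.eval x *
        ((coincWeight (N / e) n e (pt x) : ℂ) / (2 * ram (jnStar N) (pt x)))).Finite := by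
      intro e he
      refine (hlevel e he).1.subset fun x hx h => hx ?_
      simp [h]
    rw [Finset.sum_congr rfl fun E hE => mul_finsum _ (divSign N E), ← finsum_sum_comm,
      Finset.sum_congr rfl fun e he => mul_finsum _ (divSign N e), ← finsum_sum_comm]
    · exact finsum_congr hcollapse
    · intro e he
      exact (f2 e he).subset fun x hx h => hx (by simp only [h, mul_zero])
    · intro e he
      exact (f1 e he).subset fun x hx h => hx (by simp only [h, mul_zero])
  have hcusp := sum_divSign_collapse hN6 (fun E => (E * n).divisorsAntidiagonal)
    (fun A => (A.1 : ℤ)) (fun A => (A.2 : ℤ)) (fun A => (cuspWeight (A.1 - A.2) : ℂ)) (by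
      intro E _ A hA
      obtain ⟨h1, -⟩ := Nat.mem_divisorsAntidiagonal.1 hA
      exact ⟨n, by exact_mod_cast h1⟩)
  have h1N : 1 ∈ N.divisors := Nat.one_mem_divisors.2 (NeZero.ne N)
  calc _ = (∑ E ∈ N.divisors, divSign N E *
        (∑ᶠ x : ℂ, P.eval x / ram (jnStar N) (pt x) * (posFin N (E * n : ℕ) (pt x)).card)) -
        ∑ E ∈ N.divisors, divSign N E *
          ∑ A ∈ (E * n).divisorsAntidiagonal, (cuspWeight (A.1 - A.2) : ℂ) := by
        rw [← Finset.sum_sub_distrib]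
        exact Finset.sum_congr rfl fun E hE => by rw [hsplit E hE, mul_sub]
    _ = _ := by
        rw [hpos, Finset.sum_congr rfl fun e he => congrArg (divSign N e * ·) (hlevel e he).2]
        simp only [mul_add, Finset.sum_add_distrib]
        rw [hcusp, add_sub_cancel_left]
        rw [Finset.sum_eq_single_of_mem 1 h1N]
        · simp [divSign]
        · intro e _ he
          rw [if_neg he, mul_zero]

theorem tendsto_of_hasSum_pow {a : ℕ → ℂ} {S : ℂ → ℂ}
    (h : ∀ q : ℂ, q ≠ 0 → ‖q‖ < 1 → HasSum (fun m => a m * q ^ m) (S q)) :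
    Tendsto S (𝓝[≠] 0) (𝓝 (a 0)) := by
  have h0 : ∑' m : ℕ, a m * (0 : ℂ) ^ m = a 0 := by
    rw [tsum_eq_single 0 fun m hm => by simp [hm]]; simp
  have hsum : Summable fun m => ‖a m * (1 / 2 : ℂ) ^ m‖ :=
    (h (1 / 2) (by norm_num) (by norm_num)).summable.norm
  have key : Tendsto (fun q : ℂ => ∑' m : ℕ, a m * q ^ m) (𝓝[≠] 0) (𝓝 (a 0)) := by
    rw [← h0]
    refine tendsto_tsum_of_dominated_convergence hsum (fun m => ?_) ?_
    · exact ((continuous_const.mul (continuous_id.pow m)).tendsto' _ _ rfl).mono_left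
        nhdsWithin_le_nhds
    · filter_upwards [mem_nhdsWithin_of_mem_nhds (Metric.ball_mem_nhds (0 : ℂ) (by norm_num : (0 : ℝ) < 1 / 2))]
        with q hq m
      rw [norm_mul, norm_mul, norm_pow, norm_pow]
      have : ‖q‖ ≤ ‖(1 / 2 : ℂ)‖ := by
        rw [mem_ball_zero_iff] at hq
        norm_num
        linarith
      gcongr
  refine key.congr' ?_
  filter_upwards [self_mem_nhdsWithin, mem_nhdsWithin_of_mem_nhds (Metric.ball_mem_nhds (0 : ℂ) one_pos)]
    with q hq hq1
  exact (h q hq (by simpa using hq1)).tsum_eq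

theorem hasSum_pow_tail {a : ℕ → ℂ} {F : ℂ → ℂ} (hFd : DifferentiableOn ℂ F (Metric.ball 0 1))
    (h : ∀ q : ℂ, q ≠ 0 → ‖q‖ < 1 → HasSum (fun m => a m * q ^ m) (F q)) (j : ℕ) :
    (∀ q : ℂ, q ≠ 0 → ‖q‖ < 1 → HasSum (fun m => a (j + m) * q ^ m) (tail F j q)) ∧
      tail F j 0 = a j := by
  have hval : ∀ j : ℕ, (∀ q : ℂ, q ≠ 0 → ‖q‖ < 1 → HasSum (fun m => a (j + m) * q ^ m) (tail F j q)) →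
      tail F j 0 = a j := fun j hj =>
    tendsto_nhds_unique ((tail_tendsto hFd j).mono_left nhdsWithin_le_nhds) (tendsto_of_hasSum_pow hj)
  induction j with
  | zero =>
    have h0 : ∀ q : ℂ, q ≠ 0 → ‖q‖ < 1 → HasSum (fun m => a (0 + m) * q ^ m) (tail F 0 q) := by
      simpa [tail] using h
    exact ⟨h0, hval 0 h0⟩
  | succ j ih =>
    have h1 : ∀ q : ℂ, q ≠ 0 → ‖q‖ < 1 →
        HasSum (fun m => a (j + 1 + m) * q ^ m) (tail F (j + 1) q) := by
      intro q hq hq1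
      have h2 := (hasSum_nat_add_iff' 1).2 (ih.1 q hq hq1)
      rw [tail_eq F j q, ih.2] at h2
      have h3 := h2.mul_left q⁻¹
      have hval : q⁻¹ * (a j + q * tail F (j + 1) q - ∑ i ∈ Finset.range 1, a (j + i) * q ^ i) =
          tail F (j + 1) q := by
        simp [hq]
      rw [hval] at h3
      refine h3.congr_fun fun m => ?_
      rw [pow_succ, show j + (m + 1) = j + 1 + m by ring]
      field_simp
    exact ⟨h1, hval _ h1⟩

theorem HasQExp.hasSum_pow {f : ℂ → ℂ} {a : ℤ → ℂ} {k : ℕ} (h : HasQExp f a (-k)) {z : ℂ}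
    (hz : 0 < z.im) : HasSum (fun m : ℕ => a (m - k) * qc z ^ m) (f z * qc z ^ k) := by
  have h1 := (h.2 z hz).mul_right (qc z ^ k)
  refine h1.congr_fun fun m => ?_
  rw [mul_assoc, ← zpow_natCast (qc z) k, ← zpow_add₀ (qc_ne_zero z)]
  rw [show (-(k : ℤ) + m + k) = m by ring, zpow_natCast, show (-(k : ℤ) + m) = m - k by ring]

theorem coeff_eq_tail {f F : ℂ → ℂ} {c : ℤ → ℂ} (hc : HasQExp f c (-1))
    (hFd : DifferentiableOn ℂ F (Metric.ball 0 1))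
    (hF : ∀ z : ℂ, 0 < z.im → f z * qc z = F (qc z)) (j : ℕ) : c (j - 1) = tail F j 0 := by
  refine ((hasSum_pow_tail (a := fun m => c (m - 1)) hFd ?_ j).2).symm
  intro q hq hq1
  obtain ⟨z, hz, rfl⟩ := exists_qc_eq hq hq1
  have := HasQExp.hasSum_pow (k := 1) hc hz
  rw [pow_one, hF z hz] at this
  exact_mod_cast this

theorem polynomial_eq_zero_of_tendsto {α : Type*} {l : Filter α} [l.NeBot] {R : Polynomial ℂ}
    {g : α → ℂ} (hg : Tendsto (fun x => ‖g x‖) l atTop)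
    (hR : Tendsto (fun x => R.eval (g x)) l (𝓝 0)) : R = 0 := by
  rcases Nat.eq_zero_or_pos R.natDegree with h | h
  · rw [Polynomial.eq_C_of_natDegree_eq_zero h] at hR ⊢
    simp only [Polynomial.eval_C] at hR
    rw [tendsto_nhds_unique tendsto_const_nhds hR, Polynomial.C_0]
  · have h1 := R.tendsto_norm_atTop (Polynomial.natDegree_pos_iff_degree_pos.1 h) hg
    exact absurd hR.norm (not_tendsto_nhds_of_tendsto_atTop h1 _)

theorem eval_eq_of_hasQExp {f F : ℂ → ℂ} {P : Polynomial ℂ} {e : ℤ → ℂ}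
    (hFd : DifferentiableOn ℂ F (Metric.ball 0 1)) (hF0 : F 0 = 1)
    (hF : ∀ z : ℂ, 0 < z.im → f z * qc z = F (qc z))
    (hP : HasQExp (fun z => P.eval (f z)) e (-2)) (he2 : e (-2) = 1) (he1 : e (-1) = 0)
    (he0 : e 0 = 0) (x : ℂ) : P.eval x = (x - tail F 1 0) ^ 2 - 2 * tail F 2 0 := by
  set t := tail F 1 0
  set u := tail F 2 0
  let Q : Polynomial ℂ := (Polynomial.X - Polynomial.C t) ^ 2 - Polynomial.C (2 * u)
  suffices h : P - Q = 0 by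
    rw [sub_eq_zero.1 h]
    simp [Q]
  have hexp : ∀ q : ℂ, q ≠ 0 → ‖q‖ < 1 →
      HasSum (fun m : ℕ => e (m + 1) * q ^ m) ((P.eval (F q / q) * q ^ 2 - 1) / q ^ 3) := by
    intro q hq hq1
    obtain ⟨z, hz, rfl⟩ := exists_qc_eq hq hq1
    have h1 := HasQExp.hasSum_pow (k := 2) hP hz
    have h2 := ((hasSum_nat_add_iff' 3).2 h1).mul_left ((qc z ^ 3)⁻¹)
    have h3 : F (qc z) / qc z = f z := by rw [← hF z hz]; field_simp
    have h4 : ∑ i ∈ Finset.range 3, e ((i : ℤ) - (2 : ℕ)) * qc z ^ i = 1 := by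
      rw [Finset.sum_range_succ, Finset.sum_range_succ, Finset.sum_range_one]
      norm_num [he2, he1, he0]
    rw [h3, div_eq_inv_mul, ← h4]
    refine h2.congr_fun fun m => ?_
    rw [pow_add, show (((m + 3 : ℕ) : ℤ) - (2 : ℕ)) = m + 1 by push_cast; ring]
    field_simp
  have hlim := tendsto_of_hasSum_pow hexp
  have hid : Tendsto (fun q : ℂ => q) (𝓝[≠] 0) (𝓝 0) := nhdsWithin_le_nhds
  have hT := (tail_tendsto hFd 3).mono_left (nhdsWithin_le_nhds (s := {0}ᶜ))
  refine polynomial_eq_zero_of_tendsto (l := 𝓝[≠] (0 : ℂ)) (g := fun q => F q / q) ?_ ?_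
  · have h1 : Tendsto F (𝓝[≠] 0) (𝓝 1) := by
      have := (tail_tendsto hFd 0).mono_left (nhdsWithin_le_nhds (s := {0}ᶜ))
      simpa [tail, hF0] using this
    have h2 : Tendsto (fun q : ℂ => ‖F q‖ * ‖q⁻¹‖) (𝓝[≠] 0) atTop :=
      Tendsto.pos_mul_atTop (C := 1) one_pos (by simpa using h1.norm)
        (tendsto_norm_inv_nhdsNE_zero_atTop)
    refine h2.congr fun q => ?_
    rw [div_eq_mul_inv, norm_mul]
  · have h1 := hid.mul (hlim.sub ((hT.const_mul 2).add
      (hid.mul (((hid.mul hT).const_add u).pow 2))))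
    rw [zero_mul] at h1
    refine h1.congr' ?_
    filter_upwards [self_mem_nhdsWithin] with q (hq : q ≠ 0)
    have h3 : F q = 1 + t * q + u * q ^ 2 + q ^ 3 * tail F 3 q := by
      rw [show F q = tail F 0 q from rfl, tail_eq_sum F 0 3 q]
      simp only [Finset.sum_range_succ, Finset.sum_range_zero]
      simp only [zero_add, show tail F 0 0 = 1 from hF0]
      ring
    simp only [Polynomial.eval_sub, Q, Polynomial.eval_pow, Polynomial.eval_X, Polynomial.eval_C]
    generalize P.eval (F q / q) = y
    rw [h3]
    field_simp
    ring

theorem t2Star_eq_zero {N : ℕ} {P : Polynomial ℂ} {d : ℤ} (hd : d < -4) : t2Star N P d = 0 := by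
  rw [t2Star, if_neg (by omega), if_neg (by omega), if_neg (by omega), if_neg (by omega)]

theorem sum_divisors_divSign {p₁ p₂ : ℕ} (hp₁ : p₁.Prime) (hp₂ : p₂.Prime) (hne : p₁ ≠ p₂)
    (g : ℕ → ℂ) : ∑ E ∈ (p₁ * p₂).divisors, divSign (p₁ * p₂) E * g E =
      g 1 - g p₁ - g p₂ + g (p₁ * p₂) := by
  have h1 := hp₁.one_lt
  have h2 := hp₂.one_lt
  have hcop := (Nat.coprime_primes hp₁ hp₂).2 hne
  have e1 : p₁ ≠ p₁ * p₂ := by nlinarith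
  have e2 : p₂ ≠ p₁ * p₂ := by nlinarith
  have e3 : 1 ≠ p₁ * p₂ := by nlinarith
  have hdiv : (p₁ * p₂).divisors = {1, p₁, p₂, p₁ * p₂} := by
    rw [Nat.divisors_mul, hp₁.divisors, hp₂.divisors]
    ext x
    simp only [Finset.mem_mul, Finset.mem_insert, Finset.mem_singleton]
    constructor
    · rintro ⟨y, rfl | rfl, z, rfl | rfl, rfl⟩ <;> simp
    · rintro (rfl | rfl | rfl | rfl)
      exacts [⟨1, by simp, 1, by simp, rfl⟩, ⟨x, by simp, 1, by simp, mul_one x⟩,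
        ⟨1, by simp, x, by simp, one_mul x⟩, ⟨p₁, by simp, p₂, by simp, rfl⟩]
  rw [hdiv, Finset.sum_insert, Finset.sum_insert, Finset.sum_insert, Finset.sum_singleton]
  · simp only [divSign]
    simp [h1.ne', h2.ne', e1, e2]
    ring
  · simpa using e2
  · simpa using ⟨hne, e1⟩
  · simpa using ⟨h1.ne, h2.ne, e3⟩

theorem isHaupt_jnStar {N : ℕ} [NeZero N] (hN : N = 6 ∨ N = 10) : IsHaupt N (jnStar N) := by
  rcases hN with rfl | rfl
  exacts [isHaupt_jnStar_six, isHaupt_jnStar_ten]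

theorem trace_formula_of_isHaupt {p₁ p₂ : ℕ} (hp₁ : p₁.Prime) (hp₂ : p₂.Prime)
    (hne : p₁ ≠ p₂) (hN : p₁ * p₂ = 6 ∨ p₁ * p₂ = 10)
    [NeZero (p₁ * p₂)] (hf : IsHaupt (p₁ * p₂) (jnStar (p₁ * p₂)))
    {c : ℤ → ℂ} (hc : HasQExp (jnStar (p₁ * p₂)) c (-1)) {P : Polynomial ℂ} {e : ℤ → ℂ}
    (hP : HasQExp (fun z => Polynomial.eval (jnStar (p₁ * p₂) z) P) e (-2))
    (he2 : e (-2) = 1) (he1 : e (-1) = 0) (he0 : e 0 = 0) {n : ℕ} (hn : 0 < n) :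
    2 * (n : ℂ) * c n =
      ∑ᶠ r : ℤ,
        (t2Star (p₁ * p₂) P (4 * n - r ^ 2) - t2Star (p₁ * p₂) P (4 * p₁ * n - r ^ 2) -
          t2Star (p₁ * p₂) P (4 * p₂ * n - r ^ 2) +
          t2Star (p₁ * p₂) P (4 * (p₁ * p₂) * n - r ^ 2)) := by
  obtain ⟨F, hFd, hF0, hF⟩ := hf.cusp
  have hPe := eval_eq_of_hasQExp hFd hF0 hF hP he2 he1 he0
  have hcn : c n = tail F (n + 1) 0 := by
    rw [← coeff_eq_tail hc hFd hF (n + 1)]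
    push_cast
    rw [add_sub_cancel_right]
  obtain ⟨B, hB⟩ : ∃ B : ℤ, B = 4 * ((p₁ * p₂ * n : ℕ) : ℤ) + 4 := ⟨_, rfl⟩
  have hvanish : ∀ E : ℕ, E ∣ p₁ * p₂ → ∀ r : ℤ, r ∉ Finset.Icc (-B) B →
      t2Star (p₁ * p₂) P (4 * ((E * n : ℕ) : ℤ) - r ^ 2) = 0 := by
    intro E hE r hr
    refine t2Star_eq_zero ?_
    have hle : ((E * n : ℕ) : ℤ) ≤ ((p₁ * p₂ * n : ℕ) : ℤ) := by
      exact_mod_cast Nat.mul_le_mul_right n (Nat.le_of_dvd (NeZero.pos _) hE)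
    have hr2 : B ^ 2 < r ^ 2 := by
      refine sq_lt_sq.2 ?_
      rw [Finset.mem_Icc, ← abs_le, not_le] at hr
      rwa [abs_of_nonneg (by omega : (0 : ℤ) ≤ B)]
    nlinarith
  have key := sum_divSign_t2Star (B := B) hN hn hf hFd hF0 hF P hPe (by
    have : (0 : ℤ) ≤ ((p₁ * p₂ * n : ℕ) : ℤ) := Int.natCast_nonneg _
    rw [← Nat.cast_mul]
    omega)
  rw [sum_divisors_divSign hp₁ hp₂ hne, ← Finset.sum_sub_distrib, ← Finset.sum_sub_distrib,
    ← Finset.sum_add_distrib] at key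
  rw [hcn, mul_assoc, ← key]
  have hterm : ∀ r : ℤ, t2Star (p₁ * p₂) P (4 * n - r ^ 2) -
      t2Star (p₁ * p₂) P (4 * p₁ * n - r ^ 2) - t2Star (p₁ * p₂) P (4 * p₂ * n - r ^ 2) +
        t2Star (p₁ * p₂) P (4 * (p₁ * p₂) * n - r ^ 2) =
      t2Star (p₁ * p₂) P (4 * ((1 * n : ℕ) : ℤ) - r ^ 2) -
      t2Star (p₁ * p₂) P (4 * ((p₁ * n : ℕ) : ℤ) - r ^ 2) -
      t2Star (p₁ * p₂) P (4 * ((p₂ * n : ℕ) : ℤ) - r ^ 2) +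
        t2Star (p₁ * p₂) P (4 * ((p₁ * p₂ * n : ℕ) : ℤ) - r ^ 2) := by
    intro r
    push_cast
    simp only [one_mul, mul_assoc]
  simp_rw [hterm]
  refine (finsum_eq_sum_of_support_subset _ fun r hr => ?_).symm
  by_contra hr'
  rw [Finset.mem_coe] at hr'
  refine hr ?_
  simp only [hvanish 1 (one_dvd _) r hr', hvanish p₁ (dvd_mul_right _ _) r hr',
    hvanish p₂ (dvd_mul_left _ _) r hr', hvanish _ dvd_rfl r hr', sub_zero, add_zero]

end FrickeTrace

/-- **Theorem 1.1, levels 6 and 10, part 2.**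
For `N = p₁p₂ ∈ {6, 10}` with `p₁ ≠ p₂` prime and any `n ≥ -1`,
`2n c_n^{(N*)} = Σ_{r ∈ ℤ} { t₂^{(N*)}(4n-r²) - t₂^{(N*)}(4p₁n-r²) - t₂^{(N*)}(4p₂n-r²)
                 + t₂^{(N*)}(4p₁p₂n-r²) }`. -/
theorem trace_formula_jnStar_six_ten (p₁ p₂ : ℕ) (hp₁ : p₁.Prime) (hp₂ : p₂.Prime)
    (hne : p₁ ≠ p₂) (hN : p₁ * p₂ = 6 ∨ p₁ * p₂ = 10)
    (c : ℤ → ℂ) (hc : HasQExp (jnStar (p₁ * p₂)) c (-1))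
    (P : Polynomial ℂ) (e : ℤ → ℂ)
    (hP : HasQExp (fun z => Polynomial.eval (jnStar (p₁ * p₂) z) P) e (-2))
    (he2 : e (-2) = 1) (he1 : e (-1) = 0) (he0 : e 0 = 0)
    (n : ℤ) (hn : -1 ≤ n) :
    2 * (n : ℂ) * c n =
      ∑ᶠ r : ℤ,
        (t2Star (p₁ * p₂) P (4 * n - r ^ 2) - t2Star (p₁ * p₂) P (4 * p₁ * n - r ^ 2) -
          t2Star (p₁ * p₂) P (4 * p₂ * n - r ^ 2) + t2Star (p₁ * p₂) P (4 * (p₁ * p₂) * n - r ^ 2)) := by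
  have : NeZero (p₁ * p₂) := ⟨by omega⟩
  have hf := FrickeTrace.isHaupt_jnStar hN
  rcases lt_trichotomy n 0 with hlt | rfl | hpos
  · obtain rfl : n = -1 := by omega
    obtain ⟨F, hFd, hF0, hF⟩ := hf.cusp
    have hc1 : c (-1) = 1 := by
      have := FrickeTrace.coeff_eq_tail hc hFd hF 0
      rw [Nat.cast_zero, zero_sub] at this
      exact this.trans hF0
    have h1 : (2 : ℤ) ≤ p₁ := by exact_mod_cast hp₁.two_le
    have h2 : (2 : ℤ) ≤ p₂ := by exact_mod_cast hp₂.two_le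
    have hz : ∀ k : ℤ, 2 ≤ k → ∀ r : ℤ, t2Star (p₁ * p₂) P (4 * k * -1 - r ^ 2) = 0 :=
      fun k hk r => FrickeTrace.t2Star_eq_zero (by nlinarith [sq_nonneg r])
    simp only [hz _ h1, hz _ h2, hz _ (show (2 : ℤ) ≤ p₁ * p₂ by nlinarith), sub_zero, add_zero]
    rw [finsum_eq_single _ 0 fun r hr => FrickeTrace.t2Star_eq_zero (by
      have := pow_pos (abs_pos.2 hr) 2
      rw [sq_abs] at this
      linarith), hc1]
    norm_num [t2Star]
  · simp
  · lift n to ℕ using hpos.le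
    exact_mod_cast FrickeTrace.trace_formula_of_isHaupt hp₁ hp₂ hne hN hf hc hP he2 he1 he0
      (by exact_mod_cast hpos)
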